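/- The gaps between consecutive primes satisfy liminf_{n → ∞} (p_{n+1} − p_n) ≤ 7 × 10^7; that is, there are infinitely many n with p_{n+1} − p_n ≤ 7 × 10^7. -/

import Mathlib

section

open MeasureTheory Set Finset

theorem gallagher_pointwise {g g' : ℝ → ℝ} (hg : ∀ x, HasDerivAt g (g' x) x)
    (hc : Continuous g') {δ : ℝ} (hδ : 0 < δ) (x : ℝ) :
    g x ≤ δ⁻¹ * (∫ y in Ioc (x - δ/2) (x + δ/2), g y) + ∫ y in Ioc (x - δ/2) (x + δ/2), |g' y| := by
  have hgc : Continuous g := continuous_iff_continuousAt.2 fun x => (hg x).continuousAt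
  set D := ∫ y in Ioc (x - δ/2) (x + δ/2), |g' y| with hD
  have hi : IntegrableOn (fun y => |g' y|) (Ioc (x - δ/2) (x + δ/2)) :=
    (hc.abs.integrableOn_Icc).mono_set Ioc_subset_Icc_self
  have hgi : IntegrableOn g (Ioc (x - δ/2) (x + δ/2)) :=
    (hgc.integrableOn_Icc).mono_set Ioc_subset_Icc_self
  have key : ∀ y ∈ Ioc (x - δ/2) (x + δ/2), g x - D ≤ g y := by
    intro y hy
    have h1 : ∫ t in y..x, g' t = g x - g y :=
      intervalIntegral.integral_eq_sub_of_hasDerivAt (fun t _ => hg t) (hc.intervalIntegrable _ _)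
    have h2 : |∫ t in y..x, g' t| ≤ ∫ t in uIoc y x, |g' t| := by
      simpa using intervalIntegral.norm_integral_le_integral_norm_uIoc (f := g') (a := y) (b := x) (μ := volume)
    have h3 : ∫ t in uIoc y x, |g' t| ≤ D := by
      apply setIntegral_mono_set hi (Filter.Eventually.of_forall fun _ => abs_nonneg _)
      apply LE.le.eventuallyLE
      intro t ht
      rw [mem_uIoc] at ht
      rcases ht with ht | ht <;> constructor <;> linarith [hy.1, hy.2, ht.1, ht.2]
    have := le_abs_self (∫ t in y..x, g' t)
    linarith
  have h4 : ∫ y in Ioc (x - δ/2) (x + δ/2), (g x - D) ≤ ∫ y in Ioc (x - δ/2) (x + δ/2), g y :=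
    setIntegral_mono_on (by simp) hgi measurableSet_Ioc key
  have h5 : ∫ y in Ioc (x - δ/2) (x + δ/2), (g x - D) = δ * (g x - D) := by
    rw [setIntegral_const, Real.volume_real_Ioc_of_le (by linarith), smul_eq_mul]; ring
  rw [h5] at h4
  have h6 : g x - D ≤ δ⁻¹ * (∫ y in Ioc (x - δ/2) (x + δ/2), g y) := by
    rw [inv_mul_eq_div, le_div_iff₀ hδ]; linarith
  linarith

theorem gallagher_sum {ι : Type*} (s : Finset ι) (p : ι → ℝ) {δ : ℝ} (hδ : 0 < δ) (hδ1 : δ ≤ 1)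
    (hp : ∀ i ∈ s, p i ∈ Icc (0:ℝ) 1) (hs : ∀ i ∈ s, ∀ j ∈ s, i ≠ j → δ ≤ |p i - p j|)
    {g g' : ℝ → ℝ} (hg : ∀ x, HasDerivAt g (g' x) x) (hc : Continuous g') (hpos : ∀ x, 0 ≤ g x) :
    ∑ i ∈ s, g (p i) ≤ δ⁻¹ * (∫ y in Ioc (-1/2:ℝ) (3/2), g y) +
      ∫ y in Ioc (-1/2:ℝ) (3/2), |g' y| := by
  have hgc : Continuous g := continuous_iff_continuousAt.2 fun x => (hg x).continuousAt
  have hdis : (↑s : Set ι).Pairwise (Function.onFun Disjoint fun i => Ioc (p i - δ/2) (p i + δ/2)) := by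
    intro i hi j hj hij
    rw [Function.onFun, Set.disjoint_left]
    intro t h1 h2
    have := hs i hi j hj hij
    rcases abs_cases (p i - p j) with ⟨h, _⟩ | ⟨h, _⟩ <;> linarith [h1.1, h1.2, h2.1, h2.2]
  have gen : ∀ h : ℝ → ℝ, Continuous h → (∀ x, 0 ≤ h x) →
      ∑ i ∈ s, (∫ y in Ioc (p i - δ/2) (p i + δ/2), h y) ≤ ∫ y in Ioc (-1/2:ℝ) (3/2), h y := by
    intro h hh h0
    rw [← integral_biUnion_finset s (fun _ _ => measurableSet_Ioc) hdis
      (fun i _ => (hh.integrableOn_Icc).mono_set Ioc_subset_Icc_self)]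
    apply setIntegral_mono_set ((hh.integrableOn_Icc).mono_set Ioc_subset_Icc_self)
      (Filter.Eventually.of_forall h0)
    apply LE.le.eventuallyLE
    intro t ht
    simp only [Set.mem_iUnion] at ht
    obtain ⟨i, hi, ht⟩ := ht
    have := hp i hi
    constructor <;> linarith [ht.1, ht.2, this.1, this.2]
  calc ∑ i ∈ s, g (p i) ≤ ∑ i ∈ s, (δ⁻¹ * (∫ y in Ioc (p i - δ/2) (p i + δ/2), g y) +
        ∫ y in Ioc (p i - δ/2) (p i + δ/2), |g' y|) :=
        Finset.sum_le_sum fun i _ => gallagher_pointwise hg hc hδ _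
    _ ≤ _ := by
      rw [Finset.sum_add_distrib, ← Finset.mul_sum]
      gcongr
      · exact gen g hgc hpos
      · exact gen _ hc.abs fun _ => abs_nonneg _

/-- The trigonometric polynomial with coefficients `a`. -/
noncomputable def trigPoly (s : Finset ℕ) (a : ℕ → ℂ) (x : ℝ) : ℂ :=
  ∑ n ∈ s, a n * Complex.exp (2 * Real.pi * Complex.I * n * x)

theorem trigPoly_hasDerivAt (s : Finset ℕ) (a : ℕ → ℂ) (x : ℝ) :
    HasDerivAt (trigPoly s a) (trigPoly s (fun n => a n * (2 * Real.pi * Complex.I * n)) x) x := by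
  unfold trigPoly
  apply HasDerivAt.fun_sum
  intro n _
  have h : HasDerivAt (fun x : ℝ => (2 * Real.pi * Complex.I * n * x : ℂ)) (2 * Real.pi * Complex.I * n) x := by
    simpa using (Complex.ofRealCLM.hasDerivAt (x := x)).const_mul (2 * Real.pi * Complex.I * n : ℂ)
  have := (h.cexp).const_mul (a n)
  refine this.congr_deriv ?_
  simp only
  ring

theorem trigPoly_continuous (s : Finset ℕ) (a : ℕ → ℂ) : Continuous (trigPoly s a) :=
  continuous_iff_continuousAt.2 fun x => (trigPoly_hasDerivAt s a x).continuousAt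

theorem integral_exp_int (k : ℤ) :
    ∫ x in (-1/2:ℝ)..(3/2), Complex.exp (2 * Real.pi * Complex.I * k * x) = if k = 0 then 2 else 0 := by
  split_ifs with h
  · subst h; norm_num
  · have hc : (2 * Real.pi * Complex.I * k : ℂ) ≠ 0 := by
      simp [Real.pi_ne_zero, h]
    rw [integral_exp_mul_complex hc, div_eq_zero_iff]
    left
    rw [sub_eq_zero, Complex.exp_eq_exp_iff_exists_int]
    refine ⟨2 * k, ?_⟩
    push_cast; ring

theorem trigPoly_parseval (s : Finset ℕ) (a : ℕ → ℂ) :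
    ∫ x in Ioc (-1/2:ℝ) (3/2), ‖trigPoly s a x‖^2 = 2 * ∑ n ∈ s, ‖a n‖^2 := by
  have h0 : ∀ x : ℝ, ((‖trigPoly s a x‖^2 : ℝ) : ℂ) = ∑ n ∈ s, ∑ m ∈ s,
      (a n * (starRingEnd ℂ) (a m)) * Complex.exp (2 * Real.pi * Complex.I * ((n - m : ℤ) : ℂ) * x) := by
    intro x
    have : ((‖trigPoly s a x‖^2 : ℝ) : ℂ) = trigPoly s a x * (starRingEnd ℂ) (trigPoly s a x) := by
      rw [Complex.mul_conj, Complex.normSq_eq_norm_sq]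
    rw [this, trigPoly, map_sum, Finset.sum_mul_sum]
    refine Finset.sum_congr rfl fun n _ => Finset.sum_congr rfl fun m _ => ?_
    rw [map_mul, ← Complex.exp_conj]
    simp only [map_mul, Complex.conj_I, Complex.conj_ofReal, map_natCast, map_ofNat]
    rw [mul_mul_mul_comm, ← Complex.exp_add]
    congr 2
    push_cast; ring
  rw [← intervalIntegral.integral_of_le (by norm_num)]
  have h1 : ((∫ x in (-1/2:ℝ)..(3/2), ‖trigPoly s a x‖^2 : ℝ) : ℂ) = ((2 * ∑ n ∈ s, ‖a n‖^2 : ℝ) : ℂ) := by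
    rw [← intervalIntegral.integral_ofReal]
    simp_rw [h0]
    have hIn : ∀ (c : ℂ) (k : ℤ), IntervalIntegrable
        (fun x : ℝ => c * Complex.exp (2 * Real.pi * Complex.I * (k:ℂ) * x)) volume (-1/2) (3/2) :=
      fun c k => Continuous.intervalIntegrable (by fun_prop) _ _
    rw [intervalIntegral.integral_finsetSum
      (fun n _ => by
        have := IntervalIntegrable.sum s (fun m (_ : m ∈ s) => hIn (a n * (starRingEnd ℂ) (a m)) (n - m : ℤ))
        simpa [Finset.sum_fn] using this)]
    rw [Complex.ofReal_mul, Complex.ofReal_sum, Finset.mul_sum]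
    refine Finset.sum_congr rfl fun n hn => ?_
    rw [intervalIntegral.integral_finsetSum (fun m _ => hIn _ _)]
    simp_rw [intervalIntegral.integral_const_mul, integral_exp_int]
    rw [Finset.sum_eq_single n]
    · simp [Complex.mul_conj, Complex.normSq_eq_norm_sq]; ring
    · intro m _ hm
      rw [if_neg (by intro h; apply hm; omega), mul_zero]
    · intro h; exact absurd hn h
  exact_mod_cast h1

theorem additive_large_sieve {ι : Type*} (t : Finset ι) (p : ι → ℝ) {δ : ℝ} (hδ : 0 < δ) (hδ1 : δ ≤ 1)
    (hp : ∀ i ∈ t, p i ∈ Icc (0:ℝ) 1) (hs : ∀ i ∈ t, ∀ j ∈ t, i ≠ j → δ ≤ |p i - p j|)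
    (s : Finset ℕ) (N : ℝ) (hN : 0 < N) (hsN : ∀ n ∈ s, (n:ℝ) ≤ N) (a : ℕ → ℂ) :
    ∑ i ∈ t, ‖trigPoly s a (p i)‖^2 ≤ (2 * δ⁻¹ + 82 * N) * ∑ n ∈ s, ‖a n‖^2 := by
  set b : ℕ → ℂ := fun n => a n * (2 * Real.pi * Complex.I * n) with hb
  have hd := trigPoly_hasDerivAt s a
  have hg : ∀ x, HasDerivAt (fun x => ‖trigPoly s a x‖^2)
      (2 * inner ℝ (trigPoly s a x) (trigPoly s b x)) x := fun x => (hd x).norm_sq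
  have hcb := trigPoly_continuous s b
  have hca := trigPoly_continuous s a
  have h1 := gallagher_sum t p hδ hδ1 hp hs hg (by fun_prop) (fun x => by positivity)
  rw [trigPoly_parseval] at h1
  have h2 : ∫ y in Ioc (-1/2:ℝ) (3/2), |2 * inner ℝ (trigPoly s a y) (trigPoly s b y)| ≤
      ∫ y in Ioc (-1/2:ℝ) (3/2), (N * ‖trigPoly s a y‖^2 + N⁻¹ * ‖trigPoly s b y‖^2) := by
    apply setIntegral_mono
    · exact (Continuous.integrableOn_Icc (by fun_prop)).mono_set Ioc_subset_Icc_self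
    · exact (Continuous.integrableOn_Icc (by fun_prop)).mono_set Ioc_subset_Icc_self
    · intro y
      dsimp only
      rw [abs_mul, abs_two]
      have h3 := abs_real_inner_le_norm (trigPoly s a y) (trigPoly s b y)
      set A := ‖trigPoly s a y‖
      set B := ‖trigPoly s b y‖
      have : N * A^2 + N⁻¹ * B^2 - 2 * (A * B) = N * (A - N⁻¹ * B)^2 := by
        field_simp; ring
      have : 0 ≤ N * (A - N⁻¹ * B)^2 := by positivity
      linarith
  rw [integral_add, integral_const_mul, integral_const_mul, trigPoly_parseval, trigPoly_parseval] at h2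
  rotate_left
  · exact (Continuous.integrableOn_Icc (by fun_prop)).mono_set Ioc_subset_Icc_self
  · exact (Continuous.integrableOn_Icc (by fun_prop)).mono_set Ioc_subset_Icc_self
  have h4 : ∑ n ∈ s, ‖b n‖^2 ≤ 40 * N^2 * ∑ n ∈ s, ‖a n‖^2 := by
    rw [Finset.mul_sum]
    apply Finset.sum_le_sum
    intro n hn
    have hb' : ‖b n‖ = ‖a n‖ * (2 * Real.pi * n) := by
      simp [hb, abs_of_pos Real.pi_pos]
    rw [hb']
    have hpi : Real.pi^2 ≤ 10 := by nlinarith [Real.pi_lt_d2, Real.pi_pos]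
    have hn2 : (n:ℝ)^2 ≤ N^2 := by gcongr; exact hsN n hn
    calc (‖a n‖ * (2 * Real.pi * n))^2 = 4 * Real.pi^2 * (n:ℝ)^2 * ‖a n‖^2 := by ring
      _ ≤ 4 * 10 * N^2 * ‖a n‖^2 := by gcongr
      _ = _ := by ring
  have h5 : N⁻¹ * (2 * ∑ n ∈ s, ‖b n‖^2) ≤ N⁻¹ * (2 * (40 * N^2 * ∑ n ∈ s, ‖a n‖^2)) := by gcongr
  have h6 : N⁻¹ * (2 * (40 * N^2 * ∑ n ∈ s, ‖a n‖^2)) = 80 * N * ∑ n ∈ s, ‖a n‖^2 := by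
    field_simp; ring
  have h7 : (0:ℝ) ≤ ∑ n ∈ s, ‖a n‖^2 := by positivity
  nlinarith [h1, h2, h5, h6]

end

section

open Finset DirichletCharacter

theorem isPrimitive_inv {q : ℕ} {χ : DirichletCharacter ℂ q} (h : χ.IsPrimitive) : (χ⁻¹).IsPrimitive := by
  rw [IsPrimitive, conductor_inv]; exact h

theorem sum_norm_sq_char {q : ℕ} [NeZero q] (T : ZMod q → ℂ) :
    ∑ χ : DirichletCharacter ℂ q, ‖∑ x, χ x * T x‖^2 =
      q.totient * ∑ x : ZMod q with IsUnit x, ‖T x‖^2 := by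
  have key : ((∑ χ : DirichletCharacter ℂ q, ‖∑ x, χ x * T x‖^2 : ℝ) : ℂ) =
      ((q.totient * ∑ x : ZMod q with IsUnit x, ‖T x‖^2 : ℝ) : ℂ) := by
    push_cast
    have h : ∀ χ : DirichletCharacter ℂ q, ((‖∑ x, χ x * T x‖ : ℂ))^2 =
        ∑ x : ZMod q with IsUnit x, ∑ y, (χ x⁻¹ * χ y) * ((starRingEnd ℂ) (T x) * T y) := by
      intro χ
      rw [← Complex.conj_mul', map_sum, sum_mul_sum]
      rw [Finset.sum_filter]
      refine Finset.sum_congr rfl fun x _ => ?_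
      split_ifs with hx
      · refine Finset.sum_congr rfl fun y _ => ?_
        have : (starRingEnd ℂ) (χ x) = χ x⁻¹ := by
          rw [starRingEnd_apply, MulChar.star_apply', MulChar.inv_apply]
          congr 1
          obtain ⟨u, rfl⟩ := hx
          rw [Ring.inverse_unit, ZMod.inv_coe_unit]
        rw [map_mul, this]; ring
      · simp [χ.map_nonunit hx]
    simp_rw [h]
    rw [Finset.sum_comm, Finset.mul_sum]
    refine Finset.sum_congr rfl fun x hx => ?_
    rw [Finset.sum_comm]
    simp_rw [← Finset.sum_mul]
    have hx' : IsUnit x := (Finset.mem_filter.1 hx).2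
    simp_rw [sum_char_inv_mul_char_eq ℂ hx']
    simp [Complex.conj_mul']
  exact_mod_cast key

theorem gaussSum_norm_sq {q : ℕ} [NeZero q] {χ : DirichletCharacter ℂ q} (h : χ.IsPrimitive) :
    ‖gaussSum χ (ZMod.stdAddChar (N := q))‖^2 = q := by
  set e := ZMod.stdAddChar (N := q) with he
  have hprim : e.IsPrimitive := ZMod.isPrimitive_stdAddChar q
  have hS : ∑ x : ZMod q, ‖χ x‖^2 ≠ 0 := by
    have : ‖χ (1 : ZMod q)‖^2 ≤ ∑ x : ZMod q, ‖χ x‖^2 :=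
      Finset.single_le_sum (f := fun x : ZMod q => ‖χ x‖^2) (fun _ _ => by positivity) (Finset.mem_univ _)
    rw [map_one] at this
    simp only [norm_one] at this
    linarith
  have h1 : ∑ a : ZMod q, ‖gaussSum χ (e.mulShift a)‖^2 =
      (∑ x : ZMod q, ‖χ x‖^2) * ‖gaussSum χ e‖^2 := by
    rw [Finset.sum_mul]
    refine Finset.sum_congr rfl fun a _ => ?_
    rw [gaussSum_mulShift_of_isPrimitive _ h, norm_mul, mul_pow]
    congr 2
    rw [← MulChar.star_apply', norm_star]
  have h2 : ((∑ a : ZMod q, ‖gaussSum χ (e.mulShift a)‖^2 : ℝ) : ℂ) =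
      ((q * ∑ x : ZMod q, ‖χ x‖^2 : ℝ) : ℂ) := by
    push_cast
    have h3 : ∀ a : ZMod q, ((‖gaussSum χ (e.mulShift a)‖ : ℂ))^2 =
        ∑ x, ∑ y, ((starRingEnd ℂ) (χ x) * χ y) * e (a * (y - x)) := by
      intro a
      rw [← Complex.conj_mul', gaussSum, map_sum, sum_mul_sum]
      refine Finset.sum_congr rfl fun x _ => Finset.sum_congr rfl fun y _ => ?_
      rw [map_mul, AddChar.mulShift_apply, AddChar.mulShift_apply, ← AddChar.map_neg_eq_conj,
        mul_mul_mul_comm, ← AddChar.map_add_eq_mul]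
      congr 2
      ring
    simp_rw [h3]
    rw [Finset.sum_comm, Finset.mul_sum]
    refine Finset.sum_congr rfl fun x _ => ?_
    rw [Finset.sum_comm]
    simp_rw [← Finset.mul_sum, AddChar.sum_mulShift _ hprim, sub_eq_zero]
    rw [Finset.sum_eq_single x]
    · rw [Complex.conj_mul', if_pos rfl, ZMod.card, mul_comm]
    · intro y _ hy; simp [hy]
    · simp
  have h4 : ∑ a : ZMod q, ‖gaussSum χ (e.mulShift a)‖^2 = q * ∑ x : ZMod q, ‖χ x‖^2 := by
    exact_mod_cast h2
  rw [h1, mul_comm] at h4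
  exact mul_right_cancel₀ hS h4

theorem char_sum_gauss {q : ℕ} [NeZero q] {χ : DirichletCharacter ℂ q} (h : χ.IsPrimitive)
    (s : Finset ℕ) (a : ℕ → ℂ) :
    q * ‖∑ n ∈ s, a n * χ⁻¹ n‖^2 = ‖∑ x, χ x * trigPoly s a ((x.val : ℝ)/q)‖^2 := by
  refine (congrArg (· * _) (gaussSum_norm_sq h).symm).trans ?_
  rw [← mul_pow, ← norm_mul]
  congr 2
  simp_rw [trigPoly, Finset.mul_sum]
  rw [Finset.sum_comm]
  refine Finset.sum_congr rfl fun n _ => ?_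
  rw [mul_comm, mul_assoc, ← gaussSum_mulShift_of_isPrimitive _ h, gaussSum, Finset.mul_sum]
  refine Finset.sum_congr rfl fun x _ => ?_
  have : (ZMod.stdAddChar (N := q)).mulShift (n : ZMod q) x =
      Complex.exp (2 * Real.pi * Complex.I * n * ((x.val : ℝ)/q : ℝ)) := by
    rw [AddChar.mulShift_apply]
    have := ZMod.stdAddChar_coe (N := q) (n * x.val : ℤ)
    push_cast at this
    rw [ZMod.natCast_zmod_val] at this
    rw [this]
    congr 1
    push_cast; ring
  rw [this]; ring

theorem farey_sum (Q : ℕ) (hQ : 1 ≤ Q) (s : Finset ℕ) (N : ℝ) (hN : 0 < N)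
    (hsN : ∀ n ∈ s, (n:ℝ) ≤ N) (a : ℕ → ℂ) :
    ∑ q ∈ Icc 1 Q, ∑ b ∈ range q with Nat.Coprime q b, ‖trigPoly s a ((b:ℝ)/q)‖^2 ≤
      (2 * Q^2 + 82 * N) * ∑ n ∈ s, ‖a n‖^2 := by
  rw [Finset.sum_sigma']
  have hQ' : (1:ℝ) ≤ Q := by exact_mod_cast hQ
  have := additive_large_sieve ((Icc 1 Q).sigma fun q => (range q).filter (Nat.Coprime q))
    (fun i => (i.2:ℝ)/i.1) (δ := ((Q:ℝ)^2)⁻¹) (by positivity) (inv_le_one_of_one_le₀ (by nlinarith))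
    ?_ ?_ s N hN hsN a
  · simpa using this
  · rintro ⟨q, b⟩ h
    simp only [mem_sigma, mem_Icc, mem_filter, mem_range] at h
    refine ⟨by positivity, ?_⟩
    rw [div_le_one (by exact_mod_cast h.1.1)]
    exact_mod_cast h.2.1.le
  · rintro ⟨q, b⟩ h ⟨q', b'⟩ h' hne
    simp only [mem_sigma, mem_Icc, mem_filter, mem_range] at h h'
    have hq : (0:ℝ) < q := by exact_mod_cast h.1.1
    have hq' : (0:ℝ) < q' := by exact_mod_cast h'.1.1
    have h1 : (b:ℝ)/q - b'/q' = ((b * q' - b' * q : ℤ) : ℝ) / (q * q') := by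
      push_cast; field_simp
    have h2 : (b * q' - b' * q : ℤ) ≠ 0 := by
      intro h0
      have h3 : b * q' = b' * q := by zify; linarith
      have h4 : q ∣ q' := h.2.2.dvd_of_dvd_mul_left (by rw [h3]; exact dvd_mul_left _ _)
      have h5 : q' ∣ q := h'.2.2.dvd_of_dvd_mul_left (by rw [← h3]; exact dvd_mul_left _ _)
      have h6 := Nat.dvd_antisymm h4 h5
      subst h6
      have : b = b' := Nat.eq_of_mul_eq_mul_right h.1.1 h3
      subst this
      exact hne rfl
    have h3 : (1:ℝ) ≤ |((b * q' - b' * q : ℤ) : ℝ)| := by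
      rw [← Int.cast_abs]; exact_mod_cast Int.one_le_abs h2
    simp only
    rw [h1, abs_div, abs_of_pos (mul_pos hq hq'), inv_eq_one_div]
    have hqQ : (q:ℝ) ≤ Q := by exact_mod_cast h.1.2
    have hqQ' : (q':ℝ) ≤ Q := by exact_mod_cast h'.1.2
    gcongr
    nlinarith

open Classical in
/-- The primitive Dirichlet characters modulo `q`. -/
noncomputable def primChars (q : ℕ) : Finset (DirichletCharacter ℂ q) :=
  {χ | χ.IsPrimitive}

theorem mem_primChars {q : ℕ} {χ : DirichletCharacter ℂ q} : χ ∈ primChars q ↔ χ.IsPrimitive := by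
  simp [primChars]

theorem mult_large_sieve (Q : ℕ) (hQ : 1 ≤ Q) (s : Finset ℕ) (N : ℝ) (hN : 0 < N)
    (hsN : ∀ n ∈ s, (n:ℝ) ≤ N) (a : ℕ → ℂ) :
    ∑ q ∈ Icc 1 Q, (q:ℝ) / q.totient * ∑ χ ∈ primChars q,
      ‖∑ n ∈ s, a n * χ n‖^2 ≤ (2 * Q^2 + 82 * N) * ∑ n ∈ s, ‖a n‖^2 := by
  refine le_trans (Finset.sum_le_sum fun q hq => ?_) (farey_sum Q hQ s N hN hsN a)
  have hq1 : 1 ≤ q := (mem_Icc.1 hq).1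
  have : NeZero q := ⟨by omega⟩
  have hφ : (0:ℝ) < q.totient := by exact_mod_cast Nat.totient_pos.2 hq1
  have e1 : ∑ b ∈ range q with Nat.Coprime q b, ‖trigPoly s a ((b:ℝ)/q)‖^2 =
      ∑ x : ZMod q with IsUnit x, ‖trigPoly s a ((x.val:ℝ)/q)‖^2 := by
    symm
    apply Finset.sum_bij (fun x _ => ZMod.val x)
    · intro x hx
      simp only [mem_filter, mem_univ, true_and, mem_range] at hx ⊢
      refine ⟨ZMod.val_lt x, ?_⟩
      rw [Nat.coprime_comm]
      exact (ZMod.isUnit_iff_coprime x.val q).1 (by rwa [ZMod.natCast_zmod_val])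
    · intro x _ y _ h
      exact ZMod.val_injective q h
    · intro b hb
      simp only [mem_filter, mem_range] at hb
      refine ⟨(b : ZMod q), ?_, ZMod.val_cast_of_lt hb.1⟩
      simp only [mem_filter, mem_univ, true_and]
      exact (ZMod.isUnit_iff_coprime b q).2 (Nat.coprime_comm.1 hb.2)
    · intro x _; rfl
  rw [e1]
  have e2 : ∑ χ ∈ primChars q, ‖∑ n ∈ s, a n * χ n‖^2 =
      ∑ χ ∈ primChars q, ‖∑ n ∈ s, a n * χ⁻¹ n‖^2 := by
    apply Finset.sum_bij (fun χ _ => χ⁻¹)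
    · intro χ h
      rw [mem_primChars] at h ⊢
      exact isPrimitive_inv h
    · intro χ _ ψ _ h; exact inv_injective h
    · intro χ h
      rw [mem_primChars] at h
      exact ⟨χ⁻¹, mem_primChars.2 (isPrimitive_inv h), inv_inv χ⟩
    · intro χ _; rw [inv_inv]
  rw [e2, div_mul_eq_mul_div, div_le_iff₀ hφ, Finset.mul_sum, mul_comm _ (q.totient : ℝ),
    ← sum_norm_sq_char]
  refine le_trans (le_of_eq (Finset.sum_congr rfl fun χ h => ?_))
    (Finset.sum_le_sum_of_subset_of_nonneg (Finset.subset_univ _) fun _ _ _ => by positivity)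
  exact char_sum_gauss (mem_primChars.1 h) s a

end

section

open Finset DirichletCharacter

theorem norm_sq_sum_blocks {κ : Type*} (J : Finset κ) (f : κ → ℂ) :
    ‖∑ j ∈ J, f j‖^2 ≤ (#J : ℝ) * ∑ j ∈ J, ‖f j‖^2 := by
  calc ‖∑ j ∈ J, f j‖^2 ≤ (∑ j ∈ J, ‖f j‖)^2 := by gcongr; exact norm_sum_le _ _
    _ ≤ _ := sq_sum_le_card_mul_sum_sq

theorem large_sieve_dyadic (Q X : ℕ) (hQ : 1 ≤ Q) (s : Finset ℕ) (hs : s ⊆ Icc 1 X) (a : ℕ → ℂ) :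
    ∑ q ∈ Icc 1 Q, (q:ℝ) / q.totient * ∑ χ ∈ primChars q, ‖∑ n ∈ s, a n * χ n‖^2 ≤
      (Nat.log 2 X + 1) * ∑ n ∈ s, (2 * Q^2 + 164 * n) * ‖a n‖^2 := by
  set J := range (Nat.log 2 X + 1) with hJ
  have hmem : ∀ n ∈ s, Nat.log 2 n ∈ J := by
    intro n hn
    rw [hJ, mem_range, Nat.lt_succ_iff]
    exact Nat.log_mono_right (mem_Icc.1 (hs hn)).2
  have hblock : ∀ (f : ℕ → ℂ), ∑ n ∈ s, f n = ∑ j ∈ J, ∑ n ∈ s with Nat.log 2 n = j, f n :=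
    fun f => (Finset.sum_fiberwise_of_maps_to hmem f).symm
  have hblock' : ∀ (f : ℕ → ℝ), ∑ n ∈ s, f n = ∑ j ∈ J, ∑ n ∈ s with Nat.log 2 n = j, f n :=
    fun f => (Finset.sum_fiberwise_of_maps_to hmem f).symm
  calc ∑ q ∈ Icc 1 Q, (q:ℝ) / q.totient * ∑ χ ∈ primChars q, ‖∑ n ∈ s, a n * χ n‖^2
      ≤ ∑ q ∈ Icc 1 Q, (q:ℝ) / q.totient * ∑ χ ∈ primChars q,
        ((#J : ℝ) * ∑ j ∈ J, ‖∑ n ∈ s with Nat.log 2 n = j, a n * χ n‖^2) := by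
        gcongr with q _ χ _
        rw [hblock]
        exact norm_sq_sum_blocks _ _
    _ = (#J : ℝ) * ∑ j ∈ J, ∑ q ∈ Icc 1 Q, (q:ℝ) / q.totient * ∑ χ ∈ primChars q,
          ‖∑ n ∈ s with Nat.log 2 n = j, a n * χ n‖^2 := by
        rw [Finset.sum_comm, Finset.mul_sum]
        refine Finset.sum_congr rfl fun q _ => ?_
        rw [← Finset.mul_sum, ← Finset.mul_sum, Finset.sum_comm]
        ring
    _ ≤ (#J : ℝ) * ∑ j ∈ J, (2 * Q^2 + 82 * (2:ℝ)^(j+1)) * ∑ n ∈ s with Nat.log 2 n = j, ‖a n‖^2 := by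
        gcongr with j _
        refine mult_large_sieve Q hQ _ _ (by positivity) (fun n hn => ?_) a
        rw [mem_filter] at hn
        have := Nat.lt_pow_succ_log_self (b := 2) (by norm_num) n
        rw [hn.2] at this
        exact_mod_cast this.le
    _ ≤ _ := by
        rw [hblock', hJ, card_range]
        push_cast
        gcongr with j _
        rw [Finset.mul_sum]
        refine Finset.sum_le_sum fun n hn => ?_
        rw [mem_filter] at hn
        have hn0 : n ≠ 0 := by have := (mem_Icc.1 (hs hn.1)).1; omega
        have h2 := Nat.pow_log_le_self 2 hn0
        rw [hn.2] at h2
        have h3 : (2:ℝ)^j ≤ n := by exact_mod_cast h2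
        apply mul_le_mul_of_nonneg_right _ (by positivity)
        have : (2:ℝ)^(j+1) = 2 * 2^j := pow_succ' 2 j
        linarith

theorem large_sieve_above (Q X : ℕ) (hQ : 1 ≤ Q) {U : ℝ} (hU : 0 < U) (s : Finset ℕ)
    (hs : s ⊆ Icc 1 X) (hsU : ∀ n ∈ s, U ≤ n) (a : ℕ → ℂ) :
    ∑ q ∈ Icc 1 Q, (q:ℝ) / q.totient * ∑ χ ∈ primChars q, ‖∑ n ∈ s, a n * χ n‖^2 ≤
      (Nat.log 2 X + 1) * ((2 * Q^2 / U + 164) * ∑ n ∈ s, n * ‖a n‖^2) := by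
  refine (large_sieve_dyadic Q X hQ s hs a).trans ?_
  gcongr
  rw [Finset.mul_sum]
  refine Finset.sum_le_sum fun n hn => ?_
  rw [← mul_assoc]
  gcongr
  have h1 := hsU n hn
  have : (2 * (Q:ℝ)^2) ≤ 2 * Q^2 / U * n := by
    rw [div_mul_eq_mul_div, le_div_iff₀ hU]; gcongr
  linarith

theorem bilinear_block (j X : ℕ) {U : ℝ} (hU : 0 < U) (s t : Finset ℕ)
    (hs : s ⊆ Icc 1 X) (hsU : ∀ n ∈ s, U ≤ n) (ht : t ⊆ Icc 1 X) (htU : ∀ n ∈ t, U ≤ n)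
    (a b : ℕ → ℂ) {S : ℝ} (hSa : ∑ n ∈ s, n * ‖a n‖^2 ≤ S) (hSb : ∑ n ∈ t, n * ‖b n‖^2 ≤ S)
    (I : Finset ℕ) (hI : ∀ q ∈ I, 2^j ≤ q ∧ q < 2^(j+1)) :
    ∑ q ∈ I, (q.totient:ℝ)⁻¹ * ∑ χ ∈ primChars q,
      ‖∑ n ∈ s, a n * χ n‖ * ‖∑ n ∈ t, b n * χ n‖ ≤
      (Nat.log 2 X + 1) * ((8 * 2^j / U + 164 / 2^j) * S) := by
  set A := fun (q : ℕ) (χ : DirichletCharacter ℂ q) => ‖∑ n ∈ s, a n * χ n‖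
  set B := fun (q : ℕ) (χ : DirichletCharacter ℂ q) => ‖∑ n ∈ t, b n * χ n‖
  have hsub : I ⊆ Icc 1 (2^(j+1)) := by
    intro q hq
    have := hI q hq
    rw [mem_Icc]
    exact ⟨le_trans Nat.one_le_two_pow this.1, this.2.le⟩
  have h1 := large_sieve_above (2^(j+1)) X Nat.one_le_two_pow hU s hs hsU a
  have h2 := large_sieve_above (2^(j+1)) X Nat.one_le_two_pow hU t ht htU b
  calc ∑ q ∈ I, (q.totient:ℝ)⁻¹ * ∑ χ ∈ primChars q, A q χ * B q χ
      ≤ ∑ q ∈ I, ((2:ℝ)^j)⁻¹ * ((q:ℝ) / q.totient * ∑ χ ∈ primChars q, (A q χ ^2 + B q χ ^2) / 2) := by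
        refine Finset.sum_le_sum fun q hq => ?_
        have hq1 : (2:ℝ)^j ≤ q := by exact_mod_cast (hI q hq).1
        rw [← mul_assoc]
        apply mul_le_mul _ _ (Finset.sum_nonneg fun χ _ => by positivity) (by positivity)
        · rw [inv_mul_eq_div, div_div, mul_comm (q.totient:ℝ), ← div_div]
          rw [inv_eq_one_div]
          gcongr
          rw [one_le_div (by positivity)]; exact hq1
        · gcongr with χ _
          nlinarith [sq_nonneg (A q χ - B q χ)]
    _ ≤ ∑ q ∈ Icc 1 ((2:ℕ)^(j+1)), ((2:ℝ)^j)⁻¹ * ((q:ℝ) / q.totient *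
          ∑ χ ∈ primChars q, (A q χ ^2 + B q χ ^2) / 2) := by
        refine Finset.sum_le_sum_of_subset_of_nonneg hsub fun q _ _ => ?_
        have : 0 ≤ ∑ χ ∈ primChars q, (A q χ ^2 + B q χ ^2) / 2 :=
          Finset.sum_nonneg fun χ _ => by positivity
        positivity
    _ = ((2:ℝ)^j)⁻¹ * ((∑ q ∈ Icc 1 ((2:ℕ)^(j+1)), (q:ℝ) / q.totient * ∑ χ ∈ primChars q, A q χ ^2) +
          ∑ q ∈ Icc 1 ((2:ℕ)^(j+1)), (q:ℝ) / q.totient * ∑ χ ∈ primChars q, B q χ ^2) / 2 := by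
        rw [← Finset.sum_add_distrib, Finset.mul_sum, Finset.sum_div]
        refine Finset.sum_congr rfl fun q _ => ?_
        rw [← Finset.sum_div, Finset.sum_add_distrib]
        ring
    _ ≤ ((2:ℝ)^j)⁻¹ * ((Nat.log 2 X + 1) * ((2 * ((2^(j+1) : ℕ):ℝ)^2 / U + 164) * S) +
          (Nat.log 2 X + 1) * ((2 * ((2^(j+1) : ℕ):ℝ)^2 / U + 164) * S)) / 2 := by
        gcongr
        · refine h1.trans ?_
          gcongr
        · refine h2.trans ?_
          gcongr
    _ = _ := by
        push_cast
        rw [pow_succ]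
        field_simp
        ring

theorem bilinear_large_sieve (Y Q X : ℕ) (hY : 1 ≤ Y) {U : ℝ} (hU : 0 < U) (s t : Finset ℕ)
    (hs : s ⊆ Icc 1 X) (hsU : ∀ n ∈ s, U ≤ n) (ht : t ⊆ Icc 1 X) (htU : ∀ n ∈ t, U ≤ n)
    (a b : ℕ → ℂ) {S : ℝ} (hSa : ∑ n ∈ s, n * ‖a n‖^2 ≤ S) (hSb : ∑ n ∈ t, n * ‖b n‖^2 ≤ S) :
    ∑ q ∈ Ioc Y Q, (q.totient:ℝ)⁻¹ * ∑ χ ∈ primChars q,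
      ‖∑ n ∈ s, a n * χ n‖ * ‖∑ n ∈ t, b n * χ n‖ ≤
      (Nat.log 2 Q + 1) * ((Nat.log 2 X + 1) * ((8 * Q / U + 328 / Y) * S)) := by
  have hmem : ∀ q ∈ Ioc Y Q, Nat.log 2 q ∈ range (Nat.log 2 Q + 1) := by
    intro n hn
    rw [mem_range, Nat.lt_succ_iff]
    exact Nat.log_mono_right (mem_Ioc.1 hn).2
  rw [← Finset.sum_fiberwise_of_maps_to hmem]
  have hS : 0 ≤ S := le_trans (Finset.sum_nonneg fun n _ => by positivity) hSa
  calc _ ≤ ∑ j ∈ range (Nat.log 2 Q + 1), (Nat.log 2 X + 1) * ((8 * Q / U + 328 / Y) * S) := by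
        refine Finset.sum_le_sum fun j hj => ?_
        by_cases hne : ({q ∈ Ioc Y Q | Nat.log 2 q = j}).Nonempty
        · obtain ⟨q, hq⟩ := hne
          have hI : ∀ q ∈ ({q ∈ Ioc Y Q | Nat.log 2 q = j}), 2^j ≤ q ∧ q < 2^(j+1) := by
            intro q hq
            rw [mem_filter, mem_Ioc] at hq
            rw [← hq.2]
            exact ⟨Nat.pow_log_le_self 2 (by omega), Nat.lt_pow_succ_log_self (by norm_num) q⟩
          refine (bilinear_block j X hU s t hs hsU ht htU a b hSa hSb _ hI).trans ?_
          have h1 := hI q hq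
          rw [mem_filter, mem_Ioc] at hq
          have h2 : (2:ℝ)^j ≤ Q := by exact_mod_cast h1.1.trans hq.1.2
          have h3 : (Y:ℝ) ≤ 2 * 2^j := by
            have : Y ≤ 2 * 2^j := by rw [pow_succ] at h1; omega
            exact_mod_cast this
          have h4 : (0:ℝ) < Y := by exact_mod_cast hY
          have h5 : 164 / (2:ℝ)^j ≤ 328 / Y := by
            rw [div_le_div_iff₀ (by positivity) h4]; linarith
          gcongr
        · rw [Finset.not_nonempty_iff_eq_empty] at hne
          rw [hne, Finset.sum_empty]
          positivity
    _ = _ := by rw [Finset.sum_const, card_range, nsmul_eq_mul]; push_cast; ring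

end

section

open Finset DirichletCharacter Complex

theorem norm_sum_char_range_le {f : ℕ} [NeZero f] {χ : DirichletCharacter ℂ f} (hχ : χ ≠ 1) (n : ℕ) :
    ‖∑ k ∈ range n, χ k‖ ≤ f := by
  have hper : ∑ k ∈ range f, χ (k : ZMod f) = 0 := by
    rw [← MulChar.sum_eq_zero_of_ne_one hχ]
    symm
    apply Finset.sum_bij (fun x _ => ZMod.val x)
    · intro x _; exact mem_range.2 (ZMod.val_lt x)
    · intro x _ y _ h; exact ZMod.val_injective f h
    · intro b hb; exact ⟨(b : ZMod f), mem_univ _, ZMod.val_cast_of_lt (mem_range.1 hb)⟩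
    · intro x _; rw [ZMod.natCast_zmod_val]
  have hmul : ∀ m, ∑ k ∈ range (f * m), χ (k : ZMod f) = 0 := by
    intro m
    induction m with
    | zero => simp
    | succ m ih =>
      rw [Nat.mul_succ, Finset.sum_range_add, ih, zero_add, ← hper]
      refine Finset.sum_congr rfl fun k _ => ?_
      simp
  rw [← Nat.div_add_mod n f, Finset.sum_range_add, hmul, zero_add]
  refine (norm_sum_le _ _).trans ?_
  calc ∑ i ∈ range (n % f), ‖χ ((f * (n / f) + i : ℕ) : ZMod f)‖ ≤ ∑ i ∈ range (n % f), (1:ℝ) :=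
        Finset.sum_le_sum fun i _ => χ.norm_le_one _
    _ ≤ f := by
      simp only [sum_const, card_range, nsmul_eq_mul, mul_one]
      exact_mod_cast (Nat.mod_lt n (NeZero.pos f)).le

theorem norm_sum_char_Ioc_le {f : ℕ} [NeZero f] {χ : DirichletCharacter ℂ f} (hχ : χ ≠ 1) (m n : ℕ) :
    ‖∑ k ∈ Ioc m n, χ k‖ ≤ 2 * f := by
  rcases le_or_gt n m with h | h
  · rw [Ioc_eq_empty (by omega)]; simp
  · have : ∑ k ∈ Ioc m n, χ k = ∑ k ∈ range (n+1), χ k - ∑ k ∈ range (m+1), χ k := by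
      rw [← Finset.sum_Ico_eq_sub _ (by omega)]
      refine Finset.sum_congr (by ext; simp) fun _ _ => rfl
    rw [this]
    refine (norm_sub_le _ _).trans ?_
    have := norm_sum_char_range_le hχ (n+1)
    have := norm_sum_char_range_le hχ (m+1)
    linarith

/-- Partial sums of a Dirichlet character, as a function of a real variable. -/
noncomputable def charSum {f : ℕ} (χ : DirichletCharacter ℂ f) (t : ℝ) : ℂ := ∑ k ∈ Icc 1 ⌊t⌋₊, χ k

theorem norm_charSum_le {f : ℕ} [NeZero f] {χ : DirichletCharacter ℂ f} (hχ : χ ≠ 1) (t : ℝ) :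
    ‖charSum χ t‖ ≤ 2 * f := norm_sum_char_Ioc_le hχ 0 ⌊t⌋₊

theorem norm_charSum_le' {f : ℕ} (χ : DirichletCharacter ℂ f) {t : ℝ} (ht : 0 ≤ t) :
    ‖charSum χ t‖ ≤ t := by
  refine (norm_sum_le _ _).trans ?_
  calc ∑ k ∈ Icc 1 ⌊t⌋₊, ‖χ (k : ZMod f)‖ ≤ ∑ k ∈ Icc 1 ⌊t⌋₊, (1:ℝ) :=
        Finset.sum_le_sum fun i _ => χ.norm_le_one _
    _ ≤ t := by simpa using Nat.floor_le ht

theorem measurable_charSum {f : ℕ} (χ : DirichletCharacter ℂ f) : Measurable (charSum χ) :=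
  (measurable_from_top (f := fun n : ℕ => ∑ k ∈ Icc 1 n, χ (k : ZMod f))).comp Nat.measurable_floor

open MeasureTheory Set Asymptotics Filter Topology in
theorem LFunction_eq_integral {f : ℕ} [NeZero f] {χ : DirichletCharacter ℂ f} (hχ : χ ≠ 1) {s : ℂ}
    (hs : 0 < s.re) :
    χ.LFunction s = s * ∫ t in Ioi (1:ℝ), charSum χ t * t ^ (-(s+1)) := by
  have hbd : ∃ C, ∀ t, ‖charSum χ t‖ ≤ C := ⟨_, norm_charSum_le hχ⟩
  have hmel : ∀ s : ℂ, mellin (charSum χ) (-s) = ∫ t in Ioi (1:ℝ), charSum χ t * t ^ (-(s+1)) := by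
    intro s
    rw [mellin]
    have h1 : ∀ t : ℝ, (t:ℂ) ^ (-s-1) • charSum χ t = charSum χ t * t ^ (-(s+1)) := by
      intro t; rw [smul_eq_mul, mul_comm]; congr 2; ring
    simp_rw [h1]
    rw [← integral_Ici_eq_integral_Ioi (x := (1:ℝ))]
    refine setIntegral_eq_of_subset_of_forall_sdiff_eq_zero measurableSet_Ioi
      (fun x (hx : 1 ≤ x) => lt_of_lt_of_le one_pos hx) ?_
    rintro t ⟨_, ht2⟩
    rw [charSum, Nat.floor_eq_zero.2 (not_le.1 ht2)]; simp
  have hdiff : ∀ s : ℂ, 0 < s.re → DifferentiableAt ℂ (mellin (charSum χ)) (-s) := by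
    intro s hs
    refine mellin_differentiableAt_of_isBigO_rpow (a := 0) (b := -s.re - 1) ?_ ?_ (by simpa using hs) ?_ (by simp)
    · apply LocallyIntegrable.locallyIntegrableOn
      refine (locallyIntegrable_const (2 * f : ℝ)).mono (measurable_charSum χ).aestronglyMeasurable ?_
      filter_upwards with t
      rw [Real.norm_of_nonneg (by positivity)]
      exact norm_charSum_le hχ t
    · simp only [neg_zero, Real.rpow_zero]
      exact IsBigO.of_bound (2*f) (Eventually.of_forall fun t => by simpa using norm_charSum_le hχ t)
    · apply EventuallyEq.trans_isBigO (f₂ := fun _ => (0:ℂ)) _ (isBigO_zero _ _)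
      have : Ioo (0:ℝ) 1 ∈ 𝓝[>] (0:ℝ) := Ioo_mem_nhdsGT one_pos
      filter_upwards [this] with t ht
      rw [charSum, Nat.floor_eq_zero.2 ht.2]; simp
  set R : ℂ → ℂ := fun s => s * mellin (charSum χ) (-s) with hR
  have hUopen : IsOpen {s : ℂ | 0 < s.re} := isOpen_lt continuous_const continuous_re
  have h1 : AnalyticOnNhd ℂ R {s : ℂ | 0 < s.re} := by
    apply DifferentiableOn.analyticOnNhd _ hUopen
    intro s hs
    apply DifferentiableAt.differentiableWithinAt
    exact differentiableAt_id.mul ((hdiff s hs).comp s differentiableAt_id.neg)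
  have h2 : AnalyticOnNhd ℂ χ.LFunction {s : ℂ | 0 < s.re} :=
    ((differentiable_LFunction hχ).differentiableOn).analyticOnNhd hUopen
  have hpre : IsPreconnected {s : ℂ | 0 < s.re} := (convex_halfSpace_re_gt 0).isPreconnected
  have heq : EqOn χ.LFunction R {s : ℂ | 0 < s.re} := by
    apply h2.eqOn_of_preconnected_of_eventuallyEq h1 hpre (z₀ := 2) (by simp)
    have : {s : ℂ | 1 < s.re} ∈ 𝓝 (2:ℂ) :=
      (isOpen_lt continuous_const continuous_re).mem_nhds (by simp)
    filter_upwards [this] with s hs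
    have hs : 1 < s.re := hs
    rw [LFunction_eq_LSeries χ hs, LSeries_eq_mul_integral (fun n => χ n) (r := 0) le_rfl (by linarith)
      (LSeriesSummable_of_one_lt_re χ hs), hR]
    · simp only [hmel]; rfl
    · simp only [Real.rpow_zero]
      refine IsBigO.of_bound (2*f) (Eventually.of_forall fun n => ?_)
      have h := norm_sum_char_Ioc_le hχ 0 n
      rw [show Finset.Ioc 0 n = Finset.Icc 1 n from rfl] at h
      simpa using h
  rw [heq hs, hR]; simp only [hmel]

open MeasureTheory Set in
theorem norm_LFunction_le {f : ℕ} [NeZero f] {χ : DirichletCharacter ℂ f} (hχ : χ ≠ 1) {Z : ℝ}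
    (hfZ : (f:ℝ) ≤ Z) (hZ : 2 ≤ Real.log Z) {s : ℂ} (hs : ‖s - 1‖ ≤ 1 / Real.log Z) :
    ‖χ.LFunction s‖ ≤ 30 * Real.log Z := by
  set l := Real.log Z with hl
  have hl0 : 0 < l := by linarith
  have hf1 : (1:ℝ) ≤ f := by exact_mod_cast NeZero.one_le
  have hZ0 : 0 < Z := by linarith
  have hre : 1 - 1/l ≤ s.re := by
    have := (abs_re_le_norm (s-1)).trans hs
    rw [abs_le] at this
    simp at this
    linarith [this.1, one_div l]
  have hl2 : 1/l ≤ 1/2 := by gcongr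
  have hs0 : 0 < s.re := by linarith
  have hns : ‖s‖ ≤ 3/2 := by
    have : ‖s‖ ≤ ‖s - 1‖ + ‖(1:ℂ)‖ := by simpa using norm_add_le (s-1) 1
    rw [norm_one] at this
    linarith
  set η := 2/l with hη
  have hη0 : 0 < η := by positivity
  have hη1 : η ≤ 1 := by rw [hη, div_le_one hl0]; exact hZ
  have hexp : -η - s.re < -1 := by
    have : η = 2 * (1/l) := by rw [hη]; ring
    have : 0 < 1/l := by positivity
    linarith
  rw [LFunction_eq_integral hχ hs0, norm_mul]
  have hIn : ‖∫ t in Ioi (1:ℝ), charSum χ t * t ^ (-(s+1))‖ ≤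
      ∫ t in Ioi (1:ℝ), (2*f:ℝ)^η * t ^ (-η - s.re) := by
    refine norm_integral_le_of_norm_le ((integrableOn_Ioi_rpow_of_lt hexp one_pos).const_mul _) ?_
    filter_upwards [ae_restrict_mem measurableSet_Ioi] with t ht
    have ht : 1 < t := ht
    have ht0 : 0 < t := by linarith
    rw [norm_mul, norm_cpow_eq_rpow_re_of_pos ht0]
    have h1 : ‖charSum χ t‖ ≤ (2*f:ℝ)^η * t^(1-η) := by
      have e : ‖charSum χ t‖ = ‖charSum χ t‖^η * ‖charSum χ t‖^(1-η) := by
        rw [← Real.rpow_add_of_nonneg (norm_nonneg _) hη0.le (by linarith)]; simp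
      rw [e]
      gcongr
      · exact norm_charSum_le hχ t
      · exact norm_charSum_le' χ ht0.le
    calc ‖charSum χ t‖ * t ^ (-(s+1)).re ≤ (2*f:ℝ)^η * t^(1-η) * t ^ (-(s+1)).re := by gcongr
      _ = _ := by
        rw [mul_assoc, ← Real.rpow_add ht0]; congr 2; simp; ring
  rw [integral_const_mul, integral_Ioi_rpow_of_lt hexp one_pos, Real.one_rpow] at hIn
  have h2 : (2*f:ℝ)^η ≤ 2 * 8 := by
    have e8 : Real.exp 2 ≤ 8 := by
      have := Real.exp_one_lt_d9
      have e : Real.exp 2 = Real.exp 1 ^ 2 := by rw [← Real.exp_nat_mul]; norm_num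
      rw [e]; nlinarith [Real.exp_pos 1]
    calc (2*f:ℝ)^η ≤ (2*Z)^η := by gcongr
      _ = 2^η * Z^η := Real.mul_rpow (by norm_num) hZ0.le
      _ ≤ 2^(1:ℝ) * Real.exp 2 := by
        gcongr
        · norm_num
        · rw [Real.rpow_def_of_pos hZ0, ← hl, hη, mul_div_cancel₀ _ hl0.ne']
      _ ≤ 2 * 8 := by rw [Real.rpow_one]; gcongr
  have h3 : -1 / (-η - s.re + 1) ≤ l := by
    have : η = 2 * (1/l) := by rw [hη]; ring
    rw [← neg_div_neg_eq, neg_neg, div_le_iff₀ (by linarith)]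
    have : l * (1/l) = 1 := by field_simp
    nlinarith
  have h4 : 0 ≤ -1 / (-η - s.re + 1) := by
    rw [← neg_div_neg_eq, neg_neg]; apply div_nonneg zero_le_one; linarith
  calc ‖s‖ * ‖∫ t in Ioi (1:ℝ), charSum χ t * t ^ (-(s+1))‖ ≤ (3/2) * ((2*8) * l) := by
        gcongr
        exact hIn.trans (by gcongr)
    _ ≤ _ := by linarith

end

section

open Finset DirichletCharacter Complex

theorem re_log_repulsion_nonneg {a : ℝ} (ha0 : 0 ≤ a) (ha1 : a < 1) {z w : ℂ} (hz : ‖z‖ ≤ 1) (hw : ‖w‖ ≤ 1) :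
    0 ≤ 3 * (-log (1 - (a:ℂ))).re + 2 * (-log (1 - z * a)).re + 2 * (-log (1 - w * a)).re +
      2 * (-log (1 - z * (starRingEnd ℂ w) * a)).re := by
  have key : ∀ u : ℂ, ‖u‖ ≤ 1 → ‖u * a‖ < 1 := by
    intro u hu
    rw [norm_mul, norm_real, Real.norm_of_nonneg ha0]
    nlinarith [norm_nonneg u]
  have hzw : ‖z * (starRingEnd ℂ w)‖ ≤ 1 := by
    rw [norm_mul, RCLike.norm_conj]; exact mul_le_one₀ hz (norm_nonneg _) hw
  have h0 : ‖(a:ℂ)‖ < 1 := by simpa using key 1 (by simp)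
  rw [← ((((hasSum_re <| hasSum_taylorSeries_neg_log h0).mul_left 3).add
    ((hasSum_re <| hasSum_taylorSeries_neg_log (key z hz)).mul_left 2)).add
    ((hasSum_re <| hasSum_taylorSeries_neg_log (key w hw)).mul_left 2)).add
    ((hasSum_re <| hasSum_taylorSeries_neg_log (key _ hzw)).mul_left 2) |>.tsum_eq]
  refine tsum_nonneg fun n ↦ ?_
  rcases n.eq_zero_or_pos with rfl | hn
  · simp
  simp only [mul_pow, ← map_pow, ← ofReal_pow, div_natCast_re, ofReal_re, ← mul_div_assoc, ← add_div]
  refine div_nonneg ?_ n.cast_nonneg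
  have hz' : ‖z ^ n‖ ≤ 1 := by rw [norm_pow]; exact pow_le_one₀ (norm_nonneg _) hz
  have hw' : ‖w ^ n‖ ≤ 1 := by rw [norm_pow]; exact pow_le_one₀ (norm_nonneg _) hw
  generalize z ^ n = z at *
  generalize w ^ n = w at *
  have hb : 0 ≤ a ^ n := by positivity
  generalize a ^ n = b at *
  have e : (3 * b + 2 * (z * b).re + 2 * (w * b).re + 2 * (z * (starRingEnd ℂ) w * b).re) =
    b * ((1 + z.re + w.re)^2 + (z.im + w.im)^2 + (1 - ‖z‖^2) + (1 - ‖w‖^2)) := by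
    rw [Complex.sq_norm, Complex.sq_norm, normSq_apply, normSq_apply]
    simp
    ring
  rw [e]
  have : ‖z‖^2 ≤ 1 := pow_le_one₀ (norm_nonneg _) hz'
  have : ‖w‖^2 ≤ 1 := pow_le_one₀ (norm_nonneg _) hw'
  apply mul_nonneg hb
  nlinarith [sq_nonneg (1 + z.re + w.re), sq_nonneg (z.im + w.im)]

theorem norm_product_repulsion {f₁ f₂ N : ℕ} (χ₁ : DirichletCharacter ℂ f₁) (χ₂ : DirichletCharacter ℂ f₂)
    (ψ : DirichletCharacter ℂ N) (hψ : ∀ p : ℕ, ψ p = χ₁ p * starRingEnd ℂ (χ₂ p)) {x : ℝ} (hx : 0 < x) :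
    1 ≤ ‖riemannZeta (1 + x)‖ ^ 3 * ‖LSeries (fun n => χ₁ n) (1 + x)‖ ^ 2 * ‖LSeries (fun n => χ₂ n) (1 + x)‖ ^ 2 * ‖LSeries (fun n => ψ n) (1 + x)‖ ^ 2 := by
  have h₀ : 1 < (1 + x : ℂ).re := by simpa using hx
  have H₀ : Summable fun p : Nat.Primes ↦ -log (1 - (p : ℂ) ^ (-(1 + x : ℂ))) := by
    have := DirichletCharacter.summable_neg_log_one_sub_mul_prime_cpow (1 : DirichletCharacter ℂ 1) h₀
    refine this.congr fun p => ?_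
    rw [Subsingleton.elim ((p:ℕ) : ZMod 1) 1, map_one, one_mul]
  have H₁ := summable_neg_log_one_sub_mul_prime_cpow χ₁ h₀
  have H₂ := summable_neg_log_one_sub_mul_prime_cpow χ₂ h₀
  have H₃ := summable_neg_log_one_sub_mul_prime_cpow ψ h₀
  have S₀ := (hasSum_re H₀.hasSum).summable.mul_left 3
  have S₁ := (hasSum_re H₁.hasSum).summable.mul_left 2
  have S₂ := (hasSum_re H₂.hasSum).summable.mul_left 2
  have S₃ := (hasSum_re H₃.hasSum).summable.mul_left 2
  rw [← norm_pow, ← norm_pow, ← norm_pow, ← norm_pow, ← norm_mul, ← norm_mul, ← norm_mul,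
    ← riemannZeta_eulerProduct_exp_log h₀, ← LSeries_eulerProduct_exp_log _ h₀,
    ← LSeries_eulerProduct_exp_log _ h₀, ← LSeries_eulerProduct_exp_log _ h₀]
  simp only [← exp_nat_mul, Nat.cast_ofNat, ← exp_add, norm_exp, add_re, mul_re,
    re_ofNat, im_ofNat, zero_mul, sub_zero, Real.one_le_exp_iff]
  rw [re_tsum H₀, re_tsum H₁, re_tsum H₂, re_tsum H₃, ← tsum_mul_left, ← tsum_mul_left,
    ← tsum_mul_left, ← tsum_mul_left,
    ← S₀.tsum_add S₁, ← (S₀.add S₁).tsum_add S₂, ← ((S₀.add S₁).add S₂).tsum_add S₃]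
  refine tsum_nonneg fun p ↦ ?_
  have e : ((p:ℕ) : ℂ) ^ (-(1 + x : ℂ)) = (((p:ℕ):ℝ) ^ (-(1+x)) : ℝ) := by
    rw [ofReal_cpow (by positivity)]; push_cast; rfl
  rw [hψ, e]
  refine re_log_repulsion_nonneg (by positivity) ?_ (χ₁.norm_le_one _) (χ₂.norm_le_one _)
  apply Real.rpow_lt_one_of_one_lt_of_neg
  · exact_mod_cast p.prop.one_lt
  · linarith

/-- The twist `χ₁ χ̄₂` of two characters of possibly different levels. -/
noncomputable def twist {f₁ f₂ : ℕ} (χ₁ : DirichletCharacter ℂ f₁) (χ₂ : DirichletCharacter ℂ f₂) :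
    DirichletCharacter ℂ (f₁ * f₂) :=
  changeLevel (Dvd.intro _ rfl) χ₁ * (changeLevel (Dvd.intro_left _ rfl) χ₂)⁻¹

theorem changeLevel_natCast {f m : ℕ} (χ : DirichletCharacter ℂ f) (hm : f ∣ m) {a : ℕ}
    (ha : IsUnit (a : ZMod m)) : changeLevel hm χ a = χ a := by
  rw [ZMod.isUnit_iff_coprime] at ha
  have := changeLevel_eq_cast_of_dvd' χ hm (a := a) (Nat.isCoprime_iff_coprime.2 ha)
  simpa using this

theorem twist_apply {f₁ f₂ : ℕ} (χ₁ : DirichletCharacter ℂ f₁) (χ₂ : DirichletCharacter ℂ f₂) (p : ℕ) :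
    twist χ₁ χ₂ p = χ₁ p * starRingEnd ℂ (χ₂ p) := by
  by_cases h : IsUnit (p : ZMod (f₁ * f₂))
  · rw [twist, MulChar.mul_apply, ← MulChar.star_apply', changeLevel_natCast _ _ h, changeLevel_natCast _ _ h]
    rfl
  · rw [MulChar.map_nonunit _ h]
    rw [ZMod.isUnit_iff_coprime, Nat.coprime_mul_iff_right, not_and_or] at h
    rcases h with h | h
    · rw [MulChar.map_nonunit χ₁ (by rwa [ZMod.isUnit_iff_coprime])]; simp
    · rw [MulChar.map_nonunit χ₂ (by rwa [ZMod.isUnit_iff_coprime])]; simp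

theorem twist_ne_one {f₁ f₂ : ℕ} [NeZero f₁] [NeZero f₂] {χ₁ : DirichletCharacter ℂ f₁}
    {χ₂ : DirichletCharacter ℂ f₂} (h₁ : χ₁.IsPrimitive) (h₂ : χ₂.IsPrimitive)
    (h : (⟨f₁, χ₁⟩ : Σ f, DirichletCharacter ℂ f) ≠ ⟨f₂, χ₂⟩) : twist χ₁ χ₂ ≠ 1 := by
  intro h1
  rw [twist, mul_inv_eq_one] at h1
  have hc := congrArg conductor h1
  rw [conductor_changeLevel, conductor_changeLevel, h₁, h₂] at hc
  subst hc
  exact h (by rw [changeLevel_injective _ h1])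


theorem norm_riemannZeta_le {x : ℝ} (hx : 0 < x) : ‖riemannZeta (1 + x)‖ ≤ 1 + 1 / x := by
  have h1 : 1 < 1 + x := by linarith
  have h := ZetaAsymptotics.zeta_limit_aux1 h1
  have h2 : 0 ≤ ZetaAsymptotics.termTSum (1 + x) := tsum_nonneg fun n => ZetaAsymptotics.term_nonneg _ _
  have h3 : 0 ≤ ∑' n : ℕ, 1 / (n + 1 : ℝ) ^ (1 + x) := tsum_nonneg fun n => by positivity
  have e : riemannZeta (1 + x) = ((∑' n : ℕ, 1 / (n + 1 : ℝ) ^ (1 + x) : ℝ) : ℂ) := by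
    rw [zeta_eq_tsum_one_div_nat_add_one_cpow (by simpa using hx), ofReal_tsum]
    refine tsum_congr fun n => ?_
    rw [ofReal_div, ofReal_cpow (by positivity)]
    push_cast
    rfl
  rw [e, norm_real, Real.norm_of_nonneg h3]
  rw [add_sub_cancel_left] at h
  nlinarith

theorem norm_deriv_LFunction_le {f : ℕ} [NeZero f] {χ : DirichletCharacter ℂ f} (hχ : χ ≠ 1) {Z : ℝ}
    (hfZ : (f:ℝ) ≤ Z) (hZ : 2 ≤ Real.log Z) {y : ℂ} (hy : ‖y - 1‖ ≤ 1 / (2 * Real.log Z)) :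
    ‖deriv χ.LFunction y‖ ≤ 60 * Real.log Z ^ 2 := by
  have hl0 : 0 < Real.log Z := by linarith
  have := norm_deriv_le_of_forall_mem_sphere_norm_le (c := y) (R := 1 / (2 * Real.log Z)) (C := 30 * Real.log Z)
    (f := χ.LFunction) (by positivity) (differentiable_LFunction hχ).diffContOnCl ?_
  · refine this.trans (le_of_eq ?_)
    field_simp
    norm_num
  · intro w hw
    refine norm_LFunction_le hχ hfZ hZ ?_
    rw [mem_sphere_iff_norm] at hw
    calc ‖w - 1‖ ≤ ‖w - y‖ + ‖y - 1‖ := norm_sub_le_norm_sub_add_norm_sub _ _ _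
      _ ≤ 1 / (2 * Real.log Z) + 1 / (2 * Real.log Z) := add_le_add hw.le hy
      _ = _ := by field_simp; norm_num

theorem norm_LFunction_sub_le {f : ℕ} [NeZero f] {χ : DirichletCharacter ℂ f} (hχ : χ ≠ 1) {Z : ℝ}
    (hfZ : (f:ℝ) ≤ Z) (hZ : 2 ≤ Real.log Z) {s : ℂ} (hs : ‖s - 1‖ ≤ 1 / (2 * Real.log Z)) :
    ‖χ.LFunction s - χ.LFunction 1‖ ≤ 60 * Real.log Z ^ 2 * ‖s - 1‖ := by
  have hl0 : 0 < Real.log Z := by linarith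
  refine Convex.norm_image_sub_le_of_norm_deriv_le (s := Metric.closedBall (1:ℂ) (1 / (2 * Real.log Z)))
    (𝕜 := ℂ) (fun y _ => differentiable_LFunction hχ y) (fun y hy => norm_deriv_LFunction_le hχ hfZ hZ ?_)
    (convex_closedBall _ _) (by simp; positivity) (by simpa [dist_eq] using hs)
  rwa [Metric.mem_closedBall, dist_eq] at hy

/-- Two distinct primitive characters cannot both have a very small value at `1`. -/
theorem LFunction_one_repulsion {f₁ f₂ : ℕ} [NeZero f₁] [NeZero f₂] {χ₁ : DirichletCharacter ℂ f₁}
    {χ₂ : DirichletCharacter ℂ f₂} (h₁ : χ₁.IsPrimitive) (h₂ : χ₂.IsPrimitive)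
    (n₁ : χ₁ ≠ 1) (n₂ : χ₂ ≠ 1)
    (h : (⟨f₁, χ₁⟩ : Σ f, DirichletCharacter ℂ f) ≠ ⟨f₂, χ₂⟩) {Z : ℝ} (hZ : 2 ≤ Real.log Z)
    (hf : (f₁ * f₂ : ℝ) ≤ Z) (hL : ‖χ₁.LFunction 1‖ ≤ 1 / (10 ^ 11 * Real.log Z ^ 8)) :
    1 / (10 ^ 11 * Real.log Z ^ 8) < ‖χ₂.LFunction 1‖ := by
  by_contra! hL2
  set l := Real.log Z with hl
  have hl0 : 0 < l := by linarith
  have hf1 : (1:ℝ) ≤ f₁ := by exact_mod_cast NeZero.one_le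
  have hf2 : (1:ℝ) ≤ f₂ := by exact_mod_cast NeZero.one_le
  set x := 1 / (10 ^ 11 * l ^ 8) / (60 * l ^ 2) with hx
  have hx0 : 0 < x := by positivity
  have hx1 : x ≤ 1 / (2 * l) := by
    rw [hx, div_div]
    apply one_div_le_one_div_of_le (by positivity)
    have : 2 ≤ l ^ 9 := le_trans hZ (le_self_pow₀ (by linarith) (by norm_num))
    nlinarith
  have hx2 : x ≤ 1 / l := hx1.trans (by gcongr; linarith)
  have hx3 : 60 * l ^ 2 * x = 1 / (10 ^ 11 * l ^ 8) := by rw [hx]; field_simp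
  have hnx : ‖(1 + x : ℂ) - 1‖ = x := by simp [abs_of_pos hx0]
  have key : ∀ {f : ℕ} [NeZero f] {χ : DirichletCharacter ℂ f}, χ ≠ 1 → (f:ℝ) ≤ Z →
      ‖χ.LFunction 1‖ ≤ 1 / (10 ^ 11 * l ^ 8) → ‖χ.LFunction (1 + x)‖ ≤ 2 * (60 * l ^ 2 * x) := by
    intro f _ χ hχ hfZ hL
    have := norm_LFunction_sub_le hχ hfZ hZ (s := 1 + x) (by rw [hnx]; exact hx1)
    rw [hnx, ← hl] at this
    have t := norm_le_norm_add_norm_sub' (χ.LFunction (1+x)) (χ.LFunction 1)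
    linarith
  have k1 := key n₁ (le_trans (by nlinarith) hf) hL
  have k2 := key n₂ (le_trans (by nlinarith) hf) hL2
  have k3 := norm_LFunction_le (twist_ne_one h₁ h₂ h) (Z := Z) (by push_cast; exact hf) hZ (s := 1 + x)
    (by rw [hnx]; exact hx2)
  have k0 := norm_riemannZeta_le hx0
  have k0' : ‖riemannZeta (1 + x)‖ ≤ 2 / x := by
    refine k0.trans ?_
    have : 1 ≤ 1 / x := by
      rw [le_div_iff₀ hx0, one_mul]
      refine hx2.trans ?_
      rw [div_le_one hl0]; linarith
    calc 1 + 1 / x ≤ 1 / x + 1 / x := by gcongr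
      _ = _ := by ring
  have hp := norm_product_repulsion χ₁ χ₂ (twist χ₁ χ₂) (fun p => twist_apply χ₁ χ₂ p) hx0
  have hre : 1 < (1 + x : ℂ).re := by simpa using hx0
  rw [← LFunction_eq_LSeries _ hre, ← LFunction_eq_LSeries _ hre, ← LFunction_eq_LSeries _ hre] at hp
  have : (1:ℝ) ≤ (2 / x) ^ 3 * (2 * (60 * l ^ 2 * x)) ^ 2 * (2 * (60 * l ^ 2 * x)) ^ 2 * (30 * l) ^ 2 := by
    refine hp.trans ?_
    gcongr
  have e : (2 / x) ^ 3 * (2 * (60 * l ^ 2 * x)) ^ 2 * (2 * (60 * l ^ 2 * x)) ^ 2 * (30 * l) ^ 2 =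
      128 * 60 ^ 4 * 900 * l ^ 10 * x := by
    field_simp; ring
  rw [e, hx] at this
  have e2 : 128 * 60 ^ 4 * 900 * l ^ 10 * (1 / (10 ^ 11 * l ^ 8) / (60 * l ^ 2)) = (128 * 60 ^ 3 * 900 / 10 ^ 11 : ℝ) := by
    field_simp
  rw [e2] at this
  norm_num at this

/-- For infinitely many `Y` no primitive character of level at most `Y` has a small value at `1`. -/
theorem frequently_LFunction_one_large : ∃ᶠ Y : ℕ in Filter.atTop, ∀ (f : ℕ) [NeZero f], f ≤ Y →
    ∀ χ : DirichletCharacter ℂ f, χ.IsPrimitive → χ ≠ 1 →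
      1 / (10 ^ 11 * (2 * Real.log (Y + 1)) ^ 8) ≤ ‖χ.LFunction 1‖ := by
  intro hbad
  rw [Filter.eventually_atTop] at hbad
  obtain ⟨Y₀, hY₀⟩ := hbad
  set Y₁ := max Y₀ 2
  have hb : ∀ n : ℕ, ∃ f : ℕ, ∃ _ : NeZero f, ∃ χ : DirichletCharacter ℂ f, f ≤ Y₁ + n ∧ χ.IsPrimitive ∧ χ ≠ 1 ∧
      ‖χ.LFunction 1‖ < 1 / (10 ^ 11 * (2 * Real.log ((Y₁ + n : ℕ) + 1)) ^ 8) := by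
    intro n
    have := hY₀ (Y₁ + n) (by omega)
    push Not at this
    obtain ⟨f, i, h1, χ, h2, h3, h4⟩ := this
    exact ⟨f, i, χ, h1, h2, h3, h4⟩
  choose f hf χ h1 h2 h3 h4 using hb
  have hY1 : 2 ≤ Y₁ := le_max_right _ _
  have hlog3 : 1 ≤ Real.log 3 := by
    rw [Real.le_log_iff_exp_le (by norm_num)]; linarith [Real.exp_one_lt_d9]
  have step : ∀ n, (⟨f n, χ n⟩ : Σ f, DirichletCharacter ℂ f) = ⟨f (n+1), χ (n+1)⟩ := by
    intro n
    by_contra hne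
    set T : ℝ := (Y₁ + n : ℕ) + 1 with hT
    have hT3 : (3:ℝ) ≤ T := by rw [hT]; norm_cast; omega
    have hlT : 1 ≤ Real.log T := hlog3.trans (Real.log_le_log (by norm_num) hT3)
    have e : Real.log (T ^ 2) = 2 * Real.log T := by rw [Real.log_pow]; norm_num
    have hfn : (f n : ℝ) ≤ T := by rw [hT]; norm_cast; have := h1 n; omega
    have hfn1 : (f (n+1) : ℝ) ≤ T := by rw [hT]; norm_cast; have := h1 (n+1); omega
    have := LFunction_one_repulsion (h2 n) (h2 (n+1)) (h3 n) (h3 (n+1)) hne (Z := T ^ 2)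
      (by rw [e]; linarith) (by rw [sq]; gcongr) (by rw [e]; exact (h4 n).le)
    refine absurd (this.trans (h4 (n+1))) (not_lt.2 ?_)
    rw [e]
    have : T ≤ (Y₁ + (n+1) : ℕ) + 1 := by rw [hT]; push_cast; linarith
    gcongr
  have const : ∀ n, (⟨f 0, χ 0⟩ : Σ f, DirichletCharacter ℂ f) = ⟨f n, χ n⟩ := by
    intro n
    induction n with
    | zero => rfl
    | succ n ih => rw [ih, step n]
  have hval : ∀ n, ‖(χ 0).LFunction 1‖ = ‖(χ n).LFunction 1‖ := by
    intro n
    have := const n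
    rw [Sigma.mk.injEq] at this
    obtain ⟨ha, hb⟩ := this
    have : ∀ (g : ℕ) (ψ : DirichletCharacter ℂ g) (_ : NeZero g), f 0 = g → χ 0 ≍ ψ →
        ‖(χ 0).LFunction 1‖ = ‖ψ.LFunction 1‖ := by
      rintro g ψ i rfl hh
      cases hh
      congr
    exact this _ _ (hf n) ha hb
  have hpos : 0 < ‖(χ 0).LFunction 1‖ := norm_pos_iff.2 (LFunction_apply_one_ne_zero (h3 0))
  have lim : Filter.Tendsto (fun n : ℕ => 1 / (10 ^ 11 * (2 * Real.log ((Y₁ + n : ℕ) + 1)) ^ 8)) Filter.atTop (nhds 0) := by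
    have h1 : Filter.Tendsto (fun n : ℕ => Real.log ((Y₁ + n : ℕ) + 1)) Filter.atTop Filter.atTop := by
      apply Real.tendsto_log_atTop.comp
      apply Filter.tendsto_atTop_add_const_right
      apply tendsto_natCast_atTop_atTop.comp
      exact Filter.tendsto_atTop_mono (fun n => Nat.le_add_left n Y₁) Filter.tendsto_id
    simp only [one_div]
    apply Filter.Tendsto.inv_tendsto_atTop
    apply Filter.Tendsto.const_mul_atTop (by positivity)
    exact (Filter.tendsto_pow_atTop (by norm_num)).comp (h1.const_mul_atTop (by norm_num))
  obtain ⟨n, hn⟩ := (lim.eventually (gt_mem_nhds hpos)).exists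
  exact absurd (hn.trans_le (hval n).le) (not_lt.2 (h4 n).le)

end

section

open MeasureTheory Filter Complex
open scoped FourierTransform ContDiff SchwartzMap

/-- The vertical line `Re z = 1`, parametrised by frequency. -/
noncomputable def vline (t : ℝ) : ℂ := 1 - 2 * Real.pi * t * I

@[simp] theorem vline_re (t : ℝ) : (vline t).re = 1 := by simp [vline]

theorem continuous_vline : Continuous vline := by unfold vline; fun_prop

theorem one_le_norm_vline (t : ℝ) : 1 ≤ ‖vline t‖ := by
  simpa using abs_re_le_norm (vline t)

theorem vline_ne_zero (t : ℝ) : vline t ≠ 0 := by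
  intro h; have := one_le_norm_vline t; rw [h, norm_zero] at this; linarith

/-- `c` is the density of a Laplace representation of `G` along `Re z = 1`, with all moments finite. -/
structure IsLaplaceRep (G : ℝ → ℂ) (c : ℝ → ℂ) : Prop where
  cont : Continuous c
  integrable : ∀ J : ℕ, Integrable fun t => ‖c t‖ * ‖vline t‖ ^ J
  rep : ∀ v, G v = ∫ t, c t * exp (-(vline t * v))

theorem exists_isLaplaceRep {G : ℝ → ℂ} (hG : ContDiff ℝ ∞ G) (hc : HasCompactSupport G) :
    ∃ c, IsLaplaceRep G c := by
  have h1 : ContDiff ℝ ∞ fun v : ℝ => G v * exp v :=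
    hG.mul (Complex.ofRealCLM.contDiff.cexp)
  have h2 : HasCompactSupport fun v : ℝ => G v * exp v := hc.mul_right
  set g : 𝓢(ℝ, ℂ) := h2.toSchwartzMap h1 with hg
  have hgv : ∀ v, g v = G v * exp v := fun v => rfl
  refine ⟨⇑(𝓕 g : 𝓢(ℝ, ℂ)), (𝓕 g : 𝓢(ℝ, ℂ)).continuous, ?_, ?_⟩
  · intro J
    have hIn : Integrable fun t : ℝ => ((1 + 2 * Real.pi) ^ J * 2 ^ J) * (‖(𝓕 g : 𝓢(ℝ, ℂ)) t‖ + ‖t‖ ^ J * ‖(𝓕 g : 𝓢(ℝ, ℂ)) t‖) := by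
      apply Integrable.const_mul
      exact ((𝓕 g : 𝓢(ℝ, ℂ)).integrable (μ := volume)).norm.add ((𝓕 g : 𝓢(ℝ, ℂ)).integrable_pow_mul volume J)
    refine hIn.mono' (by have := (𝓕 g : 𝓢(ℝ, ℂ)).continuous; have := continuous_vline; fun_prop) ?_
    refine Eventually.of_forall fun t => ?_
    rw [Real.norm_of_nonneg (by positivity)]
    have hv : ‖vline t‖ ≤ (1 + 2 * Real.pi) * (1 + ‖t‖) := by
      calc ‖vline t‖ ≤ ‖(1:ℂ)‖ + ‖(2 * Real.pi * t * I : ℂ)‖ := norm_sub_le _ _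
        _ = 1 + 2 * Real.pi * ‖t‖ := by simp [abs_of_pos Real.pi_pos]
        _ ≤ _ := by nlinarith [Real.pi_pos, norm_nonneg t]
    have h2 : (1 + ‖t‖) ^ J ≤ 2 ^ J * (1 + ‖t‖ ^ J) := by
      rcases le_total ‖t‖ 1 with h | h
      · calc (1 + ‖t‖) ^ J ≤ 2 ^ J := by gcongr; linarith
          _ ≤ _ := by nlinarith [pow_nonneg (norm_nonneg t) J, pow_pos (two_pos : (0:ℝ) < 2) J]
      · calc (1 + ‖t‖) ^ J ≤ (2 * ‖t‖) ^ J := by gcongr; linarith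
          _ = 2 ^ J * ‖t‖ ^ J := mul_pow _ _ _
          _ ≤ _ := by gcongr; linarith
    calc ‖(𝓕 g : 𝓢(ℝ, ℂ)) t‖ * ‖vline t‖ ^ J ≤ ‖(𝓕 g : 𝓢(ℝ, ℂ)) t‖ * ((1 + 2 * Real.pi) * (1 + ‖t‖)) ^ J := by gcongr
      _ = ‖(𝓕 g : 𝓢(ℝ, ℂ)) t‖ * ((1 + 2 * Real.pi) ^ J * (1 + ‖t‖) ^ J) := by rw [mul_pow]
      _ ≤ ‖(𝓕 g : 𝓢(ℝ, ℂ)) t‖ * ((1 + 2 * Real.pi) ^ J * (2 ^ J * (1 + ‖t‖ ^ J))) := by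
        have := Real.pi_pos
        gcongr
      _ = _ := by ring
  · intro v
    have h3 : (𝓕⁻ (𝓕 g : 𝓢(ℝ, ℂ)) : 𝓢(ℝ, ℂ)) v = g v := by rw [FourierTransform.fourierInv_fourier_eq]
    rw [SchwartzMap.fourierInv_coe, Real.fourierInv_eq'] at h3
    have h4 : G v = exp (-v) * g v := by rw [hgv, mul_left_comm, ← exp_add]; simp
    rw [h4, ← h3, ← integral_const_mul]
    congr 1
    ext t
    rw [smul_eq_mul, ← mul_assoc, ← exp_add, mul_comm]
    congr 2
    simp [vline]
    ring

namespace IsLaplaceRep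
variable {G c : ℝ → ℂ}

theorem norm_exp_vline (t v : ℝ) : ‖exp (-(vline t * v))‖ = Real.exp (-v) := by
  rw [norm_exp]; simp

theorem integrable_mul_pow (h : IsLaplaceRep G c) (J : ℕ) (v : ℝ) :
    Integrable fun t => c t * vline t ^ J * exp (-(vline t * v)) := by
  refine ((h.integrable J).mul_const (Real.exp (-v))).mono' ?_ (Eventually.of_forall fun t => ?_)
  · have := h.cont; have := continuous_vline; fun_prop
  · rw [norm_mul, norm_exp_vline, norm_mul, norm_pow]

theorem moment_exp_eq_zero (h : IsLaplaceRep G c) {a : ℝ} (hG : ∀ v < a, G v = 0) (J : ℕ) :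
    ∀ v < a, ∫ t, c t * vline t ^ J * exp (-(vline t * v)) = 0 := by
  induction J with
  | zero => intro v hv; simpa using (h.rep v).symm.trans (hG v hv)
  | succ J ih =>
    intro v hv
    have hd := hasDerivAt_integral_of_dominated_loc_of_deriv_le (𝕜 := ℝ) (μ := volume) (x₀ := v) (s := Metric.ball v 1)
      (F := fun v t => c t * vline t ^ J * exp (-(vline t * v)))
      (F' := fun v t => c t * vline t ^ J * (exp (-(vline t * v)) * -vline t))
      (bound := fun t => ‖c t‖ * ‖vline t‖ ^ (J + 1) * Real.exp (-(v - 1)))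
      (Metric.ball_mem_nhds v one_pos)
      (Eventually.of_forall fun v => (h.integrable_mul_pow J v).1) (h.integrable_mul_pow J v)
      (by have := h.cont; have := continuous_vline; fun_prop)
      (Eventually.of_forall fun t x hx => by
        rw [norm_mul, norm_mul, norm_mul, norm_exp_vline, norm_neg, norm_pow]
        rw [Metric.mem_ball, Real.dist_eq, abs_lt] at hx
        have : Real.exp (-x) ≤ Real.exp (-(v - 1)) := by gcongr; linarith
        calc ‖c t‖ * ‖vline t‖ ^ J * (Real.exp (-x) * ‖vline t‖) = ‖c t‖ * ‖vline t‖ ^ (J + 1) * Real.exp (-x) := by ring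
          _ ≤ _ := by gcongr)
      ((h.integrable (J + 1)).mul_const _)
      (Eventually.of_forall fun t x _ => by
        have h1 : HasDerivAt (fun x : ℝ => (-(vline t * (x:ℂ)))) (-vline t) x := by
          have := ((Complex.ofRealCLM.hasDerivAt (x := x)).const_mul (vline t)).neg
          simp only [ofRealCLM_apply, ofReal_one, mul_one] at this
          exact this
        exact h1.cexp.const_mul _)
    have h0 : HasDerivAt (fun n : ℝ => ∫ t, c t * vline t ^ J * exp (-(vline t * n))) 0 v := by
      refine (hasDerivAt_const v (0:ℂ)).congr_of_eventuallyEq ?_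
      filter_upwards [Iio_mem_nhds hv] with w hw using ih w hw
    have := hd.2.unique h0
    rw [← neg_eq_zero, ← this, ← integral_neg]
    congr 1
    ext t
    ring

theorem moment_eq_zero (h : IsLaplaceRep G c) {a : ℝ} (ha : 0 < a) (hG : ∀ v < a, G v = 0) (J : ℕ) :
    ∫ t, c t * vline t ^ J = 0 := by
  simpa using h.moment_exp_eq_zero hG J 0 ha

end IsLaplaceRep

/-- Taylor expansion with remainder for a bounded holomorphic function on a disc. -/
theorem exists_taylor_remainder {f : ℂ → ℂ} {r B : ℝ} (hr : 0 < r)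
    (hd : DifferentiableOn ℂ f (Metric.ball 0 r)) (hB : ∀ z ∈ Metric.ball (0:ℂ) r, ‖f z‖ ≤ B) (J : ℕ) :
    ∃ (a : ℕ → ℂ) (g : ℂ → ℂ), DifferentiableOn ℂ g (Metric.ball 0 r) ∧
      (∀ j < J, ‖a j‖ ≤ B * (2 / r) ^ j) ∧ (∀ z ∈ Metric.ball (0:ℂ) r, ‖g z‖ ≤ B * (2 / r) ^ J) ∧
      ∀ z ∈ Metric.ball (0:ℂ) r, f z = ∑ j ∈ Finset.range J, a j * z ^ j + z ^ J * g z := by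
  induction J with
  | zero => exact ⟨0, f, hd, by simp, by simpa using hB, by simp⟩
  | succ J ih =>
    obtain ⟨a, g, hg, ha, hgB, hf⟩ := ih
    have h0 : (0:ℂ) ∈ Metric.ball (0:ℂ) r := Metric.mem_ball_self hr
    refine ⟨fun j => if j < J then a j else g 0, dslope g 0, ?_, ?_, ?_, ?_⟩
    · exact (differentiableOn_dslope (Metric.isOpen_ball.mem_nhds h0)).2 hg
    · intro j hj
      dsimp only
      split_ifs with h
      · exact ha j h
      · obtain rfl : j = J := by omega
        exact hgB 0 h0
    · intro z hz
      have := norm_dslope_le_div_of_mapsTo_ball (R₂ := 2 * (B * (2 / r) ^ J)) hg (fun w hw => ?_) hz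
      · refine this.trans (le_of_eq ?_)
        rw [pow_succ]; ring
      · rw [mem_closedBall_iff_norm]
        refine (norm_sub_le _ _).trans ?_
        linarith [hgB w hw, hgB 0 h0]
    · intro z hz
      rw [Finset.sum_range_succ, hf z hz]
      have e : g z = g 0 + z * dslope g 0 z := by
        have := sub_smul_dslope g 0 z
        simp only [sub_zero, smul_eq_mul] at this
        rw [this]; ring
      rw [e]
      simp only [lt_irrefl, if_false]
      have : ∑ j ∈ Finset.range J, (if j < J then a j else g 0) * z ^ j = ∑ j ∈ Finset.range J, a j * z ^ j :=
        Finset.sum_congr rfl fun j hj => by rw [if_pos (Finset.mem_range.1 hj)]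
      rw [this]
      ring

end

section

open MeasureTheory Filter Complex Topology
open scoped ContDiff

/-- A smooth bump function supported in `(1, 1.05)`. -/
noncomputable def bumpV : ContDiffBump (41 / 40 : ℝ) := ⟨1 / 100, 1 / 40, by norm_num, by norm_num⟩

/-- The smooth logarithmic weight `V(log n / L) / n`. -/
noncomputable def wt (L : ℝ) (n : ℕ) : ℝ := bumpV (Real.log n / L) / n

/-- A finite range containing the support of `wt L`. -/
noncomputable def wtSupp (L : ℝ) : Finset ℕ := Finset.Icc 1 ⌊Real.exp (21 / 20 * L)⌋₊

theorem bumpV_eq_zero {v : ℝ} (h : v ≤ 1 ∨ 21 / 20 ≤ v) : bumpV v = 0 := by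
  apply bumpV.zero_of_le_dist
  change (1 / 40 : ℝ) ≤ _
  rw [Real.dist_eq]
  rcases h with h | h
  · rw [abs_sub_comm]; exact le_trans (by linarith) (le_abs_self _)
  · exact le_trans (by linarith) (le_abs_self _)

theorem bumpV_eq_one {v : ℝ} (h : 203 / 200 ≤ v) (h' : v ≤ 207 / 200) : bumpV v = 1 := by
  apply bumpV.one_of_mem_closedBall
  change _ ∈ Metric.closedBall _ (1 / 100 : ℝ)
  rw [Metric.mem_closedBall, Real.dist_eq, abs_le]
  constructor <;> linarith

theorem wt_nonneg (L : ℝ) (n : ℕ) : 0 ≤ wt L n := div_nonneg bumpV.nonneg (Nat.cast_nonneg _)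

theorem wt_le (L : ℝ) (n : ℕ) : wt L n ≤ 1 / n := by
  unfold wt; gcongr; exact bumpV.le_one

theorem lt_of_wt_ne_zero {L : ℝ} (hL : 0 < L) {n : ℕ} (h : wt L n ≠ 0) : Real.exp L < n := by
  have hn : n ≠ 0 := by rintro rfl; simp [wt] at h
  have h1 : bumpV (Real.log n / L) ≠ 0 := fun h0 => h (by rw [wt, h0, zero_div])
  by_contra hc
  apply h1
  apply bumpV_eq_zero (Or.inl _)
  rw [div_le_one hL, Real.log_le_iff_le_exp (by positivity)]
  linarith

theorem mem_wtSupp {L : ℝ} (hL : 0 < L) {n : ℕ} (h : wt L n ≠ 0) : n ∈ wtSupp L := by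
  have hn : n ≠ 0 := by rintro rfl; simp [wt] at h
  have h1 : bumpV (Real.log n / L) ≠ 0 := fun h0 => h (by rw [wt, h0, zero_div])
  rw [wtSupp, Finset.mem_Icc]
  refine ⟨Nat.one_le_iff_ne_zero.2 hn, Nat.le_floor ?_⟩
  by_contra hc
  apply h1
  apply bumpV_eq_zero (Or.inr _)
  rw [le_div_iff₀ hL]
  rw [Real.le_log_iff_exp_le (by positivity)]
  linarith

theorem exists_isLaplaceRep_bumpV : ∃ c, IsLaplaceRep (fun v => (bumpV v : ℂ)) c :=
  exists_isLaplaceRep (Complex.ofRealCLM.contDiff.comp bumpV.contDiff)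
    (bumpV.hasCompactSupport.comp_left (g := ((↑) : ℝ → ℂ)) rfl)

/-- The density of the Laplace representation of `bumpV`. -/
noncomputable def cV : ℝ → ℂ := exists_isLaplaceRep_bumpV.choose

theorem cV_rep : IsLaplaceRep (fun v => (bumpV v : ℂ)) cV := exists_isLaplaceRep_bumpV.choose_spec

theorem cV_moment (J : ℕ) : ∫ t, cV t * vline t ^ J = 0 :=
  cV_rep.moment_eq_zero one_pos (fun v hv => by rw [bumpV_eq_zero (Or.inl hv.le), ofReal_zero]) J

theorem wt_eq_integral (L : ℝ) {n : ℕ} (hn : n ≠ 0) :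
    (wt L n : ℂ) = ∫ t, cV t * ((n : ℂ) ^ (1 + vline t / L))⁻¹ := by
  rw [wt, ofReal_div, cV_rep.rep, ← integral_div]
  congr 1
  ext t
  have hn' : (n:ℂ) ≠ 0 := by exact_mod_cast hn
  rw [cpow_add _ _ hn', cpow_one, mul_inv, mul_div_assoc, div_eq_inv_mul _ ((n:ℝ):ℂ), ofReal_natCast, ← cpow_neg,
    cpow_def_of_ne_zero hn', ← natCast_log]
  congr 3
  push_cast
  ring

theorem re_one_add_vline_div {L : ℝ} (t : ℝ) : (1 + vline t / L).re = 1 + 1 / L := by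
  simp

/-- The absolute value series `∑ ‖a n‖ n^(-1-1/L)`. -/
noncomputable def absSeries (a : ℕ → ℂ) (L : ℝ) : ℝ := ∑' n, ‖LSeries.term a (1 + 1 / L) n‖

theorem norm_term_vline (a : ℕ → ℂ) (L t : ℝ) (n : ℕ) :
    ‖LSeries.term a (1 + vline t / L) n‖ = ‖LSeries.term a (1 + 1 / L) n‖ := by
  rw [LSeries.norm_term_eq, LSeries.norm_term_eq, re_one_add_vline_div]
  simp

theorem norm_LSeries_vline_le {a : ℕ → ℂ} {L : ℝ} (ha : LSeriesSummable a (1 + 1 / L)) (t : ℝ) :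
    ‖LSeries a (1 + vline t / L)‖ ≤ absSeries a L := by
  have : Summable fun n => ‖LSeries.term a (1 + vline t / L) n‖ := by
    simp only [norm_term_vline]; exact ha.norm
  refine (norm_tsum_le_tsum_norm this).trans (le_of_eq ?_)
  simp only [norm_term_vline, absSeries]

theorem continuous_term_vline (a : ℕ → ℂ) (L : ℝ) (n : ℕ) :
    Continuous fun t => LSeries.term a (1 + vline t / L) n := by
  rcases eq_or_ne n 0 with rfl | hn
  · simp [continuous_const]
  · simp only [LSeries.term_of_ne_zero hn]
    have hn' : (n:ℂ) ≠ 0 := by exact_mod_cast hn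
    refine continuous_const.div ?_ fun t => ?_
    · have := continuous_vline
      exact (continuous_const.add (this.div_const _)).const_cpow (Or.inl hn')
    · rw [Ne, cpow_eq_zero_iff]; tauto

theorem continuous_LSeries_vline {a : ℕ → ℂ} {L : ℝ} (ha : LSeriesSummable a (1 + 1 / L)) :
    Continuous fun t => LSeries a (1 + vline t / L) :=
  continuous_tsum (continuous_term_vline a L) ha.norm fun n t => (norm_term_vline a L t n).le

theorem sum_mul_wt_eq_integral {a : ℕ → ℂ} {L : ℝ} (hL : 0 < L) (ha : LSeriesSummable a (1 + 1 / L)) :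
    ∑ n ∈ wtSupp L, a n * wt L n = ∫ t, cV t * LSeries a (1 + vline t / L) := by
  have hc0 : Integrable fun t => ‖cV t‖ := by simpa using cV_rep.integrable 0
  have h1 : ∀ n, Integrable fun t => cV t * LSeries.term a (1 + vline t / L) n := fun n => by
    refine (hc0.mul_const ‖LSeries.term a (1 + 1 / L) n‖).mono' ?_ (Eventually.of_forall fun t => ?_)
    · exact (cV_rep.cont.mul (continuous_term_vline a L n)).aestronglyMeasurable
    · rw [norm_mul, norm_term_vline]
  have h2 := hasSum_integral_of_summable_integral_norm h1 (by
    simp only [norm_mul, norm_term_vline, integral_mul_const]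
    exact ha.norm.mul_left _)
  have h3 : ∀ n, ∫ t, cV t * LSeries.term a (1 + vline t / L) n = a n * wt L n := by
    intro n
    rcases eq_or_ne n 0 with rfl | hn
    · simp [wt]
    · rw [wt_eq_integral L hn, ← integral_const_mul]
      congr 1
      ext t
      rw [LSeries.term_of_ne_zero hn]
      ring
  simp only [h3, tsum_mul_left] at h2
  have h4 : HasSum (fun n => a n * (wt L n : ℂ)) _ := hasSum_sum_of_ne_finset_zero (f := fun n => a n * (wt L n : ℂ)) (s := wtSupp L) (fun n hn => by
    by_cases h : wt L n = 0
    · simp [h]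
    · exact absurd (mem_wtSupp hL h) hn)
  exact h4.unique h2

theorem norm_sum_mul_wt_le {a : ℕ → ℂ} {L : ℝ} (hL : 0 < L) (ha : LSeriesSummable a (1 + 1 / L)) :
    ∑ n ∈ wtSupp L, ‖a n‖ * wt L n ≤ Real.exp (21/20) * absSeries a L := by
  rw [absSeries, ← tsum_mul_left]
  refine le_trans (Finset.sum_le_sum fun n hn => ?_) ((ha.norm.mul_left _).sum_le_tsum (wtSupp L) fun n _ => by positivity)
  rw [wtSupp, Finset.mem_Icc] at hn
  have hn0 : n ≠ 0 := by omega
  have hnp : (0:ℝ) < n := by exact_mod_cast Nat.pos_of_ne_zero hn0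
  have hn2 : (n:ℝ) ≤ Real.exp (21/20 * L) := (Nat.le_floor_iff (by positivity)).1 hn.2
  rw [LSeries.norm_term_eq, if_neg hn0]
  have : ((1:ℂ) + 1 / (L:ℂ)).re = 1 + 1 / L := by simp
  rw [this, Real.rpow_add hnp, Real.rpow_one]
  have h3 : (n:ℝ) ^ (1 / L) ≤ Real.exp (21/20) := by
    calc (n:ℝ) ^ (1 / L) ≤ (Real.exp (21/20 * L)) ^ (1 / L) := by gcongr
      _ = Real.exp (21/20) := by rw [← Real.exp_mul]; congr 1; field_simp
  calc ‖a n‖ * wt L n ≤ ‖a n‖ * (1 / n) := by gcongr; exact wt_le L n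
    _ = (n:ℝ) ^ (1 / L) * (‖a n‖ / (n * (n:ℝ) ^ (1 / L))) := by field_simp
    _ ≤ _ := by gcongr

end

section

open MeasureTheory Filter Complex Topology ArithmeticFunction

/-- The weighted count `∑ Λ(n) V(log n / L) / n`. -/
noncomputable def psiW (L : ℝ) : ℝ := ∑ n ∈ wtSupp L, vonMangoldt n * wt L n

/-- The weighted count `∑ V(log n / L) / n`. -/
noncomputable def oneW (L : ℝ) : ℝ := ∑ n ∈ wtSupp L, wt L n

theorem one_lt_re_one_add_inv {L : ℝ} (hL : 0 < L) : 1 < ((1:ℂ) + 1 / L).re := by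
  simp [hL]

theorem one_lt_re_vline {L : ℝ} (hL : 0 < L) (t : ℝ) : 1 < ((1:ℂ) + vline t / L).re := by
  simp [hL]

theorem tendsto_vline_div (t : ℝ) : Tendsto (fun L : ℝ => (1:ℂ) + vline t / L) atTop (𝓝 1) := by
  have : Tendsto (fun L : ℝ => ((L⁻¹ : ℝ) : ℂ)) atTop (𝓝 0) := by
    have := (continuous_ofReal.tendsto (0:ℝ)).comp tendsto_inv_atTop_zero
    rw [ofReal_zero] at this
    exact this
  have := (this.const_mul (vline t)).const_add 1
  simpa [div_eq_mul_inv] using this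

theorem tendsto_zeta_div (t : ℝ) :
    Tendsto (fun L : ℝ => riemannZeta (1 + vline t / L) / L) atTop (𝓝 (1 / vline t)) := by
  have h : Tendsto (fun L : ℝ => (1:ℂ) + vline t / L) atTop (𝓝[≠] 1) := by
    rw [tendsto_nhdsWithin_iff]
    refine ⟨tendsto_vline_div t, ?_⟩
    filter_upwards [eventually_gt_atTop 0] with L hL
    have : (L:ℂ) ≠ 0 := by exact_mod_cast hL.ne'
    simp [vline_ne_zero, this]
  have := (riemannZeta_residue_one.comp h).div_const (vline t)
  refine this.congr' ?_
  filter_upwards [eventually_gt_atTop 0] with L hL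
  have h1 : (L:ℂ) ≠ 0 := by exact_mod_cast hL.ne'
  have h2 := vline_ne_zero t
  simp only [Function.comp]
  field_simp
  ring

theorem LFunctionTrivChar_one_eq : DirichletCharacter.LFunctionTrivChar 1 = riemannZeta := by
  rw [DirichletCharacter.LFunctionTrivChar, DirichletCharacter.LFunction_modOne_eq]

open DirichletCharacter in
theorem tendsto_logDeriv_zeta : Tendsto (fun s : ℂ => -deriv riemannZeta s / riemannZeta s - 1 / (s - 1)) (𝓝[{s | 1 < s.re}] 1)
    (𝓝 (-deriv (LFunctionTrivChar₁ 1) 1 / LFunctionTrivChar₁ 1 1)) := by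
  have hc := continuousOn_neg_logDeriv_LFunctionTrivChar₁ 1 1 (Or.inl rfl)
  have hsub : {s : ℂ | 1 < s.re} ⊆ {s | s = 1 ∨ LFunctionTrivChar 1 s ≠ 0} := by
    intro s hs
    right
    rw [LFunctionTrivChar_one_eq]
    exact riemannZeta_ne_zero_of_one_lt_re hs
  have hc2 : Tendsto _ _ _ := hc.mono_left (nhdsWithin_mono _ hsub)
  refine hc2.congr' ?_
  filter_upwards [self_mem_nhdsWithin] with s hs
  have hs1 : s ≠ 1 := by rintro rfl; simp at hs
  rw [deriv_LFunctionTrivChar₁_apply_of_ne_one 1 hs1, LFunctionTrivChar₁, Function.update_of_ne hs1,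
    LFunctionTrivChar_one_eq]
  have := riemannZeta_ne_zero_of_one_lt_re hs
  have h2 : s - 1 ≠ 0 := sub_ne_zero.2 hs1
  field_simp
  ring

theorem tendsto_logDeriv_zeta_div (t : ℝ) :
    Tendsto (fun L : ℝ => (-deriv riemannZeta (1 + vline t / L) / riemannZeta (1 + vline t / L)) / L) atTop
      (𝓝 (1 / vline t)) := by
  have h : Tendsto (fun L : ℝ => (1:ℂ) + vline t / L) atTop (𝓝[{s | 1 < s.re}] 1) := by
    rw [tendsto_nhdsWithin_iff]
    refine ⟨tendsto_vline_div t, ?_⟩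
    filter_upwards [eventually_gt_atTop 0] with L hL using one_lt_re_vline hL t
  have h1 := tendsto_logDeriv_zeta.comp h
  have h0 : Tendsto (fun L : ℝ => ((L⁻¹ : ℝ) : ℂ)) atTop (𝓝 0) := by
    have := (continuous_ofReal.tendsto (0:ℝ)).comp tendsto_inv_atTop_zero
    rw [ofReal_zero] at this
    exact this
  have h2 := (h1.mul h0).add_const (1 / vline t)
  rw [mul_zero, zero_add] at h2
  refine h2.congr' ?_
  filter_upwards [eventually_gt_atTop 0] with L hL
  have h1 : (L:ℂ) ≠ 0 := by exact_mod_cast hL.ne'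
  have h2 := vline_ne_zero t
  simp only [Function.comp, ofReal_inv]
  rw [sub_mul, add_sub_cancel_left]
  have : 1 / (vline t / (L:ℂ)) * (L:ℂ)⁻¹ = 1 / vline t := by field_simp
  rw [this, sub_add_cancel]
  rfl

theorem LSeriesSummable_one_add_inv {L : ℝ} (hL : 0 < L) : LSeriesSummable 1 ((1:ℂ) + 1 / L) :=
  LSeriesSummable_one_iff.2 (one_lt_re_one_add_inv hL)

theorem LSeriesSummable_vonMangoldt_inv {L : ℝ} (hL : 0 < L) : LSeriesSummable (fun n => (vonMangoldt n : ℂ)) ((1:ℂ) + 1 / L) :=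
  LSeriesSummable_vonMangoldt (one_lt_re_one_add_inv hL)

theorem absSeries_eq {a : ℕ → ℝ} (ha : ∀ n, 0 ≤ a n) {L : ℝ} :
    absSeries (fun n => (a n : ℂ)) L = LSeries (fun n => (a n : ℂ)) (1 + vline 0 / L) := by
  rw [absSeries, LSeries, ofReal_tsum]
  refine tsum_congr fun n => ?_
  rcases eq_or_ne n 0 with rfl | hn
  · simp
  · have e : (n : ℂ) ^ ((1:ℂ) + 1 / L) = (((n:ℝ) ^ (1 + 1 / L) : ℝ) : ℂ) := by
      rw [ofReal_cpow (by positivity)]; push_cast; rfl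
    have : vline 0 = 1 := by simp [vline]
    rw [LSeries.term_of_ne_zero hn, LSeries.term_of_ne_zero hn, this, e, ← ofReal_div, norm_real,
      Real.norm_of_nonneg (div_nonneg (ha n) (by positivity))]

theorem absSeries_vonMangoldt_eq {L : ℝ} (hL : 0 < L) : (absSeries (fun n => (vonMangoldt n : ℂ)) L : ℂ) =
    -deriv riemannZeta (1 + vline 0 / L) / riemannZeta (1 + vline 0 / L) := by
  rw [absSeries_eq (a := fun n => vonMangoldt n) (fun n => vonMangoldt_nonneg),
    LSeries_vonMangoldt_eq_deriv_riemannZeta_div (one_lt_re_vline hL 0)]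

theorem absSeries_one_eq {L : ℝ} (hL : 0 < L) : (absSeries 1 L : ℂ) = riemannZeta (1 + vline 0 / L) := by
  have := absSeries_eq (a := fun _ => 1) (fun n => zero_le_one) (L := L)
  have e : (fun _ : ℕ => (((1:ℝ)):ℂ)) = 1 := by ext; simp
  rw [← LSeries_one_eq_riemannZeta (one_lt_re_vline hL 0), ← e]
  exact this

theorem eventually_absSeries_vonMangoldt_le : ∀ᶠ L : ℝ in atTop, absSeries (fun n => (vonMangoldt n : ℂ)) L ≤ 2 * L := by
  have h := (tendsto_logDeriv_zeta_div 0).norm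
  have e : ‖1 / vline 0‖ < 2 := by simp [vline]
  filter_upwards [h.eventually (gt_mem_nhds e), eventually_gt_atTop 0] with L h1 hL
  rw [← absSeries_vonMangoldt_eq hL, ← ofReal_div, norm_real, Real.norm_eq_abs] at h1
  have := (le_abs_self _).trans h1.le
  rwa [div_le_iff₀ hL] at this

theorem absSeries_one_le {L : ℝ} (hL : 0 < L) : absSeries 1 L ≤ 1 + L := by
  have h := norm_riemannZeta_le (x := 1 / L) (by positivity)
  have e := absSeries_one_eq hL
  have : (1:ℂ) + vline 0 / L = 1 + (1 / L : ℝ) := by simp [vline]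
  rw [this] at e
  rw [← e, norm_real, Real.norm_eq_abs, one_div_one_div] at h
  exact (le_abs_self _).trans h

theorem tendsto_weighted {a : ℕ → ℝ} (hs : ∀ L : ℝ, 0 < L → LSeriesSummable (fun n => (a n : ℂ)) ((1:ℂ) + 1 / L))
    (hb : ∀ᶠ L : ℝ in atTop, absSeries (fun n => (a n : ℂ)) L ≤ 2 * L)
    (hl : ∀ t, Tendsto (fun L : ℝ => LSeries (fun n => (a n : ℂ)) (1 + vline t / L) / L) atTop (𝓝 (1 / vline t))) :
    Tendsto (fun L : ℝ => (((∑ n ∈ wtSupp L, a n * wt L n) / L : ℝ) : ℂ)) atTop (𝓝 (∫ t, cV t * (1 / vline t))) := by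
  have hc0 : Integrable fun t => ‖cV t‖ := by simpa using cV_rep.integrable 0
  have key : Tendsto (fun L : ℝ => ∫ t, cV t * (LSeries (fun n => (a n : ℂ)) (1 + vline t / L) / L)) atTop
      (𝓝 (∫ t, cV t * (1 / vline t))) := by
    refine tendsto_integral_filter_of_dominated_convergence (fun t => ‖cV t‖ * 2) ?_ ?_ (hc0.mul_const 2) ?_
    · filter_upwards [eventually_gt_atTop 0] with L hL
      exact (cV_rep.cont.mul ((continuous_LSeries_vline (hs L hL)).div_const _)).aestronglyMeasurable
    · filter_upwards [eventually_gt_atTop 0, hb] with L hL h2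
      refine Eventually.of_forall fun t => ?_
      rw [norm_mul, norm_div, norm_real, Real.norm_of_nonneg hL.le]
      gcongr
      rw [div_le_iff₀ hL]
      exact (norm_LSeries_vline_le (hs L hL) t).trans h2
    · exact Eventually.of_forall fun t => (hl t).const_mul _
  refine key.congr' ?_
  filter_upwards [eventually_gt_atTop 0] with L hL
  have := sum_mul_wt_eq_integral hL (hs L hL)
  rw [ofReal_div, ofReal_sum]
  simp only [ofReal_mul]
  rw [this, ← integral_div]
  congr 1
  ext t
  rw [mul_div_assoc]

theorem tendsto_psiW : Tendsto (fun L : ℝ => ((psiW L / L : ℝ) : ℂ)) atTop (𝓝 (∫ t, cV t * (1 / vline t))) := by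
  refine tendsto_weighted (fun L hL => LSeriesSummable_vonMangoldt_inv hL) eventually_absSeries_vonMangoldt_le fun t => ?_
  refine (tendsto_logDeriv_zeta_div t).congr' ?_
  filter_upwards [eventually_gt_atTop 0] with L hL
  rw [LSeries_vonMangoldt_eq_deriv_riemannZeta_div (one_lt_re_vline hL t)]

theorem tendsto_oneW : Tendsto (fun L : ℝ => ((oneW L / L : ℝ) : ℂ)) atTop (𝓝 (∫ t, cV t * (1 / vline t))) := by
  have e : (fun _ : ℕ => (((1:ℝ)):ℂ)) = 1 := by ext; simp
  have := tendsto_weighted (a := fun _ => 1) (by rw [e]; exact fun L hL => LSeriesSummable_one_add_inv hL) ?_ fun t => ?_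
  · simp only [one_mul] at this; exact this
  · rw [e]
    filter_upwards [eventually_ge_atTop 1] with L hL
    exact (absSeries_one_le (by linarith)).trans (by linarith)
  · rw [e]
    refine (tendsto_zeta_div t).congr' ?_
    filter_upwards [eventually_gt_atTop 0] with L hL
    rw [LSeries_one_eq_riemannZeta (one_lt_re_vline hL t)]

theorem eventually_oneW_ge : ∀ᶠ L : ℝ in atTop, L / 100 ≤ oneW L := by
  filter_upwards [eventually_ge_atTop 1000] with L hL
  have hL0 : 0 < L := by linarith
  set a := ⌈Real.exp (203 / 200 * L)⌉₊
  set b := ⌊Real.exp (207 / 200 * L)⌋₊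
  have ha1 : 1 ≤ a := Nat.one_le_ceil_iff.2 (Real.exp_pos _)
  have hae : Real.exp (203 / 200 * L) ≤ a := Nat.le_ceil _
  have hbe : (b:ℝ) ≤ Real.exp (207 / 200 * L) := Nat.floor_le (Real.exp_pos _).le
  have hsub : Finset.Icc a b ⊆ wtSupp L := by
    apply Finset.Icc_subset_Icc ha1
    apply Nat.floor_le_floor
    apply Real.exp_le_exp.2
    linarith
  have h1 : ∑ n ∈ Finset.Icc a b, (1:ℝ) / n ≤ oneW L := by
    refine le_trans (Finset.sum_le_sum fun n hn => ?_) (Finset.sum_le_sum_of_subset_of_nonneg hsub fun n _ _ => wt_nonneg L n)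
    rw [Finset.mem_Icc] at hn
    have hn0 : (0:ℝ) < n := by exact_mod_cast (by omega : 0 < n)
    have h1 : (a:ℝ) ≤ n := by exact_mod_cast hn.1
    have h2 : (n:ℝ) ≤ b := by exact_mod_cast hn.2
    rw [wt, bumpV_eq_one]
    · rw [le_div_iff₀ hL0, Real.le_log_iff_exp_le hn0]; linarith
    · rw [div_le_iff₀ hL0, Real.log_le_iff_le_exp hn0]; linarith
  have h2 : Real.log ((b + 1 : ℝ) / a) ≤ ∑ n ∈ Finset.Icc a b, (1:ℝ) / n := by
    have hap : (0:ℝ) < a := by exact_mod_cast ha1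
    have : ∀ m : ℕ, Real.log ((m + a : ℝ) / a) ≤ ∑ n ∈ Finset.Ico a (m + a), (1:ℝ) / n := by
      intro m
      induction m with
      | zero => simp [hap.ne']
      | succ m ih =>
        rw [show m + 1 + a = (m + a) + 1 by ring, Finset.sum_Ico_succ_top (by omega)]
        have hma : (0:ℝ) < m + a := by positivity
        have e : Real.log (((m + 1 : ℕ) + a : ℝ) / a) = Real.log ((m + a : ℝ) / a) + Real.log (1 + 1 / (m + a)) := by
          rw [← Real.log_mul (by positivity) (by positivity)]
          congr 1
          push_cast
          field_simp
          ring
        rw [e]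
        have := Real.log_le_sub_one_of_pos (x := 1 + 1 / (m + a : ℝ)) (by positivity)
        push_cast
        linarith
    rcases le_or_gt a (b + 1) with h | h
    · have := this (b + 1 - a)
      rw [Nat.sub_add_cancel h, Nat.cast_sub h] at this
      push_cast at this
      rw [sub_add_cancel] at this
      convert this using 2
      ext; simp
    · refine le_trans (Real.log_nonpos (by positivity) ?_) (Finset.sum_nonneg fun n _ => by positivity)
      rw [div_le_one hap]; exact_mod_cast h.le
  have h3 : 207 / 200 * L - (203 / 200 * L + Real.log 2) ≤ Real.log ((b + 1 : ℝ) / a) := by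
    have hap : (0:ℝ) < a := by exact_mod_cast ha1
    rw [Real.log_div (by positivity) hap.ne']
    have := Real.log_le_log (Real.exp_pos _) (Nat.lt_floor_add_one (Real.exp (207 / 200 * L))).le
    rw [Real.log_exp] at this
    have h4 : (a:ℝ) ≤ Real.exp (203 / 200 * L) * 2 := by
      have := Nat.ceil_lt_add_one (Real.exp_pos (203 / 200 * L)).le
      have h5 : 1 ≤ Real.exp (203 / 200 * L) := Real.one_le_exp (by positivity)
      linarith
    have h5 := Real.log_le_log hap h4
    rw [Real.log_mul (Real.exp_pos _).ne' two_ne_zero, Real.log_exp] at h5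
    linarith
  have := Real.log_two_lt_d9
  linarith

theorem tendsto_psiW_div_oneW : Tendsto (fun L : ℝ => psiW L / oneW L) atTop (𝓝 1) := by
  set κ := ∫ t, cV t * (1 / vline t)
  have h1 := (continuous_re.tendsto κ).comp tendsto_psiW
  have h2 := (continuous_re.tendsto κ).comp tendsto_oneW
  have h3 : 1 / 100 ≤ κ.re := by
    refine ge_of_tendsto h2 ?_
    filter_upwards [eventually_oneW_ge, eventually_gt_atTop 0] with L h hL
    simp only [Function.comp, ofReal_re]
    rw [le_div_iff₀ hL]; linarith
  have h4 := h1.div h2 (by linarith)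
  rw [div_self (by linarith)] at h4
  refine h4.congr' ?_
  filter_upwards [eventually_gt_atTop 0] with L hL
  simp only [Function.comp, ofReal_re, Pi.div_apply]
  field_simp

theorem oneW_le {L : ℝ} (hL : 1 ≤ L) : oneW L ≤ 6 * L := by
  have h := norm_sum_mul_wt_le (by linarith) (LSeriesSummable_one_add_inv (L := L) (by linarith))
  simp only [Pi.one_apply, norm_one, one_mul] at h
  have h2 := absSeries_one_le (L := L) (by linarith)
  have h3 : Real.exp (21/20) ≤ 3 := by
    rw [← Real.le_log_iff_exp_le (by norm_num)]
    have := Real.log_three_gt_d9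
    linarith
  have h4 : 0 ≤ absSeries 1 L := tsum_nonneg fun _ => norm_nonneg _
  calc oneW L ≤ _ := h
    _ ≤ 3 * (1 + L) := by gcongr
    _ ≤ _ := by linarith

end

section

open MeasureTheory Filter Complex ArithmeticFunction DirichletCharacter

/-- The coefficients `χ(n) Λ(n)`. -/
noncomputable abbrev twistedLambda {f : ℕ} (χ : DirichletCharacter ℂ f) : ℕ → ℂ :=
  (fun n : ℕ => χ n) * fun n : ℕ => (vonMangoldt n : ℂ)

/-- The smoothly weighted sum `∑ χ(n) Λ(n) V(log n / L) / n`. -/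
noncomputable def charW {f : ℕ} (χ : DirichletCharacter ℂ f) (L : ℝ) : ℂ :=
  ∑ n ∈ wtSupp L, χ n * vonMangoldt n * wt L n

theorem norm_integral_cV_le (J : ℕ) : ∃ C, 0 ≤ C ∧ ∀ (b B : ℝ) (H : ℂ → ℂ) (φ : ℝ → ℂ), 1 ≤ b → 1 ≤ B → B ≤ b →
    DifferentiableOn ℂ H (Metric.ball 0 (1 / B)) → (∀ w ∈ Metric.ball (0:ℂ) (1 / B), ‖H w‖ ≤ B) →
    Continuous φ → (∀ t, ‖φ t‖ ≤ 2 * b ^ 4) →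
    (∀ t, vline t / (b ^ 4 : ℝ) ∈ Metric.ball (0:ℂ) (1 / B) → φ t = H (vline t / (b ^ 4 : ℝ))) →
    ‖∫ t, cV t * φ t‖ ≤ C * (b ^ 4 / b ^ (3 * J)) := by
  refine ⟨∫ t, (2 ^ J + 2 + J * 2 ^ J) * (‖cV t‖ * ‖vline t‖ ^ (2 * J)), integral_nonneg fun t => by positivity,
    fun b B H φ hb hB hBb hd hH hφ hφb hφH => ?_⟩
  have hB0 : 0 < B := by linarith
  have hb0 : 0 < b := by linarith
  obtain ⟨a, g, -, ha, hg, hf⟩ := exists_taylor_remainder (by positivity : 0 < 1 / B) hd hH J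
  have e2 : 2 / (1 / B) = 2 * B := by field_simp
  rw [e2] at ha hg
  set P : ℝ → ℂ := fun t => ∑ j ∈ Finset.range J, a j * (vline t / (b ^ 4 : ℝ)) ^ j with hP
  have hPt : ∀ t, cV t * P t = ∑ j ∈ Finset.range J, (a j / (b ^ 4 : ℝ) ^ j) * (cV t * vline t ^ j) := by
    intro t
    rw [hP, Finset.mul_sum]
    refine Finset.sum_congr rfl fun j _ => ?_
    rw [div_pow]; ring
  have hIn : ∀ j, Integrable fun t => cV t * vline t ^ j := fun j => by
    simpa using cV_rep.integrable_mul_pow j 0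
  have hPi : Integrable fun t => cV t * P t := by
    simp only [hPt]
    exact integrable_finsetSum _ fun j _ => (hIn j).const_mul _
  have hP0 : ∫ t, cV t * P t = 0 := by
    simp only [hPt]
    rw [integral_finsetSum _ fun j _ => (hIn j).const_mul _]
    refine Finset.sum_eq_zero fun j _ => ?_
    rw [integral_const_mul, cV_moment, mul_zero]
  have hφi : Integrable fun t => cV t * φ t := by
    have hc0 : Integrable fun t => ‖cV t‖ := by simpa using cV_rep.integrable 0
    refine (hc0.mul_const (2 * b ^ 4)).mono' ?_ (Eventually.of_forall fun t => ?_)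
    · have := cV_rep.cont; fun_prop
    · rw [norm_mul]; gcongr; exact hφb t
  have e : ∫ t, cV t * φ t = ∫ t, (cV t * φ t - cV t * P t) := by
    rw [integral_sub hφi hPi, hP0, sub_zero]
  rw [e]
  refine (norm_integral_le_integral_norm _).trans ?_
  rw [← integral_mul_const]
  refine integral_mono (hφi.sub hPi).norm (((cV_rep.integrable (2*J)).const_mul _).mul_const _) fun t => ?_
  simp only
  rw [← mul_sub, norm_mul]
  set z := vline t with hz
  have hz1 : 1 ≤ ‖z‖ := one_le_norm_vline t
  suffices h : ‖φ t - P t‖ ≤ (2 ^ J + 2 + J * 2 ^ J) * ‖z‖ ^ (2 * J) * (b ^ 4 / b ^ (3 * J)) by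
    calc _ ≤ ‖cV t‖ * ((2 ^ J + 2 + J * 2 ^ J) * ‖z‖ ^ (2 * J) * (b ^ 4 / b ^ (3 * J))) := by gcongr
      _ = _ := by ring
  have hb4 : b ≤ b ^ 4 := le_self_pow₀ hb (by norm_num)
  have nb : ‖(((b:ℝ) ^ 4 : ℝ) : ℂ)‖ = b ^ 4 := by rw [norm_real, Real.norm_of_nonneg (by positivity)]
  have hzJ : ‖z‖ ^ J ≤ ‖z‖ ^ (2 * J) := pow_le_pow_right₀ hz1 (by omega)
  by_cases hin : z / (b ^ 4 : ℝ) ∈ Metric.ball (0:ℂ) (1 / B)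
  · rw [hφH t hin, hf _ hin, hP]
    simp only
    rw [← hz, add_sub_cancel_left, norm_mul, norm_pow, norm_div, nb]
    calc (‖z‖ / b ^ 4) ^ J * ‖g (z / (b ^ 4 : ℝ))‖ ≤ (‖z‖ / b ^ 4) ^ J * (B * (2 * B) ^ J) := by gcongr; exact hg _ hin
      _ ≤ (‖z‖ / b ^ 4) ^ J * (b ^ 4 * (2 * b) ^ J) := by gcongr; exact hBb.trans hb4
      _ = 2 ^ J * ‖z‖ ^ J * (b ^ 4 / b ^ (3 * J)) := by
        rw [div_pow, mul_pow, pow_mul b 3 J, ← pow_mul b 4 J]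
        have : b ^ (4 * J) = b ^ J * (b ^ 3) ^ J := by rw [← mul_pow, pow_mul]; ring
        rw [this]
        field_simp
      _ ≤ _ := by
        gcongr
        nlinarith [pow_pos (two_pos : (0:ℝ) < 2) J, mul_nonneg (Nat.cast_nonneg J : (0:ℝ) ≤ J) (pow_pos (two_pos : (0:ℝ) < 2) J).le]
  · have hzb : b ^ 3 ≤ ‖z‖ := by
      rw [mem_ball_zero_iff, norm_div, nb, not_lt, div_le_div_iff₀ (by positivity) (by positivity)] at hin
      have : b ^ 3 * b ≤ ‖z‖ * b := by
        calc b ^ 3 * b = 1 * b ^ 4 := by ring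
          _ ≤ ‖z‖ * B := hin
          _ ≤ ‖z‖ * b := by gcongr
      exact le_of_mul_le_mul_right this hb0
    have hPn : ‖P t‖ ≤ J * 2 ^ J * ‖z‖ ^ J * b ^ 4 := by
      refine (norm_sum_le _ _).trans ?_
      have : ∀ j ∈ Finset.range J, ‖a j * (z / (b ^ 4 : ℝ)) ^ j‖ ≤ 2 ^ J * ‖z‖ ^ J * b ^ 4 := by
        intro j hj
        have hj' := Finset.mem_range.1 hj
        rw [norm_mul, norm_pow, norm_div, nb]
        calc ‖a j‖ * (‖z‖ / b ^ 4) ^ j ≤ (b ^ 4 * (2 * b ^ 4) ^ j) * (‖z‖ / b ^ 4) ^ j := by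
              gcongr; refine (ha j hj').trans ?_; gcongr
              · exact hBb.trans hb4
              · exact hBb.trans hb4
          _ = b ^ 4 * (2 ^ j * ‖z‖ ^ j) := by
              rw [mul_pow, div_pow]; field_simp
          _ ≤ b ^ 4 * (2 ^ J * ‖z‖ ^ J) := by
              gcongr; norm_num
          _ = _ := by ring
      refine (Finset.sum_le_sum this).trans (le_of_eq ?_)
      simp; ring
    have h1 : 1 ≤ ‖z‖ ^ J / b ^ (3 * J) := by
      rw [one_le_div (by positivity), pow_mul]
      gcongr
    have h2 : 1 ≤ ‖z‖ ^ J := one_le_pow₀ hz1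
    calc ‖φ t - P t‖ ≤ 2 * b ^ 4 + J * 2 ^ J * ‖z‖ ^ J * b ^ 4 :=
          (norm_sub_le _ _).trans (add_le_add (hφb t) hPn)
      _ ≤ 2 * ‖z‖ ^ J * b ^ 4 + J * 2 ^ J * ‖z‖ ^ J * b ^ 4 := by gcongr; linarith
      _ = (2 + J * 2 ^ J) * ‖z‖ ^ J * b ^ 4 * 1 := by ring
      _ ≤ (2 + J * 2 ^ J) * ‖z‖ ^ J * b ^ 4 * (‖z‖ ^ J / b ^ (3 * J)) := by gcongr
      _ = (2 + J * 2 ^ J) * ‖z‖ ^ (2 * J) * (b ^ 4 / b ^ (3 * J)) := by rw [two_mul J, pow_add]; ring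
      _ ≤ _ := by
        gcongr
        linarith [pow_pos (two_pos : (0:ℝ) < 2) J]

theorem absSeries_char_le {f : ℕ} (χ : DirichletCharacter ℂ f) {L : ℝ} (hL : 0 < L) :
    absSeries (twistedLambda χ) L ≤ absSeries (fun n => (vonMangoldt n : ℂ)) L := by
  have h1 := (LSeriesSummable_twist_vonMangoldt χ (one_lt_re_one_add_inv hL)).norm
  have h2 := (LSeriesSummable_vonMangoldt_inv hL).norm
  refine h1.tsum_le_tsum (fun n => ?_) h2
  apply LSeries.norm_term_le
  rw [twistedLambda, Pi.mul_apply, norm_mul]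
  exact mul_le_of_le_one_left (norm_nonneg _) (χ.norm_le_one _)

theorem charW_eq_integral {f : ℕ} (χ : DirichletCharacter ℂ f) {L : ℝ} (hL : 0 < L) :
    charW χ L = ∫ t, cV t * LSeries (twistedLambda χ) (1 + vline t / L) :=
  sum_mul_wt_eq_integral hL (LSeriesSummable_twist_vonMangoldt χ (one_lt_re_one_add_inv hL))

theorem LSeries_twist_eq_LFunction {f : ℕ} [NeZero f] (χ : DirichletCharacter ℂ f) {s : ℂ} (hs : 1 < s.re) :
    LSeries (twistedLambda χ) s = -deriv χ.LFunction s / χ.LFunction s := by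
  rw [LSeries_twist_vonMangoldt_eq χ hs, LFunction_eq_LSeries χ hs]
  congr 2
  refine Filter.EventuallyEq.deriv_eq ?_
  filter_upwards [(isOpen_lt continuous_const continuous_re).mem_nhds hs] with w hw
  exact (LFunction_eq_LSeries χ hw).symm

/-- Cancellation in weighted prime sums twisted by characters of small conductor, given a lower bound at `1`. -/
theorem norm_charW_le (J : ℕ) : ∃ C, 0 ≤ C ∧ ∀ (b δ Z : ℝ) (f : ℕ) [NeZero f] (χ : DirichletCharacter ℂ f), 1 ≤ b →
    2 ≤ Real.log Z → (f:ℝ) ≤ Z → χ ≠ 1 → 0 < δ → δ ≤ 1 → δ ≤ ‖χ.LFunction 1‖ → 120 * Real.log Z ^ 2 / δ ≤ b →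
    absSeries (fun n => (vonMangoldt n : ℂ)) (b ^ 4) ≤ 2 * b ^ 4 →
    ‖charW χ (b ^ 4)‖ ≤ C * (b ^ 4 / b ^ (3 * J)) := by
  obtain ⟨C, hC0, hC⟩ := norm_integral_cV_le J
  refine ⟨C, hC0, fun b δ Z f _ χ hb hZ hfZ hχ hδ hδ1 hL hbB hΛ => ?_⟩
  have hb0 : 0 < b ^ 4 := by positivity
  rw [charW_eq_integral χ hb0]
  set l := Real.log Z
  have hl0 : 0 < l := by linarith
  set B := 120 * l ^ 2 / δ with hB
  have hB1 : 1 ≤ B := by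
    rw [hB, le_div_iff₀ hδ]; nlinarith
  have hr : 1 / B ≤ 1 / (2 * l) := by
    apply one_div_le_one_div_of_le (by positivity)
    rw [hB, le_div_iff₀ hδ]
    nlinarith
  have hsmall : ∀ w ∈ Metric.ball (0:ℂ) (1 / B), δ / 2 ≤ ‖χ.LFunction (1 + w)‖ ∧ ‖deriv χ.LFunction (1 + w)‖ ≤ 60 * l ^ 2 := by
    intro w hw
    rw [mem_ball_zero_iff] at hw
    have hw' : ‖(1 + w) - 1‖ ≤ 1 / (2 * l) := by rw [add_sub_cancel_left]; exact hw.le.trans hr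
    refine ⟨?_, norm_deriv_LFunction_le hχ hfZ hZ hw'⟩
    have h1 := norm_LFunction_sub_le hχ hfZ hZ hw'
    rw [add_sub_cancel_left] at h1
    have h2 := norm_le_norm_add_norm_sub (χ.LFunction (1 + w)) (χ.LFunction 1)
    have h3 : 60 * l ^ 2 * ‖w‖ ≤ δ / 2 := by
      calc 60 * l ^ 2 * ‖w‖ ≤ 60 * l ^ 2 * (1 / B) := by gcongr
        _ = δ / 2 := by rw [hB]; field_simp; norm_num
    linarith
  refine hC b B (fun w => -deriv χ.LFunction (1 + w) / χ.LFunction (1 + w)) _ hb hB1 hbB ?_ ?_ ?_ ?_ ?_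
  · have hd := differentiable_LFunction hχ
    have hdd : Differentiable ℂ (deriv χ.LFunction) := fun w => (hd.analyticAt w).deriv.differentiableAt
    intro w hw
    refine DifferentiableAt.differentiableWithinAt ?_
    refine DifferentiableAt.div ?_ ?_ ?_
    · exact ((hdd _).comp w (by fun_prop)).neg
    · exact (hd _).comp w (by fun_prop)
    · intro h0
      have := (hsmall w hw).1
      rw [h0, norm_zero] at this
      linarith
  · intro w hw
    obtain ⟨h1, h2⟩ := hsmall w hw
    rw [norm_div, norm_neg]
    calc _ ≤ 60 * l ^ 2 / (δ / 2) := by gcongr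
      _ = B := by rw [hB]; field_simp; norm_num
  · exact continuous_LSeries_vline (LSeriesSummable_twist_vonMangoldt χ (one_lt_re_one_add_inv hb0))
  · intro t
    refine (norm_LSeries_vline_le (LSeriesSummable_twist_vonMangoldt χ (one_lt_re_one_add_inv hb0)) t).trans ?_
    exact (absSeries_char_le χ hb0).trans hΛ
  · intro t _
    exact LSeries_twist_eq_LFunction χ (one_lt_re_vline hb0 t)

end

section

open Finset ArithmeticFunction

/-- Truncation of an arithmetic function to `n ≤ U`. -/
noncomputable def truncAF (U : ℝ) (f : ArithmeticFunction ℝ) : ArithmeticFunction ℝ :=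
  ⟨fun n => if (n:ℝ) ≤ U then f n else 0, by simp⟩

theorem truncAF_apply (U : ℝ) (f : ArithmeticFunction ℝ) (n : ℕ) :
    truncAF U f n = if (n:ℝ) ≤ U then f n else 0 := rfl

theorem sub_truncAF_apply (U : ℝ) (f : ArithmeticFunction ℝ) (n : ℕ) :
    (f - truncAF U f) n = if (n:ℝ) ≤ U then 0 else f n := by
  change f n - truncAF U f n = _
  rw [truncAF_apply]
  split_ifs <;> simp

/-- Vaughan's identity. -/
theorem vaughan_identity (U : ℝ) : vonMangoldt = truncAF U vonMangoldt +
    truncAF U (moebius : ArithmeticFunction ℝ) * log -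
    (truncAF U vonMangoldt * truncAF U (moebius : ArithmeticFunction ℝ)) * (zeta : ArithmeticFunction ℝ) +
    (vonMangoldt - truncAF U vonMangoldt) *
      (((moebius : ArithmeticFunction ℝ) - truncAF U (moebius : ArithmeticFunction ℝ)) * (zeta : ArithmeticFunction ℝ)) := by
  have h1 : vonMangoldt * (zeta : ArithmeticFunction ℝ) = log := vonMangoldt_mul_zeta
  have h2 : (moebius : ArithmeticFunction ℝ) * (zeta : ArithmeticFunction ℝ) = 1 := coe_moebius_mul_coe_zeta
  set G := truncAF U vonMangoldt
  set M := truncAF U (moebius : ArithmeticFunction ℝ)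
  rw [← h1]
  linear_combination (G - vonMangoldt) * h2

theorem sum_mul_convolution {N f : ℕ} (χ : DirichletCharacter ℂ f) (g h : ArithmeticFunction ℝ) {k : ℕ → ℂ}
    (hk : ∀ n, N < n → k n = 0) :
    ∑ n ∈ Icc 1 N, χ n * (((g * h) n : ℝ) : ℂ) * k n =
      ∑ d ∈ Icc 1 N, ∑ m ∈ Icc 1 N, (χ d * (g d : ℂ)) * (χ m * (h m : ℂ)) * k (d * m) := by
  rw [← sum_product']
  rw [← sum_filter_of_ne (p := fun x : ℕ × ℕ => x.1 * x.2 ∈ Icc 1 N)]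
  · rw [← sum_fiberwise_of_maps_to (s := (Icc 1 N ×ˢ Icc 1 N).filter fun x : ℕ × ℕ => x.1 * x.2 ∈ Icc 1 N)
      (t := Icc 1 N) (g := fun x => x.1 * x.2) (fun x hx => (mem_filter.1 hx).2)]
    refine sum_congr rfl fun n hn => ?_
    have e : n.divisorsAntidiagonal =
        ((Icc 1 N ×ˢ Icc 1 N).filter fun x : ℕ × ℕ => x.1 * x.2 ∈ Icc 1 N).filter fun x => x.1 * x.2 = n := by
      ext ⟨a, b⟩
      simp only [Nat.mem_divisorsAntidiagonal, mem_filter, mem_product, mem_Icc] at hn ⊢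
      constructor
      · rintro ⟨rfl, h0⟩
        have ha : 1 ≤ a := Nat.one_le_iff_ne_zero.2 (by rintro rfl; simp at h0)
        have hb : 1 ≤ b := Nat.one_le_iff_ne_zero.2 (by rintro rfl; simp at h0)
        refine ⟨⟨⟨⟨ha, ?_⟩, hb, ?_⟩, hn⟩, rfl⟩
        · exact le_trans (Nat.le_mul_of_pos_right _ hb) hn.2
        · exact le_trans (Nat.le_mul_of_pos_left _ ha) hn.2
      · rintro ⟨-, rfl⟩
        exact ⟨rfl, by omega⟩
    rw [mul_apply, ← e, Complex.ofReal_sum, mul_sum, sum_mul]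
    refine sum_congr rfl fun x hx => ?_
    have := (Nat.mem_divisorsAntidiagonal.1 hx).1
    rw [← this]
    push_cast
    rw [map_mul]
    ring
  · intro x hx hne
    rw [mem_product, mem_Icc, mem_Icc] at hx
    rw [mem_Icc]
    refine ⟨Nat.one_le_iff_ne_zero.2 (Nat.mul_ne_zero (by omega) (by omega)), ?_⟩
    by_contra hc
    exact hne (by rw [hk _ (by omega), mul_zero])

theorem norm_sum_mul_le_of_partial {a : ℕ → ℂ} {h : ℕ → ℂ} {S : ℝ} {N : ℕ}
    (hS : ∀ M, ‖∑ j ∈ Ioc 0 M, a j‖ ≤ S) (hN : h (N + 1) = 0) :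
    ‖∑ m ∈ Ioc 0 N, a m * h m‖ ≤ S * ∑ m ∈ Ioc 0 N, ‖h m - h (m + 1)‖ := by
  have key : ∀ N, ∑ m ∈ Ioc 0 N, a m * h m =
      (∑ j ∈ Ioc 0 N, a j) * h (N + 1) + ∑ m ∈ Ioc 0 N, (∑ j ∈ Ioc 0 m, a j) * (h m - h (m + 1)) := by
    intro N
    induction N with
    | zero => simp
    | succ N ih =>
      rw [sum_Ioc_succ_top (Nat.zero_le _), ih, sum_Ioc_succ_top (Nat.zero_le N) fun m => (∑ j ∈ Ioc 0 m, a j) * (h m - h (m + 1)),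
        sum_Ioc_succ_top (Nat.zero_le N) a]
      ring
  rw [key, hN, mul_zero, zero_add, mul_sum]
  refine (norm_sum_le _ _).trans (sum_le_sum fun m _ => ?_)
  rw [norm_mul]
  gcongr
  exact hS m

/-- A weight of the form `Φ(log n / L)/n`. -/
noncomputable def smoothWt (Φ : ℝ → ℝ) (L : ℝ) (n : ℕ) : ℝ := Φ (Real.log n / L) / n

theorem abs_smoothWt_sub_le {Φ : ℝ → ℝ} {K : ℝ} (hΦ : ∀ v, |Φ v| ≤ K) (hΦ' : ∀ v w, |Φ v - Φ w| ≤ K * |v - w|)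
    {L : ℝ} (hL : 1 ≤ L) {n h : ℕ} (hn : 0 < n) :
    |smoothWt Φ L n - smoothWt Φ L (n + h)| ≤ 2 * K * h / (n * (n + h)) := by
  have hn' : (0:ℝ) < n := by exact_mod_cast hn
  have hh : (0:ℝ) ≤ h := Nat.cast_nonneg h
  have hK : 0 ≤ K := (abs_nonneg _).trans (hΦ 0)
  have h1 : |Real.log n / L - Real.log (n + h : ℕ) / L| ≤ h / n := by
    rw [← sub_div, abs_div, abs_of_pos (by linarith : 0 < L), abs_sub_comm, abs_of_nonneg
      (sub_nonneg.2 (Real.log_le_log hn' (by push_cast; linarith)))]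
    refine (div_le_self (sub_nonneg.2 (Real.log_le_log hn' (by push_cast; linarith))) hL).trans ?_
    rw [← Real.log_div (by push_cast; positivity) hn'.ne']
    refine (Real.log_le_sub_one_of_pos (by push_cast; positivity)).trans (le_of_eq ?_)
    push_cast; field_simp; ring
  have e : smoothWt Φ L n - smoothWt Φ L (n + h) =
      (Φ (Real.log n / L) - Φ (Real.log (n + h : ℕ) / L)) / (n + h : ℕ) + Φ (Real.log n / L) * (h / (n * (n + h))) := by
    unfold smoothWt; push_cast; field_simp; ring
  rw [e]
  refine (abs_add_le _ _).trans ?_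
  rw [abs_div, abs_mul, abs_of_nonneg (by positivity : (0:ℝ) ≤ h / (n * (n + h))), Nat.abs_cast]
  calc _ ≤ (K * (h / n)) / (n + h : ℕ) + K * (h / (n * (n + h))) := by
        gcongr
        · exact (hΦ' _ _).trans (by gcongr)
        · exact hΦ _
    _ = _ := by push_cast; field_simp; ring

theorem sum_inv_mul_succ_le (a b : ℕ) : ∑ m ∈ Ioc a b, (1:ℝ) / (m * (m + 1)) ≤ 1 / (a + 1) := by
  rcases le_or_gt a b with hab | hab
  · have : ∑ m ∈ Ioc a b, (1:ℝ) / (m * (m + 1)) = 1 / (a + 1) - 1 / (b + 1) := by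
      induction b, hab using Nat.le_induction with
      | base => simp
      | succ n hn ih =>
        rw [sum_Ioc_succ_top hn, ih]
        push_cast
        field_simp
        ring
    rw [this]
    have : (0:ℝ) ≤ 1 / (b + 1) := by positivity
    linarith
  · rw [Ioc_eq_empty (by omega), sum_empty]; positivity

theorem norm_sum_char_smoothWt_le {f : ℕ} [NeZero f] {χ : DirichletCharacter ℂ f} (hχ : χ ≠ 1) {Φ : ℝ → ℝ} {K : ℝ}
    (hΦ : ∀ v, |Φ v| ≤ K) (hΦ' : ∀ v w, |Φ v - Φ w| ≤ K * |v - w|) (h1 : ∀ v ≤ 1, Φ v = 0)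
    {L : ℝ} (hL : 1 ≤ L) {d N : ℕ} (hd : 0 < d) (hN : smoothWt Φ L (d * (N + 1)) = 0) :
    ‖∑ m ∈ Icc 1 N, χ m * (smoothWt Φ L (d * m) : ℂ)‖ ≤ 16 * K * f / Real.exp L := by
  have hK : 0 ≤ K := (abs_nonneg _).trans (hΦ 0)
  have hd' : (0:ℝ) < d := by exact_mod_cast hd
  have hI : Icc 1 N = Ioc 0 N := by ext; simp [Nat.succ_le_iff]
  rw [hI]
  refine (norm_sum_mul_le_of_partial (S := 2 * f) (h := fun m => (smoothWt Φ L (d * m) : ℂ))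
    (fun M => norm_sum_char_Ioc_le hχ 0 M) (by simp only [hN, Complex.ofReal_zero])).trans ?_
  suffices h : ∑ m ∈ Ioc 0 N, ‖(smoothWt Φ L (d * m) : ℂ) - smoothWt Φ L (d * (m + 1))‖ ≤ 8 * K / Real.exp L by
    calc _ ≤ 2 * f * (8 * K / Real.exp L) := by gcongr
      _ = _ := by ring
  set y := Real.exp L / d with hy
  have hz : ∀ n : ℕ, (n:ℝ) ≤ Real.exp L → smoothWt Φ L n = 0 := by
    intro n hn
    rcases Nat.eq_zero_or_pos n with rfl | hp
    · simp [smoothWt]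
    rw [smoothWt, h1, zero_div]
    rw [div_le_one (by linarith), Real.log_le_iff_le_exp (by exact_mod_cast hp)]
    exact hn
  have hterm : ∀ m ∈ Ioc 0 N, ‖(smoothWt Φ L (d * m) : ℂ) - smoothWt Φ L (d * (m + 1))‖ ≤
      if ⌊y⌋₊ - 1 < m then 2 * K / d * (1 / (m * (m + 1))) else 0 := by
    intro m hm
    have hm0 := (mem_Ioc.1 hm).1
    rw [← Complex.ofReal_sub, Complex.norm_real, Real.norm_eq_abs]
    split_ifs with hc
    · rw [mul_add, mul_one]
      refine (abs_smoothWt_sub_le hΦ hΦ' hL (Nat.mul_pos hd hm0)).trans (le_of_eq ?_)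
      have : (0:ℝ) < m := by exact_mod_cast hm0
      push_cast
      field_simp
    · have : ((m + 1 : ℕ) : ℝ) ≤ y := (Nat.le_floor_iff (by positivity)).1 (by omega)
      rw [hy, le_div_iff₀ hd'] at this
      push_cast at this
      rw [hz, hz]
      · simp
      · push_cast; linarith
      · push_cast; nlinarith
  refine (sum_le_sum hterm).trans ?_
  rw [← sum_filter]
  have hsub : (Ioc 0 N).filter (fun m => ⌊y⌋₊ - 1 < m) ⊆ Ioc (⌊y⌋₊ - 1) N := by
    intro m; simp only [mem_filter, mem_Ioc]; omega
  refine (sum_le_sum_of_subset_of_nonneg hsub fun _ _ _ => by positivity).trans ?_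
  rw [← mul_sum]
  refine (mul_le_mul_of_nonneg_left (sum_inv_mul_succ_le _ _) (by positivity)).trans ?_
  have hb : y ≤ 4 * ((⌊y⌋₊ - 1 : ℕ) + 1) := by
    have h2 := Nat.lt_floor_add_one y
    have h3 : (⌊y⌋₊ : ℝ) ≤ ((⌊y⌋₊ - 1 : ℕ) : ℝ) + 1 := by norm_cast; omega
    have h4 : (0:ℝ) ≤ ((⌊y⌋₊ - 1 : ℕ) : ℝ) := Nat.cast_nonneg _
    linarith
  rw [mul_one_div, div_div, div_le_div_iff₀ (by positivity) (by positivity)]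
  have : Real.exp L = d * y := by rw [hy]; field_simp
  rw [this]
  nlinarith [mul_le_mul_of_nonneg_left hb (by positivity : 0 ≤ 2 * K * d)]

end

section

open Finset ArithmeticFunction

theorem sum_le_of_support {N : ℕ} {c : ℕ → ℝ} {V B : ℝ} (hB : 0 ≤ B) (hV : 0 ≤ V) (h0 : ∀ d ∈ Icc 1 N, V < d → c d = 0)
    (hc : ∀ d ∈ Icc 1 N, (d:ℝ) ≤ V → c d ≤ B) : ∑ d ∈ Icc 1 N, c d ≤ V * B := by
  rw [← sum_filter_of_ne (p := fun d : ℕ => (d:ℝ) ≤ V) (fun d hd hne => by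
    by_contra hlt; exact hne (h0 d hd (not_le.1 hlt)))]
  refine (sum_le_card_nsmul _ _ B fun d hd => hc d (mem_filter.1 hd).1 (mem_filter.1 hd).2).trans ?_
  rw [nsmul_eq_mul]
  gcongr
  have : (Icc 1 N).filter (fun d : ℕ => (d:ℝ) ≤ V) ⊆ Icc 1 ⌊V⌋₊ := by
    intro d hd
    rw [mem_filter, mem_Icc] at hd
    exact mem_Icc.2 ⟨hd.1.1, Nat.le_floor hd.2⟩
  have h := card_le_card this
  rw [Nat.card_Icc, Nat.add_sub_cancel] at h
  exact le_trans (by exact_mod_cast h) (Nat.floor_le hV)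

theorem sum_antidiagonal_le {N : ℕ} {F : ℕ × ℕ → ℝ} (hF : ∀ x, 0 ≤ F x) :
    ∑ n ∈ Icc 1 N, ∑ x ∈ n.divisorsAntidiagonal, F x ≤ ∑ d ∈ Icc 1 N, ∑ m ∈ Icc 1 N, F (d, m) := by
  rw [← sum_product']
  have := sum_fiberwise_le_sum_of_sum_fiber_nonneg (s := Icc 1 N ×ˢ Icc 1 N) (t := Icc 1 N)
    (g := fun x => x.1 * x.2) (f := F) (fun y _ => sum_nonneg fun x _ => hF x)
  refine le_trans (sum_le_sum fun n hn => sum_le_sum_of_subset_of_nonneg ?_ fun _ _ _ => hF _) this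
  rintro ⟨a, b⟩ hx
  rw [Nat.mem_divisorsAntidiagonal] at hx
  rw [mem_Icc] at hn
  obtain ⟨h1, h0⟩ := hx
  simp only at h1
  have ha : 1 ≤ a := Nat.one_le_iff_ne_zero.2 (by rintro rfl; simp at h1; omega)
  have hb : 1 ≤ b := Nat.one_le_iff_ne_zero.2 (by rintro rfl; simp at h1; omega)
  rw [mem_filter, mem_product, mem_Icc, mem_Icc]
  exact ⟨⟨⟨ha, by nlinarith⟩, hb, by nlinarith⟩, h1⟩

theorem sum_inv_le_one_add_log (N : ℕ) : ∑ n ∈ Icc 1 N, (1:ℝ) / n ≤ 1 + Real.log N := by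
  have := harmonic_le_one_add_log N
  rw [harmonic_eq_sum_Icc] at this
  push_cast at this
  simpa using this

open Pointwise in
theorem card_divisors_mul_le (m n : ℕ) : ((m * n).divisors.card : ℝ) ≤ m.divisors.card * n.divisors.card := by
  rw [Nat.divisors_mul]; exact_mod_cast Finset.card_mul_le

theorem card_divisorsAntidiagonal_eq (n : ℕ) : n.divisorsAntidiagonal.card = n.divisors.card := by
  rw [← Nat.map_div_right_divisors, card_map]

theorem sum_card_divisors_sq_le (N : ℕ) :
    ∑ n ∈ Icc 1 N, (n.divisors.card : ℝ) ^ 2 / n ≤ (∑ n ∈ Icc 1 N, (1:ℝ) / n) ^ 4 := by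
  have h1 : ∑ n ∈ Icc 1 N, (n.divisors.card : ℝ) / n ≤ (∑ n ∈ Icc 1 N, (1:ℝ) / n) ^ 2 := by
    have := sum_antidiagonal_le (N := N) (F := fun x => 1 / (x.1 * x.2 : ℝ)) (fun x => by positivity)
    refine le_trans (le_of_eq ?_) (this.trans (le_of_eq ?_))
    · refine sum_congr rfl fun n _ => ?_
      rw [sum_congr rfl (g := fun _ => 1 / (n:ℝ))]
      · rw [sum_const, nsmul_eq_mul, card_divisorsAntidiagonal_eq]; ring
      · intro x hx
        rw [← (Nat.mem_divisorsAntidiagonal.1 hx).1]; push_cast; rfl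
    · rw [sq, sum_mul_sum]
      refine sum_congr rfl fun d _ => sum_congr rfl fun m _ => ?_
      rw [one_div_mul_one_div]
  have h2 := sum_antidiagonal_le (N := N)
    (F := fun x => (x.1.divisors.card : ℝ) / x.1 * ((x.2.divisors.card : ℝ) / x.2)) (fun x => by positivity)
  calc ∑ n ∈ Icc 1 N, (n.divisors.card : ℝ) ^ 2 / n
      ≤ ∑ n ∈ Icc 1 N, ∑ x ∈ n.divisorsAntidiagonal, (x.1.divisors.card : ℝ) / x.1 * ((x.2.divisors.card : ℝ) / x.2) := by
        refine sum_le_sum fun n _ => ?_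
        calc (n.divisors.card : ℝ) ^ 2 / n = ∑ x ∈ n.divisorsAntidiagonal, (n.divisors.card : ℝ) / n := by
              rw [sum_const, nsmul_eq_mul, card_divisorsAntidiagonal_eq]; ring
          _ ≤ _ := by
              refine sum_le_sum fun x hx => ?_
              rw [← (Nat.mem_divisorsAntidiagonal.1 hx).1, div_mul_div_comm]
              push_cast
              gcongr
              exact card_divisors_mul_le _ _
    _ ≤ _ := h2
    _ = (∑ n ∈ Icc 1 N, (n.divisors.card : ℝ) / n) ^ 2 := by rw [sq, sum_mul_sum]
    _ ≤ ((∑ n ∈ Icc 1 N, (1:ℝ) / n) ^ 2) ^ 2 := by gcongr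
    _ = _ := by ring

theorem exists_lipschitz_bound {Φ : ℝ → ℝ} (h : ContDiff ℝ 1 Φ) (hc : HasCompactSupport Φ) :
    ∃ K, (∀ v, |Φ v| ≤ K) ∧ ∀ v w, |Φ v - Φ w| ≤ K * |v - w| := by
  obtain ⟨C, hC⟩ := h.lipschitzWith_of_hasCompactSupport hc one_ne_zero
  obtain ⟨D, hD⟩ := hc.exists_bound_of_continuous h.continuous
  refine ⟨max C D, fun v => (hD v).trans (le_max_right _ _), fun v w => ?_⟩
  have := hC.dist_le_mul v w
  rw [Real.dist_eq, Real.dist_eq] at this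
  exact this.trans (by gcongr; exact le_max_left _ _)

theorem truncAF_moebius_abs_le (U : ℝ) (d : ℕ) : |truncAF U (moebius : ArithmeticFunction ℝ) d| ≤ 1 := by
  rw [truncAF_apply]
  split_ifs
  · rw [intCoe_apply, ← Int.cast_abs]; exact_mod_cast abs_moebius_le_one
  · simp

theorem truncAF_vonMangoldt_mul_moebius_abs_le (U : ℝ) (d : ℕ) :
    |(truncAF U vonMangoldt * truncAF U (moebius : ArithmeticFunction ℝ)) d| ≤ Real.log d := by
  rw [mul_apply]
  refine (abs_sum_le_sum_abs _ _).trans ?_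
  rw [← vonMangoldt_sum, ← Nat.sum_divisorsAntidiagonal (f := fun i _ => vonMangoldt i)]
  refine sum_le_sum fun x _ => ?_
  rw [abs_mul]
  refine (mul_le_of_le_one_right (abs_nonneg _) (truncAF_moebius_abs_le U _)).trans ?_
  rw [truncAF_apply]
  split_ifs
  · rw [abs_of_nonneg vonMangoldt_nonneg]
  · rw [abs_zero]; exact vonMangoldt_nonneg

theorem truncAF_mul_truncAF_eq_zero {U : ℝ} (hU : 0 ≤ U) (g h : ArithmeticFunction ℝ) {d : ℕ} (hd : U ^ 2 < d) :
    (truncAF U g * truncAF U h) d = 0 := by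
  rw [mul_apply]
  refine sum_eq_zero fun x hx => ?_
  rw [truncAF_apply, truncAF_apply]
  split_ifs with h1 h2
  · exfalso
    have := (Nat.mem_divisorsAntidiagonal.1 hx).1
    rw [← this] at hd
    push_cast at hd
    nlinarith [mul_le_mul h1 h2 (Nat.cast_nonneg _) hU]
  all_goals simp

/-- The bounds for the linear sums in Vaughan's identity. -/
theorem exists_typeI_bound : ∃ K, 0 ≤ K ∧ ∀ (L : ℝ), 1 ≤ L → ∀ (f : ℕ) [NeZero f] (χ : DirichletCharacter ℂ f), χ ≠ 1 →
    let U := Real.exp (L / 4)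
    ‖∑ n ∈ wtSupp L, χ n * (((truncAF U (moebius : ArithmeticFunction ℝ) * log) n : ℝ) : ℂ) * wt L n‖ ≤
        K * f * L * Real.exp (-(L / 2)) ∧
    ‖∑ n ∈ wtSupp L, χ n * (((truncAF U vonMangoldt * truncAF U (moebius : ArithmeticFunction ℝ) *
      (zeta : ArithmeticFunction ℝ)) n : ℝ) : ℂ) * wt L n‖ ≤ K * f * L * Real.exp (-(L / 2)) := by
  obtain ⟨K₁, h1, h1'⟩ := exists_lipschitz_bound (Φ := bumpV) bumpV.contDiff bumpV.hasCompactSupport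
  obtain ⟨K₂, h2, h2'⟩ := exists_lipschitz_bound (Φ := fun v => v * bumpV v) (contDiff_id.mul bumpV.contDiff)
    bumpV.hasCompactSupport.mul_left
  have hK1 : 0 ≤ K₁ := (abs_nonneg _).trans (h1 0)
  have hK2 : 0 ≤ K₂ := (abs_nonneg _).trans (h2 0)
  refine ⟨16 * (K₁ + K₂), by positivity, fun L hL f _ χ hχ => ?_⟩
  intro U
  have hL0 : 0 < L := by linarith
  have hU0 : 0 < U := Real.exp_pos _
  have hU1 : 1 ≤ U := Real.one_le_exp (by positivity)
  have hk : ∀ n, ⌊Real.exp (21 / 20 * L)⌋₊ < n → (wt L n : ℂ) = 0 := by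
    intro n hn
    by_contra hne
    have := mem_wtSupp hL0 (n := n) (by exact_mod_cast hne)
    rw [wtSupp, mem_Icc] at this
    omega
  have hk' : ∀ d, 0 < d → wt L (d * (⌊Real.exp (21 / 20 * L)⌋₊ + 1)) = 0 := by
    intro d hd
    have := hk (d * (⌊Real.exp (21 / 20 * L)⌋₊ + 1)) (by nlinarith)
    exact_mod_cast this
  have hw1 : ∀ d, 0 < d → ‖∑ m ∈ wtSupp L, χ m * (wt L (d * m) : ℂ)‖ ≤ 16 * K₁ * f / Real.exp L := fun d hd =>
    norm_sum_char_smoothWt_le (Φ := bumpV) hχ h1 h1' (fun v hv => bumpV_eq_zero (Or.inl hv)) hL hd (hk' d hd)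
  have hlog : ∀ n : ℕ, L * smoothWt (fun v => v * bumpV v) L n = Real.log n * wt L n := by
    intro n; rw [smoothWt, wt]; field_simp
  have hw2 : ∀ d, 0 < d → ‖∑ m ∈ wtSupp L, χ m * (smoothWt (fun v => v * bumpV v) L (d * m) : ℂ)‖ ≤ 16 * K₂ * f / Real.exp L :=
    fun d hd => norm_sum_char_smoothWt_le hχ h2 h2' (fun v hv => by rw [bumpV_eq_zero (Or.inl hv), mul_zero]) hL hd (by
      have := hlog (d * (⌊Real.exp (21 / 20 * L)⌋₊ + 1))
      rw [hk' d hd, mul_zero] at this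
      exact (mul_eq_zero.1 this).resolve_left hL0.ne')
  have hUU : U ^ 2 / Real.exp L = Real.exp (-(L / 2)) := by
    rw [← Real.exp_nat_mul, ← Real.exp_sub]; congr 1; push_cast; ring
  constructor
  · rw [wtSupp, sum_mul_convolution χ _ _ hk]
    refine (norm_sum_le _ _).trans ((sum_le_of_support (V := U) (B := 16 * (K₁ + K₂) * f * L / Real.exp L) (by positivity) hU0.le ?_ ?_).trans ?_)
    · intro d _ hd
      rw [norm_eq_zero]
      refine sum_eq_zero fun m _ => ?_
      rw [truncAF_apply, if_neg (not_le.2 hd)]; simp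
    · intro d hd hdU
      have hd0 : 0 < d := (mem_Icc.1 hd).1
      have e : ∑ m ∈ Icc 1 ⌊Real.exp (21 / 20 * L)⌋₊, (χ d * (truncAF U (moebius : ArithmeticFunction ℝ) d : ℂ)) * (χ m * (log m : ℂ)) * (wt L (d * m) : ℂ) =
          (χ d * (truncAF U (moebius : ArithmeticFunction ℝ) d : ℂ)) * (L * ∑ m ∈ wtSupp L, χ m * (smoothWt (fun v => v * bumpV v) L (d * m) : ℂ) -
            Real.log d * ∑ m ∈ wtSupp L, χ m * (wt L (d * m) : ℂ)) := by
        rw [mul_sum, mul_sum, ← sum_sub_distrib, mul_sum]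
        refine sum_congr rfl fun m hm => ?_
        have hm0 : 0 < m := (mem_Icc.1 hm).1
        have h3 : (L:ℂ) * (smoothWt (fun v => v * bumpV v) L (d * m) : ℂ) = (Real.log d + Real.log m : ℝ) * wt L (d * m) := by
          rw [← Complex.ofReal_mul, hlog, Nat.cast_mul, Real.log_mul (by positivity) (by positivity)]
          push_cast; rfl
        rw [mul_left_comm (L:ℂ), h3, log_apply]
        push_cast
        ring
      rw [e, norm_mul, norm_mul]
      have n1 : ‖χ d‖ * ‖(truncAF U (moebius : ArithmeticFunction ℝ) d : ℂ)‖ ≤ 1 := by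
        rw [Complex.norm_real]
        exact mul_le_one₀ (χ.norm_le_one _) (norm_nonneg _) (truncAF_moebius_abs_le U d)
      have hld : Real.log d ≤ L := by
        have : Real.log d ≤ Real.log U := Real.log_le_log (by positivity) hdU
        rw [Real.log_exp] at this; linarith
      have hld0 : 0 ≤ Real.log d := Real.log_natCast_nonneg d
      refine (mul_le_of_le_one_left (norm_nonneg _) n1).trans ((norm_sub_le _ _).trans ?_)
      rw [norm_mul, norm_mul, Complex.norm_real, Complex.norm_real, Real.norm_of_nonneg hL0.le, Real.norm_of_nonneg hld0]
      calc _ ≤ L * (16 * K₂ * f / Real.exp L) + L * (16 * K₁ * f / Real.exp L) := by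
            gcongr
            · exact hw2 d hd0
            · exact hw1 d hd0
        _ = _ := by ring
    · rw [← hUU]
      calc U * (16 * (K₁ + K₂) * f * L / Real.exp L) ≤ U ^ 2 * (16 * (K₁ + K₂) * f * L / Real.exp L) := by
            gcongr; exact le_self_pow₀ hU1 two_ne_zero
        _ = _ := by ring
  · rw [wtSupp, sum_mul_convolution χ _ _ hk]
    refine (norm_sum_le _ _).trans ((sum_le_of_support (V := U ^ 2) (B := 16 * (K₁ + K₂) * f * L / Real.exp L) (by positivity) (by positivity) ?_ ?_).trans ?_)
    · intro d _ hd
      rw [norm_eq_zero]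
      refine sum_eq_zero fun m _ => ?_
      rw [truncAF_mul_truncAF_eq_zero hU0.le _ _ hd]; simp
    · intro d hd hdU
      have hd0 : 0 < d := (mem_Icc.1 hd).1
      set c := (truncAF U vonMangoldt * truncAF U (moebius : ArithmeticFunction ℝ)) d with hc
      have e : ∑ m ∈ Icc 1 ⌊Real.exp (21 / 20 * L)⌋₊, (χ d * (c : ℂ)) * (χ m * (((zeta : ArithmeticFunction ℝ) m : ℝ) : ℂ)) * (wt L (d * m) : ℂ) =
          (χ d * (c : ℂ)) * ∑ m ∈ wtSupp L, χ m * (wt L (d * m) : ℂ) := by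
        rw [mul_sum]
        refine sum_congr rfl fun m hm => ?_
        have hm0 : m ≠ 0 := by have := (mem_Icc.1 hm).1; omega
        rw [natCoe_apply, zeta_apply_ne hm0]; push_cast; ring
      have hld : Real.log d ≤ L := by
        have : Real.log d ≤ Real.log (U ^ 2) := Real.log_le_log (by positivity) hdU
        rw [Real.log_pow, Real.log_exp] at this; push_cast at this; linarith
      rw [e, norm_mul, norm_mul, Complex.norm_real]
      calc ‖χ d‖ * ‖c‖ * _ ≤ 1 * L * (16 * K₁ * f / Real.exp L) := by
            gcongr
            · exact χ.norm_le_one _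
            · exact (truncAF_vonMangoldt_mul_moebius_abs_le U d).trans hld
            · exact hw1 d hd0
        _ ≤ 16 * (K₁ + K₂) * f * L / Real.exp L := by
          rw [one_mul, mul_div_assoc', mul_comm L]; gcongr; linarith
    · rw [← hUU]
      exact le_of_eq (by ring)

end

section

open Finset ArithmeticFunction MeasureTheory Filter

theorem sum_sum_wt_eq_integral {L : ℝ} (hL : 0 < L) {s t : Finset ℕ} (hs : ∀ n ∈ s, n ≠ 0) (ht : ∀ n ∈ t, n ≠ 0)
    (a b : ℕ → ℂ) :
    ∑ d ∈ s, ∑ m ∈ t, a d * b m * (wt L (d * m) : ℂ) =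
      ∫ u, cV u * ((∑ d ∈ s, a d * ((d : ℂ) ^ (1 + vline u / L))⁻¹) * ∑ m ∈ t, b m * ((m : ℂ) ^ (1 + vline u / L))⁻¹) := by
  have hcont : ∀ n : ℕ, n ≠ 0 → Continuous fun u => ((n : ℂ) ^ (1 + vline u / L))⁻¹ := by
    intro n hn
    have hn' : (n:ℂ) ≠ 0 := by exact_mod_cast hn
    have := continuous_vline
    exact ((continuous_const.add (this.div_const _)).const_cpow (Or.inl hn')).inv₀ fun u => by
      rw [Ne, Complex.cpow_eq_zero_iff]; tauto
  have hIn : ∀ n : ℕ, n ≠ 0 → Integrable fun u => cV u * ((n : ℂ) ^ (1 + vline u / L))⁻¹ := by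
    intro n hn
    have hc0 : Integrable fun t => ‖cV t‖ := by simpa using cV_rep.integrable 0
    refine (hc0.mul_const 1).mono' ((cV_rep.cont.mul (hcont n hn)).aestronglyMeasurable) (Eventually.of_forall fun u => ?_)
    rw [norm_mul, norm_inv, Complex.norm_natCast_cpow_of_pos (Nat.pos_of_ne_zero hn), re_one_add_vline_div]
    gcongr
    apply inv_le_one_of_one_le₀
    apply Real.one_le_rpow
    · exact_mod_cast Nat.one_le_iff_ne_zero.2 hn
    · positivity
  have e : ∀ u, cV u * ((∑ d ∈ s, a d * ((d : ℂ) ^ (1 + vline u / L))⁻¹) * ∑ m ∈ t, b m * ((m : ℂ) ^ (1 + vline u / L))⁻¹) =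
      ∑ d ∈ s, ∑ m ∈ t, a d * b m * (cV u * (((d * m : ℕ) : ℂ) ^ (1 + vline u / L))⁻¹) := by
    intro u
    rw [sum_mul_sum, mul_sum]
    refine sum_congr rfl fun d _ => ?_
    rw [mul_sum]
    refine sum_congr rfl fun m _ => ?_
    rw [Nat.cast_mul, Complex.natCast_mul_natCast_cpow, mul_inv]
    ring
  simp only [e]
  rw [integral_finsetSum _ fun d hd => integrable_finsetSum _ fun m hm => (hIn _ (Nat.mul_ne_zero (hs d hd) (ht m hm))).const_mul _]
  refine sum_congr rfl fun d hd => ?_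
  rw [integral_finsetSum _ fun m hm => (hIn _ (Nat.mul_ne_zero (hs d hd) (ht m hm))).const_mul _]
  refine sum_congr rfl fun m hm => ?_
  rw [integral_const_mul, wt_eq_integral L (Nat.mul_ne_zero (hs d hd) (ht m hm))]

theorem natLog_two_le {n : ℕ} : (Nat.log 2 n : ℝ) ≤ 3 / 2 * Real.log n := by
  refine (Real.natLog_le_logb n 2).trans ?_
  have h2 := Real.log_two_gt_d9
  rw [← Real.log_div_log, div_le_iff₀ (by push_cast; linarith)]
  have := Real.log_natCast_nonneg n
  push_cast
  nlinarith

theorem abs_sub_truncAF_moebius_mul_zeta_le (U : ℝ) (n : ℕ) :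
    |(((moebius : ArithmeticFunction ℝ) - truncAF U (moebius : ArithmeticFunction ℝ)) * (zeta : ArithmeticFunction ℝ)) n| ≤
      n.divisors.card := by
  rw [coe_mul_zeta_apply]
  refine (abs_sum_le_sum_abs _ _).trans ?_
  rw [← nsmul_one]
  refine sum_le_card_nsmul _ _ 1 fun d _ => ?_
  rw [sub_truncAF_apply]
  split_ifs
  · simp
  · rw [intCoe_apply, ← Int.cast_abs]; exact_mod_cast abs_moebius_le_one

theorem sub_truncAF_moebius_mul_zeta_eq_zero {U : ℝ} {n : ℕ} (hn : (n:ℝ) ≤ U) :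
    (((moebius : ArithmeticFunction ℝ) - truncAF U (moebius : ArithmeticFunction ℝ)) * (zeta : ArithmeticFunction ℝ)) n = 0 := by
  rw [coe_mul_zeta_apply]
  refine sum_eq_zero fun d hd => ?_
  rw [sub_truncAF_apply, if_pos]
  exact le_trans (by exact_mod_cast Nat.divisor_le hd) hn

theorem norm_inv_cpow_le {L : ℝ} (hL : 0 < L) {n : ℕ} (hn : n ≠ 0) (u : ℝ) : ‖((n : ℂ) ^ (1 + vline u / L))⁻¹‖ ≤ 1 / n := by
  have hn1 : (1:ℝ) ≤ n := by exact_mod_cast Nat.one_le_iff_ne_zero.2 hn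
  rw [norm_inv, Complex.norm_natCast_cpow_of_pos (Nat.pos_of_ne_zero hn), re_one_add_vline_div, ← one_div]
  gcongr
  calc (n:ℝ) = (n:ℝ) ^ (1:ℝ) := (Real.rpow_one _).symm
    _ ≤ _ := Real.rpow_le_rpow_of_exponent_le hn1 (le_add_of_nonneg_right (by positivity))

theorem sum_typeII_le {L : ℝ} (hL : 1 ≤ L) {Y Q : ℕ} (hY : 1 ≤ Y) (hQ : (Q:ℝ) ≤ Real.exp (49 / 200 * L)) (u : ℝ)
    (s : Finset ℕ) (hs : s = (wtSupp L).filter fun n : ℕ => Real.exp (L / 4) < n) :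
    let U := Real.exp (L / 4)
    ∑ q ∈ Ioc Y Q, (q.totient : ℝ)⁻¹ * ∑ χ ∈ primChars q,
      ‖∑ d ∈ s, (χ d * ((vonMangoldt - truncAF U vonMangoldt) d : ℂ)) * ((d : ℂ) ^ (1 + vline u / L))⁻¹‖ *
      ‖∑ m ∈ s, (χ m * (((((moebius : ArithmeticFunction ℝ) - truncAF U (moebius : ArithmeticFunction ℝ)) *
        (zeta : ArithmeticFunction ℝ)) m : ℝ) : ℂ)) * ((m : ℂ) ^ (1 + vline u / L))⁻¹‖ ≤
      200000 * L ^ 6 * (1 / Y + Real.exp (-(L / 200))) := by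
  intro U
  have hL0 : 0 < L := by linarith
  set N := ⌊Real.exp (21 / 20 * L)⌋₊ with hN
  have hs1 : s ⊆ Icc 1 N := by rw [hs]; exact filter_subset _ _
  have hsU : ∀ n ∈ s, U ≤ n := fun n hn => by rw [hs] at hn; exact (mem_filter.1 hn).2.le
  set g := vonMangoldt - truncAF U vonMangoldt
  set h := ((moebius : ArithmeticFunction ℝ) - truncAF U (moebius : ArithmeticFunction ℝ)) * (zeta : ArithmeticFunction ℝ) with hh
  have hlogN : Real.log N ≤ 21 / 20 * L := by
    rcases Nat.eq_zero_or_pos N with h0 | h0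
    · rw [h0]; simp; positivity
    rw [Real.log_le_iff_le_exp (by exact_mod_cast h0)]
    exact Nat.floor_le (by positivity)
  have hlogQ : Real.log Q ≤ 49 / 200 * L := by
    rcases Nat.eq_zero_or_pos Q with h0 | h0
    · rw [h0]; simp; positivity
    rw [Real.log_le_iff_le_exp (by exact_mod_cast h0)]
    exact hQ
  have hH : ∑ n ∈ Icc 1 N, (1:ℝ) / n ≤ 3 * L := (sum_inv_le_one_add_log N).trans (by linarith)
  have hH0 : 0 ≤ ∑ n ∈ Icc 1 N, (1:ℝ) / n := sum_nonneg fun _ _ => by positivity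
  have hSa : ∑ n ∈ s, n * ‖(g n : ℂ) * ((n : ℂ) ^ (1 + vline u / L))⁻¹‖ ^ 2 ≤ 81 * L ^ 4 := by
    calc _ ≤ ∑ n ∈ s, 4 * L ^ 2 * (1 / n) := by
          refine sum_le_sum fun n hn => ?_
          have hnI := mem_Icc.1 (hs1 hn)
          have hn0 : n ≠ 0 := by omega
          have hnp : (0:ℝ) < n := by exact_mod_cast hnI.1
          have hg : ‖(g n : ℂ)‖ ≤ 2 * L := by
            rw [Complex.norm_real, sub_truncAF_apply]
            split_ifs
            · rw [norm_zero]; positivity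
            · rw [Real.norm_of_nonneg vonMangoldt_nonneg]
              refine vonMangoldt_le_log.trans ?_
              have : Real.log n ≤ Real.log N := Real.log_le_log hnp (by exact_mod_cast hnI.2)
              linarith
          calc _ ≤ (n:ℝ) * (2 * L * (1 / n)) ^ 2 := by
                rw [norm_mul]; gcongr; exact norm_inv_cpow_le hL0 hn0 u
            _ = _ := by field_simp; norm_num
      _ ≤ ∑ n ∈ Icc 1 N, 4 * L ^ 2 * (1 / (n:ℝ)) := sum_le_sum_of_subset_of_nonneg hs1 fun _ _ _ => by positivity
      _ = 4 * L ^ 2 * ∑ n ∈ Icc 1 N, (1:ℝ) / n := by rw [mul_sum]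
      _ ≤ 4 * L ^ 2 * (3 * L) := by gcongr
      _ = 12 * L ^ 3 := by ring
      _ ≤ 81 * L ^ 4 := by
        have : L ^ 3 ≤ L ^ 4 := pow_le_pow_right₀ hL (by norm_num)
        nlinarith [pow_pos hL0 3]
  have hSb : ∑ n ∈ s, n * ‖(h n : ℂ) * ((n : ℂ) ^ (1 + vline u / L))⁻¹‖ ^ 2 ≤ 81 * L ^ 4 := by
    calc _ ≤ ∑ n ∈ s, (n.divisors.card : ℝ) ^ 2 / n := by
          refine sum_le_sum fun n hn => ?_
          have hnI := mem_Icc.1 (hs1 hn)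
          have hn0 : n ≠ 0 := by omega
          have hnp : (0:ℝ) < n := by exact_mod_cast hnI.1
          calc _ ≤ (n:ℝ) * (n.divisors.card * (1 / n)) ^ 2 := by
                rw [norm_mul, Complex.norm_real]; gcongr
                · exact abs_sub_truncAF_moebius_mul_zeta_le U n
                · exact norm_inv_cpow_le hL0 hn0 u
            _ = _ := by field_simp
      _ ≤ ∑ n ∈ Icc 1 N, (n.divisors.card : ℝ) ^ 2 / n := sum_le_sum_of_subset_of_nonneg hs1 fun _ _ _ => by positivity
      _ ≤ _ := sum_card_divisors_sq_le N
      _ ≤ (3 * L) ^ 4 := by gcongr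
      _ = _ := by ring
  have key := bilinear_large_sieve Y Q N hY (Real.exp_pos _ : 0 < U) s s hs1 hsU hs1 hsU _ _ hSa hSb
  have e1 : ∀ q (χ : DirichletCharacter ℂ q), ∑ n ∈ s, (g n : ℂ) * ((n : ℂ) ^ (1 + vline u / L))⁻¹ * χ n =
      ∑ d ∈ s, (χ d * (g d : ℂ)) * ((d : ℂ) ^ (1 + vline u / L))⁻¹ := fun q χ => sum_congr rfl fun _ _ => by ring
  have e2 : ∀ q (χ : DirichletCharacter ℂ q), ∑ n ∈ s, (h n : ℂ) * ((n : ℂ) ^ (1 + vline u / L))⁻¹ * χ n =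
      ∑ d ∈ s, (χ d * (h d : ℂ)) * ((d : ℂ) ^ (1 + vline u / L))⁻¹ := fun q χ => sum_congr rfl fun _ _ => by ring
  simp only [e1, e2] at key
  refine key.trans ?_
  have hQU : 8 * (Q:ℝ) / U ≤ 8 * Real.exp (-(L / 200)) := by
    rw [mul_div_assoc]
    gcongr
    rw [div_le_iff₀ (Real.exp_pos _), ← Real.exp_add]
    refine hQ.trans (Real.exp_le_exp.2 (by linarith))
  calc _ ≤ (3 / 2 * Real.log Q + 1) * ((3 / 2 * Real.log N + 1) * ((8 * Real.exp (-(L / 200)) + 328 / Y) * (81 * L ^ 4))) := by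
        have := @natLog_two_le Q
        have := @natLog_two_le N
        have := Real.log_natCast_nonneg Q
        gcongr
    _ ≤ (2 * L) * ((3 * L) * ((328 * Real.exp (-(L / 200)) + 328 / Y) * (81 * L ^ 4))) := by
        gcongr
        · linarith
        · linarith
        · norm_num
    _ = 159408 * L ^ 6 * (1 / Y + Real.exp (-(L / 200))) := by ring
    _ ≤ _ := by gcongr; norm_num

theorem primChars_card_le (q : ℕ) [NeZero q] : ((primChars q).card : ℝ) ≤ q.totient := by
  have h : (primChars q).card ≤ Fintype.card (DirichletCharacter ℂ q) := card_le_univ _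
  rw [← Nat.card_eq_fintype_card, DirichletCharacter.card_eq_totient_of_hasEnoughRootsOfUnity] at h
  exact_mod_cast h

theorem ne_one_of_mem_primChars {q : ℕ} (hq : 1 < q) {χ : DirichletCharacter ℂ q} (h : χ ∈ primChars q) : χ ≠ 1 := by
  rintro rfl
  have : NeZero q := ⟨by omega⟩
  rw [mem_primChars, DirichletCharacter.isPrimitive_def, DirichletCharacter.conductor_one] at h
  omega

/-- Average bound for prime sums twisted by primitive characters of moderate conductor. -/
theorem exists_large_conductor_bound : ∃ C, 0 ≤ C ∧ ∀ L : ℝ, 1 ≤ L → ∀ Y Q : ℕ, 1 ≤ Y → (Q:ℝ) ≤ Real.exp (49 / 200 * L) →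
    ∑ q ∈ Ioc Y Q, (q.totient : ℝ)⁻¹ * ∑ χ ∈ primChars q, ‖charW χ L‖ ≤ C * L ^ 6 * (1 / Y + Real.exp (-(L / 200))) := by
  obtain ⟨K, hK0, hK⟩ := exists_typeI_bound
  have hcV : Integrable fun u => ‖cV u‖ := by simpa using cV_rep.integrable 0
  set D := ∫ u, ‖cV u‖ with hD
  have hD0 : 0 ≤ D := integral_nonneg fun _ => norm_nonneg _
  refine ⟨2 * K + D * 200000, by positivity, fun L hL Y Q hY hQ => ?_⟩
  have hL0 : 0 < L := by linarith
  set U := Real.exp (L / 4) with hU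
  set s := (wtSupp L).filter fun n : ℕ => U < n with hs
  set g := vonMangoldt - truncAF U vonMangoldt with hg
  set h := ((moebius : ArithmeticFunction ℝ) - truncAF U (moebius : ArithmeticFunction ℝ)) * (zeta : ArithmeticFunction ℝ) with hh
  set A : ∀ q, DirichletCharacter ℂ q → ℝ → ℂ := fun q χ u => ∑ d ∈ s, (χ d * (g d : ℂ)) * ((d : ℂ) ^ (1 + vline u / L))⁻¹ with hA
  set B : ∀ q, DirichletCharacter ℂ q → ℝ → ℂ := fun q χ u => ∑ d ∈ s, (χ d * (h d : ℂ)) * ((d : ℂ) ^ (1 + vline u / L))⁻¹ with hB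
  have hs0 : ∀ n ∈ s, n ≠ 0 := fun n hn => by
    have := (mem_Icc.1 (mem_filter.1 hn).1).1; omega
  have hcont : ∀ (a : ℕ → ℂ), Continuous fun u => ∑ d ∈ s, a d * ((d : ℂ) ^ (1 + vline u / L))⁻¹ := by
    intro a
    refine continuous_finsetSum _ fun n hn => continuous_const.mul ?_
    have hn' : (n:ℂ) ≠ 0 := by exact_mod_cast hs0 n hn
    have := continuous_vline
    exact ((continuous_const.add (this.div_const _)).const_cpow (Or.inl hn')).inv₀ fun u => by
      rw [Ne, Complex.cpow_eq_zero_iff]; tauto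
  have hbd : ∀ (a : ℕ → ℂ) u, ‖∑ d ∈ s, a d * ((d : ℂ) ^ (1 + vline u / L))⁻¹‖ ≤ ∑ d ∈ s, ‖a d‖ * (1 / d) := by
    intro a u
    refine (norm_sum_le _ _).trans (sum_le_sum fun n hn => ?_)
    rw [norm_mul]; gcongr; exact norm_inv_cpow_le hL0 (hs0 n hn) u
  have hIn : ∀ q (χ : DirichletCharacter ℂ q), Integrable fun u => ‖cV u‖ * (‖A q χ u‖ * ‖B q χ u‖) := by
    intro q χ
    refine (hcV.mul_const ((∑ d ∈ s, ‖χ d * (g d : ℂ)‖ * (1 / d)) * ∑ d ∈ s, ‖χ d * (h d : ℂ)‖ * (1 / d))).mono' ?_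
      (Eventually.of_forall fun u => ?_)
    · have h1 := hcont fun d => χ d * (g d : ℂ)
      have h2 := hcont fun d => χ d * (h d : ℂ)
      exact (cV_rep.cont.norm.mul (h1.norm.mul h2.norm)).aestronglyMeasurable
    · rw [Real.norm_of_nonneg (by positivity)]
      gcongr
      · exact hbd _ u
      · exact hbd _ u
  have hchar : ∀ q ∈ Ioc Y Q, ∀ χ ∈ primChars q, ‖charW χ L‖ ≤ 2 * K * Q * L * Real.exp (-(L / 2)) +
      ∫ u, ‖cV u‖ * (‖A q χ u‖ * ‖B q χ u‖) := by
    intro q hq χ hχ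
    rw [mem_Ioc] at hq
    have : NeZero q := ⟨by omega⟩
    obtain ⟨k1, k2⟩ := hK L hL q χ (ne_one_of_mem_primChars (by omega) hχ)
    have hk : ∀ n, ⌊Real.exp (21 / 20 * L)⌋₊ < n → (wt L n : ℂ) = 0 := by
      intro n hn
      by_contra hne
      have := mem_wtSupp hL0 (n := n) (by exact_mod_cast hne)
      rw [wtSupp, mem_Icc] at this
      omega
    have e3 : ∑ n ∈ wtSupp L, χ n * (((g * h) n : ℝ) : ℂ) * wt L n = ∫ u, cV u * (A q χ u * B q χ u) := by
      rw [wtSupp, sum_mul_convolution χ _ _ hk, ← sum_sum_wt_eq_integral hL0 hs0 hs0]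
      symm
      refine (sum_subset (filter_subset _ _) fun d hd hds => ?_).trans (sum_congr rfl fun d hd => sum_subset (filter_subset _ _) fun m hm hms => ?_)
      · have hdU : (d:ℝ) ≤ U := by
          by_contra hc; exact hds (mem_filter.2 ⟨hd, not_le.1 hc⟩)
        refine sum_eq_zero fun m _ => ?_
        rw [hg, sub_truncAF_apply, if_pos hdU]; simp
      · have hmU : (m:ℝ) ≤ U := by
          by_contra hc; exact hms (mem_filter.2 ⟨hm, not_le.1 hc⟩)
        rw [hh, sub_truncAF_moebius_mul_zeta_eq_zero hmU]; simp
    have e : charW χ L = ∑ n ∈ wtSupp L, χ n * (((truncAF U (moebius : ArithmeticFunction ℝ) * log) n : ℝ) : ℂ) * wt L n -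
        ∑ n ∈ wtSupp L, χ n * (((truncAF U vonMangoldt * truncAF U (moebius : ArithmeticFunction ℝ) *
          (zeta : ArithmeticFunction ℝ)) n : ℝ) : ℂ) * wt L n + ∑ n ∈ wtSupp L, χ n * (((g * h) n : ℝ) : ℂ) * wt L n := by
      rw [← sum_sub_distrib, ← sum_add_distrib, charW]
      refine sum_congr rfl fun n _ => ?_
      by_cases hw : wt L n = 0
      · simp [hw]
      have hn := lt_of_wt_ne_zero hL0 hw
      have hv : vonMangoldt n = (truncAF U vonMangoldt) n + (truncAF U (moebius : ArithmeticFunction ℝ) * log) n -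
          (truncAF U vonMangoldt * truncAF U (moebius : ArithmeticFunction ℝ) * (zeta : ArithmeticFunction ℝ)) n + (g * h) n := by
        conv_lhs => rw [vaughan_identity U]
        rfl
      rw [truncAF_apply, if_neg, zero_add] at hv
      · rw [hv]; push_cast; ring
      · rw [not_le]; refine lt_of_le_of_lt ?_ hn
        exact Real.exp_le_exp.2 (by linarith)
    rw [e, e3]
    have hqQ : (q:ℝ) ≤ Q := by exact_mod_cast hq.2
    have k3 : ‖∫ u, cV u * (A q χ u * B q χ u)‖ ≤ ∫ u, ‖cV u‖ * (‖A q χ u‖ * ‖B q χ u‖) := by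
      refine (norm_integral_le_integral_norm _).trans (le_of_eq ?_)
      simp only [norm_mul]
    have k4 : K * q * L * Real.exp (-(L / 2)) ≤ K * Q * L * Real.exp (-(L / 2)) := by gcongr
    refine (norm_add_le _ _).trans (add_le_add ((norm_sub_le _ _).trans ?_) k3)
    linarith
  have hI : ∑ q ∈ Ioc Y Q, (q.totient : ℝ)⁻¹ * ∑ χ ∈ primChars q, ∫ u, ‖cV u‖ * (‖A q χ u‖ * ‖B q χ u‖) ≤
      D * (200000 * L ^ 6 * (1 / Y + Real.exp (-(L / 200)))) := by
    have e : ∑ q ∈ Ioc Y Q, (q.totient : ℝ)⁻¹ * ∑ χ ∈ primChars q, ∫ u, ‖cV u‖ * (‖A q χ u‖ * ‖B q χ u‖) =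
        ∫ u, ∑ q ∈ Ioc Y Q, (q.totient : ℝ)⁻¹ * ∑ χ ∈ primChars q, ‖cV u‖ * (‖A q χ u‖ * ‖B q χ u‖) := by
      rw [integral_finsetSum _ fun q _ => (integrable_finsetSum _ fun χ _ => hIn q χ).const_mul _]
      refine sum_congr rfl fun q _ => ?_
      rw [integral_const_mul, integral_finsetSum _ fun χ _ => hIn q χ]
    rw [e, hD, ← integral_mul_const]
    refine integral_mono (integrable_finsetSum _ fun q _ => (integrable_finsetSum _ fun χ _ => hIn q χ).const_mul _)
      (hcV.mul_const _) fun u => ?_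
    have := sum_typeII_le hL hY hQ u s rfl
    simp only [← mul_sum, mul_left_comm _ ‖cV u‖]
    gcongr
  calc _ ≤ ∑ q ∈ Ioc Y Q, (q.totient : ℝ)⁻¹ * ∑ χ ∈ primChars q, (2 * K * Q * L * Real.exp (-(L / 2)) +
        ∫ u, ‖cV u‖ * (‖A q χ u‖ * ‖B q χ u‖)) := by
        refine sum_le_sum fun q hq => ?_
        gcongr with χ hχ
        exact hchar q hq χ hχ
    _ = ∑ q ∈ Ioc Y Q, (q.totient : ℝ)⁻¹ * ((primChars q).card * (2 * K * Q * L * Real.exp (-(L / 2)))) +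
        ∑ q ∈ Ioc Y Q, (q.totient : ℝ)⁻¹ * ∑ χ ∈ primChars q, ∫ u, ‖cV u‖ * (‖A q χ u‖ * ‖B q χ u‖) := by
        rw [← sum_add_distrib]
        refine sum_congr rfl fun q _ => ?_
        rw [sum_add_distrib, sum_const, nsmul_eq_mul, mul_add]
    _ ≤ ∑ q ∈ Ioc Y Q, 2 * K * Q * L * Real.exp (-(L / 2)) + D * (200000 * L ^ 6 * (1 / Y + Real.exp (-(L / 200)))) := by
        refine add_le_add (sum_le_sum fun q hq => ?_) hI
        rw [mem_Ioc] at hq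
        have : NeZero q := ⟨by omega⟩
        have hφ : (0:ℝ) < q.totient := by exact_mod_cast Nat.totient_pos.2 (by omega)
        rw [inv_mul_le_iff₀ hφ]
        gcongr
        exact_mod_cast primChars_card_le q
    _ ≤ 2 * K * L ^ 6 * (1 / Y + Real.exp (-(L / 200))) + D * (200000 * L ^ 6 * (1 / Y + Real.exp (-(L / 200)))) := by
        gcongr
        rw [sum_const, nsmul_eq_mul, Nat.card_Ioc]
        have h1 : ((Q - Y : ℕ) : ℝ) ≤ Q := by exact_mod_cast Nat.sub_le Q Y
        calc ((Q - Y : ℕ) : ℝ) * (2 * K * Q * L * Real.exp (-(L / 2))) ≤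
              Real.exp (49 / 200 * L) * (2 * K * Real.exp (49 / 200 * L) * L * Real.exp (-(L / 2))) := by
              gcongr; exact h1.trans hQ
          _ = 2 * K * L * Real.exp (-(L / 100)) := by
              have : Real.exp (-(L / 100)) = Real.exp (49 / 200 * L) * Real.exp (49 / 200 * L) * Real.exp (-(L / 2)) := by
                rw [← Real.exp_add, ← Real.exp_add]; congr 1; ring
              rw [this]; ring
          _ ≤ 2 * K * L ^ 6 * (1 / Y + Real.exp (-(L / 200))) := by
              gcongr
              · exact le_self_pow₀ hL (by norm_num)
              · have : Real.exp (-(L / 100)) ≤ Real.exp (-(L / 200)) := Real.exp_le_exp.2 (by linarith)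
                have : (0:ℝ) ≤ 1 / Y := by positivity
                linarith
    _ = _ := by ring

end

section

open Finset ArithmeticFunction Filter DirichletCharacter

theorem sum_vonMangoldt_mul_wt_not_coprime_le {L : ℝ} (hL : 1 ≤ L) {q : ℕ} (hq : 1 ≤ q) :
    ∑ n ∈ wtSupp L with ¬ n.Coprime q, vonMangoldt n * wt L n ≤ 3 * L * Real.log q * Real.exp (-L) := by
  have hL0 : 0 < L := by linarith
  set N := ⌊Real.exp (21 / 20 * L)⌋₊ with hN
  set k := Nat.log 2 N + 1 with hk
  have hlogN : Real.log N ≤ 21 / 20 * L := by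
    rcases Nat.eq_zero_or_pos N with h0 | h0
    · rw [h0]; simp; positivity
    rw [Real.log_le_iff_le_exp (by exact_mod_cast h0)]
    exact Nat.floor_le (by positivity)
  have hkL : (k : ℝ) ≤ 3 * L := by
    have := @natLog_two_le N
    rw [hk]; push_cast; linarith
  have hqk : q ^ k ≠ 0 := pow_ne_zero _ (by omega)
  have hlogq : 0 ≤ Real.log q := Real.log_natCast_nonneg q
  calc _ ≤ ∑ n ∈ (wtSupp L).filter fun n => ¬ n.Coprime q, (if n ∈ (q ^ k).divisors then vonMangoldt n else 0) * Real.exp (-L) := by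
        refine sum_le_sum fun n hn => ?_
        obtain ⟨hn1, hn2⟩ := mem_filter.1 hn
        rw [wtSupp, mem_Icc, ← hN] at hn1
        by_cases hw : wt L n = 0
        · rw [hw, mul_zero]
          have : 0 ≤ vonMangoldt n := vonMangoldt_nonneg
          split_ifs <;> positivity
        have hlt := lt_of_wt_ne_zero hL0 hw
        have hw1 : wt L n ≤ Real.exp (-L) := by
          refine (wt_le L n).trans ?_
          rw [Real.exp_neg, one_div]
          gcongr
        by_cases hv : vonMangoldt n = 0
        · rw [hv]; simp
        have hpp : IsPrimePow n := vonMangoldt_ne_zero_iff.1 hv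
        obtain ⟨p, j, hp, hj, rfl⟩ := (isPrimePow_nat_iff _).1 hpp
        have hpq : p ∣ q := by
          by_contra hpq
          exact hn2 (Nat.Coprime.pow_left j ((Nat.Prime.coprime_iff_not_dvd hp).2 hpq))
        have hjk : j ≤ k := by
          have h1 : 2 ^ j ≤ N := (Nat.pow_le_pow_left hp.two_le j).trans hn1.2
          exact (Nat.le_log_of_pow_le (by norm_num) h1).trans (Nat.le_succ _)
        rw [if_pos (Nat.mem_divisors.2 ⟨(pow_dvd_pow p hjk).trans (pow_dvd_pow_of_dvd hpq k), hqk⟩)]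
        exact mul_le_mul_of_nonneg_left hw1 vonMangoldt_nonneg
    _ = (∑ n ∈ ((wtSupp L).filter fun n => ¬ n.Coprime q).filter fun n => n ∈ (q ^ k).divisors, vonMangoldt n) * Real.exp (-L) := by
        rw [← sum_mul, ← sum_filter]
    _ ≤ (∑ n ∈ (q ^ k).divisors, vonMangoldt n) * Real.exp (-L) := by
        gcongr
        exact fun n hn => (mem_filter.1 hn).2
    _ = k * Real.log q * Real.exp (-L) := by
        rw [vonMangoldt_sum]; push_cast; rw [Real.log_pow]
    _ ≤ _ := by gcongr

theorem le_card_divisors_mul_totient (n : ℕ) : n ≤ n.divisors.card * n.totient := by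
  conv_lhs => rw [← Nat.sum_totient n]
  rw [← smul_eq_mul]
  refine sum_le_card_nsmul _ _ _ fun d hd => ?_
  rcases Nat.eq_zero_or_pos n with rfl | hn
  · simp at hd
  exact Nat.le_of_dvd (Nat.totient_pos.2 hn) (Nat.totient_dvd_of_dvd (Nat.dvd_of_mem_divisors hd))

theorem sum_inv_totient_le (N : ℕ) : ∑ n ∈ Icc 1 N, (n.totient : ℝ)⁻¹ ≤ (1 + Real.log N) ^ 4 := by
  have h0 : 0 ≤ ∑ n ∈ Icc 1 N, (1:ℝ) / n := sum_nonneg fun _ _ => by positivity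
  refine le_trans (sum_le_sum fun n hn => ?_) ((sum_card_divisors_sq_le N).trans (pow_le_pow_left₀ h0 (sum_inv_le_one_add_log N) 4))
  have hn1 : 0 < n := (mem_Icc.1 hn).1
  have h1 : (n:ℝ) ≤ n.divisors.card * n.totient := by exact_mod_cast le_card_divisors_mul_totient n
  have h2 : (0:ℝ) < n.totient := by exact_mod_cast Nat.totient_pos.2 hn1
  have h3 : (1:ℝ) ≤ n.divisors.card := by
    exact_mod_cast Finset.card_pos.2 (Nat.nonempty_divisors.2 hn1.ne')
  have h4 : (0:ℝ) < n := by exact_mod_cast hn1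
  rw [inv_le_comm₀ h2 (by positivity), inv_div, div_le_iff₀ (by positivity)]
  nlinarith

theorem sum_dvd_inv_totient_le {f : ℕ} (hf : 1 ≤ f) (Q : ℕ) :
    ∑ q ∈ Icc 1 Q with f ∣ q, (q.totient : ℝ)⁻¹ ≤ (f.totient : ℝ)⁻¹ * (1 + Real.log Q) ^ 4 := by
  refine le_trans ?_ (mul_le_mul_of_nonneg_left (sum_inv_totient_le Q) (by positivity))
  rw [mul_sum]
  calc _ ≤ ∑ q ∈ (Icc 1 Q).image fun m => f * m, (q.totient : ℝ)⁻¹ := by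
        refine sum_le_sum_of_subset_of_nonneg (fun q hq => ?_) fun _ _ _ => by positivity
        obtain ⟨h1, m, rfl⟩ := mem_filter.1 hq
        rw [mem_Icc] at h1
        refine mem_image.2 ⟨m, mem_Icc.2 ⟨?_, ?_⟩, rfl⟩
        · exact Nat.pos_of_ne_zero fun h => by rw [h] at h1; omega
        · exact (Nat.le_mul_of_pos_left m hf).trans h1.2
    _ = ∑ m ∈ Icc 1 Q, ((f * m).totient : ℝ)⁻¹ := by
        rw [sum_image]
        intro a _ b _ h
        exact Nat.eq_of_mul_eq_mul_left hf h
    _ ≤ _ := by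
        refine sum_le_sum fun m hm => ?_
        rw [← mul_inv]
        have hm1 := (mem_Icc.1 hm).1
        have h1 : (0:ℝ) < f.totient := by exact_mod_cast Nat.totient_pos.2 hf
        have h2 : (0:ℝ) < m.totient := by exact_mod_cast Nat.totient_pos.2 hm1
        gcongr
        exact_mod_cast Nat.totient_super_multiplicative f m

theorem norm_charW_sub_le {L : ℝ} (hL : 1 ≤ L) {f q : ℕ} (hq : 1 ≤ q) (hf : f ∣ q) (ψ : DirichletCharacter ℂ f) :
    ‖charW (changeLevel hf ψ) L‖ ≤ ‖charW ψ L‖ + 3 * L * Real.log q * Real.exp (-L) := by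
  refine le_trans ?_ (add_le_add_right (sum_vonMangoldt_mul_wt_not_coprime_le hL hq) _)
  have e : charW (changeLevel hf ψ) L = charW ψ L - ∑ n ∈ wtSupp L with ¬ n.Coprime q, ψ n * vonMangoldt n * wt L n := by
    rw [charW, charW, eq_sub_iff_add_eq, sum_filter, ← sum_add_distrib]
    refine sum_congr rfl fun n _ => ?_
    by_cases h : n.Coprime q
    · rw [if_neg (not_not.2 h), changeLevel_natCast ψ hf ((ZMod.isUnit_iff_coprime _ _).2 h), add_zero]
    · rw [if_pos h, MulChar.map_nonunit _ (by rwa [ZMod.isUnit_iff_coprime])]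
      simp
  rw [e]
  refine (norm_sub_le _ _).trans (add_le_add_right ((norm_sum_le _ _).trans (sum_le_sum fun n _ => ?_)) _)
  rw [norm_mul, norm_mul, Complex.norm_real, Complex.norm_real, Real.norm_of_nonneg vonMangoldt_nonneg,
    Real.norm_of_nonneg (wt_nonneg _ _)]
  have := DirichletCharacter.norm_le_one ψ n
  have h1 : 0 ≤ vonMangoldt n := vonMangoldt_nonneg
  have h2 := wt_nonneg L n
  gcongr
  nlinarith

open Classical in
/-- The nonprincipal Dirichlet characters modulo `q`. -/
noncomputable def nonprincipalChars (q : ℕ) : Finset (DirichletCharacter ℂ q) := {χ | χ ≠ 1}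

theorem mem_nonprincipalChars {q : ℕ} {χ : DirichletCharacter ℂ q} : χ ∈ nonprincipalChars q ↔ χ ≠ 1 := by
  simp [nonprincipalChars]

/-- The contribution of the nonprincipal characters to primes in progressions modulo `q`. -/
noncomputable def charErr (q : ℕ) (L : ℝ) : ℝ :=
  (q.totient : ℝ)⁻¹ * ∑ χ ∈ nonprincipalChars q, ‖charW χ L‖

open Classical in
theorem sum_norm_charW_le {L : ℝ} (hL : 1 ≤ L) {q : ℕ} (hq : 1 ≤ q) :
    charErr q L ≤ (q.totient : ℝ)⁻¹ * ∑ f ∈ q.divisors.erase 1, ∑ ψ ∈ primChars f, ‖charW ψ L‖ +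
      3 * L * Real.log q * Real.exp (-L) := by
  have : NeZero q := ⟨by omega⟩
  have hφ : (0:ℝ) < q.totient := by exact_mod_cast Nat.totient_pos.2 hq
  set η := 3 * L * Real.log q * Real.exp (-L) with hη
  have hη0 : 0 ≤ η := by have := Real.log_natCast_nonneg q; positivity
  set m : DirichletCharacter ℂ q → Σ f, DirichletCharacter ℂ f := fun χ => ⟨χ.conductor, χ.primitiveCharacter⟩ with hm
  have hinj : Function.Injective m := by
    set g : (Σ f, DirichletCharacter ℂ f) → DirichletCharacter ℂ q := fun x => if h : x.1 ∣ q then changeLevel h x.2 else 1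
    refine Function.LeftInverse.injective (g := g) fun χ => ?_
    simp only [g, hm, dif_pos χ.conductor_dvd_level]
    exact χ.changeLevel_primitiveCharacter
  have hcard : (nonprincipalChars q).card * η ≤ q.totient * η := by
    gcongr
    refine (card_le_univ _).trans (le_of_eq ?_)
    rw [← Nat.card_eq_fintype_card, DirichletCharacter.card_eq_totient_of_hasEnoughRootsOfUnity]
  rw [charErr, inv_mul_le_iff₀ hφ, mul_add, mul_inv_cancel_left₀ hφ.ne']
  calc ∑ χ ∈ nonprincipalChars q, ‖charW χ L‖
      ≤ ∑ χ ∈ nonprincipalChars q, (‖charW (m χ).2 L‖ + η) := by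
        refine sum_le_sum fun χ _ => ?_
        conv_lhs => rw [← χ.changeLevel_primitiveCharacter]
        exact norm_charW_sub_le hL hq _ _
    _ = ∑ x ∈ (nonprincipalChars q).image m, ‖charW x.2 L‖ +
        (nonprincipalChars q).card * η := by
        rw [sum_add_distrib, sum_const, nsmul_eq_mul, sum_image fun _ _ _ _ h => hinj h]
    _ ≤ ∑ x ∈ (q.divisors.erase 1).sigma fun f => primChars f, ‖charW x.2 L‖ + q.totient * η := by
        refine add_le_add (sum_le_sum_of_subset_of_nonneg ?_ fun _ _ _ => norm_nonneg _) hcard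
        intro x hx
        obtain ⟨χ, hχ, rfl⟩ := mem_image.1 hx
        rw [mem_sigma, mem_erase, Nat.mem_divisors, mem_primChars]
        refine ⟨⟨fun h => ?_, χ.conductor_dvd_level, by omega⟩, χ.primitiveCharacter_isPrimitive⟩
        exact mem_nonprincipalChars.1 hχ (eq_one_iff_conductor_eq_one.2 h)
    _ = _ := by rw [sum_sigma]

theorem sum_charErr_le {L : ℝ} (hL : 1 ≤ L) {Q : ℕ} (hQ : (Q:ℝ) ≤ Real.exp (49 / 200 * L)) :
    ∑ q ∈ Icc 1 Q, charErr q L ≤ (3 * L) ^ 4 * ∑ f ∈ Ioc 1 Q, (f.totient : ℝ)⁻¹ * ∑ ψ ∈ primChars f, ‖charW ψ L‖ +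
      3 * L ^ 2 * Real.exp (-(L / 2)) := by
  have hL0 : 0 < L := by linarith
  have hlogQ : Real.log Q ≤ L := by
    rcases Nat.eq_zero_or_pos Q with h0 | h0
    · rw [h0]; simp; positivity
    rw [Real.log_le_iff_le_exp (by exact_mod_cast h0)]
    exact hQ.trans (Real.exp_le_exp.2 (by linarith))
  have hlogQ0 := Real.log_natCast_nonneg Q
  calc _ ≤ ∑ q ∈ Icc 1 Q, ((q.totient : ℝ)⁻¹ * ∑ f ∈ q.divisors.erase 1, ∑ ψ ∈ primChars f, ‖charW ψ L‖ +
        3 * L * L * Real.exp (-L)) := by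
        refine sum_le_sum fun q hq => (sum_norm_charW_le hL (mem_Icc.1 hq).1).trans ?_
        have : Real.log q ≤ L := le_trans (Real.log_le_log (by exact_mod_cast (mem_Icc.1 hq).1) (by exact_mod_cast (mem_Icc.1 hq).2)) hlogQ
        gcongr
    _ = ∑ q ∈ Icc 1 Q, ∑ f ∈ Ioc 1 Q, (if f ∣ q then (q.totient : ℝ)⁻¹ else 0) * ∑ ψ ∈ primChars f, ‖charW ψ L‖ +
        Q * (3 * L * L * Real.exp (-L)) := by
        rw [sum_add_distrib, sum_const, nsmul_eq_mul, Nat.card_Icc, Nat.add_sub_cancel]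
        congr 1
        refine sum_congr rfl fun q hq => ?_
        rw [mem_Icc] at hq
        rw [mul_sum]
        have : q.divisors.erase 1 = (Ioc 1 Q).filter fun f => f ∣ q := by
          ext f
          simp only [mem_erase, Nat.mem_divisors, mem_filter, mem_Ioc]
          constructor
          · rintro ⟨h1, h2, h3⟩
            have := Nat.le_of_dvd (by omega) h2
            have := Nat.pos_of_dvd_of_pos h2 (by omega)
            exact ⟨⟨by omega, by omega⟩, h2⟩
          · rintro ⟨⟨h1, h2⟩, h3⟩
            exact ⟨by omega, h3, by omega⟩
        rw [this, sum_filter]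
        refine sum_congr rfl fun f _ => ?_
        split_ifs <;> simp
    _ = ∑ f ∈ Ioc 1 Q, (∑ q ∈ Icc 1 Q with f ∣ q, (q.totient : ℝ)⁻¹) * ∑ ψ ∈ primChars f, ‖charW ψ L‖ +
        Q * (3 * L * L * Real.exp (-L)) := by
        rw [sum_comm]
        congr 1
        refine sum_congr rfl fun f _ => ?_
        rw [← sum_mul, sum_filter]
    _ ≤ ∑ f ∈ Ioc 1 Q, ((f.totient : ℝ)⁻¹ * (3 * L) ^ 4) * ∑ ψ ∈ primChars f, ‖charW ψ L‖ +
        Real.exp (49 / 200 * L) * (3 * L * L * Real.exp (-L)) := by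
        gcongr with f hf
        · refine (sum_dvd_inv_totient_le (mem_Ioc.1 hf).1.le Q).trans ?_
          gcongr
          linarith
    _ ≤ _ := by
        rw [mul_sum]
        refine add_le_add (le_of_eq (sum_congr rfl fun f _ => by ring)) ?_
        calc _ = 3 * L ^ 2 * (Real.exp (49 / 200 * L) * Real.exp (-L)) := by ring
          _ ≤ _ := by
            rw [← Real.exp_add]
            gcongr
            linarith

end

section

open Finset ArithmeticFunction Filter DirichletCharacter Topology

theorem tendsto_pow_mul_exp_neg_mul (k : ℕ) {c : ℝ} (hc : 0 < c) :
    Tendsto (fun L : ℝ => L ^ k * Real.exp (-(c * L))) atTop (𝓝 0) := by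
  have h := (Real.tendsto_pow_mul_exp_neg_atTop_nhds_zero k).comp (tendsto_id.const_mul_atTop hc)
  have h2 := h.const_mul ((c ^ k)⁻¹)
  rw [mul_zero] at h2
  refine h2.congr fun L => ?_
  simp only [Function.comp, id, mul_pow]
  field_simp

theorem frequently_sum_charErr_le (K : ℕ) :
    ∃ᶠ L : ℝ in atTop, ∑ q ∈ Icc 1 ⌊Real.exp (49 / 200 * L)⌋₊, charErr q L ≤ 1 / L ^ K := by
  set M := 4 * (K + 11) with hM
  set J := M + 4 * K + 24 with hJ
  obtain ⟨C₁, hC₁, h₁⟩ := norm_charW_le J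
  obtain ⟨C₂, hC₂, h₂⟩ := exists_large_conductor_bound
  have hM0 : (0:ℝ) < M := by rw [hM]; positivity
  set b : ℕ → ℝ := fun Y => (Y:ℝ) ^ (1 / (M:ℝ)) with hb
  have htb : Tendsto b atTop atTop := (tendsto_rpow_atTop (by positivity)).comp tendsto_natCast_atTop_atTop
  have htL : Tendsto (fun Y => b Y ^ 4) atTop atTop := (tendsto_pow_atTop (by norm_num)).comp htb
  refine htL.frequently (p := fun L : ℝ => ∑ q ∈ Icc 1 ⌊Real.exp (49 / 200 * L)⌋₊, charErr q L ≤ 1 / L ^ K) ?_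
  have hev1 : ∀ᶠ L : ℝ in atTop, 81 * (C₁ + C₂) / L ^ (K + 1) + 81 * C₂ * L ^ 10 * Real.exp (-(L / 200)) +
      3 * L ^ 2 * Real.exp (-(L / 2)) ≤ 1 / L ^ K := by
    have t1 := (tendsto_inv_atTop_zero (𝕜 := ℝ)).const_mul (81 * (C₁ + C₂))
    have t2 := (tendsto_pow_mul_exp_neg_mul (K + 10) (c := 1 / 200) (by norm_num)).const_mul (81 * C₂)
    have t3 := (tendsto_pow_mul_exp_neg_mul (K + 2) (c := 1 / 2) (by norm_num)).const_mul 3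
    have t := (t1.add t2).add t3
    simp only [mul_zero, add_zero] at t
    filter_upwards [t.eventually_le_const (zero_lt_one), eventually_gt_atTop 0] with L hL hL0
    rw [le_div_iff₀ (by positivity)]
    refine le_trans (le_of_eq ?_) hL
    have e1 : -(L / 200) = -(1 / 200 * L) := by ring
    have e2 : -(L / 2) = -(1 / 2 * L) := by ring
    rw [e1, e2]
    field_simp
    ring
  have hev2 : ∀ᶠ Y : ℕ in atTop, 120 * 10 ^ 11 * (2 * Real.log (Y + 1)) ^ 10 ≤ b Y := by
    have o := (isLittleO_log_rpow_atTop (r := 1 / (10 * (M:ℝ))) (by positivity)).pow (n := 10) (by norm_num)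
    have o1 := o.bound (c := 1 / (120 * 10 ^ 11 * 4 ^ 10)) (by positivity)
    have o2 := tendsto_natCast_atTop_atTop.eventually o1
    filter_upwards [o2, eventually_ge_atTop 2] with Y hY hY2
    have hY2' : (2:ℝ) ≤ Y := by exact_mod_cast hY2
    have hl : Real.log (Y + 1) ≤ 2 * Real.log Y := by
      rw [← Real.log_rpow (by linarith)]
      apply Real.log_le_log (by linarith)
      norm_num
      nlinarith
    have hl0 : 0 ≤ Real.log Y := Real.log_natCast_nonneg Y
    have hl1 : 0 ≤ Real.log ((Y:ℝ) + 1) := Real.log_nonneg (by linarith)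
    have e : ((Y:ℝ) ^ (1 / (10 * (M:ℝ)))) ^ 10 = b Y := by
      rw [hb, ← Real.rpow_natCast, ← Real.rpow_mul (by positivity)]
      congr 1
      push_cast
      field_simp
    rw [norm_pow, norm_pow, Real.norm_of_nonneg hl0, Real.norm_of_nonneg (by positivity), e, div_mul_eq_mul_div,
      le_div_iff₀ (by positivity)] at hY
    calc _ ≤ 120 * 10 ^ 11 * (2 * (2 * Real.log Y)) ^ 10 := by gcongr
      _ = Real.log Y ^ 10 * (120 * 10 ^ 11 * 4 ^ 10) := by ring
      _ ≤ _ := by rw [one_mul] at hY; exact hY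
  refine (frequently_LFunction_one_large.and_eventually ((htL.eventually hev1).and (hev2.and
    ((htL.eventually eventually_absSeries_vonMangoldt_le).and ((htb.eventually_ge_atTop 1).and (eventually_ge_atTop 2)))))).mono ?_
  rintro Y ⟨hY, hR, hbig, hΛ, hb1, hY2⟩
  have hY2' : (2:ℝ) ≤ Y := by exact_mod_cast hY2
  have hb0 : 0 < b Y := by linarith
  set β := b Y with hβ
  have hYβ : (Y:ℝ) = β ^ M := by
    rw [hβ, hb, ← Real.rpow_natCast, ← Real.rpow_mul (by positivity)]
    rw [one_div_mul_cancel hM0.ne', Real.rpow_one]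
  set L := β ^ 4 with hL
  have hL1 : 1 ≤ L := one_le_pow₀ hb1
  have hL0 : 0 < L := by linarith
  set Q := ⌊Real.exp (49 / 200 * L)⌋₊ with hQ
  have hQe : (Q:ℝ) ≤ Real.exp (49 / 200 * L) := Nat.floor_le (by positivity)
  refine (sum_charErr_le hL1 hQe).trans (le_trans ?_ hR)
  set G : ℕ → ℝ := fun f => (f.totient : ℝ)⁻¹ * ∑ ψ ∈ primChars f, ‖charW ψ L‖ with hG
  have hG0 : ∀ f, 0 ≤ G f := fun f => by positivity
  have hlog1 : (1:ℝ) ≤ Real.log (Y + 1) := by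
    rw [Real.le_log_iff_exp_le (by linarith)]
    have := Real.exp_one_lt_d9; linarith
  have hsmall : ∀ f ∈ Ioc 1 Y, G f ≤ C₁ * (β ^ 4 / β ^ (3 * J)) := by
    intro f hf
    rw [mem_Ioc] at hf
    have : NeZero f := ⟨by omega⟩
    have hφ : (0:ℝ) < f.totient := by exact_mod_cast Nat.totient_pos.2 (by omega)
    have hX : 0 ≤ C₁ * (β ^ 4 / β ^ (3 * J)) := by positivity
    rw [hG]
    simp only
    rw [inv_mul_le_iff₀ hφ]
    calc _ ≤ (primChars f).card • (C₁ * (β ^ 4 / β ^ (3 * J))) := by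
          refine sum_le_card_nsmul _ _ _ fun χ hχ => ?_
          have hχ1 := ne_one_of_mem_primChars (by omega) hχ
          have hlb := hY f hf.2 χ (mem_primChars.1 hχ) hχ1
          have hl2 : Real.log (((Y:ℝ) + 1) ^ 2) = 2 * Real.log (Y + 1) := by rw [Real.log_pow]; norm_num
          have hfY : (f:ℝ) ≤ Y := by exact_mod_cast hf.2
          refine h₁ β (1 / (10 ^ 11 * (2 * Real.log (Y + 1)) ^ 8)) (((Y:ℝ) + 1) ^ 2) f χ hb1 ?_ ?_ hχ1 (by positivity) ?_ hlb ?_ hΛ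
          · rw [hl2]; linarith
          · nlinarith
          · rw [div_le_one (by positivity)]
            have : (1:ℝ) ≤ (2 * Real.log (Y + 1)) ^ 8 := one_le_pow₀ (by linarith)
            linarith
          · rw [hl2]
            refine le_trans (le_of_eq ?_) hbig
            field_simp
      _ ≤ _ := by
          rw [nsmul_eq_mul]
          gcongr
          exact_mod_cast primChars_card_le f
  have hsum : ∑ f ∈ Ioc 1 Q, G f ≤ (C₁ + C₂) / L ^ (K + 5) + C₂ * L ^ 6 * Real.exp (-(L / 200)) := by
    calc _ ≤ ∑ f ∈ Ioc 1 Y ∪ Ioc Y Q, G f := by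
          refine sum_le_sum_of_subset_of_nonneg (fun f hf => ?_) fun f _ _ => hG0 f
          rw [mem_union, mem_Ioc, mem_Ioc]; rw [mem_Ioc] at hf; omega
      _ ≤ ∑ f ∈ Ioc 1 Y, G f + ∑ f ∈ Ioc Y Q, G f := by
          rw [← sum_union_inter]
          exact le_add_of_nonneg_right (sum_nonneg fun f _ => hG0 f)
      _ ≤ Y * (C₁ * (β ^ 4 / β ^ (3 * J))) + C₂ * L ^ 6 * (1 / Y + Real.exp (-(L / 200))) := by
          refine add_le_add ?_ (h₂ L hL1 Y Q (by omega) hQe)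
          refine (sum_le_card_nsmul _ _ _ hsmall).trans ?_
          rw [nsmul_eq_mul, Nat.card_Ioc]
          have : ((Y - 1 : ℕ) : ℝ) ≤ Y := by exact_mod_cast Nat.sub_le Y 1
          gcongr
      _ ≤ C₁ / L ^ (K + 5) + (C₂ / L ^ (K + 5) + C₂ * L ^ 6 * Real.exp (-(L / 200))) := by
          rw [mul_add (C₂ * L ^ 6)]
          refine add_le_add ?_ (add_le_add ?_ le_rfl)
          · rw [hYβ, hL, ← pow_mul]
            calc β ^ M * (C₁ * (β ^ 4 / β ^ (3 * J))) = C₁ * β ^ (M + 4) / β ^ (3 * J) := by rw [pow_add]; ring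
              _ ≤ C₁ / β ^ (4 * (K + 5)) := by
                rw [div_le_div_iff₀ (by positivity) (by positivity), mul_assoc, ← pow_add]
                gcongr ?_ * ?_
                exact pow_le_pow_right₀ hb1 (by omega)
          · rw [hYβ, hM, pow_mul, ← hL]
            have : L ^ (K + 11) = L ^ 6 * L ^ (K + 5) := by rw [← pow_add]; congr 1; ring
            rw [this]
            apply le_of_eq
            field_simp
      _ = _ := by ring
  calc _ ≤ (3 * L) ^ 4 * ((C₁ + C₂) / L ^ (K + 5) + C₂ * L ^ 6 * Real.exp (-(L / 200))) + 3 * L ^ 2 * Real.exp (-(L / 2)) := by gcongr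
    _ = _ := by
      have : L ^ (K + 5) = L ^ 4 * L ^ (K + 1) := by rw [← pow_add]; congr 1; ring
      rw [this]
      field_simp
      ring

/-- The sum of `Λ(n)` over `n ≡ c (mod q)` with the smooth weight. -/
noncomputable def progW (q c : ℕ) (L : ℝ) : ℝ := ∑ n ∈ wtSupp L with n ≡ c [MOD q], vonMangoldt n * wt L n

theorem abs_progW_sub_le {L : ℝ} (hL : 1 ≤ L) {q c : ℕ} (hq : 1 ≤ q) (hc : c.Coprime q) :
    |progW q c L - psiW L / q.totient| ≤ charErr q L + 3 * L * Real.log q * Real.exp (-L) := by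
  have : NeZero q := ⟨by omega⟩
  have hφ : (0:ℝ) < q.totient := by exact_mod_cast Nat.totient_pos.2 hq
  have hφ1 : (1:ℝ) ≤ q.totient := by exact_mod_cast Nat.totient_pos.2 hq
  have hcu : IsUnit (c : ZMod q) := (ZMod.isUnit_iff_coprime _ _).2 hc
  have h1 : (progW q c L : ℂ) = (q.totient : ℂ)⁻¹ * ∑ χ : DirichletCharacter ℂ q, χ (c:ZMod q)⁻¹ * charW χ L := by
    simp only [charW, mul_sum]
    rw [sum_comm, progW, sum_filter]
    push_cast
    refine sum_congr rfl fun n _ => ?_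
    have := DirichletCharacter.sum_char_inv_mul_char_eq ℂ hcu (n : ZMod q)
    have e : ∑ χ : DirichletCharacter ℂ q, (q.totient : ℂ)⁻¹ * (χ (c:ZMod q)⁻¹ * (χ n * vonMangoldt n * wt L n)) =
        (q.totient : ℂ)⁻¹ * (vonMangoldt n * wt L n) * ∑ χ : DirichletCharacter ℂ q, χ (c:ZMod q)⁻¹ * χ n := by
      rw [mul_sum]; refine sum_congr rfl fun χ _ => by ring
    rw [e, this]
    have hiff : (c : ZMod q) = n ↔ n ≡ c [MOD q] := by
      rw [eq_comm, ZMod.natCast_eq_natCast_iff]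
    have hne : (q.totient : ℂ) ≠ 0 := by exact_mod_cast hφ.ne'
    by_cases h : n ≡ c [MOD q]
    · rw [if_pos h, if_pos (hiff.2 h)]; push_cast; field_simp
    · rw [if_neg h, if_neg (hiff.not.2 h)]; simp
  have h2 : ∑ χ : DirichletCharacter ℂ q, χ (c:ZMod q)⁻¹ * charW χ L = charW (1 : DirichletCharacter ℂ q) L +
      ∑ χ ∈ nonprincipalChars q, χ (c:ZMod q)⁻¹ * charW χ L := by
    classical
    rw [← sum_filter_add_sum_filter_not univ (fun χ : DirichletCharacter ℂ q => χ = 1)]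
    congr 1
    · rw [filter_eq' , if_pos (mem_univ _), sum_singleton, MulChar.one_apply, one_mul]
      exact IsUnit.of_mul_eq_one c (by rw [mul_comm]; exact ZMod.coe_mul_inv_eq_one c hc)
    · refine sum_congr ?_ fun _ _ => rfl
      ext χ; simp [mem_nonprincipalChars]
  have h3 : charW (1 : DirichletCharacter ℂ q) L = psiW L - ∑ n ∈ wtSupp L with ¬ n.Coprime q, (vonMangoldt n * wt L n : ℝ) := by
    rw [charW, psiW, eq_sub_iff_add_eq, sum_filter]
    push_cast
    rw [← sum_add_distrib]
    refine sum_congr rfl fun n _ => ?_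
    by_cases h : n.Coprime q
    · rw [if_neg (not_not.2 h), MulChar.one_apply ((ZMod.isUnit_iff_coprime _ _).2 h)]; simp
    · rw [if_pos h, MulChar.map_nonunit _ (by rwa [ZMod.isUnit_iff_coprime])]; simp
  set τ := ∑ n ∈ wtSupp L with ¬ n.Coprime q, (vonMangoldt n * wt L n : ℝ) with hτ
  have hτ1 := sum_vonMangoldt_mul_wt_not_coprime_le hL hq
  rw [← hτ] at hτ1
  have hτ0 : 0 ≤ τ := sum_nonneg fun n _ => mul_nonneg vonMangoldt_nonneg (wt_nonneg _ _)
  have h4 : ((progW q c L - psiW L / q.totient : ℝ) : ℂ) = (q.totient : ℂ)⁻¹ * (∑ χ ∈ nonprincipalChars q, χ (c:ZMod q)⁻¹ * charW χ L - τ) := by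
    push_cast
    rw [h1, h2, h3]
    ring
  rw [← Real.norm_eq_abs, ← Complex.norm_real (progW q c L - psiW L / q.totient)] 
  rw [h4, norm_mul, norm_inv, Complex.norm_natCast, charErr]
  have h5 : ‖∑ χ ∈ nonprincipalChars q, χ (c:ZMod q)⁻¹ * charW χ L‖ ≤ ∑ χ ∈ nonprincipalChars q, ‖charW χ L‖ := by
    refine (norm_sum_le _ _).trans (sum_le_sum fun χ _ => ?_)
    rw [norm_mul]
    exact mul_le_of_le_one_left (norm_nonneg _) (χ.norm_le_one _)
  have h6 : (q.totient : ℝ)⁻¹ * τ ≤ τ := mul_le_of_le_one_left hτ0 (inv_le_one_of_one_le₀ hφ1)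
  calc _ ≤ (q.totient : ℝ)⁻¹ * (∑ χ ∈ nonprincipalChars q, ‖charW χ L‖ + τ) := by
        gcongr
        refine (norm_sub_le _ _).trans (add_le_add h5 (le_of_eq ?_))
        rw [Complex.norm_real, Real.norm_of_nonneg hτ0]
    _ ≤ _ := by rw [mul_add]; linarith

end

section

open Finset Filter Topology

theorem norm_prod_one_add_sub_one_sub_sum_le {ι : Type*} (s : Finset ι) (f : ι → ℂ) :
    ‖∏ i ∈ s, (1 + f i) - 1 - ∑ i ∈ s, f i‖ ≤ Real.exp (∑ i ∈ s, ‖f i‖) - 1 - ∑ i ∈ s, ‖f i‖ := by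
  classical
  induction s using Finset.induction_on with
  | empty => simp
  | insert a s ha ih =>
    rw [prod_insert ha, sum_insert ha, sum_insert ha, Real.exp_add]
    have e : (1 + f a) * ∏ i ∈ s, (1 + f i) - 1 - (f a + ∑ i ∈ s, f i) =
        (∏ i ∈ s, (1 + f i) - 1 - ∑ i ∈ s, f i) + f a * (∏ i ∈ s, (1 + f i) - 1) := by ring
    have h1 := norm_prod_one_add_sub_one_le s f
    have h2 := Real.add_one_le_exp ‖f a‖
    have h3 := Real.exp_pos (∑ i ∈ s, ‖f i‖)
    rw [e]
    calc _ ≤ _ := norm_add_le _ _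
      _ ≤ (Real.exp (∑ i ∈ s, ‖f i‖) - 1 - ∑ i ∈ s, ‖f i‖) + ‖f a‖ * (Real.exp (∑ i ∈ s, ‖f i‖) - 1) := by
        rw [norm_mul]; gcongr
      _ ≤ _ := by nlinarith

/-- The local ratio of zeta Euler factors. -/
noncomputable def zetaRatio (q x y : ℂ) : ℂ := (1 - x * y * q) / ((1 - x * q) * (1 - y * q))

theorem norm_one_sub_mul_ge {q : ℝ} (hq0 : 0 ≤ q) (hq : q ≤ 1 / 2) {x : ℂ} (hx : ‖x‖ ≤ 1) : 1 / 2 ≤ ‖1 - x * q‖ := by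
  have h := norm_sub_norm_le (1:ℂ) (x * q)
  rw [norm_one, norm_mul, Complex.norm_real, Real.norm_of_nonneg hq0] at h
  nlinarith [norm_nonneg x]

theorem zetaRatio_den_ne_zero {q : ℝ} (hq0 : 0 ≤ q) (hq : q ≤ 1 / 2) {x : ℂ} (hx : ‖x‖ ≤ 1) : 1 - x * q ≠ 0 := by
  have := norm_one_sub_mul_ge hq0 hq hx
  rw [← norm_pos_iff]; linarith

theorem norm_zetaRatio_sub_le {q r : ℝ} (hq0 : 0 ≤ q) (hq : q ≤ 1 / 2) (hr : r ≤ 1) {x y : ℂ} (hx : ‖x‖ ≤ r) (hy : ‖y‖ ≤ r) :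
    ‖zetaRatio q x y - 1‖ ≤ 16 * q * r ∧ ‖zetaRatio q x y - 1 + q * (x * y - x - y)‖ ≤ 40 * q ^ 2 := by
  have hx1 := hx.trans hr
  have hy1 := hy.trans hr
  have hx0 := norm_nonneg x
  have hy0 := norm_nonneg y
  have nx := norm_one_sub_mul_ge hq0 hq hx1
  have ny := norm_one_sub_mul_ge hq0 hq hy1
  have dx := zetaRatio_den_ne_zero hq0 hq hx1
  have dy := zetaRatio_den_ne_zero hq0 hq hy1
  have nd : 1 / 4 ≤ ‖(1 - x * q) * (1 - y * q)‖ := by rw [norm_mul]; nlinarith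
  have hqn : ‖(q:ℂ)‖ = q := by rw [Complex.norm_real, Real.norm_of_nonneg hq0]
  have hxy : ‖x * y‖ ≤ r := by rw [norm_mul]; nlinarith
  have hr0 : 0 ≤ r := hx0.trans hx
  constructor
  · have e : zetaRatio q x y - 1 = (q * (x + y - x * y - x * y * q)) / ((1 - x * q) * (1 - y * q)) := by
      rw [zetaRatio]; field_simp; ring
    rw [e, norm_div, div_le_iff₀ (by linarith), norm_mul, hqn]
    have h1 : ‖x + y - x * y - x * y * q‖ ≤ 4 * r := by
      calc _ ≤ ‖x‖ + ‖y‖ + ‖x * y‖ + ‖x * y * q‖ := by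
            refine (norm_sub_le _ _).trans (add_le_add_left ((norm_sub_le _ _).trans (add_le_add_left (norm_add_le _ _) _)) _)
        _ ≤ r + r + r + r * 1 := by
            rw [norm_mul (x * y), hqn]
            gcongr
            linarith
        _ = _ := by ring
    have : 0 ≤ q * r := by positivity
    nlinarith
  · have e : zetaRatio q x y - 1 + q * (x * y - x - y) =
        (q ^ 2 * (-(x * y) + (x + y - x * y) * (x + y - x * y * q))) / ((1 - x * q) * (1 - y * q)) := by
      rw [zetaRatio]; field_simp; ring
    rw [e, norm_div, div_le_iff₀ (by linarith), norm_mul, norm_pow, hqn]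
    have hxy1 := hxy.trans hr
    have h1 : ‖x + y - x * y‖ ≤ 3 := by
      refine (norm_sub_le _ _).trans ?_
      have := norm_add_le x y
      linarith
    have h2 : ‖x + y - x * y * q‖ ≤ 3 := by
      refine (norm_sub_le _ _).trans ?_
      have := norm_add_le x y
      rw [norm_mul _ (q:ℂ), hqn]
      nlinarith [norm_nonneg (x * y)]
    have h3 : ‖-(x * y) + (x + y - x * y) * (x + y - x * y * q)‖ ≤ 10 := by
      refine (norm_add_le _ _).trans ?_
      rw [norm_neg, norm_mul (x + y - x * y)]
      nlinarith [norm_nonneg (x + y - x * y * q)]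
    have : 0 ≤ q ^ 2 := by positivity
    nlinarith

variable {ι : Type*} [Fintype ι]

/-- The local factor of the sieve sum at a prime. -/
noncomputable def locFactor (g : ℂ) (x y : ι → ℂ) : ℂ := 1 + g * ∑ i, (x i * y i - x i - y i)

theorem norm_prod_zetaRatio_sub_one_le {q r : ℝ} (hq0 : 0 ≤ q) (hq : q ≤ 1 / 2) (hkq : 100 * Fintype.card ι * q ≤ 1) (hr : r ≤ 1)
    (hr0 : 0 ≤ r) {x y : ι → ℂ} (hx : ∀ i, ‖x i‖ ≤ r) (hy : ∀ i, ‖y i‖ ≤ r) :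
    ‖∏ i, zetaRatio q (x i) (y i) - 1‖ ≤ 32 * Fintype.card ι * q * r := by
  have h := norm_prod_one_add_sub_one_le univ fun i => zetaRatio q (x i) (y i) - 1
  simp only [add_sub_cancel] at h
  have hS : ∑ i, ‖zetaRatio q (x i) (y i) - 1‖ ≤ 16 * Fintype.card ι * q * r := by
    calc _ ≤ ∑ i : ι, 16 * q * r := sum_le_sum fun i _ => (norm_zetaRatio_sub_le hq0 hq hr (hx i) (hy i)).1
      _ = _ := by rw [sum_const, card_univ, nsmul_eq_mul]; ring
  set S := ∑ i, ‖zetaRatio q (x i) (y i) - 1‖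
  have hS0 : 0 ≤ S := sum_nonneg fun _ _ => norm_nonneg _
  have hS1 : S ≤ 1 := by
    have : 0 ≤ Fintype.card ι * q := by positivity
    nlinarith
  have := abs_le.1 (Real.abs_exp_sub_one_sub_id_le (abs_le.2 ⟨by linarith, hS1⟩))
  nlinarith

theorem norm_locFactor_mul_sub_one_le {q : ℝ} {g : ℂ} (hq0 : 0 ≤ q) (hq : q ≤ 1 / 2) (hkq : 100 * Fintype.card ι * q ≤ 1)
    (hg : ‖g - q‖ ≤ 2 * q ^ 2) {x y : ι → ℂ} (hx : ∀ i, ‖x i‖ ≤ 1) (hy : ∀ i, ‖y i‖ ≤ 1) :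
    ‖locFactor g x y * ∏ i, zetaRatio q (x i) (y i) - 1‖ ≤ 1000 * (Fintype.card ι + 1) ^ 2 * q ^ 2 := by
  set k : ℝ := ((Fintype.card ι : ℕ) : ℝ) with hk
  have hk0 : 0 ≤ k := by positivity
  have h := norm_prod_one_add_sub_one_sub_sum_le univ fun i => zetaRatio q (x i) (y i) - 1
  simp only [add_sub_cancel] at h
  have hS : ∑ i, ‖zetaRatio q (x i) (y i) - 1‖ ≤ 16 * k * q := by
    calc _ ≤ ∑ i : ι, 16 * q * 1 := sum_le_sum fun i _ => (norm_zetaRatio_sub_le hq0 hq le_rfl (hx i) (hy i)).1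
      _ = _ := by rw [sum_const, card_univ, nsmul_eq_mul]; ring
  set S := ∑ i, ‖zetaRatio q (x i) (y i) - 1‖
  set σ := ∑ i, (x i * y i - x i - y i) with hσ
  set B := ∏ i, zetaRatio q (x i) (y i) with hB
  have hS0 : 0 ≤ S := sum_nonneg fun _ _ => norm_nonneg _
  have hkq0 : 0 ≤ k * q := by positivity
  have hS1 : S ≤ 1 := by nlinarith
  have h1 := (abs_le.1 (Real.abs_exp_sub_one_sub_id_le (abs_le.2 ⟨by linarith, hS1⟩))).2
  have hσ3 : ‖σ‖ ≤ 3 * k := by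
    calc _ ≤ ∑ i : ι, (3:ℝ) := by
          refine norm_sum_le_of_le _ fun i _ => ?_
          have h1 := norm_sub_le (x i * y i - x i) (y i)
          have h2 := norm_sub_le (x i * y i) (x i)
          rw [norm_mul] at h2
          nlinarith [hx i, hy i, norm_nonneg (x i), norm_nonneg (y i)]
      _ = _ := by rw [sum_const, card_univ, nsmul_eq_mul]; ring
  have h2 : ‖∑ i, (zetaRatio q (x i) (y i) - 1) + q * σ‖ ≤ 40 * k * q ^ 2 := by
    rw [hσ, mul_sum, ← sum_add_distrib]
    calc _ ≤ ∑ i : ι, 40 * q ^ 2 := norm_sum_le_of_le _ fun i _ => (norm_zetaRatio_sub_le hq0 hq le_rfl (hx i) (hy i)).2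
      _ = _ := by rw [sum_const, card_univ, nsmul_eq_mul]; ring
  set e := B - 1 + q * σ with he
  have h3 : ‖e‖ ≤ (256 * k ^ 2 + 40 * k) * q ^ 2 := by
    have : e = (B - 1 - ∑ i, (zetaRatio q (x i) (y i) - 1)) + (∑ i, (zetaRatio q (x i) (y i) - 1) + q * σ) := by rw [he]; ring
    rw [this]
    refine (norm_add_le _ _).trans ?_
    have : S ^ 2 ≤ (16 * k * q) ^ 2 := by gcongr
    nlinarith
  set e' := (g - q) * σ with he'
  have h4 : ‖e'‖ ≤ 6 * k * q ^ 2 := by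
    rw [he', norm_mul]
    calc _ ≤ 2 * q ^ 2 * (3 * k) := by gcongr
      _ = _ := by ring
  have hqσ : ‖q * σ‖ ≤ 3 / 100 := by
    rw [norm_mul, Complex.norm_real, Real.norm_of_nonneg hq0]; nlinarith
  have hqσ2 : ‖(q * σ) ^ 2‖ ≤ 9 * k ^ 2 * q ^ 2 := by
    rw [norm_pow, norm_mul, Complex.norm_real, Real.norm_of_nonneg hq0]
    calc _ ≤ (q * (3 * k)) ^ 2 := by gcongr
      _ = _ := by ring
  have e1 : locFactor g x y * B - 1 = -(q * σ) ^ 2 + e + e' + (q * σ) * e - (q * σ) * e' + e' * e := by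
    rw [locFactor, ← hσ, he, he']; ring
  have h5 : ‖e'‖ ≤ 1 := by
    have : k * q ^ 2 ≤ 1 / 100 * (1 / 2) := by nlinarith
    linarith
  rw [e1]
  calc _ ≤ ‖(q * σ) ^ 2‖ + ‖e‖ + ‖e'‖ + ‖q * σ‖ * ‖e‖ + ‖q * σ‖ * ‖e'‖ + ‖e'‖ * ‖e‖ := by
        rw [← norm_mul, ← norm_mul, ← norm_mul, ← norm_neg ((q * σ) ^ 2)]
        refine (norm_add_le _ _).trans (add_le_add_left ((norm_sub_le _ _).trans (add_le_add_left ((norm_add_le _ _).trans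
          (add_le_add_left ((norm_add_le _ _).trans (add_le_add_left (norm_add_le _ _) _)) _)) _)) _)
    _ ≤ 9 * k ^ 2 * q ^ 2 + ‖e‖ + ‖e'‖ + 1 * ‖e‖ + 1 * ‖e'‖ + 1 * ‖e‖ := by
        gcongr <;> linarith
    _ ≤ _ := by
        have : 0 ≤ q ^ 2 := by positivity
        have : 0 ≤ k * q ^ 2 := by positivity
        nlinarith

end

section

open Finset Filter Topology

variable {ι : Type*} [Fintype ι]

/-- The primes in `[D, X)`. -/
def sievePrimes (D X : ℕ) : Finset ℕ := (Ico D X).filter Nat.Prime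

theorem mem_sievePrimes {D X p : ℕ} : p ∈ sievePrimes D X ↔ (D ≤ p ∧ p < X) ∧ p.Prime := by
  simp [sievePrimes]

theorem primesBelow_eq_sievePrimes (n : ℕ) : n.primesBelow = sievePrimes 0 n := by
  ext p; simp [mem_sievePrimes, Nat.mem_primesBelow]

theorem prod_sievePrimes_mul {M : Type*} [CommMonoid M] (f : ℕ → M) {a b c : ℕ} (hab : a ≤ b) (hbc : b ≤ c) :
    (∏ p ∈ sievePrimes a b, f p) * ∏ p ∈ sievePrimes b c, f p = ∏ p ∈ sievePrimes a c, f p := by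
  simp only [sievePrimes, prod_filter]
  exact prod_Ico_consecutive _ hab hbc

theorem sum_sievePrimes_add {M : Type*} [AddCommMonoid M] (f : ℕ → M) {a b c : ℕ} (hab : a ≤ b) (hbc : b ≤ c) :
    (∑ p ∈ sievePrimes a b, f p) + ∑ p ∈ sievePrimes b c, f p = ∑ p ∈ sievePrimes a c, f p := by
  simp only [sievePrimes, sum_filter]
  exact sum_Ico_consecutive _ hab hbc

/-- The quotient of zeta values giving the size of the sieve Euler product. -/
noncomputable def zetaQuot (s s' : ι → ℂ) : ℂ :=
  ∏ i, (riemannZeta (1 + (s i + s' i)) / (riemannZeta (1 + s i) * riemannZeta (1 + s' i)))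

/-- The inverse Euler factor at `p` of `zetaQuot`. -/
noncomputable def zetaRatioAt (s s' : ι → ℂ) (p : ℕ) : ℂ :=
  ∏ i, zetaRatio ((1 / p : ℝ) : ℂ) ((p : ℂ) ^ (-s i)) ((p : ℂ) ^ (-s' i))

/-- The sieve Euler factor at `p`. -/
noncomputable def locFactorAt (g : ℕ → ℝ) (s s' : ι → ℂ) (p : ℕ) : ℂ :=
  locFactor (g p) (fun i => (p : ℂ) ^ (-s i)) (fun i => (p : ℂ) ^ (-s' i))

theorem tendsto_prod_zetaRatioAt {s s' : ι → ℂ} (hs : ∀ i, 0 < (s i).re) (hs' : ∀ i, 0 < (s' i).re) :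
    Tendsto (fun n => ∏ p ∈ sievePrimes 0 n, zetaRatioAt s s' p) atTop (𝓝 (zetaQuot s s')⁻¹) := by
  have hz : ∀ w : ℂ, 0 < w.re → Tendsto (fun n => ∏ p ∈ sievePrimes 0 n, (1 - (p:ℂ) ^ (-w) * ((1 / p : ℝ) : ℂ))) atTop
      (𝓝 (riemannZeta (1 + w))⁻¹) := by
    intro w hw
    have hr : 1 < (1 + w).re := by simpa using hw
    have h := (riemannZeta_eulerProduct hr).inv₀ (riemannZeta_ne_zero_of_one_lt_re hr)
    refine h.congr fun n => ?_
    rw [primesBelow_eq_sievePrimes, ← prod_inv_distrib]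
    refine prod_congr rfl fun p hp => ?_
    have hp0 : (p:ℂ) ≠ 0 := by exact_mod_cast (mem_sievePrimes.1 hp).2.ne_zero
    rw [inv_inv, neg_add, Complex.cpow_add _ _ hp0, Complex.cpow_neg_one]
    push_cast
    ring
  have e : (zetaQuot s s')⁻¹ = ∏ i, (riemannZeta (1 + (s i + s' i)))⁻¹ / ((riemannZeta (1 + s i))⁻¹ * (riemannZeta (1 + s' i))⁻¹) := by
    rw [zetaQuot, ← prod_inv_distrib]
    refine prod_congr rfl fun i _ => ?_
    rw [inv_div, ← mul_inv, inv_div_inv]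
  rw [e]
  have h := tendsto_finsetProd univ fun i _ => (hz (s i + s' i) (by simpa using add_pos (hs i) (hs' i))).div
    ((hz (s i) (hs i)).mul (hz (s' i) (hs' i))) (mul_ne_zero (inv_ne_zero (riemannZeta_ne_zero_of_one_lt_re (by simpa using hs i)))
      (inv_ne_zero (riemannZeta_ne_zero_of_one_lt_re (by simpa using hs' i))))
  refine h.congr fun n => ?_
  simp only [zetaRatioAt, Pi.div_apply]
  refine Eq.trans ?_ prod_comm
  refine prod_congr rfl fun p hp => ?_
  rw [← prod_mul_distrib, ← prod_div_distrib]
  refine prod_congr rfl fun q hq => ?_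
  have hp0 : (q:ℂ) ≠ 0 := by exact_mod_cast (mem_sievePrimes.1 hq).2.ne_zero
  rw [zetaRatio, neg_add, Complex.cpow_add _ _ hp0]

theorem zetaQuot_ne_zero {s s' : ι → ℂ} (hs : ∀ i, 0 < (s i).re) (hs' : ∀ i, 0 < (s' i).re) : zetaQuot s s' ≠ 0 := by
  rw [zetaQuot, prod_ne_zero_iff]
  intro i _
  have h (w : ℂ) (hw : 0 < w.re) : riemannZeta (1 + w) ≠ 0 := riemannZeta_ne_zero_of_one_lt_re (by simpa using hw)
  exact div_ne_zero (h _ (by simpa using add_pos (hs i) (hs' i))) (mul_ne_zero (h _ (hs i)) (h _ (hs' i)))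

theorem sum_Ico_inv_sq_le {a b : ℕ} (ha : 2 ≤ a) : ∑ n ∈ Ico a b, (1 / (n:ℝ)) ^ 2 ≤ 2 / (a:ℝ) := by
  rcases le_total b a with h | h
  · rw [Ico_eq_empty_of_le h, sum_empty]; positivity
  have : ∑ n ∈ Ico a b, (1 / (n:ℝ)) ^ 2 ≤ 1 / ((a:ℝ) - 1) - 1 / ((b:ℝ) - 1) := by
    induction b, h using Nat.le_induction with
    | base => simp
    | succ b hb ih =>
      rw [sum_Ico_succ_top hb]
      have hb2 : (2:ℝ) ≤ b := by exact_mod_cast ha.trans hb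
      have : (1 / (b:ℝ)) ^ 2 ≤ 1 / ((b:ℝ) - 1) - 1 / b := by
        have h1 : (b:ℝ) - 1 ≠ 0 := by linarith
        have h2 : (b:ℝ) ≠ 0 := by linarith
        have e : 1 / ((b:ℝ) - 1) - 1 / b = 1 / (((b:ℝ) - 1) * b) := by field_simp; ring
        rw [e, div_pow, one_pow]
        apply one_div_le_one_div_of_le
        · have : 0 < (b:ℝ) - 1 := by linarith
          positivity
        · nlinarith
      push_cast
      rw [add_sub_cancel_right]
      linarith
  have ha2 : (2:ℝ) ≤ a := by exact_mod_cast ha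
  have hb2 : (2:ℝ) ≤ b := by exact_mod_cast ha.trans h
  have h3 : 0 ≤ 1 / ((b:ℝ) - 1) := by
    have : 0 < (b:ℝ) - 1 := by linarith
    positivity
  have h4 : 1 / ((a:ℝ) - 1) ≤ 2 / a := by
    rw [div_le_div_iff₀ (by linarith) (by linarith)]; linarith
  linarith

theorem exists_tail_rpow_le {σ ε : ℝ} (hσ : 0 < σ) (hε : 0 < ε) :
    ∃ X₀ : ℕ, ∀ X, X₀ ≤ X → ∀ Y, ∑ n ∈ Ico X Y, 1 / (n:ℝ) * (n:ℝ) ^ (-σ) ≤ ε := by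
  have hs : Summable fun n : ℕ => 1 / (n:ℝ) * (n:ℝ) ^ (-σ) := by
    refine ((Real.summable_nat_rpow (p := -1 - σ)).2 (by linarith)).congr_cofinite ?_
    filter_upwards [(Set.finite_singleton 0).compl_mem_cofinite] with n hn
    have : (n:ℝ) ≠ 0 := by simpa using hn
    rw [sub_eq_add_neg, Real.rpow_add (by positivity), Real.rpow_neg_one, one_div]
  have hnn : ∀ n : ℕ, 0 ≤ 1 / (n:ℝ) * (n:ℝ) ^ (-σ) := fun n => by positivity
  have ht := hs.hasSum.tendsto_sum_nat
  obtain ⟨X₀, hX₀⟩ := eventually_atTop.1 (ht.eventually (lt_mem_nhds (sub_lt_self _ hε)))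
  refine ⟨X₀, fun X hX Y => ?_⟩
  rcases le_total Y X with h | h
  · rw [Ico_eq_empty_of_le h]; simpa using hε.le
  have h1 := hX₀ X hX
  have h2 := hs.sum_le_tsum (range Y) fun n _ => hnn n
  rw [← sum_range_add_sum_Ico _ h] at h2
  linarith

/-- The sieve Euler product over `[D, X)` is close to the zeta quotient with the primes below `D` removed. -/
theorem exists_norm_prod_locFactorAt_sub_le {σ : ℝ} (hσ : 0 < σ) {D : ℕ} (hD : 2 ≤ D) (hkD : 100 * Fintype.card ι ≤ D)
    {g : ℕ → ℝ} (hg : ∀ p, p.Prime → |g p - 1 / p| ≤ 2 * (1 / p) ^ 2) :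
    ∃ X₀ : ℕ, ∀ X, X₀ ≤ X → ∀ s s' : ι → ℂ, (∀ i, (s i).re = σ) → (∀ i, (s' i).re = σ) →
      ‖∏ p ∈ sievePrimes D X, locFactorAt g s s' p - (∏ p ∈ sievePrimes 0 D, zetaRatioAt s s' p) * zetaQuot s s'‖ ≤
        (Real.exp (2001 * (Fintype.card ι + 1) ^ 2 / D) - 1) *
          ‖(∏ p ∈ sievePrimes 0 D, zetaRatioAt s s' p) * zetaQuot s s'‖ := by
  have hD0 : (0:ℝ) < D := by positivity
  have hD2 : (2:ℝ) ≤ D := by exact_mod_cast hD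
  have hkD' : 100 * (Fintype.card ι : ℝ) ≤ D := by exact_mod_cast hkD
  obtain ⟨X₀, hX₀⟩ := exists_tail_rpow_le (σ := σ) (ε := 1 / (32 * D)) hσ (by positivity)
  refine ⟨max X₀ D, fun X hX s s' hs hs' => ?_⟩
  have hXD : D ≤ X := (le_max_right _ _).trans hX
  have hsp : ∀ i, 0 < (s i).re := fun i => by rw [hs]; exact hσ
  have hsp' : ∀ i, 0 < (s' i).re := fun i => by rw [hs']; exact hσ
  set P := ∏ p ∈ sievePrimes D X, locFactorAt g s s' p
  set B := ∏ p ∈ sievePrimes 0 D, zetaRatioAt s s' p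
  set η := Real.exp (2001 * (Fintype.card ι + 1) ^ 2 / D) - 1
  have hn : ∀ (p : ℕ), p.Prime → ∀ w : ℂ, w.re = σ → ‖(p:ℂ) ^ (-w)‖ = (p:ℝ) ^ (-σ) := by
    intro p hp w hw
    rw [Complex.norm_natCast_cpow_of_pos hp.pos, Complex.neg_re, hw]
  have hn1 : ∀ p : ℕ, p.Prime → (p:ℝ) ^ (-σ) ≤ 1 := fun p hp =>
    Real.rpow_le_one_of_one_le_of_nonpos (by exact_mod_cast hp.one_le) (by linarith)
  have hq : ∀ p : ℕ, D ≤ p → (1 / p : ℝ) ≤ 1 / D := fun p hp => by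
    have : (D:ℝ) ≤ p := by exact_mod_cast hp
    gcongr
  have hq2 : ∀ p : ℕ, D ≤ p → (1 / p : ℝ) ≤ 1 / 2 := fun p hp =>
    (hq p hp).trans (by gcongr)
  have hkq : ∀ p : ℕ, D ≤ p → 100 * (Fintype.card ι : ℝ) * (1 / p : ℝ) ≤ 1 := fun p hp => by
    calc _ ≤ (D:ℝ) * (1 / D) := by
          gcongr
      _ = 1 := by field_simp
  have key : ∀ Y, X ≤ Y → ‖P * ∏ p ∈ sievePrimes 0 Y, zetaRatioAt s s' p - B‖ ≤ η * ‖B‖ := by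
    intro Y hY
    set A := ∏ p ∈ sievePrimes D X, (locFactorAt g s s' p * zetaRatioAt s s' p)
    set A' := ∏ p ∈ sievePrimes X Y, zetaRatioAt s s' p
    have e : P * ∏ p ∈ sievePrimes 0 Y, zetaRatioAt s s' p - B = B * (A * A' - 1) := by
      rw [← prod_sievePrimes_mul _ (Nat.zero_le D) (hXD.trans hY), ← prod_sievePrimes_mul _ hXD hY]
      simp only [A, prod_mul_distrib]
      ring
    rw [e, norm_mul, mul_comm]
    gcongr
    set u : ℕ → ℂ := fun p => (if p < X then locFactorAt g s s' p * zetaRatioAt s s' p else zetaRatioAt s s' p) - 1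
    have e2 : A * A' = ∏ p ∈ sievePrimes D Y, (1 + u p) := by
      rw [← prod_sievePrimes_mul _ hXD hY]
      congr 1
      · refine prod_congr rfl fun p hp => ?_
        simp only [u, if_pos (mem_sievePrimes.1 hp).1.2, add_sub_cancel]
      · refine prod_congr rfl fun p hp => ?_
        simp only [u, if_neg (not_lt.2 (mem_sievePrimes.1 hp).1.1), add_sub_cancel]
    rw [e2]
    refine (norm_prod_one_add_sub_one_le _ _).trans ?_
    simp only [η]
    gcongr
    rw [← sum_sievePrimes_add _ hXD hY]
    have h1 : ∑ p ∈ sievePrimes D X, ‖u p‖ ≤ 1000 * (Fintype.card ι + 1) ^ 2 * (2 / D) := by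
      calc _ ≤ ∑ p ∈ sievePrimes D X, 1000 * (Fintype.card ι + 1 : ℝ) ^ 2 * (1 / p : ℝ) ^ 2 := by
            refine sum_le_sum fun p hp => ?_
            obtain ⟨⟨h1, h2⟩, h3⟩ := mem_sievePrimes.1 hp
            simp only [u, if_pos h2]
            refine norm_locFactor_mul_sub_one_le (by positivity) (hq2 p h1) (hkq p h1) ?_ (fun i => ?_) (fun i => ?_)
            · rw [← Complex.ofReal_sub, Complex.norm_real]; exact hg p h3
            · rw [hn p h3 _ (hs i)]; exact hn1 p h3
            · rw [hn p h3 _ (hs' i)]; exact hn1 p h3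
        _ ≤ _ := by
            rw [← mul_sum]
            gcongr
            refine le_trans (sum_le_sum_of_subset_of_nonneg (filter_subset _ _) fun _ _ _ => by positivity) (sum_Ico_inv_sq_le hD)
    have h2 : ∑ p ∈ sievePrimes X Y, ‖u p‖ ≤ 32 * Fintype.card ι * (1 / (32 * D)) := by
      calc _ ≤ ∑ p ∈ sievePrimes X Y, 32 * Fintype.card ι * (1 / (p : ℝ) * (p:ℝ) ^ (-σ)) := by
            refine sum_le_sum fun p hp => ?_
            obtain ⟨⟨h1, h2⟩, h3⟩ := mem_sievePrimes.1 hp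
            simp only [u, if_neg (not_lt.2 h1)]
            refine (norm_prod_zetaRatio_sub_one_le (by positivity) (hq2 p (hXD.trans h1)) (hkq p (hXD.trans h1)) (hn1 p h3)
              (by positivity) (fun i => (hn p h3 _ (hs i)).le) (fun i => (hn p h3 _ (hs' i)).le)).trans (le_of_eq (by ring))
        _ ≤ _ := by
            rw [← mul_sum]
            gcongr
            exact (sum_le_sum_of_subset_of_nonneg (filter_subset _ _) fun _ _ _ => by positivity).trans
              (hX₀ X ((le_max_left _ _).trans hX) Y)
    have e3 : 2001 * (Fintype.card ι + 1 : ℝ) ^ 2 / D = 1000 * (Fintype.card ι + 1) ^ 2 * (2 / D) + (Fintype.card ι + 1) ^ 2 / D := by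
      ring
    have e4 : 32 * Fintype.card ι * (1 / (32 * (D:ℝ))) = Fintype.card ι / D := by field_simp
    have e5 : (Fintype.card ι : ℝ) / D ≤ (Fintype.card ι + 1) ^ 2 / D := by
      gcongr
      nlinarith [show (0:ℝ) ≤ Fintype.card ι by positivity]
    linarith
  have hlim : ‖P * (zetaQuot s s')⁻¹ - B‖ ≤ η * ‖B‖ := by
    refine le_of_tendsto (((tendsto_prod_zetaRatioAt hsp hsp').const_mul P).sub_const B).norm ?_
    filter_upwards [eventually_ge_atTop X] with Y hY using key Y hY
  have hne := zetaQuot_ne_zero hsp hsp'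
  have e : P - B * zetaQuot s s' = (P * (zetaQuot s s')⁻¹ - B) * zetaQuot s s' := by
    field_simp
  rw [e, norm_mul, norm_mul, ← mul_assoc]
  gcongr

end

section

open Finset Filter Topology

theorem norm_LSeries_one_add_le {a : ℕ → ℂ} (ha : ∀ n, ‖a n‖ ≤ 1) {w : ℂ} (hw : 0 < w.re) :
    ‖LSeries a (1 + w)‖ ≤ 1 + 1 / w.re := by
  have hL : 0 < 1 / w.re := by positivity
  have h1 : Summable fun n => ‖LSeries.term 1 (1 + 1 / ((1 / w.re : ℝ) : ℂ)) n‖ := (LSeriesSummable_one_add_inv hL).norm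
  have h2 : ∀ n, ‖LSeries.term a (1 + w) n‖ ≤ ‖LSeries.term 1 (1 + 1 / ((1 / w.re : ℝ) : ℂ)) n‖ := by
    intro n
    rcases eq_or_ne n 0 with rfl | hn
    · simp
    · rw [LSeries.norm_term_eq, LSeries.norm_term_eq, if_neg hn, if_neg hn]
      have e : (1 + 1 / ((1 / w.re : ℝ) : ℂ)).re = (1 + w).re := by
        rw [one_div, ← Complex.ofReal_inv]; simp
      rw [e, Pi.one_apply, norm_one]
      gcongr
      exact ha n
  exact (tsum_of_norm_bounded h1.hasSum h2).trans (absSeries_one_le hL)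

theorem norm_riemannZeta_one_add_le {w : ℂ} (hw : 0 < w.re) : ‖riemannZeta (1 + w)‖ ≤ 1 + 1 / w.re := by
  rw [← LSeries_one_eq_riemannZeta (by simpa using hw)]
  exact norm_LSeries_one_add_le (fun n => by simp) hw

theorem norm_inv_riemannZeta_one_add_le {w : ℂ} (hw : 0 < w.re) : ‖(riemannZeta (1 + w))⁻¹‖ ≤ 1 + 1 / w.re := by
  have hs : 1 < (1 + w).re := by simpa using hw
  have h := LSeries_one_mul_Lseries_moebius hs
  rw [LSeries_one_eq_riemannZeta hs] at h
  rw [← eq_inv_of_mul_eq_one_right h]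
  refine norm_LSeries_one_add_le (fun n => ?_) hw
  norm_cast
  exact ArithmeticFunction.abs_moebius_le_one

theorem tendsto_const_div_atTop_nhdsNE {z : ℂ} (hz : z ≠ 0) : Tendsto (fun L : ℝ => (1:ℂ) + z / L) atTop (𝓝[≠] 1) := by
  rw [tendsto_nhdsWithin_iff]
  constructor
  · have : Tendsto (fun L : ℝ => ((L⁻¹ : ℝ) : ℂ)) atTop (𝓝 0) := by
      have := (Complex.continuous_ofReal.tendsto (0:ℝ)).comp tendsto_inv_atTop_zero
      rw [Complex.ofReal_zero] at this
      exact this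
    have := (this.const_mul z).const_add 1
    simpa [div_eq_mul_inv] using this
  · filter_upwards [eventually_gt_atTop 0] with L hL
    have : (L:ℂ) ≠ 0 := by exact_mod_cast hL.ne'
    simp [hz, this]

theorem tendsto_zeta_one_add_div {z : ℂ} (hz : z ≠ 0) :
    Tendsto (fun L : ℝ => riemannZeta (1 + z / L) / L) atTop (𝓝 (1 / z)) := by
  have := (riemannZeta_residue_one.comp (tendsto_const_div_atTop_nhdsNE hz)).div_const z
  refine this.congr' ?_
  filter_upwards [eventually_gt_atTop 0] with L hL
  have h1 : (L:ℂ) ≠ 0 := by exact_mod_cast hL.ne'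
  simp only [Function.comp]
  field_simp
  ring

/-- Near `1` and far away, `1/ζ(1+z/L)` is at most a constant times `|z|^2/L`. -/
theorem exists_norm_inv_zeta_le : ∃ C : ℝ, 0 ≤ C ∧ ∀ L : ℝ, 1 ≤ L → ∀ z : ℂ, z.re = 2 →
    ‖(riemannZeta (1 + z / L))⁻¹‖ ≤ C * ‖z‖ ^ 2 / L := by
  have h := riemannZeta_residue_one.norm.eventually (lt_mem_nhds (show (1/2:ℝ) < ‖(1:ℂ)‖ by norm_num))
  rw [eventually_nhdsWithin_iff, Metric.eventually_nhds_iff] at h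
  obtain ⟨δ, hδ, h⟩ := h
  refine ⟨2 + 2 / δ ^ 2, by positivity, fun L hL z hz => ?_⟩
  have hL0 : 0 < L := by linarith
  have hLc : (L:ℂ) ≠ 0 := by exact_mod_cast hL0.ne'
  have hz2 : 2 ≤ ‖z‖ := hz ▸ Complex.re_le_norm z
  have hz0 : z ≠ 0 := by rw [← norm_pos_iff]; linarith
  have hn : ‖z / L‖ = ‖z‖ / L := by rw [norm_div, Complex.norm_real, Real.norm_of_nonneg hL0.le]
  have hre : (z / L).re = 2 / L := by rw [Complex.div_ofReal_re, hz]
  have hnn : 0 ≤ ‖z‖ ^ 2 / L := by positivity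
  rw [mul_div_assoc]
  rcases lt_or_ge (‖z‖ / L) δ with h1 | h1
  · have h2 := h (y := 1 + z / L) (by rw [dist_eq_norm, add_sub_cancel_left, hn]; exact h1) (by simp [hz0, hLc])
    rw [add_sub_cancel_left, norm_mul, hn] at h2
    have hζ : 0 < ‖riemannZeta (1 + z / L)‖ := by
      by_contra! hc
      have := le_antisymm hc (norm_nonneg _)
      rw [this] at h2; norm_num at h2
    rw [norm_inv, inv_le_iff_one_le_mul₀ hζ]
    calc (1:ℝ) ≤ 2 * (‖z‖ / L * ‖riemannZeta (1 + z / L)‖) := by linarith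
      _ ≤ (2 + 2 / δ ^ 2) * (‖z‖ ^ 2 / L) * ‖riemannZeta (1 + z / L)‖ := by
        rw [← mul_assoc]
        gcongr ?_ * _
        have h3 : ‖z‖ / L ≤ ‖z‖ ^ 2 / L := by gcongr; nlinarith
        have h4 : 0 ≤ 2 / δ ^ 2 * (‖z‖ ^ 2 / L) := by positivity
        nlinarith
  · have h2 := norm_inv_riemannZeta_one_add_le (w := z / L) (by rw [hre]; positivity)
    rw [hre] at h2
    rw [le_div_iff₀ hL0] at h1
    have h3 : (δ * L) ^ 2 ≤ ‖z‖ ^ 2 := by gcongr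
    have h4 : 2 * L ≤ 2 / δ ^ 2 * (‖z‖ ^ 2 / L) := by
      rw [div_mul_div_comm, le_div_iff₀ (by positivity)]
      nlinarith
    have : 1 + 1 / (2 / L) = 1 + L / 2 := by field_simp
    nlinarith

theorem exists_norm_zeta_quot_le : ∃ C : ℝ, 0 ≤ C ∧ ∀ L : ℝ, 1 ≤ L → ∀ z z' : ℂ, z.re = 2 → z'.re = 2 →
    L * ‖riemannZeta (1 + (z / L + z' / L)) / (riemannZeta (1 + z / L) * riemannZeta (1 + z' / L))‖ ≤ C * (‖z‖ ^ 2 * ‖z'‖ ^ 2) := by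
  obtain ⟨C, hC, h⟩ := exists_norm_inv_zeta_le
  refine ⟨2 * C ^ 2, by positivity, fun L hL z z' hz hz' => ?_⟩
  have hL0 : 0 < L := by linarith
  have hre : (z / L + z' / L).re = 4 / L := by
    rw [Complex.add_re, Complex.div_ofReal_re, Complex.div_ofReal_re, hz, hz']; ring
  have h1 := norm_riemannZeta_one_add_le (w := z / L + z' / L) (by rw [hre]; positivity)
  rw [hre] at h1
  have h2 : ‖riemannZeta (1 + (z / L + z' / L))‖ ≤ 2 * L := by
    have : 1 + 1 / (4 / L) = 1 + L / 4 := by field_simp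
    linarith
  rw [div_eq_mul_inv, mul_inv, norm_mul, norm_mul]
  calc _ ≤ L * (2 * L * (C * ‖z‖ ^ 2 / L * (C * ‖z'‖ ^ 2 / L))) := by
        gcongr
        · exact h L hL z hz
        · exact h L hL z' hz'
    _ = _ := by field_simp

variable {ι : Type*} [Fintype ι]

/-- The normalised Euler product of the sieve sum. -/
noncomputable def normQuot (D : ℕ) (L : ℝ) (z z' : ι → ℂ) : ℂ :=
  (((∏ p ∈ sievePrimes 0 D, (1 - 1 / (p : ℝ))) * L : ℝ) : ℂ) ^ Fintype.card ι *
    ((∏ p ∈ sievePrimes 0 D, zetaRatioAt (fun i => z i / L) (fun i => z' i / L) p) *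
      zetaQuot (fun i => z i / L) (fun i => z' i / L))

theorem tendsto_normQuot (D : ℕ) {z z' : ι → ℂ} (hz : ∀ i, (z i).re = 2) (hz' : ∀ i, (z' i).re = 2) :
    Tendsto (fun L : ℝ => normQuot D L z z') atTop (𝓝 (∏ i, (z i * z' i / (z i + z' i)))) := by
  have hne : ∀ {w : ℂ}, 0 < w.re → w ≠ 0 := fun {w} hw h => by rw [h] at hw; simp at hw
  have h1 : ∀ i, Tendsto (fun L : ℝ => riemannZeta (1 + (z i / L + z' i / L)) / L / ((riemannZeta (1 + z i / L) / L) *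
      (riemannZeta (1 + z' i / L) / L))) atTop (𝓝 (z i * z' i / (z i + z' i))) := by
    intro i
    have h0 : z i ≠ 0 := hne (by rw [hz]; norm_num)
    have h0' : z' i ≠ 0 := hne (by rw [hz']; norm_num)
    have h0'' : z i + z' i ≠ 0 := hne (by rw [Complex.add_re, hz, hz']; norm_num)
    have := (tendsto_zeta_one_add_div h0'').div ((tendsto_zeta_one_add_div h0).mul (tendsto_zeta_one_add_div h0')) (by simp [h0, h0'])
    have e : 1 / (z i + z' i) / (1 / z i * (1 / z' i)) = z i * z' i / (z i + z' i) := by field_simp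
    rw [e] at this
    refine this.congr fun L => ?_
    simp [add_div]
  have h2 := tendsto_finsetProd univ fun i _ => h1 i
  have h3 : Tendsto (fun L : ℝ => ∏ p ∈ sievePrimes 0 D, ∏ i : ι, ((1 - ((1 / p : ℝ) : ℂ)) * zetaRatio ((1 / p : ℝ) : ℂ) ((p : ℂ) ^ (-(z i / L)))
      ((p : ℂ) ^ (-(z' i / L))))) atTop (𝓝 (∏ p ∈ sievePrimes 0 D, ∏ i : ι, (1:ℂ))) := by
    refine tendsto_finsetProd _ fun p hp => tendsto_finsetProd _ fun i _ => ?_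
    have hpp := (mem_sievePrimes.1 hp).2
    have hp0 : (p:ℂ) ≠ 0 := by exact_mod_cast hpp.ne_zero
    have hx : ∀ w : ℂ, Tendsto (fun L : ℝ => (p:ℂ) ^ (-(w / L))) atTop (𝓝 1) := by
      intro w
      have h0 : Tendsto (fun L : ℝ => -(w / L)) atTop (𝓝 0) := by
        have : Tendsto (fun L : ℝ => ((L⁻¹ : ℝ) : ℂ)) atTop (𝓝 0) := by
          have := (Complex.continuous_ofReal.tendsto (0:ℝ)).comp tendsto_inv_atTop_zero
          rw [Complex.ofReal_zero] at this
          exact this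
        have := (this.const_mul w).neg
        simpa [div_eq_mul_inv] using this
      have : Tendsto (fun L : ℝ => (p:ℂ) ^ (-(w / L))) atTop (𝓝 ((p:ℂ) ^ (0:ℂ))) := h0.const_cpow (Or.inl hp0)
      simpa using this
    have hq : (1:ℂ) - 1 * ((1 / p : ℝ) : ℂ) ≠ 0 := by
      have h2 : (2:ℝ) ≤ p := by exact_mod_cast hpp.two_le
      exact zetaRatio_den_ne_zero (x := 1) (by positivity) (by gcongr) (by simp)
    have := ((((hx (z i)).mul (hx (z' i))).mul_const (((1 / p : ℝ) : ℂ))).const_sub 1).div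
      ((((hx (z i)).mul_const (((1 / p : ℝ) : ℂ))).const_sub 1).mul (((hx (z' i)).mul_const (((1 / p : ℝ) : ℂ))).const_sub 1))
      (mul_ne_zero hq hq)
    have := this.const_mul (1 - ((1 / p : ℝ) : ℂ))
    have e : (1 - ((1 / p : ℝ) : ℂ)) * ((1 - 1 * 1 * ((1 / p : ℝ) : ℂ)) / ((1 - 1 * ((1 / p : ℝ) : ℂ)) * (1 - 1 * ((1 / p : ℝ) : ℂ)))) = 1 := by
      rw [one_mul] at hq
      simp only [one_mul]
      field_simp
    rw [e] at this
    exact this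
  have h4 := h3.mul h2
  simp only [prod_const_one, one_mul] at h4
  refine h4.congr' ?_
  filter_upwards [eventually_gt_atTop 0] with L hL
  have h1 : (L:ℂ) ≠ 0 := by exact_mod_cast hL.ne'
  have e1 : ∏ i, riemannZeta (1 + (z i / L + z' i / L)) / L / ((riemannZeta (1 + z i / L) / L) *
      (riemannZeta (1 + z' i / L) / L)) = (L:ℂ) ^ Fintype.card ι * zetaQuot (fun i => z i / L) (fun i => z' i / L) := by
    rw [zetaQuot, ← card_univ, ← prod_const, ← prod_mul_distrib]
    refine prod_congr rfl fun i _ => ?_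
    rw [← mul_div_mul_left _ _ (mul_ne_zero h1 h1)]
    field_simp
  have e2 : ∏ p ∈ sievePrimes 0 D, ∏ i : ι, ((1 - ((1 / p : ℝ) : ℂ)) * zetaRatio ((1 / p : ℝ) : ℂ) ((p : ℂ) ^ (-(z i / L)))
      ((p : ℂ) ^ (-(z' i / L)))) = ((∏ p ∈ sievePrimes 0 D, (1 - 1 / (p : ℝ)) : ℝ) : ℂ) ^ Fintype.card ι *
      ∏ p ∈ sievePrimes 0 D, zetaRatioAt (fun i => z i / L) (fun i => z' i / L) p := by
    rw [Complex.ofReal_prod, ← prod_pow, ← prod_mul_distrib]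
    refine prod_congr rfl fun p _ => ?_
    rw [prod_mul_distrib, prod_const, card_univ, zetaRatioAt]
    push_cast
    rfl
  rw [e1, e2, normQuot]
  push_cast
  ring

theorem exists_norm_normQuot_le (D : ℕ) : ∃ C : ℝ, 0 ≤ C ∧ ∀ L : ℝ, 1 ≤ L → ∀ z z' : ι → ℂ, (∀ i, (z i).re = 2) →
    (∀ i, (z' i).re = 2) → ‖normQuot D L z z'‖ ≤ C * ∏ i, (‖z i‖ ^ 2 * ‖z' i‖ ^ 2) := by
  obtain ⟨C, hC, h⟩ := exists_norm_zeta_quot_le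
  refine ⟨(8 ^ Fintype.card ι) ^ (sievePrimes 0 D).card * C ^ Fintype.card ι, by positivity, fun L hL z z' hz hz' => ?_⟩
  have hL0 : 0 < L := by linarith
  have hφ : ∀ p ∈ sievePrimes 0 D, 0 ≤ 1 - 1 / (p : ℝ) ∧ 1 - 1 / (p:ℝ) ≤ 1 := by
    intro p hp
    have h2 : (1:ℝ) ≤ p := by exact_mod_cast (mem_sievePrimes.1 hp).2.one_le
    have : 1 / (p:ℝ) ≤ 1 := by rw [div_le_one (by linarith)]; exact h2
    have : 0 ≤ 1 / (p:ℝ) := by positivity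
    constructor <;> linarith
  have hpr : ‖((∏ p ∈ sievePrimes 0 D, (1 - 1 / (p : ℝ)) : ℝ) : ℂ)‖ ≤ 1 := by
    rw [Complex.norm_real, Real.norm_of_nonneg (prod_nonneg fun p hp => (hφ p hp).1)]
    exact prod_le_one (fun p hp => (hφ p hp).1) fun p hp => (hφ p hp).2
  have hB : ‖∏ p ∈ sievePrimes 0 D, zetaRatioAt (fun i => z i / L) (fun i => z' i / L) p‖ ≤
      (8 ^ Fintype.card ι) ^ (sievePrimes 0 D).card := by
    rw [← prod_const, norm_prod]
    refine prod_le_prod (fun _ _ => norm_nonneg _) fun p hp => ?_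
    have hpp := (mem_sievePrimes.1 hp).2
    rw [zetaRatioAt, norm_prod, ← card_univ, ← prod_const]
    refine prod_le_prod (fun _ _ => norm_nonneg _) fun i _ => ?_
    have h2 : (2:ℝ) ≤ p := by exact_mod_cast hpp.two_le
    have hq : (1 / p : ℝ) ≤ 1 / 2 := by gcongr
    have hn : ∀ w : ℂ, w.re = 2 → ‖(p:ℂ) ^ (-(w / L))‖ ≤ 1 := by
      intro w hw
      rw [Complex.norm_natCast_cpow_of_pos hpp.pos, Complex.neg_re, Complex.div_ofReal_re, hw]
      refine Real.rpow_le_one_of_one_le_of_nonpos (by linarith) ?_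
      have : 0 < 2 / L := by positivity
      linarith
    have := (norm_zetaRatio_sub_le (by positivity) hq le_rfl (hn _ (hz i)) (hn _ (hz' i))).1
    have h3 := norm_sub_norm_le (zetaRatio ((1 / p : ℝ) : ℂ) ((p : ℂ) ^ (-(z i / L))) ((p : ℂ) ^ (-(z' i / L)))) 1
    rw [norm_one] at h3
    have dx := norm_one_sub_mul_ge (by positivity) hq (hn _ (hz i))
    have dy := norm_one_sub_mul_ge (by positivity) hq (hn _ (hz' i))
    have nd : 1 / 4 ≤ ‖(1 - (p:ℂ) ^ (-(z i / L)) * ((1 / p : ℝ) : ℂ)) * (1 - (p:ℂ) ^ (-(z' i / L)) * ((1 / p : ℝ) : ℂ))‖ := by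
      rw [norm_mul]; nlinarith
    rw [zetaRatio, norm_div, div_le_iff₀ (by linarith)]
    have : ‖1 - (p:ℂ) ^ (-(z i / L)) * (p:ℂ) ^ (-(z' i / L)) * ((1 / p : ℝ) : ℂ)‖ ≤ 2 := by
      refine (norm_sub_le _ _).trans ?_
      rw [norm_one, norm_mul, norm_mul, Complex.norm_real, Real.norm_of_nonneg (by positivity)]
      have := mul_le_mul (mul_le_mul (hn _ (hz i)) (hn _ (hz' i)) (norm_nonneg _) zero_le_one) hq (by positivity) (by norm_num)
      linarith
    linarith
  have hQ : L ^ Fintype.card ι * ‖zetaQuot (fun i => z i / L) (fun i => z' i / L)‖ ≤ C ^ Fintype.card ι * ∏ i, (‖z i‖ ^ 2 * ‖z' i‖ ^ 2) := by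
    rw [zetaQuot, norm_prod, ← card_univ, ← prod_const, ← prod_const, ← prod_mul_distrib, ← prod_mul_distrib]
    exact prod_le_prod (fun _ _ => by positivity) fun i _ => h L hL _ _ (hz i) (hz' i)
  rw [normQuot, Complex.ofReal_mul, mul_pow, norm_mul, norm_mul, norm_mul, norm_pow, norm_pow, Complex.norm_real L, Real.norm_of_nonneg hL0.le]
  calc _ ≤ 1 ^ Fintype.card ι * L ^ Fintype.card ι * ((8 ^ Fintype.card ι) ^ (sievePrimes 0 D).card * ‖zetaQuot (fun i => z i / L) (fun i => z' i / L)‖) := by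
        gcongr
    _ = (8 ^ Fintype.card ι) ^ (sievePrimes 0 D).card * (L ^ Fintype.card ι * ‖zetaQuot (fun i => z i / L) (fun i => z' i / L)‖) := by ring
    _ ≤ (8 ^ Fintype.card ι) ^ (sievePrimes 0 D).card * (C ^ Fintype.card ι * ∏ i, (‖z i‖ ^ 2 * ‖z' i‖ ^ 2)) := by gcongr
    _ = _ := by ring

end

section

open Finset Filter Topology MeasureTheory
set_option linter.unusedSectionVars false

theorem prod_sum_sum {α β R : Type*} [Fintype α] [DecidableEq α] [Fintype β] [CommSemiring R] (φ : α → β → β → R) :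
    ∏ p, ∑ u, ∑ v, φ p u v = ∑ a : α → β, ∑ b : α → β, ∏ p, φ p (a p) (b p) := by
  simp only [← Fintype.sum_prod_type']
  rw [Fintype.prod_sum, ← (Equiv.arrowProdEquivProdArrow α (fun _ => β) (fun _ => β)).sum_comp
    (fun x : (α → β) × (α → β) => ∏ p, φ p (x.1 p) (x.2 p))]
  rfl

section
variable {ι : Type*} [Fintype ι] [DecidableEq ι]

/-- The local density of a pair of divisor conditions at a prime. -/
def locWeight (g : ℝ) : Option ι → Option ι → ℝ
  | none, none => 1
  | some _, none => g
  | none, some _ => g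
  | some i, some j => if i = j then g else 0

/-- The local Möbius factor. -/
def sgnOpt : Option ι → ℝ
  | none => 1
  | some _ => -1

/-- The divisor of the `i`-th component encoded by `a`. -/
def dPart {P : Finset ℕ} (a : P → Option ι) (i : ι) : ℕ := ∏ p : P, if a p = some i then (p : ℕ) else 1

/-- The Maynard–Tao weight of a divisor tuple. -/
noncomputable def sieveWt {P : Finset ℕ} (F : (ι → ℝ) → ℝ) (L : ℝ) (a : P → Option ι) : ℝ :=
  (∏ p, sgnOpt (a p)) * F fun i => Real.log (dPart a i) / L

/-- The quadratic form of the sieve. -/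
noncomputable def sieveSum (P : Finset ℕ) (F : (ι → ℝ) → ℝ) (g : ℕ → ℝ) (L : ℝ) : ℝ :=
  ∑ a : P → Option ι, ∑ b : P → Option ι, sieveWt F L a * sieveWt F L b * ∏ p : P, locWeight (g p) (a p) (b p)

/-- A function on the orthant, represented as a superposition of exponentials. -/
structure IsOrthantRep {Ω : Type*} [TopologicalSpace Ω] [MeasurableSpace Ω] (μ : Measure Ω) (c : Ω → ℂ) (z : Ω → ι → ℂ) : Prop where
  cont : Continuous c
  contz : ∀ i, Continuous fun ω => z ω i
  re_eq : ∀ ω i, (z ω i).re = 2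
  integrable : Integrable (fun ω => ‖c ω‖ * ∏ i, ‖z ω i‖ ^ 2) μ

/-- The local factor of the integrand. -/
noncomputable def hLoc (z : ι → ℂ) (L : ℝ) (p : ℕ) : Option ι → ℂ
  | none => 1
  | some i => -(p : ℂ) ^ (-(z i / L))

theorem sum_hLoc (g : ℕ → ℝ) (z z' : ι → ℂ) (L : ℝ) (p : ℕ) :
    ∑ u, ∑ v, hLoc z L p u * hLoc z' L p v * (locWeight (g p) u v : ℂ) =
      locFactorAt g (fun i => z i / L) (fun i => z' i / L) p := by
  simp only [Fintype.sum_option, hLoc, locWeight, locFactorAt, locFactor, one_mul, mul_one, Complex.ofReal_one]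
  have : ∀ i, ∑ j, -(p : ℂ) ^ (-(z i / L)) * -(p : ℂ) ^ (-(z' j / L)) * ((if i = j then g p else 0 : ℝ) : ℂ) =
      (g p) * ((p : ℂ) ^ (-(z i / L)) * (p : ℂ) ^ (-(z' i / L))) := by
    intro i
    rw [sum_eq_single i]
    · simp; ring
    · intro j _ hj; simp [hj.symm]
    · simp
  simp only [this]
  rw [sum_add_distrib, ← add_assoc, mul_sum, add_assoc, add_assoc, ← sum_add_distrib, ← sum_add_distrib]
  congr 1
  refine sum_congr rfl fun i _ => ?_
  ring

theorem prod_hLoc {P : Finset ℕ} (hP : ∀ p ∈ P, p ≠ 0) (z : ι → ℂ) {L : ℝ} (a : P → Option ι) :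
    ∏ p : P, hLoc z L p (a p) = ((∏ p, sgnOpt (a p) : ℝ) : ℂ) * ∏ i, Complex.exp (-(z i * (Real.log (dPart a i) / L : ℝ))) := by
  have h1 : ∀ i, Complex.exp (-(z i * (Real.log (dPart a i) / L : ℝ))) = ∏ p : P, if a p = some i then ((p:ℕ):ℂ) ^ (-(z i / L)) else 1 := by
    intro i
    have e : Real.log (dPart a i) = ∑ p : P, if a p = some i then Real.log (p:ℕ) else 0 := by
      rw [dPart, Nat.cast_prod, Real.log_prod]
      · refine sum_congr rfl fun p _ => ?_
        split_ifs <;> simp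
      · intro p _
        split_ifs
        · exact_mod_cast hP p p.2
        · simp
    rw [e, sum_div, Complex.ofReal_sum, mul_sum, ← sum_neg_distrib, Complex.exp_sum]
    refine prod_congr rfl fun p _ => ?_
    split_ifs
    · rw [Complex.cpow_def_of_ne_zero (by exact_mod_cast hP p p.2), Complex.natCast_log.symm]
      congr 1
      push_cast
      ring
    · simp
  simp only [h1]
  rw [Finset.prod_comm, Complex.ofReal_prod, ← prod_mul_distrib]
  refine prod_congr rfl fun p _ => ?_
  cases h : a p with
  | none => simp [hLoc, sgnOpt]
  | some j =>
    simp [hLoc, sgnOpt]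

theorem IsOrthantRep.two_le_norm {Ω : Type*} [TopologicalSpace Ω] [MeasurableSpace Ω] {μ : Measure Ω} {c : Ω → ℂ} {z : Ω → ι → ℂ}
    (h : IsOrthantRep μ c z) (ω : Ω) (i : ι) : 2 ≤ ‖z ω i‖ :=
  h.re_eq ω i ▸ Complex.re_le_norm _

theorem IsOrthantRep.ne_zero {Ω : Type*} [TopologicalSpace Ω] [MeasurableSpace Ω] {μ : Measure Ω} {c : Ω → ℂ} {z : Ω → ι → ℂ}
    (h : IsOrthantRep μ c z) (ω : Ω) (i : ι) : z ω i ≠ 0 := by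
  have := h.two_le_norm ω i
  rw [← norm_pos_iff]; linarith

variable {Ω : Type*} [TopologicalSpace Ω] [SecondCountableTopology Ω] [MeasurableSpace Ω] [BorelSpace Ω] {μ : Measure Ω} [SFinite μ]
  {c : Ω → ℂ} {z : Ω → ι → ℂ}

theorem norm_hLoc_le {L : ℝ} (hL : 0 < L) {p : ℕ} (hp : p ≠ 0) {w : ι → ℂ} (hw : ∀ i, (w i).re = 2) (u : Option ι) : ‖hLoc w L p u‖ ≤ 1 := by
  cases u with
  | none => simp [hLoc]
  | some i =>
    rw [hLoc, norm_neg, Complex.norm_natCast_cpow_of_pos (Nat.pos_of_ne_zero hp), Complex.neg_re, Complex.div_ofReal_re, hw]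
    refine Real.rpow_le_one_of_one_le_of_nonpos (by exact_mod_cast Nat.one_le_iff_ne_zero.2 hp) ?_
    have : 0 < 2 / L := by positivity
    linarith

theorem continuous_hLoc (h : IsOrthantRep μ c z) (L : ℝ) {p : ℕ} (hp : p ≠ 0) (u : Option ι) : Continuous fun ω => hLoc (z ω) L p u := by
  cases u with
  | none => exact continuous_const
  | some i =>
    simp only [hLoc]
    have h1 : Continuous fun ω => -(z ω i / L) := ((h.contz i).div_const _).neg
    exact (h1.const_cpow (Or.inl (by exact_mod_cast hp))).neg

theorem IsOrthantRep.continuous_div (h : IsOrthantRep μ c z) : Continuous fun ω => c ω / ∏ i, z ω i :=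
  h.cont.div (continuous_finsetProd _ fun i _ => h.contz i) fun ω => prod_ne_zero_iff.2 fun i _ => h.ne_zero ω i

theorem IsOrthantRep.one_le_prod (h : IsOrthantRep μ c z) (ω : Ω) : 1 ≤ ‖∏ i, z ω i‖ := by
  rw [norm_prod]
  exact Finset.one_le_prod fun i _ => by linarith [h.two_le_norm ω i]

theorem IsOrthantRep.integrable_div (h : IsOrthantRep μ c z) : Integrable (fun ω => c ω / ∏ i, z ω i) μ := by
  refine h.integrable.mono' h.continuous_div.aestronglyMeasurable (Eventually.of_forall fun ω => ?_)
  have h1 := h.one_le_prod ω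
  rw [norm_div, prod_pow, ← norm_prod, div_le_iff₀ (by linarith)]
  have h2 : 1 ≤ ‖∏ i, z ω i‖ ^ 2 * ‖∏ i, z ω i‖ := by rw [← pow_succ]; exact one_le_pow₀ h1
  nlinarith [norm_nonneg (c ω)]

/-- The sieve sum as an integral of Euler products. -/
theorem sieveSum_eq_integral (h : IsOrthantRep μ c z) {F : (ι → ℝ) → ℝ}
    (hF : ∀ t : ι → ℝ, (∀ i, 0 ≤ t i) → (F t : ℂ) = ∫ ω, (c ω / ∏ i, z ω i) * ∏ i, Complex.exp (-(z ω i * t i)) ∂μ)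
    {P : Finset ℕ} (hP : ∀ p ∈ P, p ≠ 0) (g : ℕ → ℝ) {L : ℝ} (hL : 0 < L) :
    (sieveSum P F g L : ℂ) = ∫ w, (c w.1 / ∏ i, z w.1 i) * (c w.2 / ∏ i, z w.2 i) *
      ∏ p ∈ P, locFactorAt g (fun i => z w.1 i / L) (fun i => z w.2 i / L) p ∂(μ.prod μ) := by
  have hIn : ∀ a : P → Option ι, Integrable (fun ω => (c ω / ∏ i, z ω i) * ∏ p : P, hLoc (z ω) L p (a p)) μ := by
    intro a
    refine h.integrable_div.mul_bdd (c := 1) ?_ (Eventually.of_forall fun ω => ?_)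
    · exact (continuous_finsetProd _ fun (p : P) _ => continuous_hLoc h L (hP p p.2) _).aestronglyMeasurable
    · rw [norm_prod]
      exact prod_le_one (fun _ _ => norm_nonneg _) fun p _ => norm_hLoc_le hL (hP p p.2) (h.re_eq ω) _
  have hwt : ∀ a : P → Option ι, (sieveWt F L a : ℂ) = ∫ ω, (c ω / ∏ i, z ω i) * ∏ p : P, hLoc (z ω) L p (a p) ∂μ := by
    intro a
    have hd : ∀ i, 0 ≤ Real.log (dPart a i) / L := fun i => div_nonneg (Real.log_natCast_nonneg _) hL.le
    rw [sieveWt, Complex.ofReal_mul, hF _ hd, ← integral_const_mul]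
    refine integral_congr_ae (Eventually.of_forall fun ω => ?_)
    simp only [prod_hLoc hP]
    ring
  have e : ∀ w : Ω × Ω, (c w.1 / ∏ i, z w.1 i) * (c w.2 / ∏ i, z w.2 i) *
      ∏ p ∈ P, locFactorAt g (fun i => z w.1 i / L) (fun i => z w.2 i / L) p = ∑ a : P → Option ι, ∑ b : P → Option ι,
        (((c w.1 / ∏ i, z w.1 i) * ∏ p : P, hLoc (z w.1) L p (a p)) * ((c w.2 / ∏ i, z w.2 i) * ∏ p : P, hLoc (z w.2) L p (b p))) *
          ((∏ p : P, locWeight (g p) (a p) (b p) : ℝ) : ℂ) := by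
    intro w
    rw [← prod_coe_sort P fun p => locFactorAt g (fun i => z w.1 i / L) (fun i => z w.2 i / L) p]
    simp only [← sum_hLoc]
    rw [prod_sum_sum, mul_sum]
    refine sum_congr rfl fun a _ => ?_
    rw [mul_sum]
    refine sum_congr rfl fun b _ => ?_
    rw [prod_mul_distrib, prod_mul_distrib, Complex.ofReal_prod]
    ring
  simp only [e]
  rw [integral_finsetSum _ fun a _ => integrable_finsetSum _ fun b _ => ((hIn a).mul_prod (hIn b)).mul_const _, sieveSum, Complex.ofReal_sum]
  refine sum_congr rfl fun a _ => ?_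
  rw [integral_finsetSum _ fun b _ => ((hIn a).mul_prod (hIn b)).mul_const _, Complex.ofReal_sum]
  refine sum_congr rfl fun b _ => ?_
  rw [integral_mul_const, integral_prod_mul (fun ω => (c ω / ∏ i, z ω i) * ∏ p : P, hLoc (z ω) L p (a p))
    (fun ω => (c ω / ∏ i, z ω i) * ∏ p : P, hLoc (z ω) L p (b p)), ← hwt, ← hwt]
  push_cast
  ring

/-- The Hermitian form describing the main term. -/
noncomputable def mainForm (μ : Measure Ω) (c : Ω → ℂ) (z : Ω → ι → ℂ) : ℂ :=
  ∫ w, c w.1 * c w.2 * ∏ i, 1 / (z w.1 i + z w.2 i) ∂(μ.prod μ)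

theorem continuous_cpow_vert (h : IsOrthantRep μ c z) (L : ℝ) {p : ℕ} (hp : p ≠ 0) (i : ι) : Continuous fun ω => (p:ℂ) ^ (-(z ω i / L)) := by
  have h1 : Continuous fun ω => -(z ω i / L) := ((h.contz i).div_const _).neg
  exact h1.const_cpow (Or.inl (by exact_mod_cast hp))

theorem continuous_zeta_one_add {X : Type*} [TopologicalSpace X] {f : X → ℂ} (hf : Continuous f) (h0 : ∀ x, 0 < (f x).re) :
    Continuous fun x => riemannZeta (1 + f x) := by
  refine continuous_iff_continuousAt.2 fun x => ?_
  have hne : 1 + f x ≠ 1 := fun h => by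
    have := h0 x
    rw [add_eq_left.1 h] at this
    simp at this
  exact ContinuousAt.comp (g := riemannZeta) (differentiableAt_riemannZeta hne).continuousAt (hf.const_add 1).continuousAt

theorem continuous_locFactorAt (h : IsOrthantRep μ c z) (g : ℕ → ℝ) (L : ℝ) {p : ℕ} (hp : p ≠ 0) :
    Continuous fun w : Ω × Ω => locFactorAt g (fun i => z w.1 i / L) (fun i => z w.2 i / L) p := by
  simp only [locFactorAt, locFactor]
  refine continuous_const.add (continuous_const.mul (continuous_finsetSum _ fun i _ => ?_))
  have h1 := (continuous_cpow_vert h L hp i).comp (continuous_fst (Y := Ω))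
  have h2 := (continuous_cpow_vert h L hp i).comp (continuous_snd (X := Ω))
  exact ((h1.mul h2).sub h1).sub h2

theorem continuous_normQuot (h : IsOrthantRep μ c z) (D : ℕ) {L : ℝ} (hL : 0 < L) : Continuous fun w : Ω × Ω => normQuot D L (z w.1) (z w.2) := by
  have hre : ∀ ω i, 0 < (z ω i / L).re := fun ω i => by rw [Complex.div_ofReal_re, h.re_eq]; positivity
  have c1 : ∀ i, Continuous fun w : Ω × Ω => z w.1 i / (L:ℂ) := fun i => ((h.contz i).comp continuous_fst).div_const _
  have c2 : ∀ i, Continuous fun w : Ω × Ω => z w.2 i / (L:ℂ) := fun i => ((h.contz i).comp continuous_snd).div_const _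
  refine continuous_const.mul (Continuous.mul ?_ ?_)
  · refine continuous_finsetProd _ fun p hp => continuous_finsetProd _ fun i _ => ?_
    have hpp := (mem_sievePrimes.1 hp).2
    have hq : (1 / p : ℝ) ≤ 1 / 2 := by
      have : (2:ℝ) ≤ p := by exact_mod_cast hpp.two_le
      gcongr
    have h1 := (continuous_cpow_vert h L hpp.ne_zero i).comp (continuous_fst (Y := Ω))
    have h2 := (continuous_cpow_vert h L hpp.ne_zero i).comp (continuous_snd (X := Ω))
    have hn : ∀ ω, ‖(p:ℂ) ^ (-(z ω i / L))‖ ≤ 1 := fun ω => by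
      have := norm_hLoc_le hL hpp.ne_zero (h.re_eq ω) (some i)
      rwa [hLoc, norm_neg] at this
    refine (continuous_const.sub ((h1.mul h2).mul continuous_const)).div
      ((continuous_const.sub (h1.mul continuous_const)).mul (continuous_const.sub (h2.mul continuous_const))) fun w => ?_
    exact mul_ne_zero (zetaRatio_den_ne_zero (by positivity) hq (hn _)) (zetaRatio_den_ne_zero (by positivity) hq (hn _))
  · refine continuous_finsetProd _ fun i _ => ?_
    refine (continuous_zeta_one_add ((c1 i).add (c2 i)) fun w => ?_).div
      ((continuous_zeta_one_add (c1 i) fun w => hre _ _).mul (continuous_zeta_one_add (c2 i) fun w => hre _ _)) fun w => ?_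
    · exact add_pos (hre _ _) (hre _ _)
    · exact mul_ne_zero (riemannZeta_ne_zero_of_one_lt_re (by simpa using hre w.1 i))
        (riemannZeta_ne_zero_of_one_lt_re (by simpa using hre w.2 i))

/-- The main term of the sieve sum. -/
theorem exists_sieveSum_asymp (h : IsOrthantRep μ c z) {F : (ι → ℝ) → ℝ}
    (hF : ∀ t : ι → ℝ, (∀ i, 0 ≤ t i) → (F t : ℂ) = ∫ ω, (c ω / ∏ i, z ω i) * ∏ i, Complex.exp (-(z ω i * t i)) ∂μ)
    {g : ℕ → ℝ} (hg : ∀ p, p.Prime → |g p - 1 / p| ≤ 2 * (1 / p) ^ 2) {ε : ℝ} (hε : 0 < ε) :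
    ∃ D₀ : ℕ, ∀ D, D₀ ≤ D → ∀ᶠ L : ℝ in atTop, ∃ X₀ : ℕ, ∀ X, X₀ ≤ X →
      ‖(((((∏ p ∈ sievePrimes 0 D, (1 - 1 / (p : ℝ))) * L) ^ Fintype.card ι * sieveSum (sievePrimes D X) F g L : ℝ)) : ℂ) -
        mainForm μ c z‖ ≤ ε := by
  set m : Ω × Ω → ℂ := fun w => (c w.1 / ∏ i, z w.1 i) * (c w.2 / ∏ i, z w.2 i) with hm
  have hmc : Continuous m := (h.continuous_div.comp continuous_fst).mul (h.continuous_div.comp continuous_snd)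
  have hlim : ∀ (D : ℕ) w, Tendsto (fun L : ℝ => m w * normQuot D L (z w.1) (z w.2)) atTop
      (𝓝 (c w.1 * c w.2 * ∏ i, 1 / (z w.1 i + z w.2 i))) := by
    intro D w
    have := (tendsto_normQuot D (h.re_eq w.1) (h.re_eq w.2)).const_mul (m w)
    have e : m w * ∏ i, (z w.1 i * z w.2 i / (z w.1 i + z w.2 i)) = c w.1 * c w.2 * ∏ i, 1 / (z w.1 i + z w.2 i) := by
      have h1 : ∏ i, z w.1 i ≠ 0 := prod_ne_zero_iff.2 fun i _ => h.ne_zero _ i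
      have h2 : ∏ i, z w.2 i ≠ 0 := prod_ne_zero_iff.2 fun i _ => h.ne_zero _ i
      simp only [hm, prod_div_distrib, prod_mul_distrib, prod_const_one]
      field_simp
    rwa [e] at this
  have hdom : Integrable (fun w : Ω × Ω => (‖c w.1‖ * ∏ i, ‖z w.1 i‖ ^ 2) * (‖c w.2‖ * ∏ i, ‖z w.2 i‖ ^ 2)) (μ.prod μ) :=
    h.integrable.mul_prod h.integrable
  have hbd : ∀ D : ℕ, ∃ C : ℝ, ∀ L : ℝ, 1 ≤ L → ∀ w, ‖m w * normQuot D L (z w.1) (z w.2)‖ ≤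
      C * ((‖c w.1‖ * ∏ i, ‖z w.1 i‖ ^ 2) * (‖c w.2‖ * ∏ i, ‖z w.2 i‖ ^ 2)) := by
    intro D
    obtain ⟨C, hC, hb⟩ := exists_norm_normQuot_le (ι := ι) D
    refine ⟨C, fun L hL w => ?_⟩
    have h1 : ‖m w‖ ≤ ‖c w.1‖ * ‖c w.2‖ := by
      rw [hm, norm_mul, norm_div, norm_div]
      gcongr
      · exact div_le_self (norm_nonneg _) (h.one_le_prod _)
      · exact div_le_self (norm_nonneg _) (h.one_le_prod _)
    rw [norm_mul]
    calc _ ≤ ‖c w.1‖ * ‖c w.2‖ * (C * ∏ i, (‖z w.1 i‖ ^ 2 * ‖z w.2 i‖ ^ 2)) := by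
          gcongr; exact hb L hL _ _ (h.re_eq _) (h.re_eq _)
      _ = _ := by rw [prod_mul_distrib]; ring
  have hmeas : ∀ (D : ℕ) {L : ℝ}, 0 < L → AEStronglyMeasurable (fun w : Ω × Ω => m w * normQuot D L (z w.1) (z w.2)) (μ.prod μ) :=
    fun D L hL => (hmc.mul (continuous_normQuot h D hL)).aestronglyMeasurable
  have hQ : ∀ (D : ℕ) {L : ℝ}, 1 ≤ L → Integrable (fun w : Ω × Ω => m w * normQuot D L (z w.1) (z w.2)) (μ.prod μ) := by
    intro D L hL
    obtain ⟨C, hC⟩ := hbd D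
    exact (hdom.const_mul C).mono' (hmeas D (by linarith)) (Eventually.of_forall fun w => hC L hL w)
  have hlim1 : ∀ D : ℕ, Tendsto (fun L : ℝ => ∫ w, m w * normQuot D L (z w.1) (z w.2) ∂(μ.prod μ)) atTop (𝓝 (mainForm μ c z)) := by
    intro D
    obtain ⟨C, hC⟩ := hbd D
    refine tendsto_integral_filter_of_dominated_convergence _ ?_ ?_ (hdom.const_mul C) (Eventually.of_forall (hlim D))
    · filter_upwards [eventually_gt_atTop 0] with L hL using hmeas D hL
    · filter_upwards [eventually_ge_atTop 1] with L hL using Eventually.of_forall fun w => hC L hL w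
  set M' := ∫ w, ‖c w.1 * c w.2 * ∏ i, 1 / (z w.1 i + z w.2 i)‖ ∂(μ.prod μ)
  have hlim2 : ∀ D : ℕ, Tendsto (fun L : ℝ => ∫ w, ‖m w * normQuot D L (z w.1) (z w.2)‖ ∂(μ.prod μ)) atTop (𝓝 M') := by
    intro D
    obtain ⟨C, hC⟩ := hbd D
    refine tendsto_integral_filter_of_dominated_convergence _ ?_ ?_ (hdom.const_mul C) (Eventually.of_forall fun w => (hlim D w).norm)
    · filter_upwards [eventually_gt_atTop 0] with L hL using (hmeas D hL).norm
    · filter_upwards [eventually_ge_atTop 1] with L hL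
      refine Eventually.of_forall fun w => ?_
      rw [norm_norm]
      exact hC L hL w
  have hη : Tendsto (fun D : ℕ => (Real.exp (2001 * (Fintype.card ι + 1) ^ 2 / D) - 1) * (M' + 1)) atTop (𝓝 0) := by
    have h1 : Tendsto (fun D : ℕ => 2001 * (Fintype.card ι + 1 : ℝ) ^ 2 / D) atTop (𝓝 0) :=
      tendsto_const_div_atTop_nhds_zero_nat _
    have := (((Real.continuous_exp.tendsto 0).comp h1).sub_const 1).mul_const (M' + 1)
    simpa using this
  obtain ⟨D₀, hD₀⟩ := eventually_atTop.1 ((hη.eventually (gt_mem_nhds (half_pos hε))).and (eventually_ge_atTop (100 * Fintype.card ι + 2)))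
  refine ⟨D₀, fun D hD => ?_⟩
  obtain ⟨hηD, hDk⟩ := hD₀ D hD
  filter_upwards [eventually_ge_atTop 1, (Metric.tendsto_nhds.1 (hlim1 D)) _ (half_pos hε),
    (hlim2 D).eventually (gt_mem_nhds (lt_add_one M'))] with L hL hl1 hl2
  have hL0 : 0 < L := by linarith
  obtain ⟨X₀, hX₀⟩ := exists_norm_prod_locFactorAt_sub_le (ι := ι) (σ := 2 / L) (by positivity) (D := D) (by omega) (by omega) hg
  refine ⟨X₀, fun X hX => ?_⟩
  set N : ℂ := (((∏ p ∈ sievePrimes 0 D, (1 - 1 / (p : ℝ))) * L : ℝ) : ℂ) ^ Fintype.card ι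
  set η := Real.exp (2001 * (Fintype.card ι + 1) ^ 2 / D) - 1
  set G : Ω × Ω → ℂ := fun w => N * (m w * ∏ p ∈ sievePrimes D X, locFactorAt g (fun i => z w.1 i / L) (fun i => z w.2 i / L) p)
  have e1 : (((((∏ p ∈ sievePrimes 0 D, (1 - 1 / (p : ℝ))) * L) ^ Fintype.card ι * sieveSum (sievePrimes D X) F g L : ℝ)) : ℂ) =
      ∫ w, G w ∂(μ.prod μ) := by
    rw [Complex.ofReal_mul, Complex.ofReal_pow, sieveSum_eq_integral h hF (fun p hp => (mem_sievePrimes.1 hp).2.ne_zero) g hL0,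
      ← integral_const_mul]
  have hdiff : ∀ w, ‖G w - m w * normQuot D L (z w.1) (z w.2)‖ ≤ η * ‖m w * normQuot D L (z w.1) (z w.2)‖ := by
    intro w
    have hre : ∀ ω i, (z ω i / L).re = 2 / L := fun ω i => by rw [Complex.div_ofReal_re, h.re_eq]
    have h1 := hX₀ X hX (fun i => z w.1 i / L) (fun i => z w.2 i / L) (fun i => hre _ i) (fun i => hre _ i)
    have e2 : G w - m w * normQuot D L (z w.1) (z w.2) = N * m w * (∏ p ∈ sievePrimes D X, locFactorAt g (fun i => z w.1 i / L) (fun i => z w.2 i / L) p -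
      (∏ p ∈ sievePrimes 0 D, zetaRatioAt (fun i => z w.1 i / L) (fun i => z w.2 i / L) p) *
      zetaQuot (fun i => z w.1 i / L) (fun i => z w.2 i / L)) := by
      simp only [G, normQuot, N]; ring
    rw [e2, norm_mul]
    calc _ ≤ ‖N * m w‖ * (η * _) := mul_le_mul_of_nonneg_left h1 (norm_nonneg _)
      _ = η * ‖m w * normQuot D L (z w.1) (z w.2)‖ := by
        rw [normQuot]
        simp only [norm_mul, N]
        ring
  have hGm : AEStronglyMeasurable G (μ.prod μ) :=
    (continuous_const.mul (hmc.mul (continuous_finsetProd _ fun p hp =>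
      continuous_locFactorAt h g L (mem_sievePrimes.1 hp).2.ne_zero))).aestronglyMeasurable
  have hdi : Integrable (fun w => G w - m w * normQuot D L (z w.1) (z w.2)) (μ.prod μ) :=
    ((hQ D hL).norm.const_mul η).mono' (hGm.sub (hmeas D hL0)) (Eventually.of_forall hdiff)
  have hGi : Integrable G (μ.prod μ) := by
    have := hdi.add (hQ D hL)
    refine this.congr (Eventually.of_forall fun w => ?_)
    simp
  have h3 : ‖∫ w, G w ∂(μ.prod μ) - ∫ w, m w * normQuot D L (z w.1) (z w.2) ∂(μ.prod μ)‖ ≤ ε / 2 := by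
    rw [← integral_sub hGi (hQ D hL)]
    calc _ ≤ ∫ w, ‖G w - m w * normQuot D L (z w.1) (z w.2)‖ ∂(μ.prod μ) := norm_integral_le_integral_norm _
      _ ≤ ∫ w, η * ‖m w * normQuot D L (z w.1) (z w.2)‖ ∂(μ.prod μ) :=
        integral_mono hdi.norm ((hQ D hL).norm.const_mul η) hdiff
      _ = η * ∫ w, ‖m w * normQuot D L (z w.1) (z w.2)‖ ∂(μ.prod μ) := integral_const_mul _ _
      _ ≤ η * (M' + 1) := by
        have : 0 ≤ η := by
          simp only [η]
          have := Real.one_le_exp (x := 2001 * (Fintype.card ι + 1 : ℝ) ^ 2 / D) (by positivity)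
          linarith
        gcongr
      _ ≤ ε / 2 := hηD.le
  rw [dist_eq_norm] at hl1
  rw [e1]
  have := norm_add_le (∫ w, G w ∂(μ.prod μ) - ∫ w, m w * normQuot D L (z w.1) (z w.2) ∂(μ.prod μ))
    (∫ w, m w * normQuot D L (z w.1) (z w.2) ∂(μ.prod μ) - mainForm μ c z)
  rw [sub_add_sub_cancel] at this
  linarith

end

end

section

open Finset Filter Topology MeasureTheory
set_option linter.unusedSectionVars false

section
variable {ι : Type*} [Fintype ι] [DecidableEq ι]

/-- Lebesgue measure on the positive orthant. -/
noncomputable def orth (ι : Type*) [Fintype ι] : Measure (ι → ℝ) := Measure.pi fun _ => volume.restrict (Set.Ioi 0)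

instance : SigmaFinite (orth ι) := by unfold orth; infer_instance

theorem ae_orth_pos : ∀ᵐ t ∂(orth ι), ∀ i, 0 < t i := by
  have h : orth ι = volume.restrict (Set.univ.pi fun _ => Set.Ioi (0:ℝ)) := by
    rw [orth, ← Measure.restrict_pi_pi]; rfl
  rw [h]
  filter_upwards [ae_restrict_mem (MeasurableSet.univ_pi fun _ => measurableSet_Ioi)] with t ht i
  exact ht i (Set.mem_univ i)

theorem integral_exp_neg_mul_Ioi {w : ℂ} (hw : 0 < w.re) : ∫ t in Set.Ioi (0:ℝ), Complex.exp (-(w * t)) = 1 / w := by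
  have := integral_exp_mul_complex_Ioi (a := -w) (by simpa using hw) 0
  simp only [neg_mul] at this
  rw [this]
  simp

theorem integrable_exp_neg_mul_Ioi {w : ℂ} (hw : 0 < w.re) :
    Integrable (fun t : ℝ => Complex.exp (-(w * t))) (volume.restrict (Set.Ioi 0)) := by
  have := integrableOn_exp_mul_complex_Ioi (a := -w) (by simpa using hw) 0
  simp only [neg_mul] at this
  exact this

theorem integral_prod_exp {w : ι → ℂ} (hw : ∀ i, 0 < (w i).re) :
    ∫ t, ∏ i, Complex.exp (-(w i * t i)) ∂(orth ι) = ∏ i, 1 / w i := by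
  rw [orth, integral_fintype_prod_eq_prod (fun i (x : ℝ) => Complex.exp (-(w i * x)))]
  exact prod_congr rfl fun i _ => integral_exp_neg_mul_Ioi (hw i)

theorem integrable_prod_exp {w : ι → ℂ} (hw : ∀ i, 0 < (w i).re) :
    Integrable (fun t : ι → ℝ => ∏ i, Complex.exp (-(w i * t i))) (orth ι) :=
  Integrable.fintype_prod (f := fun i (x : ℝ) => Complex.exp (-(w i * x))) fun i => integrable_exp_neg_mul_Ioi (hw i)

theorem norm_prod_exp (w : ι → ℂ) (t : ι → ℝ) : ‖∏ i, Complex.exp (-(w i * t i))‖ = ∏ i, Real.exp (-((w i).re * t i)) := by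
  rw [norm_prod]
  refine prod_congr rfl fun i _ => ?_
  rw [Complex.norm_exp, Complex.neg_re, Complex.re_mul_ofReal]

variable {Ω : Type*} [TopologicalSpace Ω] [SecondCountableTopology Ω] [MeasurableSpace Ω] [BorelSpace Ω] {μ : Measure Ω} [SFinite μ]
  {c : Ω → ℂ} {z : Ω → ι → ℂ}

theorem integral_integral_exp {X : Type*} [TopologicalSpace X] [SecondCountableTopology X] [MeasurableSpace X] [BorelSpace X] {ν : Measure X} [SFinite ν]
    {b : X → ℂ} (hb : Integrable b ν) (hbc : Continuous b) {w : X → ι → ℂ} (hw : ∀ i, Continuous fun x => w x i) {r : ℝ} (hr : 0 < r)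
    (hre : ∀ x i, (w x i).re = r) :
    ∫ t, ∫ x, b x * ∏ i, Complex.exp (-(w x i * t i)) ∂ν ∂(orth ι) = ∫ x, b x * ∏ i, 1 / w x i ∂ν := by
  have hIn : Integrable (Function.uncurry fun (t : ι → ℝ) x => b x * ∏ i, Complex.exp (-(w x i * t i))) ((orth ι).prod ν) := by
    have h1 : Integrable (fun p : (ι → ℝ) × X => (∏ i, Complex.exp (-((r:ℂ) * p.1 i))) * b p.2) ((orth ι).prod ν) :=
      (integrable_prod_exp fun i => by simpa using hr).mul_prod hb
    refine h1.mono (Continuous.aestronglyMeasurable ?_) (Eventually.of_forall fun p => ?_)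
    · refine (hbc.comp continuous_snd).mul (continuous_finsetProd _ fun i _ => ?_)
      have h2 : Continuous fun p : (ι → ℝ) × X => w p.2 i := (hw i).comp continuous_snd
      have h3 : Continuous fun p : (ι → ℝ) × X => ((p.1 i : ℝ) : ℂ) := Complex.continuous_ofReal.comp ((continuous_apply i).comp continuous_fst)
      exact Complex.continuous_exp.comp (h2.mul h3).neg
    · simp only [Function.uncurry]
      rw [norm_mul, norm_mul, norm_prod_exp, norm_prod_exp, mul_comm]
      simp [hre]
  rw [integral_integral_swap hIn]
  refine integral_congr_ae (Eventually.of_forall fun x => ?_)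
  simp only
  rw [integral_const_mul, integral_prod_exp fun i => by rw [hre]; exact hr]

theorem IsOrthantRep.integrable_coeff (h : IsOrthantRep μ c z) : Integrable c μ := by
  refine h.integrable.mono' h.cont.aestronglyMeasurable (Eventually.of_forall fun ω => ?_)
  have h1 := h.one_le_prod ω
  rw [prod_pow, ← norm_prod]
  have h2 : 1 ≤ ‖∏ i, z ω i‖ ^ 2 := one_le_pow₀ h1
  nlinarith [norm_nonneg (c ω)]

/-- The function represented by `c, z` is `f` on the orthant. -/
def Represents (μ : Measure Ω) (c : Ω → ℂ) (z : Ω → ι → ℂ) (f : (ι → ℝ) → ℝ) : Prop :=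
  ∀ t : ι → ℝ, (∀ i, 0 ≤ t i) → (f t : ℂ) = ∫ ω, c ω * ∏ i, Complex.exp (-(z ω i * t i)) ∂μ

theorem mainForm_eq_integral_sq (h : IsOrthantRep μ c z) {f : (ι → ℝ) → ℝ} (hf : Represents μ c z f) :
    mainForm μ c z = ((∫ t, f t ^ 2 ∂(orth ι) : ℝ) : ℂ) := by
  have h1 := integral_integral_exp (ι := ι) (ν := μ.prod μ) (b := fun w : Ω × Ω => c w.1 * c w.2) (h.integrable_coeff.mul_prod h.integrable_coeff)
    ((h.cont.comp continuous_fst).mul (h.cont.comp continuous_snd)) (w := fun w i => z w.1 i + z w.2 i)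
    (fun i => ((h.contz i).comp continuous_fst).add ((h.contz i).comp continuous_snd)) (r := 4) (by norm_num)
    (fun w i => by rw [Complex.add_re, h.re_eq, h.re_eq]; norm_num)
  rw [mainForm, ← h1, ← integral_complex_ofReal]
  refine integral_congr_ae ?_
  filter_upwards [ae_orth_pos (ι := ι)] with t ht
  rw [Complex.ofReal_pow, sq, hf t fun i => (ht i).le, ← integral_prod_mul]
  refine integral_congr_ae (Eventually.of_forall fun w => ?_)
  simp only [add_mul, neg_add, Complex.exp_add, prod_mul_distrib]
  ring

/-- The iterated upper integral of `f`. -/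
noncomputable def upperInt (f : (ι → ℝ) → ℝ) (t : ι → ℝ) : ℝ := ∫ s, f (t + s) ∂(orth ι)

theorem upperInt_rep (h : IsOrthantRep μ c z) {f : (ι → ℝ) → ℝ} (hf : Represents μ c z f) (t : ι → ℝ) (ht : ∀ i, 0 ≤ t i) :
    (upperInt f t : ℂ) = ∫ ω, (c ω / ∏ i, z ω i) * ∏ i, Complex.exp (-(z ω i * t i)) ∂μ := by
  have hc : Continuous fun ω => c ω * ∏ i, Complex.exp (-(z ω i * t i)) :=
    h.cont.mul (continuous_finsetProd _ fun i _ => Complex.continuous_exp.comp ((h.contz i).mul continuous_const).neg)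
  have hb : Integrable (fun ω => c ω * ∏ i, Complex.exp (-(z ω i * t i))) μ := by
    refine h.integrable_coeff.mono hc.aestronglyMeasurable (Eventually.of_forall fun ω => ?_)
    rw [norm_mul, norm_prod_exp]
    refine mul_le_of_le_one_right (norm_nonneg _) (prod_le_one (fun _ _ => (Real.exp_pos _).le) fun i _ => ?_)
    rw [Real.exp_le_one_iff, h.re_eq]
    linarith [ht i]
  have h1 := integral_integral_exp (ι := ι) hb hc h.contz (r := 2) (by norm_num) h.re_eq
  rw [upperInt, ← integral_complex_ofReal]
  have h2 : ∫ ω, (c ω / ∏ i, z ω i) * ∏ i, Complex.exp (-(z ω i * t i)) ∂μ =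
      ∫ ω, (c ω * ∏ i, Complex.exp (-(z ω i * t i))) * ∏ i, 1 / z ω i ∂μ := by
    refine integral_congr_ae (Eventually.of_forall fun ω => ?_)
    simp only [prod_div_distrib, prod_const_one]
    ring
  rw [h2, ← h1]
  refine integral_congr_ae ?_
  filter_upwards [ae_orth_pos (ι := ι)] with s hs
  rw [hf (t + s) fun i => add_nonneg (ht i) (hs i).le]
  refine integral_congr_ae (Eventually.of_forall fun ω => ?_)
  simp only [Pi.add_apply, Complex.ofReal_add, mul_add, neg_add, Complex.exp_add, prod_mul_distrib]
  ring

/-- Insert the value `s` at coordinate `m`. -/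
def insertAt (m : ι) (s : ℝ) (t : {i // i ≠ m} → ℝ) (i : ι) : ℝ := if h : i = m then s else t ⟨i, h⟩

theorem insertAt_self (m : ι) (s : ℝ) (t : {i // i ≠ m} → ℝ) : insertAt m s t m = s := by simp [insertAt]

theorem insertAt_ne (m : ι) (s : ℝ) (t : {i // i ≠ m} → ℝ) (i : {i // i ≠ m}) : insertAt m s t i = t i := by
  simp [insertAt, i.2]

theorem prod_eq_mul_prod_ne {M : Type*} [CommMonoid M] (m : ι) (f : ι → M) : ∏ i, f i = f m * ∏ i : {i // i ≠ m}, f i := by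
  rw [← mul_prod_erase univ f (mem_univ m)]
  congr 1
  exact prod_subtype _ (by simp) f

/-- The representation of the function integrated over the `m`-th coordinate. -/
theorem IsOrthantRep.slice (h : IsOrthantRep μ c z) (m : ι) :
    IsOrthantRep μ (fun ω => c ω / z ω m) (fun ω (i : {i // i ≠ m}) => z ω i) where
  cont := h.cont.div (h.contz m) fun ω => h.ne_zero ω m
  contz i := h.contz i
  re_eq ω i := h.re_eq ω i
  integrable := by
    have hc : Continuous fun ω => c ω / z ω m := h.cont.div (h.contz m) fun ω => h.ne_zero ω m
    refine h.integrable.mono' (hc.norm.mul (continuous_finsetProd _ fun (i : {i // i ≠ m}) _ => (h.contz i).norm.pow 2)).aestronglyMeasurable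
      (Eventually.of_forall fun ω => ?_)
    have h2 := h.two_le_norm ω m
    have h3 : 0 ≤ ∏ i : {i // i ≠ m}, ‖z ω i‖ ^ 2 := by positivity
    rw [Real.norm_of_nonneg (by positivity), prod_eq_mul_prod_ne m, norm_div, ← mul_assoc]
    gcongr
    rw [div_le_iff₀ (by linarith)]
    have : 1 ≤ ‖z ω m‖ ^ 2 * ‖z ω m‖ := by nlinarith
    nlinarith [norm_nonneg (c ω)]

/-- Integrate `f` over the `m`-th coordinate. -/
noncomputable def sliceInt (m : ι) (f : (ι → ℝ) → ℝ) (t : {i // i ≠ m} → ℝ) : ℝ := ∫ s in Set.Ioi (0:ℝ), f (insertAt m s t)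

theorem Represents.slice (h : IsOrthantRep μ c z) {f : (ι → ℝ) → ℝ} (hf : Represents μ c z f) (m : ι) :
    Represents μ (fun ω => c ω / z ω m) (fun ω (i : {i // i ≠ m}) => z ω i) (sliceInt m f) := by
  intro t ht
  have hc : Continuous fun ω => c ω * ∏ i : {i // i ≠ m}, Complex.exp (-(z ω i * t i)) :=
    h.cont.mul (continuous_finsetProd _ fun i _ => Complex.continuous_exp.comp ((h.contz i).mul continuous_const).neg)
  have hb : Integrable (fun ω => c ω * ∏ i : {i // i ≠ m}, Complex.exp (-(z ω i * t i))) μ := by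
    refine h.integrable_coeff.mono hc.aestronglyMeasurable (Eventually.of_forall fun ω => ?_)
    rw [norm_mul, norm_prod_exp]
    refine mul_le_of_le_one_right (norm_nonneg _) (prod_le_one (fun _ _ => (Real.exp_pos _).le) fun i _ => ?_)
    rw [Real.exp_le_one_iff, h.re_eq]
    linarith [ht i]
  have hIn : Integrable (Function.uncurry fun (s : ℝ) ω => (c ω * ∏ i : {i // i ≠ m}, Complex.exp (-(z ω i * t i))) * Complex.exp (-(z ω m * s)))
      ((volume.restrict (Set.Ioi 0)).prod μ) := by
    have h1 := (integrable_exp_neg_mul_Ioi (w := 2) (by simp)).mul_prod hb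
    refine h1.mono (Continuous.aestronglyMeasurable ?_) (Eventually.of_forall fun p => ?_)
    · refine (hc.comp continuous_snd).mul (Complex.continuous_exp.comp ?_)
      exact (((h.contz m).comp continuous_snd).mul (Complex.continuous_ofReal.comp continuous_fst)).neg
    · simp only [Function.uncurry]
      rw [norm_mul, norm_mul (Complex.exp _), mul_comm]
      gcongr
      rw [Complex.norm_exp, Complex.norm_exp, Complex.neg_re, Complex.neg_re, Complex.re_mul_ofReal, Complex.re_mul_ofReal, h.re_eq]
      simp
  have h1 := integral_integral_swap hIn
  rw [sliceInt, ← integral_complex_ofReal]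
  have h2 : ∫ ω, c ω / z ω m * ∏ i : {i // i ≠ m}, Complex.exp (-(z ω i * t i)) ∂μ =
      ∫ ω, (∫ s in Set.Ioi (0:ℝ), (c ω * ∏ i : {i // i ≠ m}, Complex.exp (-(z ω i * t i))) * Complex.exp (-(z ω m * s))) ∂μ := by
    refine integral_congr_ae (Eventually.of_forall fun ω => ?_)
    simp only
    rw [integral_const_mul, integral_exp_neg_mul_Ioi (by rw [h.re_eq]; norm_num)]
    ring
  rw [h2, ← h1]
  refine setIntegral_congr_fun measurableSet_Ioi fun s hs => ?_
  rw [hf]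
  · refine integral_congr_ae (Eventually.of_forall fun ω => ?_)
    simp only
    rw [prod_eq_mul_prod_ne m, insertAt_self]
    simp only [insertAt_ne]
    ring
  · intro i
    rw [insertAt]
    split_ifs with hi
    · exact le_of_lt hs
    · exact ht _

theorem upperInt_insertAt_rep (h : IsOrthantRep μ c z) {f : (ι → ℝ) → ℝ} (hf : Represents μ c z f) (m : ι) (t : {i // i ≠ m} → ℝ) (ht : ∀ i, 0 ≤ t i) :
    (upperInt f (insertAt m 0 t) : ℂ) =
      ∫ ω, (c ω / z ω m / ∏ i : {i // i ≠ m}, z ω i) * ∏ i : {i // i ≠ m}, Complex.exp (-(z ω i * t i)) ∂μ := by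
  rw [upperInt_rep h hf]
  · refine integral_congr_ae (Eventually.of_forall fun ω => ?_)
    simp only
    rw [prod_eq_mul_prod_ne m, prod_eq_mul_prod_ne m (fun i => Complex.exp _), insertAt_self]
    simp only [insertAt_ne]
    rw [div_mul_eq_div_div]
    simp
  · intro i
    rw [insertAt]
    split_ifs with hi
    · exact le_rfl
    · exact ht _

theorem exists_upperInt_bound (h : IsOrthantRep μ c z) {f : (ι → ℝ) → ℝ} (hf : Represents μ c z f) :
    ∃ K : ℝ, 0 ≤ K ∧ ∀ t : ι → ℝ, (∀ i, 0 ≤ t i) → |upperInt f t| ≤ K := by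
  refine ⟨∫ ω, ‖c ω / ∏ i, z ω i‖ ∂μ, integral_nonneg fun _ => norm_nonneg _, fun t ht => ?_⟩
  have e := upperInt_rep h hf t ht
  rw [← Real.norm_eq_abs, ← Complex.norm_real, e]
  refine norm_integral_le_of_norm_le h.integrable_div.norm (Eventually.of_forall fun ω => ?_)
  rw [norm_mul, norm_prod_exp]
  refine mul_le_of_le_one_right (norm_nonneg _) (prod_le_one (fun _ _ => (Real.exp_pos _).le) fun i _ => ?_)
  rw [Real.exp_le_one_iff, h.re_eq]
  linarith [ht i]

theorem upperInt_eq_zero {f : (ι → ℝ) → ℝ} {θ : ℝ} (hf : ∀ t : ι → ℝ, (∀ i, 0 ≤ t i) → θ ≤ ∑ i, t i → f t = 0) {t : ι → ℝ} (ht : ∀ i, 0 ≤ t i)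
    (hθ : θ ≤ ∑ i, t i) : upperInt f t = 0 := by
  rw [upperInt, ← integral_zero (ι → ℝ) ℝ (μ := orth ι)]
  refine integral_congr_ae ?_
  filter_upwards [ae_orth_pos (ι := ι)] with s hs
  refine hf _ (fun i => add_nonneg (ht i) (hs i).le) (hθ.trans (sum_le_sum fun i _ => ?_))
  simpa using (hs i).le

end

end

section

open Finset
set_option linter.unusedSectionVars false

section
variable {ρ : Type*} [Fintype ρ] [DecidableEq ρ]

/-- Functions into a pointed set, summed according to their support. -/
theorem sum_supp_eq {α : Type*} [Fintype α] [DecidableEq α] (o : α) (Y : Finset ρ → ℝ) :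
    ∑ f : ρ → α, Y {p | f p ≠ o} = ∑ S : Finset ρ, ((Fintype.card α - 1 : ℕ) : ℝ) ^ #S * Y S := by
  rw [← sum_fiberwise_of_maps_to (s := univ) (t := univ) (g := fun f : ρ → α => ({p | f p ≠ o} : Finset ρ)) (fun _ _ => mem_univ _)]
  refine sum_congr rfl fun S _ => ?_
  rw [sum_congr rfl (g := fun _ => Y S) fun f hf => by rw [(mem_filter.1 hf).2], sum_const, nsmul_eq_mul]
  congr 1
  have h : ({f : ρ → α | ({p | f p ≠ o} : Finset ρ) = S} : Finset (ρ → α)) = Fintype.piFinset fun p => if p ∈ S then ({x | x ≠ o} : Finset α) else {o} := by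
    ext f
    simp only [mem_filter, mem_univ, true_and, Fintype.mem_piFinset, Finset.ext_iff]
    refine forall_congr' fun p => ?_
    by_cases hp : p ∈ S <;> simp [hp]
  rw [h, Fintype.card_piFinset]
  have h2 : ∀ p, #(if p ∈ S then ({x | x ≠ o} : Finset α) else {o}) = if p ∈ S then Fintype.card α - 1 else 1 := by
    intro p
    split_ifs
    · rw [filter_ne', card_erase_of_mem (mem_univ _), card_univ]
    · simp
  simp only [h2, prod_ite_mem, univ_inter, prod_const, Nat.cast_pow]

end

section
variable {P : Finset ℕ}

/-- The product of a set of primes. -/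
def qOf (S : Finset P) : ℕ := ∏ p ∈ S, (p : ℕ)

theorem qOf_pos (hP : ∀ p ∈ P, p.Prime) (S : Finset P) : 0 < qOf S := prod_pos fun p _ => (hP p p.2).pos

theorem dvd_qOf_iff (hP : ∀ p ∈ P, p.Prime) {S : Finset P} {p : P} : (p : ℕ) ∣ qOf S ↔ p ∈ S := by
  constructor
  · intro h
    obtain ⟨r, hr, hr'⟩ := (Prime.dvd_finsetProd_iff (hP p p.2).prime _).1 h
    have := (Nat.prime_dvd_prime_iff_eq (hP p p.2) (hP r r.2)).1 hr'
    rwa [Subtype.ext this]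
  · exact fun h => dvd_prod_of_mem (fun p : P => (p : ℕ)) h

theorem qOf_injective (hP : ∀ p ∈ P, p.Prime) : Function.Injective (qOf (P := P)) := by
  intro S T h
  ext p
  rw [← dvd_qOf_iff hP, ← dvd_qOf_iff hP, h]

theorem qOf_supp_eq_prod_dPart {ι : Type*} [Fintype ι] [DecidableEq ι] (a : P → Option ι) :
    qOf ({p | a p ≠ none} : Finset P) = ∏ i, dPart a i := by
  unfold qOf dPart
  rw [Finset.prod_comm, prod_filter]
  refine prod_congr rfl fun p _ => ?_
  cases h : a p with
  | none => simp
  | some i => simp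

theorem dPart_pos (hP : ∀ p ∈ P, p.Prime) {ι : Type*} [DecidableEq ι] (a : P → Option ι) (i : ι) : 0 < dPart a i :=
  prod_pos fun p _ => by split_ifs; exacts [(hP p p.2).pos, one_pos]

theorem dvd_dPart_iff (hP : ∀ p ∈ P, p.Prime) {ι : Type*} [DecidableEq ι] {a : P → Option ι} {i : ι} {p : P} :
    (p : ℕ) ∣ dPart a i ↔ a p = some i := by
  rw [dPart, ← prod_filter, ← qOf, dvd_qOf_iff hP]
  simp

theorem dPart_injective (hP : ∀ p ∈ P, p.Prime) {ι : Type*} [DecidableEq ι] :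
    Function.Injective (fun (a : P → Option ι) i => dPart a i) := by
  intro a b h
  funext p
  refine Option.ext fun i => ?_
  rw [← dvd_dPart_iff hP, ← dvd_dPart_iff hP]
  simp only at h
  rw [congrFun h i]

theorem sum_pow_card_div_qOf_le (hP : ∀ p ∈ P, p.Prime) (κ N : ℕ) :
    ∑ S : Finset P with qOf S ≤ N, (κ : ℝ) ^ #S / qOf S ≤ (1 + Real.log N) ^ κ := by
  have h1 := sum_supp_eq (ρ := P) (α := Option (Fin κ)) none (fun S => if qOf S ≤ N then 1 / (qOf S : ℝ) else 0)
  have h2 : ∑ S : Finset P with qOf S ≤ N, (κ : ℝ) ^ #S / qOf S =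
      ∑ f : P → Option (Fin κ) with qOf ({p | f p ≠ none} : Finset P) ≤ N, ∏ i, 1 / (dPart f i : ℝ) := by
    rw [sum_filter, sum_filter]
    convert h1.symm using 1
    · refine sum_congr rfl fun S _ => ?_
      simp only [Fintype.card_option, Fintype.card_fin, Nat.add_sub_cancel]
      split_ifs <;> simp [div_eq_mul_inv]
    · refine sum_congr rfl fun f _ => ?_
      rw [qOf_supp_eq_prod_dPart]
      simp
  rw [h2]
  calc _ = ∑ d ∈ ({f : P → Option (Fin κ) | qOf ({p | f p ≠ none} : Finset P) ≤ N} : Finset _).image (fun a i => dPart a i), ∏ i, 1 / (d i : ℝ) := by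
        rw [sum_image fun a _ b _ h => dPart_injective hP h]
    _ ≤ ∑ d ∈ Fintype.piFinset fun _ : Fin κ => Icc 1 N, ∏ i, 1 / (d i : ℝ) := by
        refine sum_le_sum_of_subset_of_nonneg ?_ fun d _ _ => prod_nonneg fun i _ => by positivity
        intro d hd
        obtain ⟨f, hf, rfl⟩ := mem_image.1 hd
        rw [mem_filter, qOf_supp_eq_prod_dPart] at hf
        rw [Fintype.mem_piFinset]
        intro i
        rw [mem_Icc]
        refine ⟨dPart_pos hP f i, le_trans (Nat.le_of_dvd (prod_pos fun i _ => dPart_pos hP f i) (dvd_prod_of_mem _ (mem_univ i))) hf.2⟩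
    _ = (∑ n ∈ Icc 1 N, 1 / (n : ℝ)) ^ κ := by
        rw [← prod_univ_sum (fun _ : Fin κ => Icc 1 N) (fun _ n => 1 / (n : ℝ))]
        simp
    _ ≤ _ := pow_le_pow_left₀ (sum_nonneg fun _ _ => by positivity) (sum_inv_le_one_add_log N) κ

end

end

section

open Finset
set_option linter.unusedSectionVars false

theorem dvd_add_iff_modEq {p : ℕ} (hp : 0 < p) (n r : ℕ) : p ∣ n + r ↔ n ≡ p * r - r [MOD p] := by
  have h : r ≤ p * r := Nat.le_mul_of_pos_left r hp
  rw [← Nat.modEq_zero_iff_dvd]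
  constructor
  · intro h1
    refine Nat.ModEq.add_right_cancel' r ?_
    rw [Nat.sub_add_cancel h]
    exact h1.trans (Nat.modEq_zero_iff_dvd.2 (dvd_mul_right _ _)).symm
  · intro h1
    have := h1.add_right r
    rw [Nat.sub_add_cancel h] at this
    exact this.trans (Nat.modEq_zero_iff_dvd.2 (dvd_mul_right _ _))

section
variable {P : Finset ℕ}

theorem exists_modEq_iff (hP : ∀ p ∈ P, p.Prime) {W : ℕ} (hW : ∀ p ∈ P, W.Coprime p) (v : ℕ) (r : P → ℕ) (S : Finset P) :
    ∃ c, ∀ n, (n ≡ v [MOD W] ∧ ∀ p ∈ S, (p : ℕ) ∣ n + r p) ↔ n ≡ c [MOD W * qOf S] := by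
  induction S using Finset.induction_on with
  | empty => exact ⟨v, fun n => by simp [qOf]⟩
  | insert p S hp ih =>
    obtain ⟨c, hc⟩ := ih
    have hcop : (W * qOf S).Coprime p := by
      refine Nat.Coprime.mul_left (hW p p.2) (Nat.Coprime.symm ?_)
      rw [Nat.Prime.coprime_iff_not_dvd (hP p p.2), dvd_qOf_iff hP]
      exact hp
    refine ⟨Nat.chineseRemainder hcop c (p * r p - r p), fun n => ?_⟩
    have h1 : qOf (insert p S) = p * qOf S := prod_insert hp
    rw [h1, mul_left_comm, mul_comm (p : ℕ), ← Nat.modEq_and_modEq_iff_modEq_mul hcop]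
    have h2 := (Nat.chineseRemainder hcop c (p * r p - r p)).2
    have h3 : n ≡ (Nat.chineseRemainder hcop c (p * r p - r p) : ℕ) [MOD W * qOf S] ↔ n ≡ c [MOD W * qOf S] :=
      ⟨fun h => h.trans h2.1, fun h => h.trans h2.1.symm⟩
    have h4 : n ≡ (Nat.chineseRemainder hcop c (p * r p - r p) : ℕ) [MOD p] ↔ n ≡ p * r p - r p [MOD p] :=
      ⟨fun h => h.trans h2.2, fun h => h.trans h2.2.symm⟩
    rw [h3, h4, ← hc, ← dvd_add_iff_modEq (hP p p.2).pos]
    simp only [mem_insert, forall_eq_or_imp]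
    tauto

variable {ι : Type*} [Fintype ι] [DecidableEq ι]

/-- `n` satisfies the divisibility conditions encoded by `a`. -/
def Compat (h : ι → ℕ) (a : P → Option ι) (n : ℕ) : Prop := ∀ p : P, ∀ i, a p = some i → (p : ℕ) ∣ n + h i

/-- The union of the supports of two tuples. -/
def suppPair (a b : P → Option ι) : Finset P := {p | (a p, b p) ≠ (none, none)}

theorem prod_locWeight_eq (g : ℕ → ℝ) (a b : P → Option ι) (hab : ∀ p i j, a p = some i → b p = some j → i = j) :
    ∏ p : P, locWeight (g p) (a p) (b p) = ∏ p ∈ suppPair a b, g p := by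
  rw [suppPair, prod_filter]
  refine prod_congr rfl fun p _ => ?_
  cases ha : a p with
  | none => cases hb : b p <;> simp [locWeight]
  | some i => cases hb : b p with
    | none => simp [locWeight]
    | some j => simp [locWeight, hab p i j ha hb]

theorem compat_or_iff (h : ι → ℕ) (a b : P → Option ι) (hab : ∀ p i j, a p = some i → b p = some j → i = j) (n : ℕ) :
    Compat h (fun p => (a p).or (b p)) n ↔ Compat h a n ∧ Compat h b n := by
  constructor
  · refine fun H => ⟨fun p i hi => H p i (by simp [hi]), fun p i hi => H p i ?_⟩
    simp only
    cases ha : a p with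
    | none => simpa using hi
    | some j => simp [hab p j i ha hi]
  · rintro ⟨H1, H2⟩ p i hi
    simp only at hi
    cases ha : a p with
    | none => rw [ha] at hi; exact H2 p i (by simpa using hi)
    | some j => rw [ha] at hi; exact H1 p i (by rw [ha]; simpa using hi)

theorem supp_or (a b : P → Option ι) : ({p | (a p).or (b p) ≠ none} : Finset P) = suppPair a b := by
  ext p
  simp only [suppPair, mem_filter, mem_univ, true_and]
  cases a p <;> cases b p <;> simp

theorem qOf_suppPair_le (hP : ∀ p ∈ P, p.Prime) (a b : P → Option ι) :
    qOf (suppPair a b) ≤ qOf ({p | a p ≠ none} : Finset P) * qOf ({p | b p ≠ none} : Finset P) := by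
  refine Nat.le_of_dvd (mul_pos (qOf_pos hP _) (qOf_pos hP _)) ?_
  have h : suppPair a b = ({p | a p ≠ none} : Finset P) ∪ ({p | b p ≠ none} : Finset P) := by
    ext p
    simp only [suppPair, mem_filter, mem_univ, true_and, mem_union]
    cases a p <;> cases b p <;> simp
  rw [h]
  unfold qOf
  rw [← prod_union_inter]
  exact dvd_mul_right _ _

open Classical in
/-- The linear form whose square is the sieve weight. -/
noncomputable def sieveLin (P : Finset ℕ) (h : ι → ℕ) (F : (ι → ℝ) → ℝ) (L : ℝ) (n : ℕ) : ℝ :=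
  ∑ a : P → Option ι, if Compat h a n then sieveWt F L a else 0

open Classical in
theorem abs_sum_sieve_sub_le (hP : ∀ p ∈ P, p.Prime) {h : ι → ℕ} {F : (ι → ℝ) → ℝ} {L K : ℝ} (hK : 0 ≤ K) {N₁ N : ℕ} (hN : N₁ ^ 2 ≤ N)
    (hF : ∀ a : P → Option ι, |sieveWt F L a| ≤ K)
    (hF0 : ∀ a : P → Option ι, sieveWt F L a ≠ 0 → qOf ({p | a p ≠ none} : Finset P) ≤ N₁)
    (hsep : ∀ p ∈ P, ∀ i j, i ≠ j → ∀ n, p ∣ n + h i → ¬ p ∣ n + h j)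
    {T : Finset ℕ} {u : ℕ → ℝ} {M : ℝ} {g : ℕ → ℝ} {E : Finset P → ℝ} (hE0 : ∀ S, 0 ≤ E S)
    (hE : ∀ e : P → Option ι, qOf ({p | e p ≠ none} : Finset P) ≤ N →
      |∑ n ∈ T with Compat h e n, u n - M * ∏ p ∈ ({p | e p ≠ none} : Finset P), g p| ≤ E {p | e p ≠ none}) :
    |∑ n ∈ T, u n * sieveLin P h F L n ^ 2 - M * sieveSum P F g L| ≤
      K ^ 2 * ∑ S : Finset P with qOf S ≤ N, ((((Fintype.card ι + 1) ^ 2 - 1 : ℕ) : ℝ)) ^ #S * E S := by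
  have h1 : ∑ n ∈ T, u n * sieveLin P h F L n ^ 2 =
      ∑ a : P → Option ι, ∑ b : P → Option ι, sieveWt F L a * sieveWt F L b * ∑ n ∈ T with Compat h a n ∧ Compat h b n, u n := by
    have : ∀ n, u n * sieveLin P h F L n ^ 2 = ∑ a : P → Option ι, ∑ b : P → Option ι,
        sieveWt F L a * sieveWt F L b * if Compat h a n ∧ Compat h b n then u n else 0 := by
      intro n
      rw [sieveLin, sq, sum_mul_sum, mul_sum]
      refine sum_congr rfl fun a _ => ?_
      rw [mul_sum]
      refine sum_congr rfl fun b _ => ?_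
      by_cases ha : Compat h a n <;> by_cases hb : Compat h b n <;> simp [ha, hb]
      ring
    simp only [this]
    rw [Finset.sum_comm]
    refine sum_congr rfl fun a _ => ?_
    rw [Finset.sum_comm]
    refine sum_congr rfl fun b _ => ?_
    rw [← mul_sum, sum_filter]

  have h2 : ∀ a b : P → Option ι, |sieveWt F L a * sieveWt F L b * (∑ n ∈ T with Compat h a n ∧ Compat h b n, u n) -
      M * (sieveWt F L a * sieveWt F L b * ∏ p : P, locWeight (g p) (a p) (b p))| ≤
      K ^ 2 * if qOf (suppPair a b) ≤ N then E (suppPair a b) else 0 := by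
    intro a b
    by_cases h0 : sieveWt F L a = 0 ∨ sieveWt F L b = 0
    · have : sieveWt F L a * sieveWt F L b = 0 := by simpa using h0
      rw [this]
      simp only [zero_mul, mul_zero, sub_zero, abs_zero]
      split_ifs
      · exact mul_nonneg (sq_nonneg K) (hE0 _)
      · simp
    push Not at h0
    have hq : qOf (suppPair a b) ≤ N := by
      refine (qOf_suppPair_le hP a b).trans (le_trans ?_ hN)
      rw [sq]
      exact Nat.mul_le_mul (hF0 a h0.1) (hF0 b h0.2)
    rw [if_pos hq]
    have hfac : sieveWt F L a * sieveWt F L b * (∑ n ∈ T with Compat h a n ∧ Compat h b n, u n) -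
      M * (sieveWt F L a * sieveWt F L b * ∏ p : P, locWeight (g p) (a p) (b p)) =
      sieveWt F L a * sieveWt F L b * ((∑ n ∈ T with Compat h a n ∧ Compat h b n, u n) - M * ∏ p : P, locWeight (g p) (a p) (b p)) := by ring
    rw [hfac, abs_mul, abs_mul, sq]
    refine mul_le_mul (mul_le_mul (hF a) (hF b) (abs_nonneg _) hK) ?_ (abs_nonneg _) (by positivity)
    by_cases hab : ∀ p i j, a p = some i → b p = some j → i = j
    · have := hE (fun p => (a p).or (b p)) (by rw [supp_or]; exact hq)
      rw [supp_or] at this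
      rw [prod_locWeight_eq _ _ _ hab]
      simpa only [compat_or_iff h a b hab] using this
    · push Not at hab
      obtain ⟨p, i, j, hi, hj, hij⟩ := hab
      rw [prod_eq_zero (mem_univ p) (by simp [hi, hj, locWeight, hij]), filter_false_of_mem]
      · simpa using hE0 _
      · exact fun n _ H => hsep p p.2 i j hij n (H.1 p i hi) (H.2 p j hj)
  have h3 : ∑ a : P → Option ι, ∑ b : P → Option ι, (if qOf (suppPair a b) ≤ N then E (suppPair a b) else 0) =
      ∑ S : Finset P with qOf S ≤ N, ((((Fintype.card ι + 1) ^ 2 - 1 : ℕ) : ℝ)) ^ #S * E S := by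
    have := sum_supp_eq (ρ := P) (α := Option ι × Option ι) (none, none) (fun S => if qOf S ≤ N then E S else 0)
    rw [sum_filter]
    simp only [Fintype.card_prod, Fintype.card_option, ← sq, mul_ite, mul_zero] at this
    rw [← this, ← (Equiv.arrowProdEquivProdArrow P (fun _ => Option ι) (fun _ => Option ι)).symm.sum_comp, Fintype.sum_prod_type]
    rfl
  rw [h1, sieveSum, mul_sum, ← sum_sub_distrib, ← h3, mul_sum]
  refine (abs_sum_le_sum_abs _ _).trans (sum_le_sum fun a _ => ?_)
  rw [mul_sum, mul_sum, ← sum_sub_distrib]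
  exact (abs_sum_le_sum_abs _ _).trans (sum_le_sum fun b _ => h2 a b)

end

end

section

open Finset Filter Topology
open ArithmeticFunction (vonMangoldt vonMangoldt_nonneg)
set_option linter.unusedSectionVars false

/-- An initial segment containing the support of `wt L`. -/
noncomputable def wtRange (L : ℝ) : Finset ℕ := range (⌊Real.exp (21 / 20 * L)⌋₊ + 1)

theorem mem_wtRange_of_ne_zero {L : ℝ} (hL : 0 < L) {n : ℕ} (h : wt L n ≠ 0) : n ∈ wtRange L := by
  have := (mem_Icc.1 (mem_wtSupp hL h)).2
  exact mem_range.2 (by omega)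

theorem sum_wtRange_filter (L : ℝ) (f : ℕ → ℝ) (p : ℕ → Prop) [DecidablePred p] :
    ∑ n ∈ wtRange L with p n, f n * wt L n = ∑ n ∈ wtSupp L with p n, f n * wt L n := by
  symm
  refine sum_subset (filter_subset_filter _ fun n hn => ?_) fun n hn hn' => ?_
  · have := (mem_Icc.1 hn).2
    exact mem_range.2 (by omega)
  · rw [mem_filter] at hn hn'
    have h1 := mem_range.1 hn.1
    have : n = 0 := by
      by_contra h0
      exact hn' ⟨mem_Icc.2 ⟨by omega, by omega⟩, hn.2⟩
    simp [this, wt]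

theorem sum_wtRange_shift {L : ℝ} (hL : 0 < L) {j : ℕ} (hj : (j:ℝ) ≤ Real.exp L) (q c : ℕ) (f : ℕ → ℝ) :
    ∑ n ∈ wtRange L with n ≡ c [MOD q], f (n + j) * wt L (n + j) = ∑ n ∈ wtSupp L with n ≡ c + j [MOD q], f n * wt L n := by
  rw [← sum_wtRange_filter]
  refine sum_bij_ne_zero (fun n _ _ => n + j) (fun n hn h0 => ?_) (fun _ _ _ _ _ _ h => Nat.add_right_cancel h) (fun n hn h0 => ?_) fun _ _ _ => rfl
  · exact mem_filter.2 ⟨mem_wtRange_of_ne_zero hL (right_ne_zero_of_mul h0), (mem_filter.1 hn).2.add_right j⟩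
  · have h1 := lt_of_wt_ne_zero hL (right_ne_zero_of_mul h0)
    have h2 : j ≤ n := by
      have : (j:ℝ) < n := lt_of_le_of_lt hj h1
      exact_mod_cast this.le
    have h3 : n - j + j = n := Nat.sub_add_cancel h2
    refine ⟨n - j, mem_filter.2 ⟨mem_range.2 ?_, ?_⟩, ?_, h3⟩
    · have := mem_range.1 (mem_filter.1 hn).1
      omega
    · refine Nat.ModEq.add_right_cancel' j ?_
      rw [h3]
      exact (mem_filter.1 hn).2
    · rw [h3]; exact h0

theorem exists_sum_abs_wt_sub_le : ∃ K : ℝ, 0 ≤ K ∧ ∀ L : ℝ, 1 ≤ L → ∀ j : ℕ, 2 * (j:ℝ) ≤ Real.exp L →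
    ∑ n ∈ wtRange L, |wt L n - wt L (n + j)| ≤ K * j * Real.exp (-L) := by
  obtain ⟨K, hK1, hK2⟩ := exists_lipschitz_bound (Φ := bumpV) bumpV.contDiff bumpV.hasCompactSupport
  have hK : 0 ≤ K := (abs_nonneg _).trans (hK1 0)
  refine ⟨4 * K, by positivity, fun L hL j hj => ?_⟩
  have hL0 : 0 < L := by linarith
  rcases Nat.eq_zero_or_pos j with rfl | hj0
  · simp
  set a := ⌊Real.exp L / 2⌋₊ with ha
  have hj1 : (1:ℝ) ≤ j := by exact_mod_cast hj0
  have h1 : ∀ n ∈ wtRange L, |wt L n - wt L (n + j)| ≠ 0 → n ∈ Ioc a ⌊Real.exp (21 / 20 * L)⌋₊ := by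
    intro n hn h0
    have h2 : Real.exp L < n + j := by
      by_contra hc
      push Not at hc
      have e1 : wt L n = 0 := by
        by_contra h
        have := lt_of_wt_ne_zero hL0 h
        linarith
      have e2 : wt L (n + j) = 0 := by
        by_contra h
        have := lt_of_wt_ne_zero hL0 h
        push_cast at this
        linarith
      simp [e1, e2] at h0
    have h3 := mem_range.1 hn
    refine mem_Ioc.2 ⟨?_, by omega⟩
    rw [ha, Nat.floor_lt (by positivity)]
    linarith
  calc _ = ∑ n ∈ wtRange L with n ∈ Ioc a ⌊Real.exp (21 / 20 * L)⌋₊, |wt L n - wt L (n + j)| := by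
        rw [sum_filter_of_ne h1]
    _ ≤ ∑ n ∈ Ioc a ⌊Real.exp (21 / 20 * L)⌋₊, |wt L n - wt L (n + j)| := by
        refine sum_le_sum_of_subset_of_nonneg (fun n hn => (mem_filter.1 hn).2) fun _ _ _ => abs_nonneg _
    _ ≤ ∑ n ∈ Ioc a ⌊Real.exp (21 / 20 * L)⌋₊, 2 * K * j * (1 / (n * (n + 1))) := by
        refine sum_le_sum fun n hn => ?_
        have hn0 : 0 < n := by have := (mem_Ioc.1 hn).1; omega
        have hn' : (0:ℝ) < n := by exact_mod_cast hn0
        refine (abs_smoothWt_sub_le hK1 hK2 hL hn0).trans ?_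
        rw [mul_one_div]
        gcongr
    _ ≤ 2 * K * j * (1 / (a + 1)) := by
        rw [← mul_sum]
        gcongr
        exact sum_inv_mul_succ_le _ _
    _ ≤ 2 * K * j * (2 * Real.exp (-L)) := by
        gcongr
        rw [Real.exp_neg, ← div_eq_mul_inv, div_le_div_iff₀ (by positivity) (Real.exp_pos L)]
        have := Nat.lt_floor_add_one (Real.exp L / 2)
        rw [← ha] at this
        linarith
    _ = _ := by ring

theorem exists_abs_sum_wt_modEq_sub_le : ∃ K : ℝ, 0 ≤ K ∧ ∀ L : ℝ, 1 ≤ L → ∀ q c : ℕ, 1 ≤ q → 2 * (q:ℝ) ≤ Real.exp L →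
    |∑ n ∈ wtRange L with n ≡ c [MOD q], wt L n - oneW L / q| ≤ K * q * Real.exp (-L) := by
  obtain ⟨K, hK, H⟩ := exists_sum_abs_wt_sub_le
  refine ⟨K, hK, fun L hL q c hq hq2 => ?_⟩
  have hL0 : 0 < L := by linarith
  have hq0 : (0:ℝ) < q := by exact_mod_cast hq
  have h1 : oneW L = ∑ j ∈ range q, ∑ n ∈ wtRange L with n ≡ c [MOD q], wt L (n + j) := by
    have h2 : ∀ j ∈ range q, ∑ n ∈ wtRange L with n ≡ c [MOD q], wt L (n + j) = ∑ n ∈ wtSupp L with n ≡ c + j [MOD q], wt L n := by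
      intro j hj
      have hjq : (j:ℝ) ≤ q := by exact_mod_cast (mem_range.1 hj).le
      have := sum_wtRange_shift hL0 (j := j) (by linarith) q c (fun _ => 1)
      simpa using this
    rw [sum_congr rfl h2, oneW]
    simp only [sum_filter]
    rw [Finset.sum_comm]
    refine sum_congr rfl fun n _ => ?_
    have hex : ∃ j ∈ range q, n ≡ c + j [MOD q] := by
      refine ⟨(n + c * q - c) % q, mem_range.2 (Nat.mod_lt _ hq), ?_⟩
      have hc : c ≤ c * q := Nat.le_mul_of_pos_right c hq
      have h3 : c + (n + c * q - c) % q ≡ c + (n + c * q - c) [MOD q] := (Nat.mod_modEq _ _).add_left c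
      have h4 : c + (n + c * q - c) = n + c * q := by omega
      rw [h4] at h3
      refine (h3.trans ?_).symm
      exact Nat.ModEq.symm (by simp [Nat.ModEq])
    obtain ⟨j, hj, hj'⟩ := hex
    rw [sum_eq_single_of_mem j hj, if_pos hj']
    intro i hi hij
    rw [if_neg]
    intro hi'
    have h5 := Nat.ModEq.add_left_cancel' c (hi'.symm.trans hj')
    exact hij (Nat.ModEq.eq_of_lt_of_lt h5 (mem_range.1 hi) (mem_range.1 hj))
  have h3 : (q:ℝ) * ∑ n ∈ wtRange L with n ≡ c [MOD q], wt L n - oneW L =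
      ∑ j ∈ range q, ∑ n ∈ wtRange L with n ≡ c [MOD q], (wt L n - wt L (n + j)) := by
    rw [h1]
    simp only [sum_sub_distrib, sum_const, card_range, nsmul_eq_mul]
  have h4 : |(q:ℝ) * ∑ n ∈ wtRange L with n ≡ c [MOD q], wt L n - oneW L| ≤ q * (K * q * Real.exp (-L)) := by
    rw [h3]
    calc _ ≤ ∑ j ∈ range q, K * q * Real.exp (-L) := by
          refine (abs_sum_le_sum_abs _ _).trans (sum_le_sum fun j hj => ?_)
          have hjq : (j:ℝ) ≤ q := by exact_mod_cast (mem_range.1 hj).le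
          refine (abs_sum_le_sum_abs _ _).trans ((sum_le_sum_of_subset_of_nonneg (filter_subset _ _) fun _ _ _ => abs_nonneg _).trans
            ((H L hL j (by linarith)).trans ?_))
          gcongr
      _ = _ := by simp
  have h5 : ∑ n ∈ wtRange L with n ≡ c [MOD q], wt L n - oneW L / q =
      ((q:ℝ) * ∑ n ∈ wtRange L with n ≡ c [MOD q], wt L n - oneW L) / q := by field_simp
  rw [h5, abs_div, abs_of_pos hq0, div_le_iff₀ hq0, mul_comm _ (q:ℝ)]
  exact h4

/-- The von Mangoldt function restricted to primes. -/
noncomputable def primeLog (n : ℕ) : ℝ := if n.Prime then Real.log n else 0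

theorem primeLog_nonneg (n : ℕ) : 0 ≤ primeLog n := by
  unfold primeLog; split_ifs <;> simp [Real.log_natCast_nonneg]

theorem primeLog_le (n : ℕ) : primeLog n ≤ vonMangoldt n := by
  unfold primeLog
  split_ifs with h
  · rw [ArithmeticFunction.vonMangoldt_apply_prime h]
  · exact vonMangoldt_nonneg

theorem exists_sum_vonMangoldt_sub_primeLog_le : ∃ C : ℝ, 0 ≤ C ∧ ∀ L : ℝ, 1 ≤ L →
    ∑ n ∈ wtSupp L, (vonMangoldt n - primeLog n) * wt L n ≤ C * Real.exp (-(19 / 40 * L)) := by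
  obtain ⟨C, hC⟩ := Chebyshev.psi_sub_theta_le_mul_sqrt
  have hC0 : 0 ≤ C := by
    have := hC 1
    have := Chebyshev.theta_le_psi 1
    simp at *
    linarith
  refine ⟨C, hC0, fun L hL => ?_⟩
  have hL0 : 0 < L := by linarith
  have h1 : ∀ n ∈ wtSupp L, (vonMangoldt n - primeLog n) * wt L n ≤ (vonMangoldt n - primeLog n) * Real.exp (-L) := by
    intro n hn
    refine mul_le_mul_of_nonneg_left ?_ (sub_nonneg.2 (primeLog_le n))
    by_cases h0 : wt L n = 0
    · rw [h0]; positivity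
    · have := lt_of_wt_ne_zero hL0 h0
      refine (wt_le L n).trans ?_
      rw [Real.exp_neg, one_div]
      exact inv_anti₀ (Real.exp_pos L) this.le
  have h2 : ∑ n ∈ wtSupp L, (vonMangoldt n - primeLog n) = Chebyshev.psi (Real.exp (21 / 20 * L)) - Chebyshev.theta (Real.exp (21 / 20 * L)) := by
    rw [Chebyshev.psi_sub_theta_eq_sum_not_prime, sum_filter]
    refine sum_congr rfl fun n _ => ?_
    by_cases hn : n.Prime
    · simp [primeLog, hn, ArithmeticFunction.vonMangoldt_apply_prime]
    · simp [primeLog, hn]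
  refine (sum_le_sum h1).trans ?_
  rw [← sum_mul, h2]
  calc _ ≤ (C * √(Real.exp (21 / 20 * L))) * Real.exp (-L) := by gcongr; exact hC _
    _ = _ := by
      rw [mul_assoc, Real.sqrt_eq_rpow, ← Real.exp_mul, ← Real.exp_add]
      congr 2; ring

theorem exists_abs_sum_primeLog_sub_le : ∃ C : ℝ, 0 ≤ C ∧ ∀ L : ℝ, 1 ≤ L → ∀ h : ℕ, (h:ℝ) ≤ Real.exp L → ∀ q c : ℕ,
    |∑ n ∈ wtRange L with n ≡ c [MOD q], primeLog (n + h) * wt L (n + h) - progW q (c + h) L| ≤ C * Real.exp (-(19 / 40 * L)) := by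
  obtain ⟨C, hC, H⟩ := exists_sum_vonMangoldt_sub_primeLog_le
  refine ⟨C, hC, fun L hL h hh q c => ?_⟩
  rw [sum_wtRange_shift (by linarith) hh q c primeLog, progW, abs_sub_comm, ← sum_sub_distrib]
  simp only [← sub_mul]
  have h0 : ∀ n, 0 ≤ (vonMangoldt n - primeLog n) * wt L n := fun n => mul_nonneg (sub_nonneg.2 (primeLog_le n)) (wt_nonneg L n)
  rw [abs_of_nonneg (sum_nonneg fun n _ => h0 n)]
  exact (sum_le_sum_of_subset_of_nonneg (filter_subset _ _) fun n _ _ => h0 n).trans (H L hL)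

theorem psiW_le {L : ℝ} (hL : 1 ≤ L) : psiW L ≤ 21 / 20 * L * oneW L := by
  rw [psiW, oneW, mul_sum]
  refine sum_le_sum fun n hn => mul_le_mul_of_nonneg_right ?_ (wt_nonneg L n)
  obtain ⟨h1, h2⟩ := mem_Icc.1 hn
  refine ArithmeticFunction.vonMangoldt_le_log.trans ?_
  rw [Real.log_le_iff_le_exp (by exact_mod_cast h1)]
  exact (Nat.cast_le.2 h2).trans (Nat.floor_le (Real.exp_pos _).le)

theorem progW_le {L : ℝ} (q c : ℕ) :
    progW q c L ≤ 21 / 20 * L * ∑ n ∈ wtRange L with n ≡ c [MOD q], wt L n := by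
  have := sum_wtRange_filter L (fun _ => 1) (fun n => n ≡ c [MOD q])
  simp only [one_mul] at this
  rw [this, progW, mul_sum]
  refine sum_le_sum fun n hn => mul_le_mul_of_nonneg_right ?_ (wt_nonneg L n)
  obtain ⟨h1, h2⟩ := mem_Icc.1 (mem_filter.1 hn).1
  refine ArithmeticFunction.vonMangoldt_le_log.trans ?_
  rw [Real.log_le_iff_le_exp (by exact_mod_cast h1)]
  exact (Nat.cast_le.2 h2).trans (Nat.floor_le (Real.exp_pos _).le)

end

section

open Finset Filter Topology
open ArithmeticFunction (vonMangoldt vonMangoldt_nonneg)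
set_option linter.unusedSectionVars false

section
variable {ι : Type*} [Fintype ι] [DecidableEq ι]

theorem abs_sieveWt_le {P : Finset ℕ} {F : (ι → ℝ) → ℝ} {K : ℝ} (hF : ∀ t : ι → ℝ, (∀ i, 0 ≤ t i) → |F t| ≤ K) {L : ℝ} (hL : 0 < L)
    (a : P → Option ι) : |sieveWt F L a| ≤ K := by
  rw [sieveWt, abs_mul, abs_prod]
  have : ∀ p, |sgnOpt (a p)| = 1 := by
    intro p
    cases a p <;> simp [sgnOpt]
  simp only [this, prod_const_one, one_mul]
  exact hF _ fun i => div_nonneg (Real.log_natCast_nonneg _) hL.le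

theorem qOf_le_of_sieveWt_ne_zero {P : Finset ℕ} (hP : ∀ p ∈ P, p.Prime) {F : (ι → ℝ) → ℝ} {θ : ℝ}
    (hF : ∀ t : ι → ℝ, (∀ i, 0 ≤ t i) → θ ≤ ∑ i, t i → F t = 0) {L : ℝ} (hL : 0 < L)
    {a : P → Option ι} (ha : sieveWt F L a ≠ 0) : qOf ({p | a p ≠ none} : Finset P) ≤ ⌊Real.exp (θ * L)⌋₊ := by
  have h1 : ∑ i, Real.log (dPart a i) / L < θ := by
    by_contra hc
    push Not at hc
    exact ha (by rw [sieveWt, hF _ (fun i => div_nonneg (Real.log_natCast_nonneg _) hL.le) hc, mul_zero])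
  rw [← sum_div, div_lt_iff₀ hL, ← Real.log_prod fun i _ => by exact_mod_cast (dPart_pos hP a i).ne'] at h1
  have h2 : ∏ i, (dPart a i : ℝ) = (qOf ({p | a p ≠ none} : Finset P) : ℕ) := by rw [qOf_supp_eq_prod_dPart]; push_cast; rfl
  have h3 : (0:ℝ) < (qOf ({p | a p ≠ none} : Finset P) : ℕ) := by exact_mod_cast qOf_pos hP _
  rw [h2] at h1
  exact Nat.le_floor ((Real.log_le_iff_le_exp h3).1 h1.le)

theorem exists_modEq_iff_compat {P : Finset ℕ} (hP : ∀ p ∈ P, p.Prime) {W : ℕ} (hW : ∀ p ∈ P, W.Coprime p) (v : ℕ) (h : ι → ℕ) (e : P → Option ι) :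
    ∃ c, ∀ n, (n ≡ v [MOD W] ∧ Compat h e n) ↔ n ≡ c [MOD W * qOf ({p | e p ≠ none} : Finset P)] := by
  obtain ⟨c, hc⟩ := exists_modEq_iff hP hW v (fun p => ((e p).map h).getD 0) {p | e p ≠ none}
  refine ⟨c, fun n => ?_⟩
  rw [← hc]
  refine and_congr_right fun _ => ?_
  constructor
  · intro H p hp
    obtain ⟨i, hi⟩ := Option.ne_none_iff_exists'.1 (mem_filter.1 hp).2
    simpa [hi] using H p i hi
  · intro H p i hi
    simpa [hi] using H p (mem_filter.2 ⟨mem_univ _, by simp [hi]⟩)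

end

/-- The product of the primes below `D`. -/
def primeProd (D : ℕ) : ℕ := ∏ p ∈ sievePrimes 0 D, p

theorem prime_of_mem_sievePrimes {D X : ℕ} : ∀ p ∈ sievePrimes D X, p.Prime := fun _ hp => (mem_sievePrimes.1 hp).2

theorem primeProd_pos (D : ℕ) : 0 < primeProd D := prod_pos fun p hp => (prime_of_mem_sievePrimes p hp).pos

theorem primeProd_coprime {D X : ℕ} : ∀ p ∈ sievePrimes D X, (primeProd D).Coprime p := by
  intro p hp
  refine Nat.Coprime.prod_left fun q hq => ?_
  rw [mem_sievePrimes] at hp hq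
  exact (Nat.coprime_primes hq.2 hp.2).2 (by omega)

theorem not_dvd_add_of_sievePrimes {D X a b : ℕ} (ha : a < D) (hb : b < D) (hab : a ≠ b) : ∀ p ∈ sievePrimes D X, ∀ n, p ∣ n + a → ¬ p ∣ n + b := by
  intro p hp n h1 h2
  have h3 := (mem_sievePrimes.1 hp).1.1
  have h4 : (p:ℤ) ∣ (a:ℤ) - b := by
    have e1 : (p:ℤ) ∣ (n:ℤ) + a := by exact_mod_cast h1
    have e2 : (p:ℤ) ∣ (n:ℤ) + b := by exact_mod_cast h2
    have := dvd_sub e1 e2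
    simpa using this
  have := Int.eq_zero_of_abs_lt_dvd h4 (by rw [abs_lt]; constructor <;> omega)
  omega

theorem prod_inv_eq_one_div_qOf {P : Finset ℕ} (S : Finset P) : ∏ p ∈ S, (1 / ((p:ℕ):ℝ)) = 1 / qOf S := by
  rw [prod_div_distrib, prod_const_one, qOf]; push_cast; rfl

theorem totient_qOf {P : Finset ℕ} (hP : ∀ p ∈ P, p.Prime) (S : Finset P) : ((qOf S).totient : ℝ) = ∏ p ∈ S, (((p:ℕ):ℝ) - 1) := by
  induction S using Finset.induction_on with
  | empty => simp [qOf]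
  | insert p S hp ih =>
    have h1 : qOf (insert p S) = p * qOf S := prod_insert hp
    rw [h1, Nat.totient_mul, Nat.totient_prime (hP p p.2), prod_insert hp, Nat.cast_mul, ih, Nat.cast_pred (hP p p.2).pos]
    rw [Nat.Prime.coprime_iff_not_dvd (hP p p.2), dvd_qOf_iff hP]
    exact hp

theorem qOf_le_two_pow_mul_totient {P : Finset ℕ} (hP : ∀ p ∈ P, p.Prime) (S : Finset P) : (qOf S : ℝ) ≤ 2 ^ #S * (qOf S).totient := by
  rw [totient_qOf hP, ← prod_const, ← prod_mul_distrib, qOf, Nat.cast_prod]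
  refine prod_le_prod (fun _ _ => Nat.cast_nonneg _) fun p _ => ?_
  have : (2:ℝ) ≤ (p:ℕ) := by exact_mod_cast (hP p p.2).two_le
  linarith

theorem coprime_qOf {P : Finset ℕ} {W : ℕ} (hW : ∀ p ∈ P, W.Coprime p) (S : Finset P) : W.Coprime (qOf S) :=
  Nat.Coprime.prod_right fun p _ => hW p p.2

section
variable {ι : Type*} [Fintype ι] [DecidableEq ι]

/-- `F` is bounded on the orthant and vanishes for `Σ t ≥ 3/25`. -/
structure IsSieveFun (F : (ι → ℝ) → ℝ) (K : ℝ) : Prop where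
  nonneg : 0 ≤ K
  bound : ∀ t : ι → ℝ, (∀ i, 0 ≤ t i) → |F t| ≤ K
  vanish : ∀ t : ι → ℝ, (∀ i, 0 ≤ t i) → 3 / 25 ≤ ∑ i, t i → F t = 0

theorem floor_exp_sq_le (L : ℝ) : ⌊Real.exp (3 / 25 * L)⌋₊ ^ 2 ≤ ⌊Real.exp (6 / 25 * L)⌋₊ := by
  refine Nat.le_floor ?_
  push_cast
  calc _ ≤ Real.exp (3 / 25 * L) ^ 2 := by gcongr; exact Nat.floor_le (Real.exp_pos _).le
    _ = _ := by rw [← Real.exp_nat_mul]; congr 1; push_cast; ring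

theorem log_floor_exp_le {θ L : ℝ} (h : 0 ≤ θ * L) : Real.log ⌊Real.exp (θ * L)⌋₊ ≤ θ * L := by
  have h1 : 1 ≤ ⌊Real.exp (θ * L)⌋₊ := Nat.le_floor (by simpa using h)
  rw [Real.log_le_iff_le_exp (by exact_mod_cast h1)]
  exact Nat.floor_le (Real.exp_pos _).le

/-- The numbers in a residue class modulo the product of the small primes. -/
noncomputable def sieveRange (D v : ℕ) (L : ℝ) : Finset ℕ := {n ∈ wtRange L | n ≡ v [MOD primeProd D]}

open Classical in
theorem exists_sum_wt_sieve_sub_le {h : ι → ℕ} (hh : Function.Injective h) {D : ℕ} (hD : ∀ i, h i < D) (v : ℕ) {F : (ι → ℝ) → ℝ} {K : ℝ}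
    (hF : IsSieveFun F K) : ∃ C : ℝ, 0 ≤ C ∧ ∀ L : ℝ, 1 ≤ L → 2 * (primeProd D : ℝ) ≤ Real.exp (L / 200) → ∀ X : ℕ,
    |∑ n ∈ sieveRange D v L, wt L n * sieveLin (sievePrimes D X) h F L n ^ 2 -
      oneW L / primeProd D * sieveSum (sievePrimes D X) F (fun p => 1 / (p:ℝ)) L| ≤
      C * (1 + L) ^ ((Fintype.card ι + 1) ^ 2 - 1) * Real.exp (-(13 / 25 * L)) := by
  obtain ⟨K₁, hK₁, H⟩ := exists_abs_sum_wt_modEq_sub_le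
  set κ := (Fintype.card ι + 1) ^ 2 - 1 with hκ
  set W := primeProd D with hWdef
  have hW0 : (0:ℝ) < W := by exact_mod_cast primeProd_pos D
  refine ⟨K ^ 2 * (K₁ * W), by positivity, fun L hL hWL X => ?_⟩
  have hL0 : 0 < L := by linarith
  set P := sievePrimes D X
  set N := ⌊Real.exp (6 / 25 * L)⌋₊ with hN
  have hNle : (N:ℝ) ≤ Real.exp (6 / 25 * L) := Nat.floor_le (Real.exp_pos _).le
  have hP : ∀ p ∈ P, p.Prime := prime_of_mem_sievePrimes
  have key := abs_sum_sieve_sub_le hP (h := h) (F := F) (L := L) hF.nonneg (floor_exp_sq_le L) (fun a => abs_sieveWt_le hF.bound hL0 a)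
    (fun a ha => qOf_le_of_sieveWt_ne_zero hP hF.vanish hL0 ha)
    (fun p hp i j hij n => not_dvd_add_of_sievePrimes (hD i) (hD j) (fun e => hij (hh e)) p hp n)
    (T := sieveRange D v L) (u := wt L) (M := oneW L / W) (g := fun p => 1 / (p:ℝ)) (E := fun S => K₁ * (W * qOf S) * Real.exp (-L))
    (fun S => by positivity) (by
      intro e he
      obtain ⟨c, hc⟩ := exists_modEq_iff_compat hP primeProd_coprime v h e
      have e1 : ({n ∈ sieveRange D v L | Compat h e n} : Finset ℕ) =
          {n ∈ wtRange L | n ≡ c [MOD W * qOf ({p | e p ≠ none} : Finset P)]} := by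
        ext n
        rw [sieveRange, mem_filter, mem_filter, mem_filter, and_assoc, hc]
      have hq : (qOf ({p | e p ≠ none} : Finset P) : ℝ) ≤ Real.exp (6 / 25 * L) := (Nat.cast_le.2 he).trans hNle
      rw [prod_inv_eq_one_div_qOf, div_mul_div_comm, mul_one]
      have := H L hL (W * qOf ({p | e p ≠ none} : Finset P)) c (Nat.mul_pos (primeProd_pos D) (qOf_pos hP _)) (by
        push_cast
        calc 2 * ((W:ℝ) * qOf ({p | e p ≠ none} : Finset P)) = 2 * W * qOf ({p | e p ≠ none} : Finset P) := by ring
          _ ≤ Real.exp (L / 200) * Real.exp (6 / 25 * L) := by gcongr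
          _ ≤ Real.exp L := by rw [← Real.exp_add]; exact Real.exp_le_exp.2 (by linarith))
      push_cast at this
      convert this using 3
      exact sum_congr (by convert e1) fun _ _ => rfl)
  refine key.trans ?_
  have h2 : ∑ S : Finset P with qOf S ≤ N, (κ:ℝ) ^ #S * (K₁ * (W * qOf S) * Real.exp (-L)) ≤
      (K₁ * W * Real.exp (-L) * N ^ 2) * ∑ S : Finset P with qOf S ≤ N, (κ:ℝ) ^ #S / qOf S := by
    rw [mul_sum]
    refine sum_le_sum fun S hS => ?_
    have h3 : (0:ℝ) < qOf S := by exact_mod_cast qOf_pos hP S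
    have h4 : (qOf S:ℝ) ≤ N := by exact_mod_cast (mem_filter.1 hS).2
    have h5 : (κ:ℝ) ^ #S * (K₁ * (W * qOf S) * Real.exp (-L)) = K₁ * W * Real.exp (-L) * (qOf S : ℝ) ^ 2 * ((κ:ℝ) ^ #S / qOf S) := by
      field_simp
    rw [h5]
    gcongr
  have h6 : ∑ S : Finset P with qOf S ≤ N, (κ:ℝ) ^ #S / qOf S ≤ (1 + L) ^ κ := by
    refine (sum_pow_card_div_qOf_le hP κ N).trans ?_
    have := log_floor_exp_le (θ := 6 / 25) (L := L) (by positivity)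
    have h7 : 0 ≤ Real.log N := Real.log_natCast_nonneg N
    gcongr
    linarith
  calc _ ≤ K ^ 2 * ((K₁ * W * Real.exp (-L) * Real.exp (6 / 25 * L) ^ 2) * (1 + L) ^ κ) := by
        gcongr
        refine h2.trans ?_
        gcongr
    _ = _ := by
        have : Real.exp (-(13 / 25 * L)) = Real.exp (-L) * Real.exp (6 / 25 * L) ^ 2 := by
          rw [← Real.exp_nat_mul, ← Real.exp_add]; congr 1; push_cast; ring
        rw [this]; ring

end

end

section

open Finset Filter Topology
open ArithmeticFunction (vonMangoldt vonMangoldt_nonneg)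

theorem charErr_nonneg (q : ℕ) (L : ℝ) : 0 ≤ charErr q L := by
  unfold charErr; positivity

theorem mul_min_le {c l x y : ℝ} (hl : 0 < l) (hc : 0 ≤ c) (hx : 0 ≤ x) (hy : 0 ≤ y) :
    c * min x y ≤ l * x + c ^ 2 * y / l := by
  rcases le_total c l with h | h
  · calc c * min x y ≤ l * x := by gcongr; exact min_le_left _ _
      _ ≤ _ := by have : 0 ≤ c ^ 2 * y / l := by positivity
                  linarith
  · calc c * min x y ≤ c * y := by gcongr; exact min_le_right _ _
      _ ≤ c ^ 2 * y / l := by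
        rw [le_div_iff₀ hl]
        nlinarith [mul_le_mul_of_nonneg_left h (mul_nonneg hc hy)]
      _ ≤ _ := by have : 0 ≤ l * x := by positivity
                  linarith

theorem sq_le_mul_exp_half {L : ℝ} (hL : 0 ≤ L) : L ^ 2 ≤ 16 * Real.exp (L / 2) := by
  have h1 := Real.add_one_le_exp (L / 4)
  have h2 : Real.exp (L / 2) = Real.exp (L / 4) ^ 2 := by rw [← Real.exp_nat_mul]; congr 1; push_cast; ring
  rw [h2]
  nlinarith

theorem sum_primeLog_shift_le {L : ℝ} (hL : 0 < L) {j : ℕ} (hj : (j:ℝ) ≤ Real.exp L) (q c : ℕ) :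
    ∑ n ∈ wtRange L with n ≡ c [MOD q], primeLog (n + j) * wt L (n + j) ≤ progW q (c + j) L := by
  rw [sum_wtRange_shift hL hj q c primeLog, progW]
  exact sum_le_sum fun n _ => mul_le_mul_of_nonneg_right (primeLog_le n) (wt_nonneg L n)

/-- The trivial bound for primes in progressions with modulus `W * q`. -/
theorem exists_progW_le : ∃ C : ℝ, 0 ≤ C ∧ ∀ L : ℝ, 1 ≤ L → ∀ q c : ℕ, 1 ≤ q → 2 * (q:ℝ) ≤ Real.exp (L / 2) →
    progW q c L ≤ C * L ^ 2 / q := by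
  obtain ⟨K, hK, H⟩ := exists_abs_sum_wt_modEq_sub_le
  refine ⟨21 / 20 * (6 + K), by positivity, fun L hL q c hq hq2 => ?_⟩
  have hL0 : 0 < L := by linarith
  have hq0 : (0:ℝ) < q := by exact_mod_cast hq
  have hq1 : (1:ℝ) ≤ q := by exact_mod_cast hq
  have h1 := (abs_le.1 (H L hL q c hq (hq2.trans (Real.exp_le_exp.2 (by linarith))))).2
  have h2 := oneW_le hL
  have h3 : (q:ℝ) * Real.exp (-L) ≤ 1 / q := by
    rw [le_div_iff₀ hq0]
    calc (q:ℝ) * Real.exp (-L) * q ≤ Real.exp (L / 2) * Real.exp (-L) * Real.exp (L / 2) := by gcongr <;> linarith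
      _ = 1 := by rw [← Real.exp_add, ← Real.exp_add, Real.exp_eq_one_iff]; ring
  have h4 : ∑ n ∈ wtRange L with n ≡ c [MOD q], wt L n ≤ (6 + K) * L / q := by
    calc _ ≤ oneW L / q + K * (q * Real.exp (-L)) := by linarith
      _ ≤ 6 * L / q + K * (1 / q) := by gcongr
      _ ≤ 6 * L / q + K * (L / q) := by gcongr
      _ = _ := by ring
  calc _ ≤ _ := progW_le q c
    _ ≤ 21 / 20 * L * ((6 + K) * L / q) := by gcongr
    _ = _ := by ring

section
variable {ι : Type*} [Fintype ι] [DecidableEq ι]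

open Classical in
set_option maxHeartbeats 1000000 in
theorem exists_sum_primeLog_sieve_sub_le {h : ι → ℕ} (hh : Function.Injective h) {D : ℕ} (hD : ∀ i, h i < D) {j : ℕ} (hj : j < D)
    (hjh : ∀ i, h i ≠ j) {v : ℕ} (hv : (v + j).Coprime (primeProd D)) {F : (ι → ℝ) → ℝ} {K : ℝ}
    (hF : IsSieveFun F K) (A : ℕ) : ∃ C : ℝ, 0 ≤ C ∧ ∀ L : ℝ, 1 ≤ L → 2 * (primeProd D : ℝ) ≤ Real.exp (L / 200) →
    (D:ℝ) ≤ Real.exp L → ∀ X : ℕ,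
    |∑ n ∈ sieveRange D v L, primeLog (n + j) * wt L (n + j) * sieveLin (sievePrimes D X) h F L n ^ 2 -
      psiW L / (primeProd D).totient * sieveSum (sievePrimes D X) F (fun p => 1 / ((p:ℝ) - 1)) L| ≤
      C * (L ^ A * (∑ q ∈ Icc 1 ⌊Real.exp (49 / 200 * L)⌋₊, charErr q L + Real.exp (-(L / 5))) +
        (1 + L) ^ (2 * ((Fintype.card ι + 1) ^ 2 - 1) ^ 2 + 2) / L ^ A) := by
  obtain ⟨C₁, hC₁, H₁⟩ := exists_progW_le
  obtain ⟨C₂, hC₂, H₂⟩ := exists_abs_sum_primeLog_sub_le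
  set κ := (Fintype.card ι + 1) ^ 2 - 1 with hκ
  set W := primeProd D with hWdef
  have hW0 : (0:ℝ) < W := by exact_mod_cast primeProd_pos D
  have hW1 : (1:ℝ) ≤ W := by exact_mod_cast primeProd_pos D
  have hφW : 0 < W.totient := Nat.totient_pos.2 (primeProd_pos D)
  refine ⟨K ^ 2 * (1 + (C₂ + 48) + (C₁ + 7)), by positivity, fun L hL hWL hDL X => ?_⟩
  have hL0 : 0 < L := by linarith
  set P := sievePrimes D X
  set N := ⌊Real.exp (6 / 25 * L)⌋₊ with hN
  have hNle : (N:ℝ) ≤ Real.exp (6 / 25 * L) := Nat.floor_le (Real.exp_pos _).le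
  have hP : ∀ p ∈ P, p.Prime := prime_of_mem_sievePrimes
  have hjL : (j:ℝ) ≤ Real.exp L := le_trans (by exact_mod_cast hj.le) hDL
  have hWq : ∀ S : Finset P, qOf S ≤ N → 2 * ((W * qOf S : ℕ) : ℝ) ≤ Real.exp (49 / 200 * L) := by
    intro S hS
    have hq : (qOf S : ℝ) ≤ Real.exp (6 / 25 * L) := (Nat.cast_le.2 hS).trans hNle
    push_cast
    calc 2 * ((W:ℝ) * qOf S) = 2 * W * qOf S := by ring
      _ ≤ Real.exp (L / 200) * Real.exp (6 / 25 * L) := by gcongr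
      _ = Real.exp (49 / 200 * L) := by rw [← Real.exp_add]; congr 1; ring
  have key := abs_sum_sieve_sub_le hP (h := h) (F := F) (L := L) hF.nonneg (floor_exp_sq_le L) (fun a => abs_sieveWt_le hF.bound hL0 a)
    (fun a ha => qOf_le_of_sieveWt_ne_zero hP hF.vanish hL0 ha)
    (fun p hp i j hij n => not_dvd_add_of_sievePrimes (hD i) (hD j) (fun e => hij (hh e)) p hp n)
    (T := sieveRange D v L) (u := fun n => primeLog (n + j) * wt L (n + j)) (M := psiW L / W.totient) (g := fun p => 1 / ((p:ℝ) - 1))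
    (E := fun S => min (charErr (W * qOf S) L + (C₂ + 48) * Real.exp (-(19 / 40 * L))) ((C₁ + 7) * L ^ 2 * (2 ^ #S / qOf S)))
    (fun S => le_min (by have := charErr_nonneg (W * qOf S) L; positivity) (by positivity)) (by
      intro e he
      obtain ⟨c, hc⟩ := exists_modEq_iff_compat hP primeProd_coprime v h e
      set S : Finset P := {p | e p ≠ none} with hS
      have e1 : ({n ∈ sieveRange D v L | Compat h e n} : Finset ℕ) = {n ∈ wtRange L | n ≡ c [MOD W * qOf S]} := by
        ext n
        rw [sieveRange, mem_filter, mem_filter, mem_filter, and_assoc, hc]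
      have e2 : ∑ n ∈ sieveRange D v L with Compat h e n, primeLog (n + j) * wt L (n + j) =
          ∑ n ∈ wtRange L with n ≡ c [MOD W * qOf S], primeLog (n + j) * wt L (n + j) :=
        sum_congr (by convert e1) fun _ _ => rfl
      have hqpos : 0 < W * qOf S := Nat.mul_pos (primeProd_pos D) (qOf_pos hP _)
      have hq0 : (0:ℝ) < qOf S := by exact_mod_cast qOf_pos hP S
      have hcc := (hc c).2 (Nat.ModEq.refl c)
      have hcop : (c + j).Coprime (W * qOf S) := by
        refine Nat.Coprime.mul_right ?_ (Nat.Coprime.prod_right fun p hp => ?_)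
        · have : (c + j) ≡ v + j [MOD W] := hcc.1.add_right j
          rw [Nat.Coprime, this.gcd_eq]
          exact hv
        · obtain ⟨i, hi⟩ := Option.ne_none_iff_exists'.1 (mem_filter.1 hp).2
          have h1 := hcc.2 p i hi
          have h2 := not_dvd_add_of_sievePrimes (hD i) hj (hjh i) p p.2 c h1
          exact ((Nat.Prime.coprime_iff_not_dvd (hP p p.2)).2 h2).symm
      have htot : ((W * qOf S).totient : ℝ) = W.totient * (qOf S).totient := by
        rw [Nat.totient_mul (coprime_qOf primeProd_coprime S)]; push_cast; rfl
      have hφS : (0:ℝ) < (qOf S).totient := by exact_mod_cast Nat.totient_pos.2 (qOf_pos hP S)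
      have e3 : psiW L / W.totient * ∏ p ∈ S, (1 / (((p:ℕ):ℝ) - 1)) = psiW L / (W * qOf S).totient := by
        rw [prod_div_distrib, prod_const_one, ← totient_qOf hP, htot, div_mul_div_comm, mul_one]
      have hψ : psiW L ≤ 7 * L ^ 2 := by
        have h1 := psiW_le hL
        have h2 := oneW_le hL
        have : 21 / 20 * L * oneW L ≤ 21 / 20 * L * (6 * L) := by gcongr
        nlinarith
      have hψ0 : 0 ≤ psiW L := sum_nonneg fun n _ => mul_nonneg vonMangoldt_nonneg (wt_nonneg L n)
      rw [e3]
      rw [e2]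
      refine le_min ?_ ?_
      · have a1 := H₂ L hL j hjL (W * qOf S) c
        have a2 := abs_progW_sub_le hL hqpos hcop
        have a3 := abs_sub_le (∑ n ∈ wtRange L with n ≡ c [MOD W * qOf S], primeLog (n + j) * wt L (n + j)) (progW (W * qOf S) (c + j) L)
          (psiW L / (W * qOf S).totient)
        have a4 : Real.log ((W * qOf S : ℕ) : ℝ) ≤ L := by
          rw [Real.log_le_iff_le_exp (by exact_mod_cast hqpos)]
          have := hWq S he
          have : Real.exp (49 / 200 * L) ≤ Real.exp L := Real.exp_le_exp.2 (by linarith)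
          have : (0:ℝ) ≤ ((W * qOf S : ℕ) : ℝ) := by positivity
          linarith
        have a5 : 3 * L * Real.log ((W * qOf S : ℕ) : ℝ) * Real.exp (-L) ≤ 48 * Real.exp (-(19 / 40 * L)) := by
          calc _ ≤ 3 * L * L * Real.exp (-L) := by gcongr
            _ = 3 * L ^ 2 * Real.exp (-L) := by ring
            _ ≤ 3 * (16 * Real.exp (L / 2)) * Real.exp (-L) := by gcongr; exact sq_le_mul_exp_half hL0.le
            _ = 48 * Real.exp (-(L / 2)) := by
                have : Real.exp (-(L / 2)) = Real.exp (L / 2) * Real.exp (-L) := by rw [← Real.exp_add]; congr 1; ring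
                rw [this]; ring
            _ ≤ _ := by gcongr 48 * Real.exp ?_; linarith
        linarith
      · have b1 := sum_primeLog_shift_le hL0 hjL (W * qOf S) c
        have b2 := H₁ L hL (W * qOf S) (c + j) hqpos ((hWq S he).trans (Real.exp_le_exp.2 (by linarith)))
        have b3 : C₁ * L ^ 2 / ((W * qOf S : ℕ) : ℝ) ≤ C₁ * L ^ 2 * (2 ^ #S / qOf S) := by
          rw [← mul_one_div]
          refine mul_le_mul_of_nonneg_left ?_ (by positivity)
          have : (qOf S:ℝ) ≤ ((W * qOf S : ℕ) : ℝ) := by push_cast; nlinarith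
          gcongr
          exact one_le_pow₀ (by norm_num)
        have b4 : psiW L / (W * qOf S).totient ≤ 7 * L ^ 2 * (2 ^ #S / qOf S) := by
          rw [htot, div_eq_mul_inv]
          have : ((W.totient : ℝ) * (qOf S).totient)⁻¹ ≤ 2 ^ #S / qOf S := by
            rw [← one_div, div_le_div_iff₀ (by positivity) hq0, one_mul]
            refine (qOf_le_two_pow_mul_totient hP S).trans ?_
            gcongr
            have : (1:ℝ) ≤ W.totient := by exact_mod_cast hφW
            nlinarith
          gcongr
        have b5 : 0 ≤ psiW L / (W * qOf S).totient := by positivity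
        have b6 : 0 ≤ ∑ n ∈ wtRange L with n ≡ c [MOD W * qOf S], primeLog (n + j) * wt L (n + j) :=
          sum_nonneg fun n _ => mul_nonneg (primeLog_nonneg _) (wt_nonneg _ _)
        have b7 : 0 ≤ C₁ * L ^ 2 * (2 ^ #S / (qOf S : ℝ)) := by positivity
        have b8 : 0 ≤ 7 * L ^ 2 * (2 ^ #S / (qOf S : ℝ)) := by positivity
        have b9 : (C₁ + 7) * L ^ 2 * (2 ^ #S / (qOf S : ℝ)) = C₁ * L ^ 2 * (2 ^ #S / qOf S) + 7 * L ^ 2 * (2 ^ #S / qOf S) := by ring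
        rw [abs_le, b9]
        constructor <;> linarith)
  refine key.trans ?_
  rw [mul_assoc (K ^ 2)]
  refine mul_le_mul_of_nonneg_left ?_ (sq_nonneg K)
  set T : Finset (Finset P) := {S | qOf S ≤ N} with hT
  set Sc := ∑ q ∈ Icc 1 ⌊Real.exp (49 / 200 * L)⌋₊, charErr q L with hSc
  have hS0 : 0 ≤ Sc := sum_nonneg fun q _ => charErr_nonneg q L
  have hLA : (0:ℝ) < L ^ A := by positivity
  have s1 : ∑ S ∈ T, charErr (W * qOf S) L ≤ Sc := by
    have hinj : Set.InjOn (fun S : Finset P => W * qOf S) T := fun S _ S' _ hSS => qOf_injective hP (Nat.eq_of_mul_eq_mul_left (primeProd_pos D) hSS)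
    rw [← sum_image (f := fun q => charErr q L) hinj]
    refine sum_le_sum_of_subset_of_nonneg (fun q hq => ?_) fun q _ _ => charErr_nonneg q L
    obtain ⟨S, hS, rfl⟩ := mem_image.1 hq
    have h1 := hWq S (mem_filter.1 hS).2
    refine mem_Icc.2 ⟨Nat.mul_pos (primeProd_pos D) (qOf_pos hP _), Nat.le_floor ?_⟩
    have : (0:ℝ) ≤ ((W * qOf S : ℕ) : ℝ) := by positivity
    linarith
  have s2 : (#T : ℝ) ≤ Real.exp (6 / 25 * L) := by
    refine le_trans ?_ hNle
    have : #T ≤ #(Icc 1 N) := card_le_card_of_injOn qOf (fun S hS => mem_coe.2 (mem_Icc.2 ⟨qOf_pos hP S, (mem_filter.1 hS).2⟩))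
      fun S _ S' _ hSS => qOf_injective hP hSS
    rw [Nat.card_Icc] at this
    exact_mod_cast this
  have s3 : ∑ S ∈ T, ((2 * κ ^ 2 : ℕ) : ℝ) ^ #S / qOf S ≤ (1 + L) ^ (2 * κ ^ 2) := by
    refine (sum_pow_card_div_qOf_le hP (2 * κ ^ 2) N).trans ?_
    have := log_floor_exp_le (θ := 6 / 25) (L := L) (by positivity)
    have h7 : 0 ≤ Real.log N := Real.log_natCast_nonneg N
    gcongr
    linarith
  have s4 : Real.exp (6 / 25 * L) * Real.exp (-(19 / 40 * L)) ≤ Real.exp (-(L / 5)) := by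
    rw [← Real.exp_add]; exact Real.exp_le_exp.2 (by linarith)
  calc _ ≤ ∑ S ∈ T, (L ^ A * (charErr (W * qOf S) L + (C₂ + 48) * Real.exp (-(19 / 40 * L))) +
        (C₁ + 7) * L ^ 2 / L ^ A * (((2 * κ ^ 2 : ℕ) : ℝ) ^ #S / qOf S)) := by
        refine sum_le_sum fun S _ => ?_
        refine (mul_min_le hLA (by positivity) (by have := charErr_nonneg (W * qOf S) L; positivity) (by positivity)).trans_eq ?_
        congr 1
        push_cast
        rw [mul_pow, ← pow_mul, ← pow_mul, mul_comm #S 2]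
        ring
    _ = L ^ A * (∑ S ∈ T, charErr (W * qOf S) L + (C₂ + 48) * (#T * Real.exp (-(19 / 40 * L)))) +
        (C₁ + 7) * L ^ 2 / L ^ A * ∑ S ∈ T, ((2 * κ ^ 2 : ℕ) : ℝ) ^ #S / qOf S := by
        rw [sum_add_distrib, ← mul_sum, ← mul_sum, sum_add_distrib, sum_const, nsmul_eq_mul]; ring
    _ ≤ L ^ A * (Sc + (C₂ + 48) * Real.exp (-(L / 5))) + (C₁ + 7) * L ^ 2 / L ^ A * (1 + L) ^ (2 * κ ^ 2) := by
        gcongr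
        refine le_trans ?_ s4
        gcongr
    _ ≤ L ^ A * (Sc + (C₂ + 48) * Real.exp (-(L / 5))) + (C₁ + 7) * ((1 + L) ^ (2 * κ ^ 2 + 2) / L ^ A) := by
        have : L ^ 2 ≤ (1 + L) ^ 2 := by gcongr; linarith
        rw [pow_add]
        have e : (C₁ + 7) * L ^ 2 / L ^ A * (1 + L) ^ (2 * κ ^ 2) = (C₁ + 7) * ((1 + L) ^ (2 * κ ^ 2) * L ^ 2 / L ^ A) := by ring
        rw [e]
        gcongr
    _ ≤ _ := by
        have t1 : 0 ≤ (1 + L) ^ (2 * κ ^ 2 + 2) / L ^ A := by positivity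
        have t2 : 0 ≤ L ^ A * Real.exp (-(L / 5)) := by positivity
        have t3 : 0 ≤ L ^ A * Sc := by positivity
        linarith [mul_nonneg hC₁ t2, mul_nonneg hC₂ t1, mul_nonneg hC₁ t3, mul_nonneg hC₂ t3]

end

end

section

open Finset Filter Topology
set_option linter.unusedSectionVars false

section
variable {ι : Type*} [Fintype ι] [DecidableEq ι]

/-- View a tuple avoiding the index `m` as a tuple over all indices. -/
def liftTuple {P : Finset ℕ} (m : ι) (a : P → Option {i // i ≠ m}) (p : P) : Option ι := (a p).map Subtype.val

theorem liftTuple_eq_some {P : Finset ℕ} {m : ι} {a : P → Option {i // i ≠ m}} {p : P} {i : {i // i ≠ m}} :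
    liftTuple m a p = some (i:ι) ↔ a p = some i := by
  unfold liftTuple
  cases a p with
  | none => simp
  | some j => simp [Subtype.ext_iff]

theorem liftTuple_ne {P : Finset ℕ} (m : ι) (a : P → Option {i // i ≠ m}) (p : P) : liftTuple m a p ≠ some m := by
  unfold liftTuple
  cases a p with
  | none => simp
  | some j => simpa using j.2

theorem liftTuple_injective {P : Finset ℕ} (m : ι) : Function.Injective (liftTuple (P := P) m) := by
  intro a b h
  funext p
  have := congrFun h p
  exact Option.map_injective Subtype.val_injective this

theorem exists_liftTuple {P : Finset ℕ} {m : ι} {a : P → Option ι} (ha : ∀ p, a p ≠ some m) : ∃ b, liftTuple m b = a := by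
  refine ⟨fun p => (a p).pbind fun i hi => some ⟨i, fun e => ha p (by rw [hi, e])⟩, ?_⟩
  funext p
  unfold liftTuple
  have := ha p
  cases hx : a p <;> simp [hx]

theorem sieveWt_liftTuple {P : Finset ℕ} (m : ι) (F : (ι → ℝ) → ℝ) (L : ℝ) (a : P → Option {i // i ≠ m}) :
    sieveWt F L (liftTuple m a) = sieveWt (fun t => F (insertAt m 0 t)) L a := by
  unfold sieveWt
  congr 1
  · refine prod_congr rfl fun p _ => ?_
    unfold liftTuple
    cases a p <;> rfl
  · simp only
    congr 1
    funext i
    by_cases hi : i = m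
    · subst hi
      rw [insertAt_self, dPart]
      simp [liftTuple_ne]
    · rw [insertAt, dif_neg hi]
      congr 3
      refine prod_congr rfl fun p _ => ?_
      have := liftTuple_eq_some (a := a) (p := p) (i := ⟨i, hi⟩)
      simp only at this
      simp only [this]

theorem sieveLin_eq_of_prime {P : Finset ℕ} (hP : ∀ p ∈ P, p.Prime) (h : ι → ℕ) {F : (ι → ℝ) → ℝ} {K : ℝ} (hF : IsSieveFun F K) {L : ℝ} (hL : 0 < L)
    (m : ι) {n : ℕ} (hn : (n + h m).Prime) (hn' : ⌊Real.exp (3 / 25 * L)⌋₊ < n + h m) :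
    sieveLin P h F L n = sieveLin P (fun i : {i // i ≠ m} => h i) (fun t => F (insertAt m 0 t)) L n := by
  classical
  symm
  unfold sieveLin
  refine Fintype.sum_of_injective (liftTuple m) (liftTuple_injective m) _ _ (fun a ha => ?_) fun a => ?_
  · obtain ⟨p, hp⟩ : ∃ p, a p = some m := by
      by_contra hc
      push Not at hc
      exact ha (exists_liftTuple hc)
    rw [ite_eq_right_iff]
    intro hcomp
    by_contra h0
    have h1 := qOf_le_of_sieveWt_ne_zero hP hF.vanish hL h0
    have h2 : (p:ℕ) ∣ qOf ({p | a p ≠ none} : Finset P) := (dvd_qOf_iff hP).2 (by simp [hp])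
    have h3 := Nat.le_of_dvd (qOf_pos hP _) h2
    have h4 := (Nat.prime_dvd_prime_iff_eq (hP p p.2) hn).1 (hcomp p m hp)
    omega
  · rw [sieveWt_liftTuple]
    refine if_congr ?_ rfl rfl
    constructor
    · intro H p i hi
      have hne : i ≠ m := fun e => liftTuple_ne m a p (by rw [hi, e])
      exact H p ⟨i, hne⟩ ((liftTuple_eq_some (i := ⟨i, hne⟩)).1 hi)
    · intro H p i hi
      exact H p i (liftTuple_eq_some.2 hi)

theorem insertAt_nonneg {m : ι} {t : {i // i ≠ m} → ℝ} (ht : ∀ i, 0 ≤ t i) (i : ι) : 0 ≤ insertAt m 0 t i := by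
  unfold insertAt
  split_ifs
  exacts [le_rfl, ht _]

theorem sum_insertAt (m : ι) (s : ℝ) (t : {i // i ≠ m} → ℝ) : ∑ i, insertAt m s t i = s + ∑ i, t i := by
  rw [← add_sum_erase univ _ (mem_univ m), insertAt_self]
  congr 1
  rw [sum_subtype (p := fun i => i ≠ m) _ (by simp)]
  exact sum_congr rfl fun i _ => insertAt_ne m s t i

theorem IsSieveFun.slice {F : (ι → ℝ) → ℝ} {K : ℝ} (hF : IsSieveFun F K) (m : ι) : IsSieveFun (fun t => F (insertAt m 0 t)) K where
  nonneg := hF.nonneg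
  bound t ht := hF.bound _ (insertAt_nonneg ht)
  vanish t ht hs := hF.vanish _ (insertAt_nonneg ht) (by rwa [sum_insertAt, zero_add])

theorem abs_sieveLin_le {P : Finset ℕ} (hP : ∀ p ∈ P, p.Prime) (h : ι → ℕ) {F : (ι → ℝ) → ℝ} {K : ℝ} (hF : IsSieveFun F K) {L : ℝ} (hL : 1 ≤ L) (n : ℕ) :
    |sieveLin P h F L n| ≤ K * (Real.exp (3 / 25 * L) * (1 + L) ^ Fintype.card ι) := by
  classical
  have hL0 : 0 < L := by linarith
  have hK := hF.nonneg
  set N := ⌊Real.exp (3 / 25 * L)⌋₊ with hN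
  have hNle : (N:ℝ) ≤ Real.exp (3 / 25 * L) := Nat.floor_le (Real.exp_pos _).le
  calc |sieveLin P h F L n| ≤ ∑ a : P → Option ι, if qOf ({p | a p ≠ none} : Finset P) ≤ N then K else 0 := by
        refine (abs_sum_le_sum_abs _ _).trans (sum_le_sum fun a _ => ?_)
        split_ifs with h1 h2 h2
        · exact abs_sieveWt_le hF.bound hL0 a
        · rw [abs_nonpos_iff]
          by_contra h0
          exact h2 (qOf_le_of_sieveWt_ne_zero hP hF.vanish hL0 h0)
        · simpa using hK
        · simp
    _ = ∑ S : Finset P with qOf S ≤ N, (Fintype.card ι : ℝ) ^ #S * K := by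
        rw [sum_filter]
        have := sum_supp_eq (ρ := P) (α := Option ι) none (fun S => if qOf S ≤ N then K else 0)
        simp only [Fintype.card_option, Nat.add_sub_cancel, mul_ite, mul_zero] at this
        exact this
    _ ≤ ∑ S : Finset P with qOf S ≤ N, (K * N) * ((Fintype.card ι : ℝ) ^ #S / qOf S) := by
        refine sum_le_sum fun S hS => ?_
        have h3 : (0:ℝ) < qOf S := by exact_mod_cast qOf_pos hP S
        have h4 : (qOf S:ℝ) ≤ N := by exact_mod_cast (mem_filter.1 hS).2
        rw [mul_div_assoc', le_div_iff₀ h3]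
        have : 0 ≤ (Fintype.card ι : ℝ) ^ #S * K := by positivity
        nlinarith
    _ = (K * N) * ∑ S : Finset P with qOf S ≤ N, ((Fintype.card ι : ℝ) ^ #S / qOf S) := by rw [mul_sum]
    _ ≤ (K * Real.exp (3 / 25 * L)) * (1 + L) ^ Fintype.card ι := by
        have h6 := sum_pow_card_div_qOf_le hP (Fintype.card ι) N
        have h7 := log_floor_exp_le (θ := 3 / 25) (L := L) (by positivity)
        have h8 : 0 ≤ Real.log N := Real.log_natCast_nonneg N
        gcongr
        refine h6.trans ?_
        gcongr
        linarith
    _ = _ := by ring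

theorem tendsto_pow_mul_one_add_pow_mul_exp (r s : ℕ) {a : ℝ} (ha : 0 < a) (C : ℝ) :
    Tendsto (fun L : ℝ => L ^ r * (C * (1 + L) ^ s * Real.exp (-(a * L)))) atTop (𝓝 0) := by
  have h1 := (tendsto_pow_mul_exp_neg_mul (r + s) ha).const_mul (|C| * 2 ^ s)
  rw [mul_zero] at h1
  refine squeeze_zero_norm' ?_ h1
  filter_upwards [eventually_ge_atTop 1] with L hL
  have hL0 : 0 < L := by linarith
  rw [norm_mul, norm_mul, norm_mul, norm_pow, norm_pow, Real.norm_of_nonneg (Real.exp_pos _).le, Real.norm_of_nonneg hL0.le,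
    Real.norm_of_nonneg (by linarith : 0 ≤ 1 + L), Real.norm_eq_abs]
  calc L ^ r * (|C| * (1 + L) ^ s * Real.exp (-(a * L))) ≤ L ^ r * (|C| * (2 * L) ^ s * Real.exp (-(a * L))) := by gcongr; linarith
    _ = _ := by rw [mul_pow, pow_add]; ring

theorem eventually_mul_le_exp_div (C : ℝ) {a : ℝ} (ha : 0 < a) : ∀ᶠ L : ℝ in atTop, C ≤ Real.exp (a * L) :=
  (Real.tendsto_exp_atTop.comp (tendsto_id.const_mul_atTop ha)).eventually_ge_atTop C

theorem eventually_sum_wt_sieve_sub_le {h : ι → ℕ} (hh : Function.Injective h) {D : ℕ} (hD : ∀ i, h i < D) (v : ℕ) {F : (ι → ℝ) → ℝ} {K : ℝ}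
    (hF : IsSieveFun F K) (r : ℕ) {η : ℝ} (hη : 0 < η) : ∀ᶠ L : ℝ in atTop, ∀ X : ℕ,
    L ^ r * |∑ n ∈ sieveRange D v L, wt L n * sieveLin (sievePrimes D X) h F L n ^ 2 -
      oneW L / primeProd D * sieveSum (sievePrimes D X) F (fun p => 1 / (p:ℝ)) L| ≤ η := by
  obtain ⟨C, hC, H⟩ := exists_sum_wt_sieve_sub_le hh hD v hF
  filter_upwards [eventually_ge_atTop 1, eventually_mul_le_exp_div (2 * primeProd D) (by norm_num : (0:ℝ) < 1 / 200),
    (tendsto_pow_mul_one_add_pow_mul_exp r ((Fintype.card ι + 1) ^ 2 - 1) (by norm_num : (0:ℝ) < 13 / 25) C).eventually_le_const hη] with L h1 h2 h3 X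
  have := H L h1 (by convert h2 using 2; ring) X
  refine le_trans ?_ h3
  gcongr

theorem exists_eventually_sum_primeLog_sieve_sub_le {h : ι → ℕ} (hh : Function.Injective h) {D : ℕ} (hD : ∀ i, h i < D) {j : ℕ} (hj : j < D)
    (hjh : ∀ i, h i ≠ j) {v : ℕ} (hv : (v + j).Coprime (primeProd D)) {F : (ι → ℝ) → ℝ} {K : ℝ}
    (hF : IsSieveFun F K) (r : ℕ) {η : ℝ} (hη : 0 < η) : ∀ᶠ B : ℕ in atTop, ∀ᶠ L : ℝ in atTop,
    ∑ q ∈ Icc 1 ⌊Real.exp (49 / 200 * L)⌋₊, charErr q L ≤ 1 / L ^ B → ∀ X : ℕ,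
    L ^ r * |∑ n ∈ sieveRange D v L, primeLog (n + j) * wt L (n + j) * sieveLin (sievePrimes D X) h F L n ^ 2 -
      psiW L / (primeProd D).totient * sieveSum (sievePrimes D X) F (fun p => 1 / ((p:ℝ) - 1)) L| ≤ η := by
  set b := 2 * ((Fintype.card ι + 1) ^ 2 - 1) ^ 2 + 2
  set A := b + r + 1 with hA
  obtain ⟨C, hC, H⟩ := exists_sum_primeLog_sieve_sub_le hh hD hj hjh hv hF A
  filter_upwards [eventually_ge_atTop (A + r + 1)] with B hB
  have hlim : Tendsto (fun L : ℝ => C * (1 / L + L ^ (r + A) * Real.exp (-(1 / 5 * L)) + 2 ^ b * (1 / L))) atTop (𝓝 0) := by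
    have h1 : Tendsto (fun L : ℝ => 1 / L) atTop (𝓝 0) := by simpa using tendsto_inv_atTop_zero
    have := ((h1.add (tendsto_pow_mul_exp_neg_mul (r + A) (by norm_num : (0:ℝ) < 1 / 5))).add (h1.const_mul (2 ^ b))).const_mul C
    simpa using this
  filter_upwards [eventually_ge_atTop 1, eventually_mul_le_exp_div (2 * primeProd D) (by norm_num : (0:ℝ) < 1 / 200),
    eventually_mul_le_exp_div D one_pos, hlim.eventually_le_const hη] with L h1 h2 h3 h4 hBV X
  have hL0 : 0 < L := by linarith
  have := H L h1 (by convert h2 using 2; ring) (by simpa using h3) X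
  refine le_trans ?_ h4
  calc _ ≤ L ^ r * (C * (L ^ A * (1 / L ^ B + Real.exp (-(L / 5))) + (1 + L) ^ b / L ^ A)) := by
        refine mul_le_mul_of_nonneg_left (this.trans ?_) (by positivity)
        gcongr
    _ = C * (L ^ (r + A) / L ^ B + L ^ (r + A) * Real.exp (-(1 / 5 * L)) + L ^ r * ((1 + L) ^ b / L ^ A)) := by
        have : -(L / 5) = -(1 / 5 * L) := by ring
        rw [this, pow_add]; ring
    _ ≤ C * (L ^ (r + A) / L ^ (A + r + 1) + L ^ (r + A) * Real.exp (-(1 / 5 * L)) + L ^ r * ((2 * L) ^ b / L ^ A)) := by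
        gcongr
        linarith
    _ = _ := by
        have e1 : L ^ (r + A) / L ^ (A + r + 1) = 1 / L := by
          rw [add_comm r A, pow_succ]; field_simp
        have e2 : L ^ r * ((2 * L) ^ b / L ^ A) = 2 ^ b * (1 / L) := by
          rw [hA, mul_pow, pow_succ, pow_add]; field_simp; ring
        rw [e1, e2]

theorem eventually_sum_abs_wt_sub_mul_le (h : ι → ℕ) {F : (ι → ℝ) → ℝ} {K : ℝ} (hF : IsSieveFun F K) (j D v r : ℕ) {η : ℝ} (hη : 0 < η) :
    ∀ᶠ L : ℝ in atTop, ∀ X : ℕ,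
    L ^ r * ∑ n ∈ sieveRange D v L, |wt L n - wt L (n + j)| * sieveLin (sievePrimes D X) h F L n ^ 2 ≤ η := by
  obtain ⟨K₁, hK₁, H⟩ := exists_sum_abs_wt_sub_le
  have hK := hF.nonneg
  filter_upwards [eventually_ge_atTop 1, eventually_mul_le_exp_div (2 * j) one_pos,
    (tendsto_pow_mul_one_add_pow_mul_exp r (2 * Fintype.card ι) (by norm_num : (0:ℝ) < 19 / 25) (K₁ * j * K ^ 2)).eventually_le_const hη] with L h1 h2 h3 X
  refine le_trans ?_ h3
  have hL0 : 0 < L := by linarith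
  refine mul_le_mul_of_nonneg_left ?_ (by positivity)
  set M := K * (Real.exp (3 / 25 * L) * (1 + L) ^ Fintype.card ι) with hM
  calc _ ≤ ∑ n ∈ wtRange L, |wt L n - wt L (n + j)| * M ^ 2 := by
        refine (sum_le_sum_of_subset_of_nonneg (filter_subset _ _) fun n _ _ => by positivity).trans ?_
        refine sum_le_sum fun n _ => ?_
        refine mul_le_mul_of_nonneg_left ?_ (abs_nonneg _)
        rw [← sq_abs]
        exact pow_le_pow_left₀ (abs_nonneg _) (abs_sieveLin_le prime_of_mem_sievePrimes h hF h1 n) 2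
    _ ≤ K₁ * j * Real.exp (-L) * M ^ 2 := by
        rw [← sum_mul]
        gcongr
        exact H L h1 j (by simpa using h2)
    _ = _ := by
        have : Real.exp (-(19 / 25 * L)) = Real.exp (-L) * Real.exp (3 / 25 * L) ^ 2 := by
          rw [← Real.exp_nat_mul, ← Real.exp_add]; congr 1; push_cast; ring
        rw [this, hM]; ring

end

end

section

open Finset Filter Topology MeasureTheory
set_option linter.unusedSectionVars false

section
variable {ι : Type*} [Fintype ι] [DecidableEq ι]

theorem primeLog_mul_wt_le {L : ℝ} (hL : 0 < L) (n : ℕ) : primeLog n * wt L n ≤ 21 / 20 * L * wt L n := by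
  by_cases h0 : wt L n = 0
  · simp [h0]
  · obtain ⟨h1, h2⟩ := mem_Icc.1 (mem_wtSupp hL h0)
    refine mul_le_mul_of_nonneg_right ?_ (wt_nonneg L n)
    refine (primeLog_le n).trans (ArithmeticFunction.vonMangoldt_le_log.trans ?_)
    rw [Real.log_le_iff_le_exp (by exact_mod_cast h1)]
    exact (Nat.cast_le.2 h2).trans (Nat.floor_le (Real.exp_pos _).le)

theorem sum_primeLog_mul_wt_le {h : ι → ℕ} {N₀ : ℕ} (hone : ∀ n, N₀ ≤ n → ∀ i j, (n + h i).Prime → (n + h j).Prime → i = j) {L : ℝ} (hL : 0 < L)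
    (hN : ∀ m, ((N₀ + h m : ℕ) : ℝ) ≤ Real.exp L) (n : ℕ) :
    ∑ m, primeLog (n + h m) * wt L (n + h m) ≤ 21 / 20 * L * (wt L n + ∑ m, |wt L n - wt L (n + h m)|) := by
  have hw := wt_nonneg L n
  by_cases hex : ∃ m, primeLog (n + h m) * wt L (n + h m) ≠ 0
  · obtain ⟨m, hm⟩ := hex
    have hp : (n + h m).Prime := by
      by_contra hc
      exact hm (by simp [primeLog, hc])
    have h1 : N₀ ≤ n := by
      have := (hN m).trans_lt (lt_of_wt_ne_zero hL (right_ne_zero_of_mul hm))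
      have : N₀ + h m < n + h m := by exact_mod_cast this
      omega
    rw [sum_eq_single m (fun m' _ hne => ?_) (by simp)]
    · refine (primeLog_mul_wt_le hL _).trans ?_
      have h2 := single_le_sum (f := fun m => |wt L n - wt L (n + h m)|) (fun _ _ => abs_nonneg _) (mem_univ m)
      have h3 := neg_abs_le (wt L n - wt L (n + h m))
      gcongr
      linarith
    · have : ¬ (n + h m').Prime := fun hc => hne (hone n h1 _ _ hc hp)
      simp [primeLog, this]
  · push Not at hex
    rw [sum_eq_zero fun m _ => hex m]
    have : 0 ≤ ∑ m, |wt L n - wt L (n + h m)| := sum_nonneg fun _ _ => abs_nonneg _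
    positivity

theorem sum_primeLog_sieve_le {P : Finset ℕ} (hP : ∀ p ∈ P, p.Prime) {h : ι → ℕ} {F : (ι → ℝ) → ℝ} {K : ℝ} (hF : IsSieveFun F K) {N₀ : ℕ}
    (hone : ∀ n, N₀ ≤ n → ∀ i j, (n + h i).Prime → (n + h j).Prime → i = j) {L : ℝ} (hL : 0 < L)
    (hN : ∀ m, ((N₀ + h m : ℕ) : ℝ) ≤ Real.exp L) (T : Finset ℕ) :
    ∑ m, ∑ n ∈ T, primeLog (n + h m) * wt L (n + h m) * sieveLin P (fun i : {i // i ≠ m} => h i) (fun t => F (insertAt m 0 t)) L n ^ 2 ≤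
      21 / 20 * L * (∑ n ∈ T, wt L n * sieveLin P h F L n ^ 2 + ∑ m, ∑ n ∈ T, |wt L n - wt L (n + h m)| * sieveLin P h F L n ^ 2) := by
  have h1 : ∀ m, ∑ n ∈ T, primeLog (n + h m) * wt L (n + h m) * sieveLin P (fun i : {i // i ≠ m} => h i) (fun t => F (insertAt m 0 t)) L n ^ 2 =
      ∑ n ∈ T, primeLog (n + h m) * wt L (n + h m) * sieveLin P h F L n ^ 2 := by
    intro m
    refine sum_congr rfl fun n _ => ?_
    by_cases h0 : primeLog (n + h m) * wt L (n + h m) = 0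
    · simp [h0]
    · have hp : (n + h m).Prime := by
        by_contra hc
        exact h0 (by simp [primeLog, hc])
      rw [sieveLin_eq_of_prime hP h hF hL m hp]
      have h2 := lt_of_wt_ne_zero hL (right_ne_zero_of_mul h0)
      have h3 : (⌊Real.exp (3 / 25 * L)⌋₊ : ℝ) ≤ Real.exp L := (Nat.floor_le (Real.exp_pos _).le).trans (Real.exp_le_exp.2 (by linarith))
      exact_mod_cast h3.trans_lt h2
  simp only [h1]
  rw [Finset.sum_comm, Finset.sum_comm (s := univ) (t := T), ← sum_add_distrib, mul_sum]
  refine sum_le_sum fun n _ => ?_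
  rw [← sum_mul, ← sum_mul, ← add_mul, ← mul_assoc]
  exact mul_le_mul_of_nonneg_right (sum_primeLog_mul_wt_le hone hL hN n) (sq_nonneg _)

/-- The comparison of the two sieve averages. -/
theorem sieve_comparison {k : ℕ} (hk : Fintype.card ι = k + 1) {I T₁ S₁ L V W Ψ O ε η : ℝ} {J T₂ S₂ R : ι → ℝ} (hI : 0 < I) (hJ : 11 / 10 * I ≤ ∑ m, J m)
    (hε : ε = I / (100 * (k + 2))) (hη : 100 * W * η = ε) (hL : 1 ≤ L) (hV : 0 < V) (hV1 : V ≤ 1) (hW : 0 < W)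
    (hO : L / 100 ≤ O) (hΨ : 999 / 1000 * O ≤ Ψ) (ha : |(V * L) ^ (k + 1) * T₁ - I| ≤ ε) (hb : ∀ m, |(V * L) ^ k * T₂ m - J m| ≤ ε)
    (hc : L ^ (k + 2) * |S₁ - O / W * T₁| ≤ η) (hd : ∀ m, L ^ (k + 1) * |S₂ m - Ψ / (W * V) * T₂ m| ≤ η) (hr : ∀ m, L ^ (k + 2) * R m ≤ η)
    (he : ∑ m, S₂ m ≤ 21 / 20 * L * (S₁ + ∑ m, R m)) : False := by
  have hL0 : 0 < L := by linarith
  have hO0 : 0 < O := by linarith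
  have hη0 : 0 ≤ η := (by positivity : (0:ℝ) ≤ L ^ (k + 2) * |S₁ - O / W * T₁|).trans hc
  set ρ := V ^ (k + 1) * L ^ k * W / O with hρ
  have hρ0 : 0 < ρ := by positivity
  have hρη : ρ * η / L ^ (k + 1) ≤ ε := by
    have e : ρ * η / L ^ (k + 1) = V ^ (k + 1) * (W * η) / (O * L) := by rw [hρ, pow_succ L]; field_simp
    rw [e, div_le_iff₀ (by positivity), ← hη]
    have h1 : V ^ (k + 1) ≤ 1 := pow_le_one₀ hV.le hV1
    have h2 : 1 ≤ 100 * (O * L) := by nlinarith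
    have h3 : 0 ≤ W * η := by positivity
    nlinarith [mul_le_mul_of_nonneg_right h1 h3, mul_le_mul_of_nonneg_left h2 h3]
  have h1 : ρ * L * S₁ ≤ I + 2 * ε := by
    have e1 : S₁ ≤ O / W * T₁ + η / L ^ (k + 2) := by
      have : |S₁ - O / W * T₁| ≤ η / L ^ (k + 2) := by rw [le_div_iff₀ (by positivity)]; linarith
      linarith [(abs_le.1 this).2]
    calc ρ * L * S₁ ≤ ρ * L * (O / W * T₁ + η / L ^ (k + 2)) := by gcongr
      _ = (V * L) ^ (k + 1) * T₁ + ρ * η / L ^ (k + 1) := by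
        rw [mul_add]
        congr 1
        · rw [hρ, mul_pow, pow_succ L]; field_simp
        · rw [pow_succ L (k + 1)]; field_simp
      _ ≤ _ := by linarith [(abs_le.1 ha).2]
  have h2 : ∀ m, ρ * L * R m ≤ ε := by
    intro m
    have e1 : R m ≤ η / L ^ (k + 2) := by rw [le_div_iff₀ (by positivity)]; linarith [hr m]
    calc ρ * L * R m ≤ ρ * L * (η / L ^ (k + 2)) := by gcongr
      _ = ρ * η / L ^ (k + 1) := by rw [pow_succ L (k + 1)]; field_simp
      _ ≤ ε := hρη
  have h3 : ∀ m, Ψ / O * ((V * L) ^ k * T₂ m) - ε ≤ ρ * S₂ m := by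
    intro m
    have e1 : Ψ / (W * V) * T₂ m - η / L ^ (k + 1) ≤ S₂ m := by
      have : |S₂ m - Ψ / (W * V) * T₂ m| ≤ η / L ^ (k + 1) := by rw [le_div_iff₀ (by positivity)]; linarith [hd m]
      linarith [(abs_le.1 this).1]
    calc _ ≤ Ψ / O * ((V * L) ^ k * T₂ m) - ρ * η / L ^ (k + 1) := by linarith
      _ = ρ * (Ψ / (W * V) * T₂ m - η / L ^ (k + 1)) := by
        rw [mul_sub]
        congr 1
        · rw [hρ, mul_pow, pow_succ V]; field_simp
        · ring
      _ ≤ _ := by gcongr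
  have hcard : (#(univ : Finset ι) : ℝ) = k + 1 := by rw [card_univ, hk]; push_cast; ring
  have h4 : ∑ m, J m - (k + 1) * ε ≤ ∑ m, (V * L) ^ k * T₂ m := by
    have := sum_le_sum fun m (_ : m ∈ univ) => (by linarith [(abs_le.1 (hb m)).1] : J m - ε ≤ (V * L) ^ k * T₂ m)
    rw [sum_sub_distrib, sum_const, nsmul_eq_mul, hcard] at this
    exact this
  have h5 := sum_le_sum fun m (_ : m ∈ univ) => h3 m
  rw [sum_sub_distrib, sum_const, nsmul_eq_mul, hcard, ← mul_sum univ _ (Ψ / O), ← mul_sum univ _ ρ] at h5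
  have h6 := sum_le_sum fun m (_ : m ∈ univ) => h2 m
  rw [sum_const, nsmul_eq_mul, hcard, ← mul_sum] at h6
  have h7 := mul_le_mul_of_nonneg_left he hρ0.le
  have hkε : (k + 1) * ε ≤ I / 100 := by
    rw [hε, mul_div_assoc', div_le_div_iff₀ (by positivity) (by norm_num)]
    nlinarith
  have hε2 : ε ≤ I / 200 := by
    rw [hε, div_le_div_iff₀ (by positivity) (by norm_num)]
    have : 0 ≤ I * k := by positivity
    nlinarith
  have h8 : 999 / 1000 ≤ Ψ / O := by rwa [le_div_iff₀ hO0]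
  have h9 : 0 ≤ ∑ m, (V * L) ^ k * T₂ m := by linarith
  have h10 : 999 / 1000 * ∑ m, (V * L) ^ k * T₂ m ≤ Ψ / O * ∑ m, (V * L) ^ k * T₂ m := by gcongr
  have h11 : ρ * (21 / 20 * L * (S₁ + ∑ m, R m)) = 21 / 20 * (ρ * L * S₁ + ρ * L * ∑ m, R m) := by ring
  linarith

theorem exists_coprime_shift (h : ι → ℕ) (hadm : ∀ p : ℕ, p.Prime → ∃ v, ∀ i, ¬ p ∣ v + h i) (D : ℕ) :
    ∃ v, ∀ i, (v + h i).Coprime (primeProd D) := by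
  choose! u hu using hadm
  obtain ⟨v, hv⟩ := Nat.chineseRemainderOfFinset u id (sievePrimes 0 D) (fun p hp => (prime_of_mem_sievePrimes p hp).ne_zero)
    (fun p hp q hq hpq => (Nat.coprime_primes (prime_of_mem_sievePrimes p hp) (prime_of_mem_sievePrimes q hq)).2 hpq)
  refine ⟨v, fun i => Nat.Coprime.prod_right fun p hp => ?_⟩
  have hpp := prime_of_mem_sievePrimes p hp
  refine ((Nat.Prime.coprime_iff_not_dvd hpp).2 fun hd => hu p hpp i ?_).symm
  have : v + h i ≡ u p + h i [MOD p] := (hv p hp).add_right _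
  exact (this.dvd_iff dvd_rfl).1 hd

theorem totient_primeProd (D : ℕ) : ((primeProd D).totient : ℝ) = primeProd D * ∏ p ∈ sievePrimes 0 D, (1 - 1 / (p:ℝ)) := by
  have := Nat.totient_eq_mul_prod_factors (primeProd D)
  have h2 : (primeProd D).primeFactors = sievePrimes 0 D := Nat.primeFactors_prod prime_of_mem_sievePrimes
  rw [h2] at this
  have h3 := congrArg (fun x : ℚ => (x:ℝ)) this
  push_cast at h3
  simpa using h3

variable {Ω : Type*} [TopologicalSpace Ω] [SecondCountableTopology Ω] [MeasurableSpace Ω] [BorelSpace Ω] {μ : Measure Ω} [SFinite μ]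
  {c : Ω → ℂ} {z : Ω → ι → ℂ}

theorem abs_inv_pred_sub_inv_le (p : ℕ) (hp : p.Prime) : |1 / ((p:ℝ) - 1) - 1 / p| ≤ 2 * (1 / p) ^ 2 := by
  have h2 : (2:ℝ) ≤ p := by exact_mod_cast hp.two_le
  have e : 1 / ((p:ℝ) - 1) - 1 / p = 1 / (p * (p - 1)) := by
    have : (p:ℝ) - 1 ≠ 0 := by linarith
    field_simp
    ring
  rw [e, abs_of_nonneg (by apply one_div_nonneg.2; nlinarith), div_pow, one_pow, mul_one_div, div_le_div_iff₀ (by nlinarith) (by positivity)]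
  nlinarith

theorem exists_two_primes (hrep : IsOrthantRep μ c z) {f : (ι → ℝ) → ℝ} (hf : Represents μ c z f)
    (hf0 : ∀ t : ι → ℝ, (∀ i, 0 ≤ t i) → 3 / 25 ≤ ∑ i, t i → f t = 0) {h : ι → ℕ} (hh : Function.Injective h)
    (hadm : ∀ p : ℕ, p.Prime → ∃ v, ∀ i, ¬ p ∣ v + h i) (hI : 0 < ∫ t, f t ^ 2 ∂(orth ι))
    (hJ : 11 / 10 * ∫ t, f t ^ 2 ∂(orth ι) ≤ ∑ m, ∫ t, sliceInt m f t ^ 2 ∂(orth {i // i ≠ m})) (N₀ : ℕ) :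
    ∃ n, N₀ ≤ n ∧ ∃ i j, i ≠ j ∧ (n + h i).Prime ∧ (n + h j).Prime := by
  by_contra hcon
  have hone : ∀ n, N₀ ≤ n → ∀ i j, (n + h i).Prime → (n + h j).Prime → i = j := by
    intro n hn i j hi hj
    by_contra hij
    exact hcon ⟨n, hn, i, j, hij, hi, hj⟩
  have hne : Nonempty ι := by
    by_contra hc
    rw [not_nonempty_iff] at hc
    rw [univ_eq_empty, sum_empty] at hJ
    linarith
  obtain ⟨k, hk⟩ : ∃ k, Fintype.card ι = k + 1 := Nat.exists_eq_succ_of_ne_zero Fintype.card_ne_zero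
  have hk' : ∀ m : ι, Fintype.card {i // i ≠ m} = k := fun m => by
    have := Fintype.card_subtype_compl (fun i => i = m)
    rw [Fintype.card_subtype_eq] at this
    simp only [ne_eq]
    omega
  set I := ∫ t, f t ^ 2 ∂(orth ι) with hIdef
  set ε := I / (100 * (k + 2)) with hε
  have hε0 : 0 < ε := by positivity
  obtain ⟨K, hK, hFb⟩ := exists_upperInt_bound hrep hf
  have hF : IsSieveFun (upperInt f) K := ⟨hK, hFb, fun t ht hs => upperInt_eq_zero hf0 ht hs⟩
  obtain ⟨D₁, hD₁⟩ := exists_sieveSum_asymp hrep (upperInt_rep hrep hf) (g := fun p => 1 / (p:ℝ)) (fun p _ => by simp) hε0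
  have hslice := fun m => exists_sieveSum_asymp (hrep.slice m) (upperInt_insertAt_rep hrep hf m) abs_inv_pred_sub_inv_le hε0
  choose D₂ hD₂ using hslice
  set D := D₁ + ∑ m, D₂ m + ∑ m, h m + 1 with hD
  have hDh : ∀ i, h i < D := fun i => by
    have := single_le_sum (f := h) (fun _ _ => Nat.zero_le _) (mem_univ i)
    omega
  have hDm : ∀ i, D₂ i ≤ D := fun i => by
    have := single_le_sum (f := D₂) (fun _ _ => Nat.zero_le _) (mem_univ i)
    omega
  obtain ⟨v, hv⟩ := exists_coprime_shift h hadm D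
  set V := ∏ p ∈ sievePrimes 0 D, (1 - 1 / (p:ℝ)) with hV
  have hp01 : ∀ p ∈ sievePrimes 0 D, 0 < 1 - 1 / (p:ℝ) ∧ 1 - 1 / (p:ℝ) ≤ 1 := by
    intro p hp
    have h2 : (2:ℝ) ≤ p := by exact_mod_cast (prime_of_mem_sievePrimes p hp).two_le
    have : 1 / (p:ℝ) < 1 := by rw [div_lt_one (by linarith)]; linarith
    have : 0 ≤ 1 / (p:ℝ) := by positivity
    constructor <;> linarith
  have hV0 : 0 < V := prod_pos fun p hp => (hp01 p hp).1
  have hV1 : V ≤ 1 := prod_le_one (fun p hp => (hp01 p hp).1.le) fun p hp => (hp01 p hp).2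
  have hW : (0:ℝ) < primeProd D := by exact_mod_cast primeProd_pos D
  set η := ε / (100 * (primeProd D : ℝ)) with hη
  have hη0 : 0 < η := by positivity
  have hS₂ := fun m => exists_eventually_sum_primeLog_sieve_sub_le (h := fun i : {i // i ≠ m} => h i) (fun a b e => Subtype.ext (hh e)) (fun i => hDh i)
    (hDh m) (fun i e => i.2 (hh e)) (hv m) (hF.slice m) (k + 1) hη0
  obtain ⟨B, hB⟩ := (eventually_all.2 hS₂).exists
  have hψ : ∀ᶠ L : ℝ in atTop, 999 / 1000 ≤ psiW L / oneW L := tendsto_psiW_div_oneW.eventually_const_le (by norm_num)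
  obtain ⟨L, hBV, hL1, hBL, ha, hb, hc, hr, hO, hΨ, hN⟩ := ((frequently_sum_charErr_le B).and_eventually
    ((eventually_ge_atTop (1:ℝ)).and ((eventually_all.2 hB).and ((hD₁ D (by omega)).and ((eventually_all.2 fun m => hD₂ m D (hDm m)).and
    ((eventually_sum_wt_sieve_sub_le hh hDh v hF (k + 2) hη0).and
    ((eventually_all.2 fun m => eventually_sum_abs_wt_sub_mul_le h hF (h m) D v (k + 2) hη0).and
    (eventually_oneW_ge.and (hψ.and (eventually_all.2 fun m => eventually_mul_le_exp_div ((N₀ + h m : ℕ):ℝ) one_pos)))))))))).exists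
  have hL0 : 0 < L := by linarith
  have hO0 : 0 < oneW L := by linarith
  obtain ⟨X₁, hX₁⟩ := ha
  choose X₂ hX₂ using hb
  set X := X₁ + ∑ m, X₂ m with hX
  have hXm : ∀ i, X₂ i ≤ X := fun i => by
    have := single_le_sum (f := X₂) (fun _ _ => Nat.zero_le _) (mem_univ i)
    omega
  refine sieve_comparison hk hI hJ hε (by rw [hη]; field_simp) hL1 hV0 hV1 hW hO (by rwa [le_div_iff₀ hO0] at hΨ) ?_ ?_ (hc X) (fun m => ?_) (fun m => hr m X)
    (sum_primeLog_sieve_le (P := sievePrimes D X) prime_of_mem_sievePrimes hF hone hL0 (by simpa using hN) (sieveRange D v L))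
      (T₂ := fun m => sieveSum (sievePrimes D X) (fun t => upperInt f (insertAt m 0 t)) (fun p => 1 / ((p:ℝ) - 1)) L) (Ψ := psiW L)
  · have := hX₁ X (by omega)
    rw [mainForm_eq_integral_sq hrep hf, ← Complex.ofReal_sub, Complex.norm_real, hk] at this
    exact this
  · intro m
    have := hX₂ m X (hXm m)
    rw [mainForm_eq_integral_sq (hrep.slice m) (hf.slice hrep m), ← Complex.ofReal_sub, Complex.norm_real, hk' m] at this
    exact this
  · have := hBL m hBV X
    rwa [totient_primeProd] at this

end

end

section

open Finset Filter Topology MeasureTheory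
set_option linter.unusedSectionVars false

section
variable {ι : Type*} [Fintype ι] [DecidableEq ι]

/-- The density of a product-type function. -/
noncomputable def prodCoeff (a b : ℝ → ℂ) (ω : ℝ × (ι → ℝ)) : ℂ := a ω.1 * ∏ i, b (ω.2 i)

/-- The exponents of a product-type function. -/
noncomputable def prodExpo (ω : ℝ × (ι → ℝ)) (i : ι) : ℂ := vline ω.1 + vline (ω.2 i)

theorem isOrthantRep_prod {ψ g : ℝ → ℂ} {a b : ℝ → ℂ} (hψ : IsLaplaceRep ψ a) (hg : IsLaplaceRep g b) :
    IsOrthantRep (ι := ι) volume (prodCoeff a b) prodExpo where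
  cont := (hψ.cont.comp continuous_fst).mul (continuous_finsetProd _ fun i _ => hg.cont.comp ((continuous_apply i).comp continuous_snd))
  contz i := (continuous_vline.comp continuous_fst).add (continuous_vline.comp ((continuous_apply i).comp continuous_snd))
  re_eq ω i := by rw [prodExpo, Complex.add_re, vline_re, vline_re]; norm_num
  integrable := by
    have h1 : Integrable (fun ω : ℝ × (ι → ℝ) => (‖a ω.1‖ * ‖vline ω.1‖ ^ (2 * Fintype.card ι)) * ∏ i, (‖b (ω.2 i)‖ * ‖vline (ω.2 i)‖ ^ 2))
        (volume.prod volume) := by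
      refine (hψ.integrable _).mul_prod (g := fun x : ι → ℝ => ∏ i, (‖b (x i)‖ * ‖vline (x i)‖ ^ 2)) ?_
      exact Integrable.fintype_prod (f := fun _ x => ‖b x‖ * ‖vline x‖ ^ 2) fun _ => hg.integrable 2
    refine (h1.const_mul (4 ^ Fintype.card ι)).mono' (Continuous.aestronglyMeasurable ?_) (Eventually.of_forall fun ω => ?_)
    · refine Continuous.mul (Continuous.norm ?_) (continuous_finsetProd _ fun i _ => (Continuous.norm ?_).pow 2)
      · exact (hψ.cont.comp continuous_fst).mul (continuous_finsetProd _ fun i _ => hg.cont.comp ((continuous_apply i).comp continuous_snd))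
      · exact (continuous_vline.comp continuous_fst).add (continuous_vline.comp ((continuous_apply i).comp continuous_snd))
    · have h2 : ∀ i, ‖prodExpo ω i‖ ^ 2 ≤ 4 * ‖vline ω.1‖ ^ 2 * ‖vline (ω.2 i)‖ ^ 2 := by
        intro i
        have e1 := one_le_norm_vline ω.1
        have e2 := one_le_norm_vline (ω.2 i)
        have e3 : ‖prodExpo ω i‖ ≤ 2 * (‖vline ω.1‖ * ‖vline (ω.2 i)‖) := (norm_add_le _ _).trans (by nlinarith)
        calc _ ≤ (2 * (‖vline ω.1‖ * ‖vline (ω.2 i)‖)) ^ 2 := pow_le_pow_left₀ (norm_nonneg _) e3 2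
          _ = _ := by ring
      rw [Real.norm_of_nonneg (by positivity), prodCoeff, norm_mul, norm_prod]
      calc _ ≤ ‖a ω.1‖ * (∏ i, ‖b (ω.2 i)‖) * ∏ i, (4 * ‖vline ω.1‖ ^ 2 * ‖vline (ω.2 i)‖ ^ 2) := by
            refine mul_le_mul_of_nonneg_left (prod_le_prod (fun _ _ => by positivity) fun i _ => h2 i) (by positivity)
        _ = _ := by
          rw [prod_mul_distrib, prod_mul_distrib, prod_mul_distrib, prod_const, prod_const, card_univ, pow_mul]
          ring

theorem represents_prod {ψ g : ℝ → ℝ} {a b : ℝ → ℂ} (hψ : IsLaplaceRep (fun v => (ψ v : ℂ)) a) (hg : IsLaplaceRep (fun v => (g v : ℂ)) b) :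
    Represents (ι := ι) volume (prodCoeff a b) prodExpo (fun t => ψ (∑ i, t i) * ∏ i, g (t i)) := by
  intro t _
  have e1 : ∀ ω : ℝ × (ι → ℝ), prodCoeff a b ω * ∏ i, Complex.exp (-(prodExpo ω i * t i)) =
      (a ω.1 * Complex.exp (-(vline ω.1 * (∑ i, t i : ℝ)))) * ∏ i, (b (ω.2 i) * Complex.exp (-(vline (ω.2 i) * t i))) := by
    intro ω
    have : ∀ i, Complex.exp (-(prodExpo ω i * t i)) = Complex.exp (-(vline ω.1 * t i)) * Complex.exp (-(vline (ω.2 i) * t i)) := by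
      intro i; rw [← Complex.exp_add, prodExpo]; congr 1; ring
    simp only [this]
    rw [prod_mul_distrib, prod_mul_distrib, ← Complex.exp_sum, prodCoeff]
    have : ∑ i, -(vline ω.1 * t i) = -(vline ω.1 * (∑ i, t i : ℝ)) := by
      rw [sum_neg_distrib, Complex.ofReal_sum, mul_sum]
    rw [this]
    ring
  simp only [e1]
  rw [Complex.ofReal_mul, Complex.ofReal_prod, hψ.rep, Measure.volume_eq_prod,
    integral_prod_mul (fun x : ℝ => a x * Complex.exp (-(vline x * (∑ i, t i : ℝ))))
      (fun y : ι → ℝ => ∏ i, (b (y i) * Complex.exp (-(vline (y i) * t i))))]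
  congr 1
  rw [volume_pi, integral_fintype_prod_eq_prod (fun i (x : ℝ) => b x * Complex.exp (-(vline x * t i)))]
  exact prod_congr rfl fun i _ => hg.rep (t i)

end

end

section

open Finset Filter Topology MeasureTheory
open scoped ContDiff
set_option linter.unusedSectionVars false

section
variable {ι : Type*} [Fintype ι] [DecidableEq ι]

theorem integral_sq_sum_mul_prod {u w : ℝ → ℝ} (h0 : Integrable w (volume.restrict (Set.Ioi 0)))
    (h1 : Integrable (fun x => u x * w x) (volume.restrict (Set.Ioi 0))) (h2 : Integrable (fun x => u x ^ 2 * w x) (volume.restrict (Set.Ioi 0)))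
    (hm : ∫ x in Set.Ioi 0, u x * w x = 0) :
    Integrable (fun t : ι → ℝ => (∑ i, u (t i)) ^ 2 * ∏ i, w (t i)) (orth ι) ∧
      ∫ t, (∑ i, u (t i)) ^ 2 * ∏ i, w (t i) ∂(orth ι) =
        Fintype.card ι * ((∫ x in Set.Ioi 0, u x ^ 2 * w x) * (∫ x in Set.Ioi 0, w x) ^ (Fintype.card ι - 1)) := by
  set v : ι → ι → ι → ℝ → ℝ := fun i j l x => (if l = i then u x else 1) * (if l = j then u x else 1) * w x with hv
  have hvi : ∀ i j l, Integrable (v i j l) (volume.restrict (Set.Ioi 0)) := by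
    intro i j l
    simp only [hv]
    by_cases hi : l = i <;> by_cases hj : l = j
    · simpa only [if_pos hi, if_pos hj, sq] using h2
    · simpa only [if_pos hi, if_neg hj, mul_one] using h1
    · simpa only [if_neg hi, if_pos hj, one_mul] using h1
    · simpa only [if_neg hi, if_neg hj, one_mul] using h0
  have e1 : (fun t : ι → ℝ => (∑ i, u (t i)) ^ 2 * ∏ i, w (t i)) = fun t => ∑ i, ∑ j, ∏ l, v i j l (t l) := by
    funext t
    rw [sq, sum_mul_sum, sum_mul]
    refine sum_congr rfl fun i _ => ?_
    rw [sum_mul]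
    refine sum_congr rfl fun j _ => ?_
    simp only [hv]
    rw [prod_mul_distrib, prod_mul_distrib, prod_ite_eq' univ i, prod_ite_eq' univ j]
    simp
  have hpi : ∀ i j, Integrable (fun t : ι → ℝ => ∏ l, v i j l (t l)) (orth ι) := fun i j => Integrable.fintype_prod fun l => hvi i j l
  rw [e1]
  refine ⟨integrable_finsetSum _ fun i _ => integrable_finsetSum _ fun j _ => hpi i j, ?_⟩
  rw [integral_finsetSum _ fun i _ => integrable_finsetSum _ fun j _ => hpi i j]
  have e2 : ∀ i, ∫ t, ∑ j, ∏ l, v i j l (t l) ∂(orth ι) = (∫ x in Set.Ioi 0, u x ^ 2 * w x) * (∫ x in Set.Ioi 0, w x) ^ (Fintype.card ι - 1) := by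
    intro i
    rw [integral_finsetSum _ fun j _ => hpi i j, sum_eq_single i]
    · rw [orth, integral_fintype_prod_eq_prod, ← mul_prod_erase _ _ (mem_univ i)]
      congr 1
      · simp [hv, sq]
      · rw [← card_univ, ← card_erase_of_mem (mem_univ i), ← prod_const]
        refine prod_congr rfl fun l hl => ?_
        simp [hv, ne_of_mem_erase hl]
    · intro j _ hj
      rw [orth, integral_fintype_prod_eq_prod]
      refine prod_eq_zero (mem_univ i) ?_
      simpa [hv, hj.symm] using hm
    · simp
  simp only [e2, sum_const, card_univ, nsmul_eq_mul]

theorem integral_prod_sub_le {c δ : ℝ} (hδ : 0 < δ) {w : ℝ → ℝ} (h0 : Integrable w (volume.restrict (Set.Ioi 0)))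
    (h1 : Integrable (fun x => (x - c) * w x) (volume.restrict (Set.Ioi 0))) (h2 : Integrable (fun x => (x - c) ^ 2 * w x) (volume.restrict (Set.Ioi 0)))
    (hm : ∫ x in Set.Ioi 0, (x - c) * w x = 0) (hw : ∀ x, 0 ≤ w x) {q : (ι → ℝ) → ℝ} (hq : Integrable (fun t => q t * ∏ i, w (t i)) (orth ι))
    (hq0 : ∀ t, 0 ≤ q t) {θ : ℝ} (hθ : Fintype.card ι * c + δ ≤ θ) {b : ℝ} (hb : 0 ≤ b)
    (hq1 : ∀ t, (∀ i, 0 < t i) → ∑ i, t i ≤ θ → b ≤ q t) :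
    b * ((∫ x in Set.Ioi 0, w x) ^ Fintype.card ι -
      Fintype.card ι * ((∫ x in Set.Ioi 0, (x - c) ^ 2 * w x) * (∫ x in Set.Ioi 0, w x) ^ (Fintype.card ι - 1)) / δ ^ 2) ≤
      ∫ t, q t * ∏ i, w (t i) ∂(orth ι) := by
  obtain ⟨i1, i2⟩ := integral_sq_sum_mul_prod (ι := ι) (u := fun x => x - c) h0 h1 h2 hm
  have i0 : Integrable (fun t : ι → ℝ => ∏ i, w (t i)) (orth ι) := Integrable.fintype_prod fun _ => h0
  have e0 : ∫ t, ∏ i, w (t i) ∂(orth ι) = (∫ x in Set.Ioi 0, w x) ^ Fintype.card ι := by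
    rw [orth, integral_fintype_prod_eq_prod, prod_const, card_univ]
  rw [← e0, ← i2, ← integral_div, ← integral_sub i0 (i1.div_const _), ← integral_const_mul]
  refine integral_mono_ae ((i0.sub (i1.div_const _)).const_mul _) hq ?_
  filter_upwards [ae_orth_pos] with t ht
  have hp : 0 ≤ ∏ i, w (t i) := prod_nonneg fun i _ => hw _
  by_cases hs : ∑ i, t i ≤ θ
  · have := hq1 t ht hs
    have h3 : 0 ≤ (∑ i, (t i - c)) ^ 2 * (∏ i, w (t i)) / δ ^ 2 := div_nonneg (mul_nonneg (sq_nonneg _) hp) (sq_nonneg _)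
    calc _ ≤ b * ∏ i, w (t i) := mul_le_mul_of_nonneg_left (by linarith) hb
      _ ≤ _ := mul_le_mul_of_nonneg_right this hp
  · have h3 : δ ≤ ∑ i, (t i - c) := by
      rw [sum_sub_distrib, sum_const, card_univ, nsmul_eq_mul]; linarith
    have h4 : ∏ i, w (t i) ≤ (∑ i, (t i - c)) ^ 2 * (∏ i, w (t i)) / δ ^ 2 := by
      rw [le_div_iff₀ (by positivity), mul_comm]
      exact mul_le_mul_of_nonneg_right (pow_le_pow_left₀ hδ.le h3 2) hp
    calc _ ≤ 0 := mul_nonpos_of_nonneg_of_nonpos hb (by linarith)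
      _ ≤ _ := mul_nonneg (hq0 t) hp

theorem sliceInt_prod (ψ g : ℝ → ℝ) (m : ι) (t : {i // i ≠ m} → ℝ) :
    sliceInt m (fun t => ψ (∑ i, t i) * ∏ i, g (t i)) t = (∫ s in Set.Ioi 0, ψ (s + ∑ i, t i) * g s) * ∏ i, g (t i) := by
  rw [sliceInt, ← integral_mul_const]
  refine integral_congr_ae (Eventually.of_forall fun s => ?_)
  simp only [sum_insertAt, prod_eq_mul_prod_ne m, insertAt_self, insertAt_ne]
  ring

theorem exists_isLaplaceRep_ofReal {g : ℝ → ℝ} (hg : ContDiff ℝ ∞ g) (hgc : HasCompactSupport g) :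
    ∃ c, IsLaplaceRep (fun v => (g v : ℂ)) c := by
  have h1 : ContDiff ℝ ∞ (fun v => (g v : ℂ)) := Complex.ofRealCLM.contDiff.comp hg
  have h2 : HasCompactSupport (fun v => (g v : ℂ)) := hgc.comp_left (g := Complex.ofReal) Complex.ofReal_zero
  exact exists_isLaplaceRep h1 h2

theorem exists_two_primes_of_prod {ψ g : ℝ → ℝ} (hψ : ContDiff ℝ ∞ ψ) (hψc : HasCompactSupport ψ) (hg : ContDiff ℝ ∞ g) (hgc : HasCompactSupport g)
    (hψ0 : ∀ v, 0 ≤ ψ v) (hψle : ∀ v, ψ v ≤ 1) {θ : ℝ} (hψ1 : ∀ v, 0 ≤ v → v ≤ θ → ψ v = 1) (hψv : ∀ v, 3 / 25 ≤ v → ψ v = 0)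
    (hg0 : ∀ x, 0 ≤ g x) {T : ℝ} (hT : 0 ≤ T) (hgT : ∀ x, T < x → g x = 0) {c δ a s b : ℝ} (hδ : 0 < δ)
    (hm : ∫ x in Set.Ioi 0, (x - c) * g x ^ 2 = 0) (ha : ∫ x in Set.Ioi 0, g x ^ 2 = a) (ha0 : 0 < a)
    (hs : ∫ x in Set.Ioi 0, (x - c) ^ 2 * g x ^ 2 = s) (hb : ∫ x in Set.Ioi 0, g x = b) (hc : 0 ≤ c)
    (hθ : Fintype.card ι * c + δ ≤ θ - T) (hvar : 40 * (Fintype.card ι * s) ≤ a * δ ^ 2)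
    (hratio : 113 / 100 * a ≤ Fintype.card ι * b ^ 2)
    {h : ι → ℕ} (hh : Function.Injective h) (hadm : ∀ p : ℕ, p.Prime → ∃ v, ∀ i, ¬ p ∣ v + h i) (N₀ : ℕ) :
    ∃ n, N₀ ≤ n ∧ ∃ i j, i ≠ j ∧ (n + h i).Prime ∧ (n + h j).Prime := by
  have hψC := hψ.continuous
  have hgC := hg.continuous
  obtain ⟨A, hA⟩ := exists_isLaplaceRep_ofReal hψ hψc
  obtain ⟨B, hB⟩ := exists_isLaplaceRep_ofReal hg hgc
  have hgc2 : HasCompactSupport (fun x => g x ^ 2) := hgc.comp_left (g := fun x : ℝ => x ^ 2) (by simp)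
  have hIn : ∀ q : ℝ → ℝ, Continuous q → Integrable (fun x => q x * g x ^ 2) (volume.restrict (Set.Ioi 0)) := fun q hq => by
    have h1 : HasCompactSupport (fun x => q x * g x ^ 2) := hgc2.mul_left
    have h2 : Integrable (fun x => q x * g x ^ 2) := Continuous.integrable_of_hasCompactSupport (by fun_prop) h1
    exact h2.integrableOn
  have h0 : Integrable (fun x => g x ^ 2) (volume.restrict (Set.Ioi 0)) := by simpa using hIn (fun _ => 1) continuous_const
  have h1 := hIn (fun x => x - c) (by fun_prop)
  have h2 := hIn (fun x => (x - c) ^ 2) (by fun_prop)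
  have hgi : Integrable g (volume.restrict (Set.Ioi 0)) := (hgC.integrable_of_hasCompactSupport hgc).integrableOn
  have hb0 : 0 ≤ b := hb ▸ integral_nonneg hg0
  have hs0 : 0 ≤ s := hs ▸ integral_nonneg fun x => by positivity
  have hw : ∀ x, 0 ≤ g x ^ 2 := fun x => sq_nonneg _
  have hk : 0 < Fintype.card ι := by
    rcases Nat.eq_zero_or_pos (Fintype.card ι) with h | h
    · rw [h] at hratio; norm_num at hratio; linarith
    · exact h
  obtain ⟨k, hk⟩ := Nat.exists_eq_add_of_lt hk
  rw [zero_add] at hk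
  have hkc : (Fintype.card ι : ℝ) = k + 1 := by rw [hk]; push_cast; ring
  have hi0 : Integrable (fun t : ι → ℝ => ∏ i, g (t i) ^ 2) (orth ι) := Integrable.fintype_prod fun _ => h0
  have e0 : ∫ t, ∏ i, g (t i) ^ 2 ∂(orth ι) = a ^ (k + 1) := by
    rw [orth, integral_fintype_prod_eq_prod (fun _ x => g x ^ 2), prod_const, card_univ, ha, hk]
  have hiI : Integrable (fun t : ι → ℝ => ψ (∑ i, t i) ^ 2 * ∏ i, g (t i) ^ 2) (orth ι) := by
    refine hi0.mono' (Continuous.aestronglyMeasurable (by fun_prop)) (Eventually.of_forall fun t => ?_)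
    rw [Real.norm_of_nonneg (by positivity)]
    exact mul_le_of_le_one_left (by positivity) (pow_le_one₀ (hψ0 _) (hψle _))
  have eI : ∫ t, (ψ (∑ i, t i) * ∏ i, g (t i)) ^ 2 ∂(orth ι) = ∫ t, ψ (∑ i, t i) ^ 2 * ∏ i, g (t i) ^ 2 ∂(orth ι) := by
    simp only [mul_pow, prod_pow]
  have hIle : ∫ t, ψ (∑ i, t i) ^ 2 * ∏ i, g (t i) ^ 2 ∂(orth ι) ≤ a ^ (k + 1) := by
    rw [← e0]
    exact integral_mono hiI hi0 fun t => mul_le_of_le_one_left (by positivity) (pow_le_one₀ (hψ0 _) (hψle _))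
  have hIge := integral_prod_sub_le (ι := ι) hδ h0 h1 h2 hm hw hiI (fun t => sq_nonneg _) (θ := θ) (by linarith) zero_le_one
    fun t ht hts => by rw [hψ1 _ (sum_nonneg fun i _ => (ht i).le) hts]; norm_num
  rw [ha, hs, hkc, hk, Nat.add_sub_cancel, one_mul] at hIge
  have hak : 0 < a ^ k := by positivity
  have hP : ((k:ℝ) + 1) * (s * a ^ k) / δ ^ 2 ≤ a ^ (k + 1) / 40 := by
    rw [div_le_iff₀ (by positivity), pow_succ]
    rw [hkc] at hvar
    nlinarith
  refine exists_two_primes (isOrthantRep_prod hA hB) (represents_prod hA hB) (fun t _ hts => by rw [hψv _ hts, zero_mul]) hh hadm ?_ ?_ N₀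
  · rw [eI]
    have : 0 < a ^ (k + 1) := by positivity
    linarith
  · rw [eI]
    have hJ : ∀ m : ι, b ^ 2 * (39 / 40 * a ^ k) ≤
        ∫ t, sliceInt m (fun t => ψ (∑ i, t i) * ∏ i, g (t i)) t ^ 2 ∂(orth {i // i ≠ m}) := by
      intro m
      simp only [sliceInt_prod, mul_pow, ← prod_pow]
      set β : ℝ → ℝ := fun v => ∫ s in Set.Ioi 0, ψ (s + v) * g s with hβ
      have hβc : Continuous β := by
        refine continuous_of_dominated (bound := g) (fun v => Continuous.aestronglyMeasurable (by fun_prop)) (fun v => Eventually.of_forall fun s => ?_) hgi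
          (Eventually.of_forall fun s => by fun_prop)
        rw [Real.norm_of_nonneg (mul_nonneg (hψ0 _) (hg0 _))]
        exact mul_le_of_le_one_left (hg0 _) (hψle _)
      have hβi : ∀ v, Integrable (fun s => ψ (s + v) * g s) (volume.restrict (Set.Ioi 0)) := fun v =>
        hgi.mono' (Continuous.aestronglyMeasurable (by fun_prop)) (Eventually.of_forall fun s => by
          rw [Real.norm_of_nonneg (mul_nonneg (hψ0 _) (hg0 _))]
          exact mul_le_of_le_one_left (hg0 _) (hψle _))
      have hβ0 : ∀ v, 0 ≤ β v := fun v => integral_nonneg fun s => mul_nonneg (hψ0 _) (hg0 _)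
      have hβb : ∀ v, β v ≤ b := fun v => by
        rw [← hb]
        exact integral_mono (hβi v) hgi fun s => mul_le_of_le_one_left (hg0 _) (hψle _)
      have hβ1 : ∀ v, 0 ≤ v → v ≤ θ - T → β v = b := by
        intro v hv hvT
        rw [← hb]
        refine setIntegral_congr_fun measurableSet_Ioi fun s hs => ?_
        rcases le_or_gt s T with h | h
        · rw [hψ1 _ (by have : 0 < s := hs; linarith) (by linarith), one_mul]
        · rw [hgT s h, mul_zero]
      have hi1 : Integrable (fun t : {i // i ≠ m} → ℝ => ∏ i, g (t i) ^ 2) (orth {i // i ≠ m}) := Integrable.fintype_prod fun _ => h0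
      have hiJ : Integrable (fun t : {i // i ≠ m} → ℝ => β (∑ i, t i) ^ 2 * ∏ i, g (t i) ^ 2) (orth {i // i ≠ m}) := by
        refine (hi1.const_mul (b ^ 2)).mono' (Continuous.aestronglyMeasurable (by fun_prop)) (Eventually.of_forall fun t => ?_)
        rw [Real.norm_of_nonneg (by positivity)]
        exact mul_le_mul_of_nonneg_right (pow_le_pow_left₀ (hβ0 _) (hβb _) 2) (by positivity)
      have hcard : Fintype.card {i // i ≠ m} = k := by
        rw [Fintype.card_subtype_compl, hk]; simp
      have := integral_prod_sub_le (ι := {i // i ≠ m}) hδ h0 h1 h2 hm hw hiJ (fun t => sq_nonneg _) (θ := θ - T)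
        (by rw [hcard]; rw [hkc] at hθ; linarith) (sq_nonneg b)
        fun t ht hts => by rw [hβ1 _ (sum_nonneg fun i _ => (ht i).le) hts]
      refine le_trans (mul_le_mul_of_nonneg_left ?_ (sq_nonneg b)) this
      rw [ha, hs, hcard]
      have h3 : (k:ℝ) * (s * a ^ (k - 1)) / δ ^ 2 ≤ a ^ k / 40 := by
        rcases Nat.eq_zero_or_pos k with h | h
        · subst h; norm_num
        · obtain ⟨j, rfl⟩ := Nat.exists_eq_add_of_lt h
          rw [zero_add] at *
          have : 0 < a ^ j := by positivity
          rw [div_le_iff₀ (by positivity), Nat.add_sub_cancel, pow_succ]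
          rw [hkc] at hvar
          have h4 : ((j + 1 : ℕ) : ℝ) * s * 40 ≤ a * δ ^ 2 := by linarith
          nlinarith
      linarith
    have hJs : ((k:ℝ) + 1) * (b ^ 2 * (39 / 40 * a ^ k)) ≤
        ∑ m : ι, ∫ t, sliceInt m (fun t => ψ (∑ i, t i) * ∏ i, g (t i)) t ^ 2 ∂(orth {i // i ≠ m}) := by
      rw [← hkc, ← card_univ (α := ι), ← nsmul_eq_mul]
      exact card_nsmul_le_sum _ _ _ fun m _ => hJ m
    refine le_trans ?_ hJs
    rw [hkc] at hratio
    have : a ^ (k + 1) = a ^ k * a := pow_succ a k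
    nlinarith
end

end

section

open Finset Filter Topology MeasureTheory
open scoped ContDiff

section

theorem integral_Ioi_le_of_hasDerivAt {f Φ Φ' : ℝ → ℝ} {T : ℝ} (hT : 0 ≤ T) (hf : Continuous f) (hfT : ∀ x, T < x → f x = 0)
    (hΦ : ∀ x, 0 ≤ x → HasDerivAt Φ (Φ' x) x) (hle : ∀ x, 0 < x → f x ≤ Φ' x) : ∫ x in Set.Ioi 0, f x ≤ Φ T - Φ 0 := by
  have h1 : ∫ x in Set.Ioi 0, f x = ∫ x in (0:ℝ)..T, f x := by
    rw [intervalIntegral.integral_of_le hT]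
    refine setIntegral_eq_of_subset_of_forall_sdiff_eq_zero measurableSet_Ioi Set.Ioc_subset_Ioi_self fun x hx => hfT x ?_
    by_contra h
    exact hx.2 ⟨hx.1, not_lt.1 h⟩
  rw [h1]
  exact intervalIntegral.integral_le_sub_of_hasDeriv_right_of_le hT (fun x hx => (hΦ x hx.1).continuousAt.continuousWithinAt)
    (fun x hx => (hΦ x hx.1.le).hasDerivWithinAt) hf.continuousOn.integrableOn_Icc fun x hx => hle x hx.1

theorem le_integral_Ioi_of_hasDerivAt {f Φ Φ' : ℝ → ℝ} {S : ℝ} (hS : 0 ≤ S) (hf : Continuous f) (hfc : HasCompactSupport f) (hf0 : ∀ x, 0 ≤ f x)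
    (hΦ : ∀ x, 0 ≤ x → HasDerivAt Φ (Φ' x) x) (hle : ∀ x, 0 < x → x < S → Φ' x ≤ f x) : Φ S - Φ 0 ≤ ∫ x in Set.Ioi 0, f x := by
  have h1 : ∫ x in (0:ℝ)..S, f x ≤ ∫ x in Set.Ioi 0, f x := by
    rw [intervalIntegral.integral_of_le hS]
    exact setIntegral_mono_set (hf.integrable_of_hasCompactSupport hfc).integrableOn (Eventually.of_forall hf0)
      (Eventually.of_forall fun x hx => hx.1)
  refine le_trans ?_ h1
  exact intervalIntegral.sub_le_integral_of_hasDeriv_right_of_le hS (fun x hx => (hΦ x hx.1).continuousAt.continuousWithinAt)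
    (fun x hx => (hΦ x hx.1.le).hasDerivWithinAt) hf.continuousOn.integrableOn_Icc fun x hx => hle x hx.1 hx.2

/-- A smooth cutoff of `1 / (1 + A x)` on the half line. -/
theorem exists_smooth_inv {A S : ℝ} (hA : 0 < A) (hS : 0 < S) : ∃ g : ℝ → ℝ, ContDiff ℝ ∞ g ∧ HasCompactSupport g ∧ (∀ x, 0 ≤ g x) ∧
    (∀ x, 0 ≤ x → g x ≤ 1 / (1 + A * x)) ∧ (∀ x, 0 ≤ x → x ≤ S → g x = 1 / (1 + A * x)) ∧ ∀ x, S + 1 / (2 * A) < x → g x = 0 := by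
  let χ : ContDiffBump (S / 2) := ⟨S / 2, S / 2 + 1 / (2 * A), by positivity, by have : 0 < 1 / (2 * A) := by positivity
                                                                                 linarith⟩
  have hA2 : 0 < 1 / (2 * A) := by positivity
  have hneg : ∀ x, x ≤ -(1 / (2 * A)) → χ x = 0 := fun x hx => χ.zero_of_le_dist (by
    rw [Real.dist_eq, abs_of_nonpos (by linarith)]
    change S / 2 + 1 / (2 * A) ≤ _
    linarith)
  have e : A * (1 / (2 * A)) = 1 / 2 := by field_simp
  refine ⟨fun x => χ x * (1 / (1 + A * x)), ?_, χ.hasCompactSupport.mul_right, ?_, ?_, ?_, ?_⟩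
  · rw [contDiff_iff_contDiffAt]
    intro x
    rcases lt_or_ge x (-(1 / (2 * A))) with h | h
    · refine (contDiffAt_const (c := (0:ℝ))).congr_of_eventuallyEq ?_
      filter_upwards [eventually_lt_nhds h] with y hy
      rw [hneg y hy.le, zero_mul]
    · refine χ.contDiffAt.mul (contDiffAt_const.div (by fun_prop) ?_)
      have := mul_le_mul_of_nonneg_left h hA.le
      linarith
  · intro x
    rcases le_or_gt x (-(1 / (2 * A))) with h | h
    · simp only [hneg x h, zero_mul, le_refl]
    · have := mul_lt_mul_of_pos_left h hA
      exact mul_nonneg χ.nonneg (one_div_nonneg.2 (by linarith))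
  · intro x hx
    exact mul_le_of_le_one_left (by positivity) χ.le_one
  · intro x hx hxS
    have : χ x = 1 := χ.one_of_mem_closedBall (by
      rw [Metric.mem_closedBall, Real.dist_eq, abs_le]
      change -(S / 2) ≤ _ ∧ _ ≤ S / 2
      constructor <;> linarith)
    simp only [this, one_mul]
  · intro x hx
    have : χ x = 0 := χ.zero_of_le_dist (by
      rw [Real.dist_eq, abs_of_nonneg (by linarith)]
      change S / 2 + 1 / (2 * A) ≤ _
      linarith)
    simp only [this, zero_mul]

theorem exists_two_primes_of_card {ι : Type*} [Fintype ι] [DecidableEq ι] (hk : Fintype.card ι = 10 ^ 6)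
    {h : ι → ℕ} (hh : Function.Injective h) (hadm : ∀ p : ℕ, p.Prime → ∃ v, ∀ i, ¬ p ∣ v + h i) (N₀ : ℕ) :
    ∃ n, N₀ ≤ n ∧ ∃ i j, i ≠ j ∧ (n + h i).Prime ∧ (n + h j).Prime := by
  obtain ⟨A, hA⟩ : ∃ A : ℝ, A = 10 ^ 8 := ⟨_, rfl⟩
  have hA0 : 0 < A := by rw [hA]; norm_num
  obtain ⟨g, hg, hgc, hg0, hgle, hgeq, hgT⟩ := exists_smooth_inv hA0 (S := 65535 / A) (by positivity)
  let ψ : ContDiffBump (0:ℝ) := ⟨119 / 1000, 3 / 25, by norm_num, by norm_num⟩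
  obtain ⟨T, hT⟩ : ∃ T : ℝ, T = 65535 / A + 1 / (2 * A) := ⟨_, rfl⟩
  rw [← hT] at hgT
  have hT0 : 0 < T := by rw [hT]; positivity
  have hAT : 1 + A * T = 2 ^ 16 + 1 / 2 := by rw [hT]; field_simp; norm_num
  have hAS : 1 + A * (65535 / A) = 2 ^ 16 := by field_simp; norm_num
  have hgC := hg.continuous
  have hpos : ∀ x, 0 ≤ x → 0 < 1 + A * x := fun x hx => by positivity
  have hd : ∀ x, HasDerivAt (fun x => 1 + A * x) A x := fun x => by simpa using ((hasDerivAt_id x).const_mul A).const_add 1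
  have hg2 : ∀ x, 0 ≤ x → g x ^ 2 ≤ 1 / (1 + A * x) ^ 2 := fun x hx => by
    have := pow_le_pow_left₀ (hg0 x) (hgle x hx) 2
    rwa [div_pow, one_pow] at this
  have hgc2 : HasCompactSupport (fun x => g x ^ 2) := hgc.comp_left (g := fun x : ℝ => x ^ 2) (by simp)
  have hIn : ∀ q : ℝ → ℝ, Continuous q → Integrable (fun x => q x * g x ^ 2) (volume.restrict (Set.Ioi 0)) := fun q hq => by
    have h1 : HasCompactSupport (fun x => q x * g x ^ 2) := hgc2.mul_left
    have h2 : Integrable (fun x => q x * g x ^ 2) := Continuous.integrable_of_hasCompactSupport (by fun_prop) h1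
    exact h2.integrableOn
  have dlog : ∀ x, 0 ≤ x → HasDerivAt (fun x => Real.log (1 + A * x) / A) (1 / (1 + A * x)) x := fun x hx => by
    have := (hpos x hx).ne'
    exact (((hd x).log this).div_const A).congr_deriv (by field_simp)
  have dinv : ∀ x, 0 ≤ x → HasDerivAt (fun x => -(1 + A * x)⁻¹ / A) (1 / (1 + A * x) ^ 2) x := fun x hx => by
    have := (hpos x hx).ne'
    exact (((hd x).fun_inv this).fun_neg.div_const A).congr_deriv (by field_simp)
  have hl2 := Real.log_two_gt_d9
  have hl2' := Real.log_two_lt_d9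
  have hb : 11.0903 / A ≤ ∫ x in Set.Ioi 0, g x := by
    have := le_integral_Ioi_of_hasDerivAt (S := 65535 / A) (by positivity) hgC hgc hg0 dlog fun x h1 h2 => (hgeq x h1.le h2.le).ge
    simp only [hAS, Real.log_pow, mul_zero, add_zero, Real.log_one, zero_div, sub_zero] at this
    refine le_trans (div_le_div_of_nonneg_right ?_ hA0.le) this
    push_cast
    linarith
  have ha1 : (65535 / 65536) / A ≤ ∫ x in Set.Ioi 0, g x ^ 2 := by
    have := le_integral_Ioi_of_hasDerivAt (S := 65535 / A) (f := fun x => g x ^ 2) (by positivity) (hgC.pow 2) hgc2 (fun x => sq_nonneg _) dinv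
      fun x h1 h2 => by rw [hgeq x h1.le h2.le, div_pow, one_pow]
    simp only [hAS, mul_zero, add_zero] at this
    refine le_trans (le_of_eq ?_) this
    ring
  have ha2 : ∫ x in Set.Ioi 0, g x ^ 2 ≤ 1 / A := by
    have := integral_Ioi_le_of_hasDerivAt (f := fun x => g x ^ 2) hT0.le (hgC.pow 2) (fun x hx => by rw [hgT x hx]; norm_num) dinv fun x hx => hg2 x hx.le
    refine this.trans ?_
    simp only [hAT, mul_zero, add_zero]
    rw [← sub_div]
    exact div_le_div_of_nonneg_right (by norm_num) hA0.le
  have hm1 : ∫ x in Set.Ioi 0, x * g x ^ 2 ≤ 10.0904 / A ^ 2 := by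
    have := integral_Ioi_le_of_hasDerivAt hT0.le (f := fun x => x * g x ^ 2) (by fun_prop) (fun x hx => by rw [hgT x hx]; norm_num)
      (fun x hx => ((dlog x hx).sub (dinv x hx)).div_const A) fun x hx => ?_
    · refine this.trans ?_
      simp only [hAT, mul_zero, add_zero, Pi.sub_apply, Real.log_one]
      have h1 : Real.log (2 ^ 16 + 1 / 2) ≤ 16 * Real.log 2 + 1 / 2 ^ 17 := by
        have e : (2:ℝ) ^ 16 + 1 / 2 = 2 ^ 16 * (1 + 1 / 2 ^ 17) := by norm_num
        rw [e, Real.log_mul (by norm_num) (by norm_num), Real.log_pow]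
        have := Real.log_le_sub_one_of_pos (show (0:ℝ) < 1 + 1 / 2 ^ 17 by norm_num)
        push_cast
        linarith
      have e : (Real.log (2 ^ 16 + 1 / 2) / A - -(2 ^ 16 + 1 / 2)⁻¹ / A) / A - (0 / A - -1⁻¹ / A) / A =
          (Real.log (2 ^ 16 + 1 / 2) + (2 ^ 16 + 1 / 2)⁻¹ - 1) / A ^ 2 := by
        field_simp
        ring
      rw [e]
      refine div_le_div_of_nonneg_right ?_ (by positivity)
      norm_num at h1 ⊢
      linarith
    · have h1 := hpos x hx.le
      refine (mul_le_mul_of_nonneg_left (hg2 x hx.le) hx.le).trans (le_of_eq ?_)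
      field_simp
      ring
  have hm2 : ∫ x in Set.Ioi 0, x ^ 2 * g x ^ 2 ≤ T / A ^ 2 := by
    have := integral_Ioi_le_of_hasDerivAt hT0.le (f := fun x => x ^ 2 * g x ^ 2) (by fun_prop) (fun x hx => by rw [hgT x hx]; norm_num)
      (Φ := fun x => x / A ^ 2) (fun x hx => (hasDerivAt_id x).div_const (A ^ 2)) fun x hx => ?_
    · simpa using this
    · have h1 := hpos x hx.le
      refine (mul_le_mul_of_nonneg_left (hg2 x hx.le) (sq_nonneg x)).trans ?_
      rw [mul_one_div, div_le_div_iff₀ (by positivity) (by positivity)]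
      nlinarith [mul_pos hA0 hx]
  obtain ⟨a, ha⟩ : ∃ a, a = ∫ x in Set.Ioi 0, g x ^ 2 := ⟨_, rfl⟩
  obtain ⟨m, hm⟩ : ∃ m, m = ∫ x in Set.Ioi 0, x * g x ^ 2 := ⟨_, rfl⟩
  rw [← ha] at ha1 ha2
  rw [← hm] at hm1
  have ha0 : 0 < a := lt_of_lt_of_le (by positivity) ha1
  have hm0 : 0 ≤ m := hm ▸ setIntegral_nonneg measurableSet_Ioi fun x hx => mul_nonneg (le_of_lt hx) (sq_nonneg _)
  have hmc : m / a * a = m := div_mul_cancel₀ m ha0.ne'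
  have i0 : Integrable (fun x => g x ^ 2) (volume.restrict (Set.Ioi 0)) := by simpa using hIn (fun _ => 1) continuous_const
  have i1 := hIn (fun x => x) continuous_id
  have i2 := hIn (fun x => x ^ 2) (by fun_prop)
  have hmean : ∫ x in Set.Ioi 0, (x - m / a) * g x ^ 2 = 0 := by
    simp only [sub_mul]
    rw [integral_sub i1 (i0.const_mul _), integral_const_mul, ← ha, ← hm, hmc, sub_self]
  have hvar : ∫ x in Set.Ioi 0, (x - m / a) ^ 2 * g x ^ 2 ≤ T / A ^ 2 := by
    have e : ∀ x, (x - m / a) ^ 2 * g x ^ 2 = x ^ 2 * g x ^ 2 - 2 * (m / a) * (x * g x ^ 2) + (m / a) ^ 2 * g x ^ 2 := fun x => by ring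
    simp only [e]
    have i3 : Integrable (fun x => x ^ 2 * g x ^ 2 - 2 * (m / a) * (x * g x ^ 2)) (volume.restrict (Set.Ioi 0)) := i2.sub (i1.const_mul _)
    rw [integral_add i3 (i0.const_mul _), integral_sub i2 (i1.const_mul _), integral_const_mul, integral_const_mul, ← ha, ← hm]
    have : (m / a) ^ 2 * a = m / a * m := by rw [sq, mul_assoc, hmc]
    have : 0 ≤ m / a * m := by positivity
    linarith
  have hTv : T = 65535.5 / 10 ^ 8 := by rw [hT, hA]; norm_num
  have hc : m / a ≤ 10.0906 / A := by
    rw [div_le_iff₀ ha0]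
    calc m ≤ 10.0904 / A ^ 2 := hm1
      _ ≤ 10.0906 / A * (65535 / 65536 / A) := by rw [hA]; norm_num
      _ ≤ _ := mul_le_mul_of_nonneg_left ha1 (by positivity)
  refine exists_two_primes_of_prod ψ.contDiff ψ.hasCompactSupport hg hgc (fun v => ψ.nonneg) (fun v => ψ.le_one) (θ := 119 / 1000) ?_ ?_ hg0 hT0.le hgT
    (c := m / a) (δ := 174 / 10000) (by norm_num) hmean ha.symm ha0 rfl rfl (by positivity) ?_ ?_ ?_ hh hadm N₀
  · intro v h1 h2
    refine ψ.one_of_mem_closedBall ?_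
    rw [Metric.mem_closedBall, Real.dist_eq, sub_zero, abs_of_nonneg h1]
    exact h2
  · intro v hv
    refine ψ.zero_of_le_dist ?_
    rw [Real.dist_eq, sub_zero, abs_of_nonneg (by linarith)]
    exact hv
  · rw [hk, hTv]
    rw [hA] at hc
    push_cast
    norm_num at hc ⊢
    linarith
  · rw [hk]
    rw [hTv, hA] at hvar
    rw [hA] at ha1
    push_cast
    norm_num at hvar ha1 ⊢
    linarith
  · rw [hk]
    have h1 := pow_le_pow_left₀ (by positivity) hb 2
    rw [hA] at h1 ha2
    push_cast
    norm_num at h1 ha2 ⊢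
    linarith
end

end

open Filter

section

theorem two_mul_le_primeCounting : 2 * 10 ^ 6 ≤ Nat.primeCounting (7 * 10 ^ 7) := by
  have h := Chebyshev.pi_ge (7 * 10 ^ 7)
  have hl : Real.log ((7 * 10 ^ 7 : ℕ) : ℝ) ≤ 27 * Real.log 2 := by
    have := Real.log_le_log (x := ((7 * 10 ^ 7 : ℕ) : ℝ)) (y := 2 ^ 27) (by norm_num) (by norm_num)
    rwa [Real.log_pow] at this
  have hl1 : Real.log ((7 * 10 ^ 7 : ℕ) + 1 : ℝ) ≤ 27 * Real.log 2 := by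
    have := Real.log_le_log (x := ((7 * 10 ^ 7 : ℕ) + 1 : ℝ)) (y := 2 ^ 27) (by norm_num) (by norm_num)
    rwa [Real.log_pow] at this
  have hp : 0 < Real.log ((7 * 10 ^ 7 : ℕ) : ℝ) := Real.log_pos (by norm_num)
  rw [div_le_iff₀ hp] at h
  have h2 := Real.log_two_gt_d9
  have h3 : ((2 * 10 ^ 6 : ℕ) : ℝ) ≤ Nat.primeCounting (7 * 10 ^ 7) := by
    by_contra hc
    push Not at hc
    have h4 : (Nat.primeCounting (7 * 10 ^ 7) : ℝ) * Real.log ((7 * 10 ^ 7 : ℕ) : ℝ) ≤ ((2 * 10 ^ 6 : ℕ) : ℝ) * (27 * Real.log 2) :=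
      mul_le_mul hc.le hl hp.le (by positivity)
    have h5 := h.trans h4
    push_cast at h5 hl1
    linarith
  exact_mod_cast h3

theorem exists_prime_tuple : ∃ h : Fin (10 ^ 6) → ℕ, Function.Injective h ∧ ∀ i, (h i).Prime ∧ 10 ^ 6 < h i ∧ h i ≤ 7 * 10 ^ 7 := by
  set s := (Finset.Ioc (10 ^ 6) (7 * 10 ^ 7)).filter Nat.Prime with hs
  have hc : 10 ^ 6 ≤ s.card := by
    have h1 := two_mul_le_primeCounting
    have h2 : Nat.primesLE (7 * 10 ^ 7) ⊆ Finset.Ioc 0 (10 ^ 6) ∪ s := by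
      intro p hp
      rw [Nat.mem_primesLE] at hp
      rw [Finset.mem_union, hs, Finset.mem_filter, Finset.mem_Ioc, Finset.mem_Ioc]
      have := hp.2.pos
      rcases le_or_gt p (10 ^ 6) with h | h
      · exact Or.inl ⟨this, h⟩
      · exact Or.inr ⟨⟨h, hp.1⟩, hp.2⟩
    have h3 := (Finset.card_le_card h2).trans (Finset.card_union_le _ _)
    rw [Nat.primesLE_card_eq_primeCounting, Nat.card_Ioc] at h3
    omega
  obtain ⟨t, hts, htc⟩ := Finset.exists_subset_card_eq hc
  refine ⟨fun i => t.orderEmbOfFin htc i, fun i j hij => (t.orderEmbOfFin htc).injective hij, fun i => ?_⟩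
  have := hts (t.orderEmbOfFin_mem htc i)
  rw [hs, Finset.mem_filter, Finset.mem_Ioc] at this
  exact ⟨this.2, this.1⟩

theorem prime_tuple_admissible {h : Fin (10 ^ 6) → ℕ} (hh : ∀ i, (h i).Prime ∧ 10 ^ 6 < h i) (p : ℕ) (hp : p.Prime) :
    ∃ v, ∀ i, ¬ p ∣ v + h i := by
  rcases le_or_gt p (10 ^ 6) with hle | hlt
  · refine ⟨0, fun i hd => ?_⟩
    rw [zero_add, Nat.prime_dvd_prime_iff_eq hp (hh i).1] at hd
    have := (hh i).2
    omega
  · have : NeZero p := ⟨hp.ne_zero⟩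
    have hns : ¬ Function.Surjective fun i : Fin (10 ^ 6) => (h i : ZMod p) := fun hsurj => by
      have := Fintype.card_le_of_surjective _ hsurj
      rw [ZMod.card, Fintype.card_fin] at this
      omega
    rw [Function.Surjective] at hns
    push Not at hns
    obtain ⟨r, hr⟩ := hns
    refine ⟨(-r).val, fun i hd => hr i ?_⟩
    rw [← ZMod.natCast_eq_zero_iff, Nat.cast_add, ZMod.natCast_zmod_val] at hd
    exact (neg_add_eq_zero.1 hd).symm

theorem frequently_nth_prime_gap_le {D : ℕ} (h : ∀ N, ∃ p q : ℕ, p.Prime ∧ q.Prime ∧ N ≤ p ∧ p < q ∧ q ≤ p + D) :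
    ∃ᶠ n : ℕ in atTop, Nat.nth Nat.Prime (n + 1) - Nat.nth Nat.Prime n ≤ D := by
  rw [frequently_atTop]
  intro M
  obtain ⟨p, q, hp, hq, hpN, hpq, hqD⟩ := h (Nat.nth Nat.Prime M)
  refine ⟨Nat.count Nat.Prime p, ?_, ?_⟩
  · have := Nat.count_monotone Nat.Prime hpN
    rwa [Nat.count_nth_of_infinite Nat.infinite_setOfPred_prime] at this
  · rw [Nat.nth_count hp]
    have : Nat.nth Nat.Prime (Nat.count Nat.Prime p + 1) ≤ q := by
      rw [← Nat.nth_count hq]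
      refine Nat.nth_monotone Nat.infinite_setOfPred_prime ?_
      have := Nat.count_monotone Nat.Prime (Nat.succ_le_of_lt hpq)
      rwa [Nat.succ_eq_add_one, Nat.count_succ, if_pos hp] at this
    omega

end

/-- Zhang's theorem: there are infinitely many `n` with `p_{n+1} - p_n ≤ 7 × 10^7`,
i.e. `liminf (p_{n+1} - p_n) ≤ 7 × 10^7`. -/
theorem zhang_bounded_prime_gaps :
    ∃ᶠ n : ℕ in atTop,
      Nat.nth Nat.Prime (n + 1) - Nat.nth Nat.Prime n ≤ 7 * 10 ^ 7 := by
  refine frequently_nth_prime_gap_le fun N => ?_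
  obtain ⟨h, hinj, hh⟩ := exists_prime_tuple
  obtain ⟨n, hn, i, j, hij, hi, hj⟩ := exists_two_primes_of_card (Fintype.card_fin _) hinj
    (prime_tuple_admissible fun i => ⟨(hh i).1, (hh i).2.1⟩) N
  have hi' := (hh i).2
  have hj' := (hh j).2
  rcases lt_or_gt_of_ne fun e => hij (hinj e) with hlt | hlt
  · exact ⟨n + h i, n + h j, hi, hj, by omega, by omega, by omega⟩
  · exact ⟨n + h j, n + h i, hj, hi, by omega, by omega, by omega⟩
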